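/- Let f: [0,t] × ℝⁿ → ℝ be a Carathéodory function (Borel, and f(u,·) continuous for each u) with polynomial growth: |f(u,x)| ≤ C(1+‖x‖^m). Fix σ continuous bounded with a = σσ* strictly elliptic and λ Borel bounded. Then there is a continuous real-valued function L(f) on [0,t] × ℝⁿ such that E_{Q^{σ,λ}_{s,y}}[∫_s^t f(u, X_u) du] = L(f)(s,y) for all (s,y) ∈ [0,t] × ℝⁿ, with L(f)(t,y) = 0 for all y. Moreover, for all 0 ≤ r ≤ s ≤ t and y, E_{Q^{σ,λ}_{r,y}}[∫_s^t f(u,X_u) du | B^r_s](ω) = L(f)(s, X_s(ω)) for Q^{σ,λ}_{r,y}-a.e. ω. -/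

import Mathlib

open MeasureTheory Filter Topology Matrix

/-- The path space of continuous functions `[0,∞) → ℝⁿ` with the topology of
uniform convergence on compact sets. -/
abbrev PathSp (n : ℕ) := C(↥(Set.Ici (0 : ℝ)), Fin n → ℝ)

/-- The canonical coordinate process. -/
def Xcan (n : ℕ) (u : ℝ) (ω : PathSp n) : Fin n → ℝ :=
  ω ⟨max u 0, le_max_right u 0⟩

/-- The canonical filtration `B_s`, generated by `X_u`, `u ≤ s`. -/
def canonFiltr (n : ℕ) (s : ℝ) : MeasurableSpace (PathSp n) :=
  MeasurableSpace.comap (fun ω => fun u : Set.Icc (0 : ℝ) s => ω ⟨u.1, u.2.1⟩)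
    inferInstance

/-- The exponential process of the martingale problem with diffusion `a = σσ*`
and drift `σλ`, started from `y` at time `s`. -/
noncomputable def MexpP (n : ℕ)
    (σ : ℝ → (Fin n → ℝ) → Matrix (Fin n) (Fin n) ℝ)
    (l : ℝ → (Fin n → ℝ) → (Fin n → ℝ))
    (s : ℝ) (y θ : Fin n → ℝ) (u : ℝ) (ω : PathSp n) : ℝ :=
  Real.exp (θ ⬝ᵥ (Xcan n u ω - y)
    - (∫ v in Set.Ioc s u,
        θ ⬝ᵥ ((σ v (Xcan n v ω)).mulVec (l v (Xcan n v ω))))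
    - (1 / 2) * ∫ v in Set.Ioc s u,
        θ ⬝ᵥ ((σ v (Xcan n v ω) * (σ v (Xcan n v ω))ᵀ).mulVec θ))

/-- `P` solves the martingale problem for `(σσ*, σλ)` starting from `y` at time
`s` (paths being frozen at `y` before time `s`). -/
def SolvesMPFrom (n : ℕ) [MeasurableSpace (PathSp n)]
    (σ : ℝ → (Fin n → ℝ) → Matrix (Fin n) (Fin n) ℝ)
    (l : ℝ → (Fin n → ℝ) → (Fin n → ℝ))
    (s : ℝ) (y : Fin n → ℝ) (P : Measure (PathSp n)) : Prop :=
  P {ω | ∀ u ≤ s, Xcan n u ω = y} = 1 ∧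
  ∀ (θ : Fin n → ℝ) (s' t' : ℝ), s ≤ s' → s' ≤ t' →
    Integrable (MexpP n σ l s y θ t') P ∧
    ∀ A : Set (PathSp n), MeasurableSet[canonFiltr n s'] A →
      ∫ ω in A, MexpP n σ l s y θ t' ω ∂P = ∫ ω in A, MexpP n σ l s y θ s' ω ∂P

section PathSpaceBasics

open scoped ENNReal NNReal

instance instLocallyCompactSpaceIciZero : LocallyCompactSpace ↥(Set.Ici (0 : ℝ)) :=
  isClosed_Ici.locallyCompactSpace

variable {n : ℕ}

theorem continuous_Xcan_uncurry : Continuous (fun p : ℝ × PathSp n => Xcan n p.1 p.2) := by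
  unfold Xcan
  exact (continuous_eval (F := PathSp n)).comp
    (continuous_snd.prodMk ((continuous_fst.max continuous_const).subtype_mk _))

theorem continuous_Xcan (u : ℝ) : Continuous (Xcan n u) :=
  continuous_Xcan_uncurry.comp (continuous_const.prodMk continuous_id)

theorem continuous_Xcan_time (ω : PathSp n) : Continuous (fun u => Xcan n u ω) :=
  continuous_Xcan_uncurry.comp (continuous_id.prodMk continuous_const)

theorem measurable_Xcan_canonFiltr {u s : ℝ} (hs : 0 ≤ s) (hus : u ≤ s) :
    Measurable[canonFiltr n s] (Xcan n u) := by
  have h : Xcan n u = (fun f : Set.Icc (0 : ℝ) s → (Fin n → ℝ) =>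
      f ⟨max u 0, le_max_right u 0, max_le hus hs⟩) ∘
      (fun (ω : PathSp n) => fun u : Set.Icc (0 : ℝ) s => ω ⟨u.1, u.2.1⟩) := by
    ext ω; rfl
  rw [h]
  exact (measurable_pi_apply _).comp (comap_measurable _)

theorem canonFiltr_mono {s t : ℝ} (hst : s ≤ t) : canonFiltr n s ≤ canonFiltr n t := by
  rw [canonFiltr, ← measurable_iff_comap_le, @measurable_pi_iff]
  intro u
  have h : (fun ω : PathSp n => ω ⟨u.1, u.2.1⟩) = Xcan n u.1 := by
    ext ω; simp [Xcan, u.2.1]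
  rw [h]
  exact measurable_Xcan_canonFiltr ((u.2.1.trans u.2.2).trans hst) (u.2.2.trans hst)

theorem measurable_pathIntegral_canonFiltr {G : ℝ × (Fin n → ℝ) → ℝ} (hG : Measurable G)
    (s : ℝ) {t : ℝ} (ht : 0 ≤ t) :
    Measurable[canonFiltr n t] (fun ω => ∫ v in Set.Ioc s t, G (v, Xcan n v ω)) := by
  have h1 : (fun ω => ∫ v in Set.Ioc s t, G (v, Xcan n v ω)) =
      (fun ω => ∫ v in Set.Ioc s t, G (v, Xcan n (min v t) ω)) := by
    ext ω
    refine setIntegral_congr_fun measurableSet_Ioc fun v hv => ?_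
    simp only [min_eq_left hv.2]
  rw [h1]
  let _ : MeasurableSpace (PathSp n) := canonFiltr n t
  have h2 : Measurable (Function.uncurry fun (v : ℝ) (ω : PathSp n) => Xcan n (min v t) ω) := by
    refine measurable_uncurry_of_continuous_of_measurable (fun ω => ?_) fun v => ?_
    · exact (continuous_Xcan_time ω).comp (continuous_id.min continuous_const)
    · exact measurable_Xcan_canonFiltr ht (min_le_right _ _)
  have h3 : Measurable (fun p : PathSp n × ℝ => G (p.2, Xcan n (min p.2 t) p.1)) :=
    hG.comp (measurable_snd.prodMk (h2.comp measurable_swap))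
  exact (h3.stronglyMeasurable.integral_prod_right' (ν := volume.restrict (Set.Ioc s t))).measurable

variable [MeasurableSpace (PathSp n)] [BorelSpace (PathSp n)]

theorem measurable_Xcan (u : ℝ) : Measurable (Xcan n u) := (continuous_Xcan u).measurable

theorem measurable_Xcan_uncurry : Measurable (fun p : ℝ × PathSp n => Xcan n p.1 p.2) :=
  continuous_Xcan_uncurry.measurable

theorem canonFiltr_le (s : ℝ) : canonFiltr n s ≤ ‹MeasurableSpace (PathSp n)› := by
  rw [canonFiltr, ← measurable_iff_comap_le, @measurable_pi_iff]
  intro u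
  exact (continuous_eval_const (F := PathSp n) _).measurable

theorem measurable_pathIntegrand {G : ℝ × (Fin n → ℝ) → ℝ} (hG : Measurable G) :
    Measurable (fun p : ℝ × PathSp n => G (p.1, Xcan n p.1 p.2)) :=
  hG.comp (measurable_fst.prodMk measurable_Xcan_uncurry)

theorem measurable_pathIntegral {G : ℝ × (Fin n → ℝ) → ℝ} (hG : Measurable G) (s t : ℝ) :
    Measurable (fun ω : PathSp n => ∫ v in Set.Ioc s t, G (v, Xcan n v ω)) :=
  (((measurable_pathIntegrand hG).comp measurable_swap).stronglyMeasurable.integral_prod_right'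
    (ν := volume.restrict (Set.Ioc s t))).measurable

omit [MeasurableSpace (PathSp n)] [BorelSpace (PathSp n)] in
theorem integrableOn_path {G : ℝ × (Fin n → ℝ) → ℝ} (hG : Measurable G) {C : ℝ}
    (hC : ∀ p, |G p| ≤ C) (s t : ℝ) (ω : PathSp n) :
    IntegrableOn (fun v => G (v, Xcan n v ω)) (Set.Ioc s t) := by
  have hm : Measurable (fun v => G (v, Xcan n v ω)) :=
    hG.comp (measurable_id.prodMk (continuous_Xcan_time ω).measurable)
  exact Measure.integrableOn_of_bounded (M := C) (by simp) hm.aestronglyMeasurable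
    (Eventually.of_forall fun v => hC _)

omit [MeasurableSpace (PathSp n)] [BorelSpace (PathSp n)] in
theorem abs_pathIntegral_le {G : ℝ × (Fin n → ℝ) → ℝ} {C : ℝ}
    (hC : ∀ p, |G p| ≤ C) {s t : ℝ} (hst : s ≤ t) (ω : PathSp n) :
    |∫ v in Set.Ioc s t, G (v, Xcan n v ω)| ≤ C * (t - s) := by
  have := norm_setIntegral_le_of_norm_le_const (μ := volume) (s := Set.Ioc s t)
    (f := fun v => G (v, Xcan n v ω)) (C := C) (by simp) (fun v _ => hC _)
  simpa [hst] using this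

omit [MeasurableSpace (PathSp n)] [BorelSpace (PathSp n)] in
theorem pathIntegral_add {G : ℝ × (Fin n → ℝ) → ℝ} (hG : Measurable G) {C : ℝ}
    (hC : ∀ p, |G p| ≤ C) {s t u : ℝ} (hst : s ≤ t) (htu : t ≤ u) (ω : PathSp n) :
    (∫ v in Set.Ioc s u, G (v, Xcan n v ω)) =
      (∫ v in Set.Ioc s t, G (v, Xcan n v ω)) + ∫ v in Set.Ioc t u, G (v, Xcan n v ω) := by
  rw [← Set.Ioc_union_Ioc_eq_Ioc hst htu]
  exact setIntegral_union (Set.Ioc_disjoint_Ioc_of_le le_rfl) measurableSet_Ioc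
    (integrableOn_path hG hC _ _ _) (integrableOn_path hG hC _ _ _)

end PathSpaceBasics

section ExponentialMartingale

open scoped ENNReal NNReal

variable {n : ℕ}

/-- Bounded measurable diffusion matrix `a` and drift vector `b`. -/
structure BoundedCoeff (n : ℕ) (a : ℝ → (Fin n → ℝ) → Matrix (Fin n) (Fin n) ℝ)
    (b : ℝ → (Fin n → ℝ) → (Fin n → ℝ)) (B : ℝ) : Prop where
  nonneg : 0 ≤ B
  meas_a : ∀ i j, Measurable (fun p : ℝ × (Fin n → ℝ) => a p.1 p.2 i j)
  meas_b : ∀ i, Measurable (fun p : ℝ × (Fin n → ℝ) => b p.1 p.2 i)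
  bound_a : ∀ u x i j, |a u x i j| ≤ B
  bound_b : ∀ u x i, |b u x i| ≤ B

/-- The compensator density of `exp (θ ⬝ X)`. -/
noncomputable def compDens (a : ℝ → (Fin n → ℝ) → Matrix (Fin n) (Fin n) ℝ)
    (b : ℝ → (Fin n → ℝ) → (Fin n → ℝ)) (θ : Fin n → ℝ) (p : ℝ × (Fin n → ℝ)) : ℝ :=
  θ ⬝ᵥ b p.1 p.2 + 1 / 2 * (θ ⬝ᵥ (a p.1 p.2).mulVec θ)

/-- The increment of the exponential martingale between `s` and `t`. -/
noncomputable def expIncr (a : ℝ → (Fin n → ℝ) → Matrix (Fin n) (Fin n) ℝ)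
    (b : ℝ → (Fin n → ℝ) → (Fin n → ℝ)) (θ : Fin n → ℝ) (s t : ℝ) (ω : PathSp n) : ℝ :=
  Real.exp (θ ⬝ᵥ (Xcan n t ω - Xcan n s ω) - ∫ v in Set.Ioc s t, compDens a b θ (v, Xcan n v ω))

/-- A uniform bound for `compDens`. -/
noncomputable def compBound (n : ℕ) (B : ℝ) (θ : Fin n → ℝ) : ℝ :=
  B * (∑ i, |θ i|) + 1 / 2 * (B * (∑ i, |θ i|) ^ 2)

/-- All exponential increments after `s₀` have conditional expectation one. -/
def ExpMart [MeasurableSpace (PathSp n)] (a : ℝ → (Fin n → ℝ) → Matrix (Fin n) (Fin n) ℝ)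
    (b : ℝ → (Fin n → ℝ) → (Fin n → ℝ)) (s₀ : ℝ) (P : Measure (PathSp n)) : Prop :=
  ∀ (θ : Fin n → ℝ) (s t : ℝ), s₀ ≤ s → s ≤ t → ∀ Z : PathSp n → ℝ≥0∞,
    Measurable[canonFiltr n s] Z →
    ∫⁻ ω, Z ω * ENNReal.ofReal (expIncr a b θ s t ω) ∂P = ∫⁻ ω, Z ω ∂P

theorem abs_dotProduct_le_of_le {B : ℝ} (θ v : Fin n → ℝ) (hv : ∀ i, |v i| ≤ B) :
    |θ ⬝ᵥ v| ≤ B * ∑ i, |θ i| := by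
  rw [dotProduct, Finset.mul_sum]
  refine (Finset.abs_sum_le_sum_abs _ _).trans (Finset.sum_le_sum fun i _ => ?_)
  rw [abs_mul, mul_comm]
  exact mul_le_mul_of_nonneg_right (hv i) (abs_nonneg _)

theorem abs_quadForm_le_of_le {B : ℝ} (θ : Fin n → ℝ) (A : Matrix (Fin n) (Fin n) ℝ)
    (hA : ∀ i j, |A i j| ≤ B) :
    |θ ⬝ᵥ A.mulVec θ| ≤ B * (∑ i, |θ i|) ^ 2 := by
  have h := abs_dotProduct_le_of_le (B := B * ∑ i, |θ i|) θ (A.mulVec θ) fun i => by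
    rw [mulVec, dotProduct_comm]; exact abs_dotProduct_le_of_le _ _ (hA i)
  calc _ ≤ _ := h
    _ = _ := by ring

variable {a : ℝ → (Fin n → ℝ) → Matrix (Fin n) (Fin n) ℝ}
  {b : ℝ → (Fin n → ℝ) → (Fin n → ℝ)} {B : ℝ}

theorem BoundedCoeff.measurable_compDens (h : BoundedCoeff n a b B) (θ : Fin n → ℝ) :
    Measurable (compDens a b θ) := by
  unfold compDens
  refine Measurable.add ?_ (Measurable.const_mul ?_ _)
  · exact Finset.measurable_sum _ fun i _ => (h.meas_b i).const_mul _
  · refine Finset.measurable_sum _ fun i _ => Measurable.const_mul ?_ _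
    simp only [mulVec, dotProduct]
    exact Finset.measurable_sum _ fun j _ => (h.meas_a i j).mul_const _

theorem BoundedCoeff.abs_compDens_le (h : BoundedCoeff n a b B) (θ : Fin n → ℝ)
    (p : ℝ × (Fin n → ℝ)) : |compDens a b θ p| ≤ compBound n B θ := by
  unfold compDens compBound
  refine (abs_add_le _ _).trans (add_le_add (abs_dotProduct_le_of_le _ _ (h.bound_b _ _)) ?_)
  rw [abs_mul, abs_of_pos (by norm_num : (0 : ℝ) < 1 / 2)]
  exact mul_le_mul_of_nonneg_left (abs_quadForm_le_of_le _ _ (h.bound_a _ _)) (by norm_num)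

theorem compBound_nonneg (hB : 0 ≤ B) (θ : Fin n → ℝ) : 0 ≤ compBound n B θ := by
  unfold compBound
  have : 0 ≤ ∑ i, |θ i| := Finset.sum_nonneg fun i _ => abs_nonneg _
  positivity

theorem expIncr_pos (θ : Fin n → ℝ) (s t : ℝ) (ω : PathSp n) : 0 < expIncr a b θ s t ω :=
  Real.exp_pos _

theorem BoundedCoeff.expIncr_mul (h : BoundedCoeff n a b B) (θ : Fin n → ℝ) {s t u : ℝ}
    (hst : s ≤ t) (htu : t ≤ u) (ω : PathSp n) :
    expIncr a b θ s u ω = expIncr a b θ s t ω * expIncr a b θ t u ω := by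
  unfold expIncr
  rw [← Real.exp_add, pathIntegral_add (h.measurable_compDens θ) (h.abs_compDens_le θ) hst htu]
  congr 1
  simp only [dotProduct_sub]
  ring

theorem measurable_dotProduct_left {α : Type*} [MeasurableSpace α] {f : α → (Fin n → ℝ)}
    (hf : Measurable f) (θ : Fin n → ℝ) : Measurable (fun x => θ ⬝ᵥ f x) :=
  Finset.measurable_sum _ fun i _ => ((measurable_pi_apply i).comp hf).const_mul _

theorem BoundedCoeff.measurable_expIncr_canonFiltr (h : BoundedCoeff n a b B) (θ : Fin n → ℝ)
    {s t : ℝ} (ht : 0 ≤ t) (hst : s ≤ t) :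
    Measurable[canonFiltr n t] (expIncr a b θ s t) := by
  unfold expIncr
  refine Real.measurable_exp.comp (Measurable.sub ?_ ?_)
  · exact @measurable_dotProduct_left n _ (canonFiltr n t) _
      ((measurable_Xcan_canonFiltr ht le_rfl).sub (measurable_Xcan_canonFiltr ht hst)) θ
  · exact measurable_pathIntegral_canonFiltr (h.measurable_compDens θ) s ht

theorem BoundedCoeff.measurable_expIncr [MeasurableSpace (PathSp n)] [BorelSpace (PathSp n)]
    (h : BoundedCoeff n a b B) (θ : Fin n → ℝ) (s t : ℝ) :
    Measurable (expIncr a b θ s t) := by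
  unfold expIncr
  refine Real.measurable_exp.comp (Measurable.sub ?_ ?_)
  · exact measurable_dotProduct_left ((measurable_Xcan _).sub (measurable_Xcan _)) θ
  · exact measurable_pathIntegral (h.measurable_compDens θ) s t

end ExponentialMartingale

section MartingaleProblem

open scoped ENNReal NNReal

variable {n : ℕ} [MeasurableSpace (PathSp n)] [BorelSpace (PathSp n)]
  {σ : ℝ → (Fin n → ℝ) → Matrix (Fin n) (Fin n) ℝ} {l : ℝ → (Fin n → ℝ) → (Fin n → ℝ)}
  {B : ℝ} {s : ℝ} {y : Fin n → ℝ} {P : Measure (PathSp n)}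

omit [MeasurableSpace (PathSp n)] [BorelSpace (PathSp n)] in
theorem isClosed_frozen (s : ℝ) (y : Fin n → ℝ) :
    IsClosed {ω : PathSp n | ∀ u ≤ s, Xcan n u ω = y} := by
  have h : {ω : PathSp n | ∀ u ≤ s, Xcan n u ω = y} =
      ⋂ u : ℝ, ⋂ _ : u ≤ s, {ω | Xcan n u ω = y} := by
    ext ω; simp
  rw [h]
  exact isClosed_iInter fun u => isClosed_iInter fun _ =>
    isClosed_eq (continuous_Xcan u) continuous_const

omit [MeasurableSpace (PathSp n)] [BorelSpace (PathSp n)] in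
theorem MexpP_eq_expIncr
    (h : BoundedCoeff n (fun u x => σ u x * (σ u x)ᵀ) (fun u x => (σ u x).mulVec (l u x)) B)
    (θ : Fin n → ℝ) (u : ℝ) {ω : PathSp n} (hω : Xcan n s ω = y) :
    MexpP n σ l s y θ u ω =
      expIncr (fun u x => σ u x * (σ u x)ᵀ) (fun u x => (σ u x).mulVec (l u x)) θ s u ω := by
  unfold MexpP expIncr compDens
  have hb : Measurable (fun p : ℝ × (Fin n → ℝ) => θ ⬝ᵥ (σ p.1 p.2).mulVec (l p.1 p.2)) :=
    Finset.measurable_sum _ fun i _ => (h.meas_b i).const_mul _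
  have ha : Measurable (fun p : ℝ × (Fin n → ℝ) =>
      θ ⬝ᵥ (σ p.1 p.2 * (σ p.1 p.2)ᵀ).mulVec θ) := by
    refine Finset.measurable_sum _ fun i _ => Measurable.const_mul ?_ _
    simp only [mulVec, dotProduct]
    exact Finset.measurable_sum _ fun j _ => (h.meas_a i j).mul_const _
  have ib := integrableOn_path hb (fun p => abs_dotProduct_le_of_le θ _ (h.bound_b p.1 p.2)) s u ω
  have ia := integrableOn_path ha (fun p => abs_quadForm_le_of_le θ _ (h.bound_a p.1 p.2)) s u ω
  simp only
  rw [integral_add ib (ia.const_mul _), integral_const_mul, hω, sub_sub]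

theorem SolvesMPFrom.ae_frozen [IsProbabilityMeasure P] (h : SolvesMPFrom n σ l s y P) :
    ∀ᵐ ω ∂P, ∀ u ≤ s, Xcan n u ω = y :=
  (mem_ae_iff_prob_eq_one (isClosed_frozen s y).measurableSet).2 h.1

theorem SolvesMPFrom.expMart [IsProbabilityMeasure P]
    (hc : BoundedCoeff n (fun u x => σ u x * (σ u x)ᵀ) (fun u x => (σ u x).mulVec (l u x)) B)
    (hs : 0 ≤ s) (h : SolvesMPFrom n σ l s y P) :
    ExpMart (fun u x => σ u x * (σ u x)ᵀ) (fun u x => (σ u x).mulVec (l u x)) s P := by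
  intro θ s' t' hs' ht' Z hZ
  set a : ℝ → (Fin n → ℝ) → Matrix (Fin n) (Fin n) ℝ := fun u x => σ u x * (σ u x)ᵀ
  set b : ℝ → (Fin n → ℝ) → (Fin n → ℝ) := fun u x => (σ u x).mulVec (l u x)
  have hX : ∀ᵐ ω ∂P, Xcan n s ω = y := h.ae_frozen.mono fun ω hω => hω s le_rfl
  have hM : ∀ u, MexpP n σ l s y θ u =ᵐ[P] expIncr a b θ s u := fun u =>
    hX.mono fun ω hω => MexpP_eq_expIncr hc θ u hω
  have hint : ∀ u, s ≤ u → Integrable (expIncr a b θ s u) P := fun u hu =>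
    ((h.2 θ u u hu le_rfl).1).congr (hM u)
  have hle := canonFiltr_le (n := n) s'
  have key : ∀ W : PathSp n → ℝ≥0∞, Measurable[canonFiltr n s'] W →
      ∫⁻ ω, W ω * ENNReal.ofReal (expIncr a b θ s t' ω) ∂P =
        ∫⁻ ω, W ω * ENNReal.ofReal (expIncr a b θ s s' ω) ∂P := by
    intro W hW
    have hmt := (hc.measurable_expIncr θ s t').ennreal_ofReal
    have hms := (hc.measurable_expIncr θ s s').ennreal_ofReal
    have htrim : (P.withDensity fun ω => ENNReal.ofReal (expIncr a b θ s t' ω)).trim hle =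
        (P.withDensity fun ω => ENNReal.ofReal (expIncr a b θ s s' ω)).trim hle := by
      refine @Measure.ext _ (canonFiltr n s') _ _ fun A hA => ?_
      rw [trim_measurableSet_eq hle hA, trim_measurableSet_eq hle hA,
        withDensity_apply _ (hle _ hA), withDensity_apply _ (hle _ hA),
        ← ofReal_integral_eq_lintegral_ofReal (hint _ (hs'.trans ht')).integrableOn
          (Eventually.of_forall fun ω => (expIncr_pos θ s t' ω).le),
        ← ofReal_integral_eq_lintegral_ofReal (hint _ hs').integrableOn
          (Eventually.of_forall fun ω => (expIncr_pos θ s s' ω).le)]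
      have h1 := (h.2 θ s' t' hs' ht').2 A hA
      rw [setIntegral_congr_ae (g := expIncr a b θ s t') (hle _ hA)
          ((hM t').mono fun ω hω _ => hω),
        setIntegral_congr_ae (g := expIncr a b θ s s') (hle _ hA)
          ((hM s').mono fun ω hω _ => hω)] at h1
      rw [h1]
    have h2 := congrArg (fun μ => @lintegral _ (canonFiltr n s') μ W) htrim
    beta_reduce at h2
    rw [lintegral_trim hle hW, lintegral_trim hle hW,
      lintegral_withDensity_eq_lintegral_mul _ hmt (hW.mono hle le_rfl),
      lintegral_withDensity_eq_lintegral_mul _ hms (hW.mono hle le_rfl)] at h2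
    simpa only [Pi.mul_apply, mul_comm] using h2
  have hs'0 : 0 ≤ s' := hs.trans hs'
  have hN := (hc.measurable_expIncr_canonFiltr θ hs'0 hs').ennreal_ofReal
  have hpos : ∀ ω, ENNReal.ofReal (expIncr a b θ s s' ω) ≠ 0 := fun ω => by
    simpa using expIncr_pos θ s s' ω
  have h3 := key (fun ω => Z ω / ENNReal.ofReal (expIncr a b θ s s' ω)) (hZ.div hN)
  have h4 : ∀ ω, Z ω / ENNReal.ofReal (expIncr a b θ s s' ω) *
      ENNReal.ofReal (expIncr a b θ s t' ω) = Z ω * ENNReal.ofReal (expIncr a b θ s' t' ω) := by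
    intro ω
    rw [hc.expIncr_mul θ hs' ht', ENNReal.ofReal_mul (expIncr_pos θ s s' ω).le, ← mul_assoc,
      ENNReal.div_mul_cancel (hpos ω) ENNReal.ofReal_ne_top]
  have h5 : ∀ ω, Z ω / ENNReal.ofReal (expIncr a b θ s s' ω) *
      ENNReal.ofReal (expIncr a b θ s s' ω) = Z ω := fun ω =>
    ENNReal.div_mul_cancel (hpos ω) ENNReal.ofReal_ne_top
  simpa only [h4, h5] using h3

theorem ExpMart.solvesMPFrom [IsProbabilityMeasure P]
    (hc : BoundedCoeff n (fun u x => σ u x * (σ u x)ᵀ) (fun u x => (σ u x).mulVec (l u x)) B)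
    (hs : 0 ≤ s) (hfr : ∀ᵐ ω ∂P, ∀ u ≤ s, Xcan n u ω = y)
    (h : ExpMart (fun u x => σ u x * (σ u x)ᵀ) (fun u x => (σ u x).mulVec (l u x)) s P) :
    SolvesMPFrom n σ l s y P := by
  refine ⟨(mem_ae_iff_prob_eq_one (isClosed_frozen s y).measurableSet).1 hfr, ?_⟩
  intro θ s' t' hs' ht'
  set a : ℝ → (Fin n → ℝ) → Matrix (Fin n) (Fin n) ℝ := fun u x => σ u x * (σ u x)ᵀ
  set b : ℝ → (Fin n → ℝ) → (Fin n → ℝ) := fun u x => (σ u x).mulVec (l u x)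
  have hM : ∀ u, MexpP n σ l s y θ u =ᵐ[P] expIncr a b θ s u := fun u =>
    hfr.mono fun ω hω => MexpP_eq_expIncr hc θ u (hω s le_rfl)
  have hint : ∀ u, s ≤ u → Integrable (expIncr a b θ s u) P := fun u hu => by
    refine ⟨(hc.measurable_expIncr θ s u).aestronglyMeasurable, ?_⟩
    rw [hasFiniteIntegral_iff_ofReal (Eventually.of_forall fun ω => (expIncr_pos θ s u ω).le)]
    have := h θ s u le_rfl hu (fun _ => 1) measurable_const
    simp only [one_mul, lintegral_const, measure_univ] at this
    rw [this]; exact ENNReal.one_lt_top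
  refine ⟨(hint t' (hs'.trans ht')).congr (hM t').symm, fun A hA => ?_⟩
  have hAm := canonFiltr_le s' _ hA
  rw [setIntegral_congr_ae (g := expIncr a b θ s t') hAm ((hM t').mono fun ω hω _ => hω),
    setIntegral_congr_ae (g := expIncr a b θ s s') hAm ((hM s').mono fun ω hω _ => hω),
    integral_eq_lintegral_of_nonneg_ae (Eventually.of_forall fun ω => (expIncr_pos θ s t' ω).le)
      (hc.measurable_expIncr θ s t').aestronglyMeasurable,
    integral_eq_lintegral_of_nonneg_ae (Eventually.of_forall fun ω => (expIncr_pos θ s s' ω).le)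
      (hc.measurable_expIncr θ s s').aestronglyMeasurable]
  congr 1
  have hN := (hc.measurable_expIncr_canonFiltr θ (hs.trans hs') hs').ennreal_ofReal
  have h1 := h θ s' t' hs' ht'
    (A.indicator fun ω => ENNReal.ofReal (expIncr a b θ s s' ω)) (hN.indicator hA)
  rw [← lintegral_indicator hAm, ← lintegral_indicator hAm, ← h1]
  refine lintegral_congr fun ω => ?_
  by_cases hω : ω ∈ A
  · simp only [Set.indicator_of_mem hω]
    rw [hc.expIncr_mul θ hs' ht', ENNReal.ofReal_mul (expIncr_pos θ s s' ω).le]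
  · simp [hω]

end MartingaleProblem

section Moments

open scoped ENNReal NNReal

variable {n : ℕ} [MeasurableSpace (PathSp n)] [BorelSpace (PathSp n)]
  {a : ℝ → (Fin n → ℝ) → Matrix (Fin n) (Fin n) ℝ}
  {b : ℝ → (Fin n → ℝ) → (Fin n → ℝ)} {B s₀ s t : ℝ} {P : Measure (PathSp n)}
  [IsProbabilityMeasure P]

omit [BorelSpace (PathSp n)] in
theorem ExpMart.lintegral_expIncr (h : ExpMart a b s₀ P) (θ : Fin n → ℝ) (hs : s₀ ≤ s)
    (hst : s ≤ t) : ∫⁻ ω, ENNReal.ofReal (expIncr a b θ s t ω) ∂P = 1 := by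
  have := h θ s t hs hst (fun _ => 1) measurable_const
  simpa using this

omit [MeasurableSpace (PathSp n)] [BorelSpace (PathSp n)] in
theorem BoundedCoeff.exp_le_expIncr (hc : BoundedCoeff n a b B) (θ : Fin n → ℝ) (hst : s ≤ t)
    (ω : PathSp n) : Real.exp (θ ⬝ᵥ (Xcan n t ω - Xcan n s ω)) ≤
      Real.exp (compBound n B θ * (t - s)) * expIncr a b θ s t ω := by
  rw [expIncr, ← Real.exp_add]
  have := (abs_le.1 (abs_pathIntegral_le (hc.abs_compDens_le θ) hst ω)).2
  exact Real.exp_le_exp.2 (by linarith)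

omit [BorelSpace (PathSp n)] in
theorem ExpMart.lintegral_exp_le (h : ExpMart a b s₀ P) (hc : BoundedCoeff n a b B)
    (θ : Fin n → ℝ) (hs : s₀ ≤ s) (hst : s ≤ t) :
    ∫⁻ ω, ENNReal.ofReal (Real.exp (θ ⬝ᵥ (Xcan n t ω - Xcan n s ω))) ∂P ≤
      ENNReal.ofReal (Real.exp (compBound n B θ * (t - s))) := by
  calc _ ≤ ∫⁻ ω, ENNReal.ofReal (Real.exp (compBound n B θ * (t - s))) *
        ENNReal.ofReal (expIncr a b θ s t ω) ∂P := by
        refine lintegral_mono fun ω => ?_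
        rw [← ENNReal.ofReal_mul (Real.exp_pos _).le]
        exact ENNReal.ofReal_le_ofReal (hc.exp_le_expIncr θ hst ω)
    _ = _ := by
        rw [lintegral_const_mul' _ _ ENNReal.ofReal_ne_top, h.lintegral_expIncr θ hs hst, mul_one]

/-- The constant in the moment bounds for increments. -/
noncomputable def momentConst (n : ℕ) (B T : ℝ) (p : ℕ) : ℝ :=
  n * (p.factorial * (2 * Real.exp (B * √T + B / 2)))

theorem momentConst_nonneg (n : ℕ) (B T : ℝ) (p : ℕ) : 0 ≤ momentConst n B T p := by
  unfold momentConst; positivity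

theorem ExpMart.lintegral_coord_pow_le (h : ExpMart a b s₀ P) (hc : BoundedCoeff n a b B)
    (hs : s₀ ≤ s) (hst : s < t) {T : ℝ} (hT : t - s ≤ T) (p : ℕ) (i : Fin n) :
    ∫⁻ ω, ENNReal.ofReal (|Xcan n t ω i - Xcan n s ω i| ^ p) ∂P ≤
      ENNReal.ofReal (p.factorial * (2 * Real.exp (B * √T + B / 2)) * √(t - s) ^ p) := by
  have hh : 0 < √(t - s) := Real.sqrt_pos.2 (by linarith)
  have hhT : √(t - s) ≤ √T := Real.sqrt_le_sqrt hT
  have hsq : √(t - s) ^ 2 = t - s := Real.sq_sqrt (by linarith)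
  have hexp : ∀ ε : ℝ, |ε| = 1 →
      ∫⁻ ω, ENNReal.ofReal (Real.exp (ε / √(t - s) * (Xcan n t ω i - Xcan n s ω i))) ∂P ≤
        ENNReal.ofReal (Real.exp (B * √T + B / 2)) := by
    intro ε hε
    have h1 := h.lintegral_exp_le hc (Pi.single i (ε / √(t - s))) hs hst.le
    simp only [single_dotProduct, Pi.sub_apply] at h1
    refine h1.trans (ENNReal.ofReal_le_ofReal (Real.exp_le_exp.2 ?_))
    have h2 : ∑ j, |(Pi.single i (ε / √(t - s)) : Fin n → ℝ) j| = 1 / √(t - s) := by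
      rw [Finset.sum_eq_single i]
      · simp [abs_div, hε, abs_of_pos hh]
      · intro j _ hj; simp [hj]
      · simp
    have hB := hc.nonneg
    rw [compBound, h2]
    have h3 : (B * (1 / √(t - s)) + 1 / 2 * (B * (1 / √(t - s)) ^ 2)) * (t - s) =
        B * √(t - s) + B / 2 := by
      rw [← hsq]; field_simp; rw [Real.sqrt_sq hh.le]
    rw [h3]
    nlinarith
  have hpt : ∀ ω : PathSp n, |Xcan n t ω i - Xcan n s ω i| ^ p ≤ p.factorial * √(t - s) ^ p *
      (Real.exp (1 / √(t - s) * (Xcan n t ω i - Xcan n s ω i)) +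
        Real.exp (-1 / √(t - s) * (Xcan n t ω i - Xcan n s ω i))) := by
    intro ω
    set x := Xcan n t ω i - Xcan n s ω i
    have h1 : (|x| / √(t - s)) ^ p / p.factorial ≤ Real.exp (|x| / √(t - s)) :=
      Real.pow_div_factorial_le_exp _ (by positivity) p
    have h2 : Real.exp (|x| / √(t - s)) ≤
        Real.exp (1 / √(t - s) * x) + Real.exp (-1 / √(t - s) * x) := by
      rcases abs_cases x with ⟨hx, _⟩ | ⟨hx, _⟩
      · rw [hx, show x / √(t - s) = 1 / √(t - s) * x by ring]
        linarith [Real.exp_pos (-1 / √(t - s) * x)]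
      · rw [hx, show -x / √(t - s) = -1 / √(t - s) * x by ring]
        linarith [Real.exp_pos (1 / √(t - s) * x)]
    rw [div_le_iff₀ (by positivity), div_pow, div_le_iff₀ (by positivity)] at h1
    calc |x| ^ p ≤ _ := h1
      _ = p.factorial * √(t - s) ^ p * Real.exp (|x| / √(t - s)) := by ring
      _ ≤ _ := mul_le_mul_of_nonneg_left h2 (by positivity)
  calc _ ≤ ∫⁻ ω, ENNReal.ofReal (p.factorial * √(t - s) ^ p) *
      (ENNReal.ofReal (Real.exp (1 / √(t - s) * (Xcan n t ω i - Xcan n s ω i))) +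
        ENNReal.ofReal (Real.exp (-1 / √(t - s) * (Xcan n t ω i - Xcan n s ω i)))) ∂P := by
        refine lintegral_mono fun ω => ?_
        rw [← ENNReal.ofReal_add (Real.exp_pos _).le (Real.exp_pos _).le,
          ← ENNReal.ofReal_mul (by positivity)]
        exact ENNReal.ofReal_le_ofReal (hpt ω)
    _ ≤ ENNReal.ofReal (p.factorial * √(t - s) ^ p) *
        (ENNReal.ofReal (Real.exp (B * √T + B / 2)) +
          ENNReal.ofReal (Real.exp (B * √T + B / 2))) := by
        rw [lintegral_const_mul' _ _ ENNReal.ofReal_ne_top]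
        gcongr
        have hm : Measurable fun ω : PathSp n => ENNReal.ofReal
            (Real.exp (1 / √(t - s) * (Xcan n t ω i - Xcan n s ω i))) := by
          have h1 := (measurable_pi_apply i).comp (measurable_Xcan (n := n) t)
          have h2 := (measurable_pi_apply i).comp (measurable_Xcan (n := n) s)
          exact (Real.measurable_exp.comp ((h1.sub h2).const_mul _)).ennreal_ofReal
        rw [lintegral_add_left hm]
        exact add_le_add (hexp 1 (by simp)) (hexp (-1) (by simp))
    _ = _ := by
        rw [← ENNReal.ofReal_add (Real.exp_pos _).le (Real.exp_pos _).le,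
          ← ENNReal.ofReal_mul (by positivity)]
        congr 1; ring

omit [MeasurableSpace (PathSp n)] [BorelSpace (PathSp n)] in
theorem norm_pow_le_sum_abs_pow (x : Fin n → ℝ) {p : ℕ} (hp : p ≠ 0) :
    ‖x‖ ^ p ≤ ∑ i, |x i| ^ p := by
  rcases isEmpty_or_nonempty (Fin n) with hn | hn
  · simp [Pi.norm_def, hp]
  · obtain ⟨i, hi⟩ := (Finite.exists_max fun i => ‖x i‖)
    have h1 : ‖x‖ ≤ ‖x i‖ := (pi_norm_le_iff_of_nonneg (norm_nonneg _)).2 hi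
    calc ‖x‖ ^ p ≤ |x i| ^ p := pow_le_pow_left₀ (norm_nonneg _) h1 p
      _ ≤ _ := Finset.single_le_sum (f := fun i => |x i| ^ p)
        (fun j _ => by positivity) (Finset.mem_univ i)

theorem ExpMart.lintegral_norm_pow_le (h : ExpMart a b s₀ P) (hc : BoundedCoeff n a b B)
    (hs : s₀ ≤ s) (hst : s ≤ t) {T : ℝ} (hT : t - s ≤ T) {p : ℕ} (hp : p ≠ 0) :
    ∫⁻ ω, ENNReal.ofReal (‖Xcan n t ω - Xcan n s ω‖ ^ p) ∂P ≤
      ENNReal.ofReal (momentConst n B T p * √(t - s) ^ p) := by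
  rcases hst.eq_or_lt with rfl | hst
  · simp [hp]
  calc _ ≤ ∫⁻ ω, ∑ i, ENNReal.ofReal (|Xcan n t ω i - Xcan n s ω i| ^ p) ∂P := by
        refine lintegral_mono fun ω => ?_
        rw [← ENNReal.ofReal_sum_of_nonneg fun i _ => by positivity]
        exact ENNReal.ofReal_le_ofReal (norm_pow_le_sum_abs_pow _ hp)
    _ = ∑ i, ∫⁻ ω, ENNReal.ofReal (|Xcan n t ω i - Xcan n s ω i| ^ p) ∂P := by
        refine lintegral_finsetSum _ fun i _ => ?_
        have h1 := (measurable_pi_apply i).comp (measurable_Xcan (n := n) t)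
        have h2 := (measurable_pi_apply i).comp (measurable_Xcan (n := n) s)
        exact ((h1.sub h2).abs.pow_const p).ennreal_ofReal
    _ ≤ ∑ _i : Fin n, ENNReal.ofReal
        (p.factorial * (2 * Real.exp (B * √T + B / 2)) * √(t - s) ^ p) :=
        Finset.sum_le_sum fun i _ => h.lintegral_coord_pow_le hc hs hst hT p i
    _ = _ := by
        rw [Finset.sum_const, Finset.card_univ, Fintype.card_fin, nsmul_eq_mul,
          ← ENNReal.ofReal_natCast, ← ENNReal.ofReal_mul (by positivity), momentConst]
        congr 1; ring

theorem ExpMart.lintegral_norm_pow_le_of_frozen (h : ExpMart a b s₀ P)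
    (hc : BoundedCoeff n a b B) {y : Fin n → ℝ} (hfr : ∀ᵐ ω ∂P, ∀ u ≤ s₀, Xcan n u ω = y)
    (hst : s ≤ t) {T : ℝ} (hT : t - s ≤ T) {p : ℕ} (hp : p ≠ 0) :
    ∫⁻ ω, ENNReal.ofReal (‖Xcan n t ω - Xcan n s ω‖ ^ p) ∂P ≤
      ENNReal.ofReal (momentConst n B T p * √(t - s) ^ p) := by
  have h0 : max t s₀ - max s s₀ ≤ t - s := by
    rcases le_total s s₀ with h1 | h1 <;> rcases le_total t s₀ with h2 | h2 <;>
      simp only [max_eq_left, max_eq_right, h1, h2] <;> linarith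
  have h1 := h.lintegral_norm_pow_le hc (le_max_right s s₀) (max_le_max_right s₀ hst)
    (h0.trans hT) hp
  have h2 : ∀ᵐ ω ∂P, ∀ u, Xcan n (max u s₀) ω = Xcan n u ω := hfr.mono fun ω hω u => by
    rcases le_total u s₀ with hu | hu
    · rw [max_eq_right hu, hω _ le_rfl, hω _ hu]
    · rw [max_eq_left hu]
  calc _ = _ := lintegral_congr_ae (h2.mono fun ω hω => by simp only [hω] : _ =ᵐ[P]
        fun ω => ENNReal.ofReal (‖Xcan n (max t s₀) ω - Xcan n (max s s₀) ω‖ ^ p))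
    _ ≤ _ := h1
    _ ≤ _ := by
      gcongr
      exact momentConst_nonneg _ _ _ _

end Moments

section ExponentialExpansion

theorem abs_exp_sub_quadratic_le (U : ℝ) :
    |Real.exp U - (1 + U + U ^ 2 / 2)| ≤ |U| ^ 3 * Real.exp |U| := by
  have h := Complex.norm_exp_sub_sum_le_norm_mul_exp (U : ℂ) 3
  have h2 : Complex.exp (U : ℂ) - ∑ m ∈ Finset.range 3, (U : ℂ) ^ m / m.factorial =
      ((Real.exp U - (1 + U + U ^ 2 / 2) : ℝ) : ℂ) := by
    simp [Finset.sum_range_succ, Nat.factorial]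
  rw [h2, Complex.norm_real, Complex.norm_real] at h
  simpa using h

theorem abs_exp_sub_quadratic_le_scaled {U δ Y : ℝ} (hδ : 0 < δ) (hδ1 : δ ≤ 1) (hY : 0 ≤ Y)
    (hU : |U| ≤ δ * Y) :
    |Real.exp U - (1 + U + U ^ 2 / 2)| ≤ 6 * δ ^ 3 * Real.exp (2 * Y) := by
  refine (abs_exp_sub_quadratic_le U).trans ?_
  have h1 : |U| ^ 3 ≤ (δ * Y) ^ 3 := pow_le_pow_left₀ (abs_nonneg _) hU 3
  have h2 : Real.exp |U| ≤ Real.exp Y := Real.exp_le_exp.2 (hU.trans (by nlinarith))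
  have h3 : Y ^ 3 / (Nat.factorial 3) ≤ Real.exp Y := Real.pow_div_factorial_le_exp _ hY 3
  have h4 : Y ^ 3 ≤ 6 * Real.exp Y := by
    simp [Nat.factorial] at h3; linarith
  calc |U| ^ 3 * Real.exp |U| ≤ (δ * Y) ^ 3 * Real.exp Y := by gcongr
    _ = δ ^ 3 * (Y ^ 3 * Real.exp Y) := by ring
    _ ≤ δ ^ 3 * (6 * Real.exp Y * Real.exp Y) := by gcongr
    _ = _ := by rw [two_mul Y, Real.exp_add]; ring

theorem abs_exp_add_exp_sub_le {x β α δ C : ℝ} (hδ : 0 < δ) (hδ1 : δ ≤ 1) (hC : 0 ≤ C)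
    (hβ : |β| ≤ C * δ ^ 2) (hα : |α| ≤ C * δ ^ 2) :
    |Real.exp (x - β - α / 2) + Real.exp (-x + β - α / 2) - 2 - (x ^ 2 - α)| ≤
      (12 + 2 * C + 2 * C ^ 2) * δ ^ 3 * Real.exp (2 * (|x| / δ + 2 * C)) ∧
    |Real.exp (x - β - α / 2) - Real.exp (-x + β - α / 2) - 2 * (x - β)| ≤
      (12 + 2 * C + 2 * C ^ 2) * δ ^ 3 * Real.exp (2 * (|x| / δ + 2 * C)) := by
  set Y := |x| / δ + 2 * C with hYdef
  have hY : 0 ≤ Y := by positivity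
  have hδY : δ * Y = |x| + 2 * C * δ := by rw [hYdef]; field_simp
  have hδ2 : δ ^ 2 ≤ δ := by nlinarith
  have hCδ : C * δ ^ 2 ≤ C * δ := by gcongr
  have hCδ0 : 0 ≤ C * δ := by positivity
  have hxβ : |x - β| ≤ δ * Y := by
    have := abs_sub x β; rw [hδY]; linarith
  have hx : |x| ≤ δ * Y := by rw [hδY]; linarith
  have hα2 : |α / 2| ≤ C * δ ^ 2 / 2 := by
    rw [abs_div, abs_two]; linarith
  have hU1 : |x - β - α / 2| ≤ δ * Y := by
    have h1 := abs_sub (x - β) (α / 2)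
    have h2 := abs_sub x β
    rw [hδY]; linarith
  have hU2 : |-x + β - α / 2| ≤ δ * Y := by
    have h1 := abs_sub (-x + β) (α / 2)
    have h2 := abs_add_le (-x) β
    rw [abs_neg] at h2
    rw [hδY]; linarith
  have e1 := abs_exp_sub_quadratic_le_scaled hδ hδ1 hY hU1
  have e2 := abs_exp_sub_quadratic_le_scaled hδ hδ1 hY hU2
  have hexp1 : 1 ≤ Real.exp (2 * Y) := Real.one_le_exp (by positivity)
  have hexpY : Y ≤ Real.exp (2 * Y) := by
    have := Real.add_one_le_exp (2 * Y); linarith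
  have hδ43 : δ ^ 4 ≤ δ ^ 3 := by
    calc δ ^ 4 = δ ^ 3 * δ := by ring
      _ ≤ δ ^ 3 * 1 := by gcongr
      _ = _ := mul_one _
  have c1 : |-(2 * (x * β)) + β ^ 2 + α ^ 2 / 4| ≤ (2 * C + 2 * C ^ 2) * δ ^ 3 *
      Real.exp (2 * Y) := by
    have h1 : |x * β| ≤ δ * Y * (C * δ ^ 2) := by
      rw [abs_mul]; gcongr
    have h2 : β ^ 2 ≤ (C * δ ^ 2) ^ 2 := by rw [← sq_abs]; gcongr
    have h3 : α ^ 2 ≤ (C * δ ^ 2) ^ 2 := by rw [← sq_abs α]; gcongr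
    have h4 : (C * δ ^ 2) ^ 2 ≤ C ^ 2 * δ ^ 3 := by
      calc (C * δ ^ 2) ^ 2 = C ^ 2 * δ ^ 4 := by ring
        _ ≤ _ := by gcongr
    have h5 : δ * Y * (C * δ ^ 2) ≤ C * δ ^ 3 * Real.exp (2 * Y) := by
      calc δ * Y * (C * δ ^ 2) = C * δ ^ 3 * Y := by ring
        _ ≤ _ := by gcongr
    have h6 : C ^ 2 * δ ^ 3 ≤ C ^ 2 * δ ^ 3 * Real.exp (2 * Y) :=
      le_mul_of_one_le_right (by positivity) hexp1
    have h7 := abs_le.1 h1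
    have h8 : (2 * C + 2 * C ^ 2) * δ ^ 3 * Real.exp (2 * Y) =
      2 * (C * δ ^ 3 * Real.exp (2 * Y)) + 2 * (C ^ 2 * δ ^ 3 * Real.exp (2 * Y)) := by ring
    rw [h8, abs_le]
    constructor <;> linarith [sq_nonneg β, sq_nonneg α]
  have c2 : |(x - β) * α| ≤ C * δ ^ 3 * Real.exp (2 * Y) := by
    rw [abs_mul]
    calc _ ≤ δ * Y * (C * δ ^ 2) := by gcongr
      _ = C * δ ^ 3 * Y := by ring
      _ ≤ _ := by gcongr
  have hpos : 0 ≤ C * δ ^ 3 * Real.exp (2 * Y) := by positivity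
  have hpos2 : 0 ≤ C ^ 2 * δ ^ 3 * Real.exp (2 * Y) := by positivity
  have hK : (12 + 2 * C + 2 * C ^ 2) * δ ^ 3 * Real.exp (2 * Y) =
      12 * (δ ^ 3 * Real.exp (2 * Y)) + 2 * (C * δ ^ 3 * Real.exp (2 * Y)) +
        2 * (C ^ 2 * δ ^ 3 * Real.exp (2 * Y)) := by ring
  have hK2 : (2 * C + 2 * C ^ 2) * δ ^ 3 * Real.exp (2 * Y) =
      2 * (C * δ ^ 3 * Real.exp (2 * Y)) + 2 * (C ^ 2 * δ ^ 3 * Real.exp (2 * Y)) := by ring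
  have i1 : Real.exp (x - β - α / 2) + Real.exp (-x + β - α / 2) - 2 - (x ^ 2 - α) =
      (Real.exp (x - β - α / 2) - (1 + (x - β - α / 2) + (x - β - α / 2) ^ 2 / 2)) +
      (Real.exp (-x + β - α / 2) - (1 + (-x + β - α / 2) + (-x + β - α / 2) ^ 2 / 2)) +
      (-(2 * (x * β)) + β ^ 2 + α ^ 2 / 4) := by ring
  have i2 : Real.exp (x - β - α / 2) - Real.exp (-x + β - α / 2) - 2 * (x - β) =
      (Real.exp (x - β - α / 2) - (1 + (x - β - α / 2) + (x - β - α / 2) ^ 2 / 2)) -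
      (Real.exp (-x + β - α / 2) - (1 + (-x + β - α / 2) + (-x + β - α / 2) ^ 2 / 2)) -
      (x - β) * α := by ring
  rw [i1, i2, hK]
  rw [hK2] at c1
  generalize Real.exp (x - β - α / 2) - (1 + (x - β - α / 2) + (x - β - α / 2) ^ 2 / 2) = E1 at *
  generalize Real.exp (-x + β - α / 2) - (1 + (-x + β - α / 2) + (-x + β - α / 2) ^ 2 / 2) = E2 at *
  generalize -(2 * (x * β)) + β ^ 2 + α ^ 2 / 4 = E3 at *
  generalize (x - β) * α = E4 at *
  rw [abs_le] at e1 e2 c1 c2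
  constructor
  · rw [abs_le]; constructor <;> linarith
  · rw [abs_le]; constructor <;> linarith

end ExponentialExpansion

section IncrementMoments

open scoped ENNReal NNReal

variable {n : ℕ}

theorem exp_norm_le_sum (x : Fin n → ℝ) (c : ℝ) :
    Real.exp (c * ‖x‖) ≤ 1 + ∑ i, (Real.exp (c * x i) + Real.exp (-c * x i)) := by
  rcases isEmpty_or_nonempty (Fin n) with hn | hn
  · simp [Pi.norm_def]
  · obtain ⟨i, hi⟩ := (Finite.exists_max fun i => ‖x i‖)
    have h1 : ‖x‖ = |x i| :=
      le_antisymm ((pi_norm_le_iff_of_nonneg (norm_nonneg _)).2 hi) (norm_le_pi_norm x i)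
    have h2 : Real.exp (c * |x i|) ≤ Real.exp (c * x i) + Real.exp (-c * x i) := by
      rcases abs_cases (x i) with ⟨hx, _⟩ | ⟨hx, _⟩
      · rw [hx]; linarith [Real.exp_pos (-c * x i)]
      · rw [hx, mul_neg, ← neg_mul]; linarith [Real.exp_pos (c * x i)]
    have h3 := Finset.single_le_sum (f := fun i => Real.exp (c * x i) + Real.exp (-c * x i))
        (fun j _ => by positivity) (Finset.mem_univ i)
    rw [h1]; linarith

variable [MeasurableSpace (PathSp n)] [BorelSpace (PathSp n)]
  {a : ℝ → (Fin n → ℝ) → Matrix (Fin n) (Fin n) ℝ}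
  {b : ℝ → (Fin n → ℝ) → (Fin n → ℝ)} {B s₀ s t : ℝ} {P : Measure (PathSp n)}
  [IsProbabilityMeasure P]

omit [BorelSpace (PathSp n)] in
theorem ExpMart.lintegral_exp_coord_le (h : ExpMart a b s₀ P) (hc : BoundedCoeff n a b B)
    (hs : s₀ ≤ s) (hst : s ≤ t) (i : Fin n) (c : ℝ) :
    ∫⁻ ω, ENNReal.ofReal (Real.exp (c * (Xcan n t ω - Xcan n s ω) i)) ∂P ≤
      ENNReal.ofReal (Real.exp ((B * |c| + B * c ^ 2 / 2) * (t - s))) := by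
  have h1 := h.lintegral_exp_le hc (Pi.single i c) hs hst
  simp only [single_dotProduct] at h1
  refine h1.trans (le_of_eq ?_)
  have h2 : ∑ j, |(Pi.single i c : Fin n → ℝ) j| = |c| := by
    rw [Finset.sum_eq_single i]
    · simp
    · intro j _ hj; simp [hj]
    · simp
  rw [compBound, h2, sq_abs]
  congr 2; ring

/-- A uniform bound for scaled exponential moments of increments. -/
noncomputable def expMomentConst (n : ℕ) (B c : ℝ) : ℝ :=
  1 + n * (2 * Real.exp (B * c + B * c ^ 2 / 2))

theorem ExpMart.integrable_exp_norm_and_le (h : ExpMart a b s₀ P) (hc : BoundedCoeff n a b B)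
    (hs : s₀ ≤ s) {δ : ℝ} (hδ : 0 < δ) (hδ1 : δ ≤ 1) (hst : t = s + δ ^ 2) {c : ℝ} (hc0 : 0 ≤ c) :
    Integrable (fun ω => Real.exp (c / δ * ‖Xcan n t ω - Xcan n s ω‖)) P ∧
    ∫ ω, Real.exp (c / δ * ‖Xcan n t ω - Xcan n s ω‖) ∂P ≤ expMomentConst n B c := by
  have hst' : s ≤ t := by rw [hst]; nlinarith
  have hB := hc.nonneg
  have hXm : Measurable fun ω : PathSp n => Xcan n t ω - Xcan n s ω :=
    (measurable_Xcan t).sub (measurable_Xcan s)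
  have hm : ∀ (c : ℝ) (i : Fin n), Measurable fun ω : PathSp n =>
      ENNReal.ofReal (Real.exp (c * (Xcan n t ω - Xcan n s ω) i)) := fun c i =>
    (Real.measurable_exp.comp (((measurable_pi_apply i).comp hXm).const_mul _)).ennreal_ofReal
  have hcoord : ∀ ε : ℝ, |ε| = c → ∀ i,
      ∫⁻ ω, ENNReal.ofReal (Real.exp (ε / δ * (Xcan n t ω - Xcan n s ω) i)) ∂P ≤
      ENNReal.ofReal (Real.exp (B * c + B * c ^ 2 / 2)) := by
    intro ε hε i
    refine (h.lintegral_exp_coord_le hc hs hst' i (ε / δ)).trans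
      (ENNReal.ofReal_le_ofReal (Real.exp_le_exp.2 ?_))
    rw [abs_div, hε, abs_of_pos hδ, hst, div_pow, ← sq_abs ε, hε]
    have : (B * (c / δ) + B * (c ^ 2 / δ ^ 2) / 2) * (s + δ ^ 2 - s) =
      B * c * δ + B * c ^ 2 / 2 := by field_simp; ring
    rw [this]
    have : B * c * δ ≤ B * c * 1 := by gcongr
    linarith
  have hle : ∫⁻ ω, ENNReal.ofReal (Real.exp (c / δ * ‖Xcan n t ω - Xcan n s ω‖)) ∂P ≤
      ENNReal.ofReal (expMomentConst n B c) := by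
    calc _ ≤ ∫⁻ ω, (1 + ∑ i, (ENNReal.ofReal (Real.exp (c / δ * (Xcan n t ω - Xcan n s ω) i)) +
          ENNReal.ofReal (Real.exp (-c / δ * (Xcan n t ω - Xcan n s ω) i)))) ∂P := by
          refine lintegral_mono fun ω => ?_
          refine (ENNReal.ofReal_le_ofReal (exp_norm_le_sum _ _)).trans (le_of_eq ?_)
          rw [ENNReal.ofReal_add zero_le_one (Finset.sum_nonneg fun i _ => by positivity),
            ENNReal.ofReal_one, ENNReal.ofReal_sum_of_nonneg fun i _ => by positivity]
          congr 1
          refine Finset.sum_congr rfl fun i _ => ?_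
          rw [ENNReal.ofReal_add (Real.exp_pos _).le (Real.exp_pos _).le, neg_div]
      _ = 1 + ∑ i, (∫⁻ ω, ENNReal.ofReal (Real.exp (c / δ * (Xcan n t ω - Xcan n s ω) i)) ∂P +
          ∫⁻ ω, ENNReal.ofReal (Real.exp (-c / δ * (Xcan n t ω - Xcan n s ω) i)) ∂P) := by
          rw [lintegral_add_left measurable_const,
            lintegral_finsetSum (f := fun i ω =>
              ENNReal.ofReal (Real.exp (c / δ * (Xcan n t ω - Xcan n s ω) i)) +
              ENNReal.ofReal (Real.exp (-c / δ * (Xcan n t ω - Xcan n s ω) i))) _ fun i _ =>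
            (hm _ i).add (hm _ i)]
          simp only [lintegral_const, measure_univ, mul_one]
          congr 1
          refine Finset.sum_congr rfl fun i _ => ?_
          rw [lintegral_add_left (hm _ i)]
      _ ≤ 1 + ∑ _i : Fin n, (ENNReal.ofReal (Real.exp (B * c + B * c ^ 2 / 2)) +
          ENNReal.ofReal (Real.exp (B * c + B * c ^ 2 / 2))) := by
          gcongr with i
          · exact hcoord c (abs_of_nonneg hc0) i
          · exact hcoord (-c) (by rw [abs_neg, abs_of_nonneg hc0]) i
      _ = _ := by
          rw [← ENNReal.ofReal_add (Real.exp_pos _).le (Real.exp_pos _).le, Finset.sum_const,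
            Finset.card_univ, Fintype.card_fin, nsmul_eq_mul, ← ENNReal.ofReal_natCast,
            ← ENNReal.ofReal_mul (by positivity), ← ENNReal.ofReal_one,
            ← ENNReal.ofReal_add (by positivity) (by positivity), expMomentConst, ← two_mul]
  have hmeas : Measurable fun ω : PathSp n => Real.exp (c / δ * ‖Xcan n t ω - Xcan n s ω‖) :=
    Real.measurable_exp.comp (hXm.norm.const_mul _)
  have hpos : 0 ≤ expMomentConst n B c := by unfold expMomentConst; positivity
  refine ⟨⟨hmeas.aestronglyMeasurable, ?_⟩, ?_⟩
  · rw [hasFiniteIntegral_iff_ofReal (Eventually.of_forall fun ω => (Real.exp_pos _).le)]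
    exact hle.trans_lt ENNReal.ofReal_lt_top
  · rw [integral_eq_lintegral_of_nonneg_ae (Eventually.of_forall fun ω => (Real.exp_pos _).le)
      hmeas.aestronglyMeasurable]
    exact ENNReal.toReal_le_of_le_ofReal hpos hle

theorem ExpMart.integrable_expIncr (h : ExpMart a b s₀ P) (hc : BoundedCoeff n a b B)
    (θ : Fin n → ℝ) (hs : s₀ ≤ s) (hst : s ≤ t) : Integrable (expIncr a b θ s t) P := by
  refine ⟨(hc.measurable_expIncr θ s t).aestronglyMeasurable, ?_⟩
  rw [hasFiniteIntegral_iff_ofReal (Eventually.of_forall fun ω => (expIncr_pos θ s t ω).le),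
    h.lintegral_expIncr θ hs hst]
  exact ENNReal.one_lt_top

theorem ExpMart.integral_mul_expIncr (h : ExpMart a b s₀ P) (hc : BoundedCoeff n a b B)
    (θ : Fin n → ℝ) (hs : s₀ ≤ s) (hst : s ≤ t) {Z : PathSp n → ℝ}
    (hZ : Measurable[canonFiltr n s] Z) {M : ℝ} (hM : ∀ ω, |Z ω| ≤ M) :
    ∫ ω, Z ω * expIncr a b θ s t ω ∂P = ∫ ω, Z ω ∂P := by
  have hZm : Measurable Z := hZ.mono (canonFiltr_le s) le_rfl
  have hI := h.integrable_expIncr hc θ hs hst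
  have hZI : Integrable Z P := Integrable.of_bound hZm.aestronglyMeasurable M
    (Eventually.of_forall hM)
  have hZE : Integrable (fun ω => Z ω * expIncr a b θ s t ω) P :=
    hI.bdd_mul (c := M) hZm.aestronglyMeasurable (Eventually.of_forall hM)
  have key : ∀ W : PathSp n → ℝ, Measurable[canonFiltr n s] W → (∀ ω, 0 ≤ W ω) →
      ∫ ω, W ω * expIncr a b θ s t ω ∂P = ∫ ω, W ω ∂P := by
    intro W hW hW0
    have hWm : Measurable W := hW.mono (canonFiltr_le s) le_rfl
    rw [integral_eq_lintegral_of_nonneg_ae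
        (Eventually.of_forall fun ω => mul_nonneg (hW0 ω) (expIncr_pos θ s t ω).le)
        (hWm.mul (hc.measurable_expIncr θ s t)).aestronglyMeasurable,
      integral_eq_lintegral_of_nonneg_ae (Eventually.of_forall hW0) hWm.aestronglyMeasurable,
      ← h θ s t hs hst (fun ω => ENNReal.ofReal (W ω)) hW.ennreal_ofReal]
    simp only [ENNReal.ofReal_mul (hW0 _)]
  have h1 := key (fun ω => Z ω + M) (hZ.add_const M) fun ω => by
    have := abs_le.1 (hM ω); linarith
  have h2 := key (fun _ => |M|) measurable_const fun _ => abs_nonneg _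
  have h3 : ∫ ω, M * expIncr a b θ s t ω ∂P = M := by
    have h4 : ∫ ω, expIncr a b θ s t ω ∂P = 1 := by
      have := key (fun _ => 1) measurable_const fun _ => zero_le_one
      simpa using this
    rw [integral_const_mul, h4, mul_one]
  simp only [add_mul] at h1
  rw [integral_add hZE (hI.const_mul M), h3, integral_add hZI (integrable_const _)] at h1
  simpa using h1

end IncrementMoments

section IncrementIdentities

open scoped ENNReal NNReal

variable {n : ℕ} [MeasurableSpace (PathSp n)] [BorelSpace (PathSp n)]
  {a : ℝ → (Fin n → ℝ) → Matrix (Fin n) (Fin n) ℝ}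
  {b : ℝ → (Fin n → ℝ) → (Fin n → ℝ)} {B s₀ : ℝ} {P : Measure (PathSp n)}
  [IsProbabilityMeasure P]

omit [BorelSpace (PathSp n)] [MeasurableSpace (PathSp n)] in
theorem abs_dotProduct_le_norm (θ w : Fin n → ℝ) : |θ ⬝ᵥ w| ≤ (∑ i, |θ i|) * ‖w‖ := by
  rw [mul_comm]
  exact abs_dotProduct_le_of_le θ w fun i => norm_le_pi_norm w i

omit [MeasurableSpace (PathSp n)] [BorelSpace (PathSp n)] in
theorem BoundedCoeff.measurable_drift (hc : BoundedCoeff n a b B) (θ : Fin n → ℝ) :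
    Measurable (fun p : ℝ × (Fin n → ℝ) => θ ⬝ᵥ b p.1 p.2) :=
  Finset.measurable_sum _ fun i _ => (hc.meas_b i).const_mul _

omit [MeasurableSpace (PathSp n)] [BorelSpace (PathSp n)] in
theorem BoundedCoeff.measurable_quad (hc : BoundedCoeff n a b B) (θ : Fin n → ℝ) :
    Measurable (fun p : ℝ × (Fin n → ℝ) => θ ⬝ᵥ (a p.1 p.2).mulVec θ) := by
  refine Finset.measurable_sum _ fun i _ => Measurable.const_mul ?_ _
  simp only [mulVec, dotProduct]
  exact Finset.measurable_sum _ fun j _ => (hc.meas_a i j).mul_const _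

omit [MeasurableSpace (PathSp n)] [BorelSpace (PathSp n)] in
theorem BoundedCoeff.integral_compDens (hc : BoundedCoeff n a b B) (θ : Fin n → ℝ) (s t : ℝ)
    (ω : PathSp n) : ∫ v in Set.Ioc s t, compDens a b θ (v, Xcan n v ω) =
      (∫ v in Set.Ioc s t, θ ⬝ᵥ b v (Xcan n v ω)) +
        (∫ v in Set.Ioc s t, θ ⬝ᵥ (a v (Xcan n v ω)).mulVec θ) / 2 := by
  unfold compDens
  have ib := integrableOn_path (hc.measurable_drift θ)
    (fun p => abs_dotProduct_le_of_le θ _ (hc.bound_b p.1 p.2)) s t ω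
  have ia := integrableOn_path (hc.measurable_quad θ)
    (fun p => abs_quadForm_le_of_le θ _ (hc.bound_a p.1 p.2)) s t ω
  rw [integral_add ib (ia.const_mul _), integral_const_mul]
  ring

theorem ExpMart.integrable_norm_pow (h : ExpMart a b s₀ P) (hc : BoundedCoeff n a b B)
    {s t : ℝ} (hs : s₀ ≤ s) (hst : s ≤ t) {p : ℕ} (hp : p ≠ 0) :
    Integrable (fun ω => ‖Xcan n t ω - Xcan n s ω‖ ^ p) P ∧
    ∀ T, t - s ≤ T → ∫ ω, ‖Xcan n t ω - Xcan n s ω‖ ^ p ∂P ≤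
      momentConst n B T p * √(t - s) ^ p := by
  have hm : Measurable fun ω : PathSp n => ‖Xcan n t ω - Xcan n s ω‖ ^ p :=
    ((measurable_Xcan t).sub (measurable_Xcan s)).norm.pow_const p
  refine ⟨⟨hm.aestronglyMeasurable, ?_⟩, fun T hT => ?_⟩
  · rw [hasFiniteIntegral_iff_ofReal (Eventually.of_forall fun ω => by positivity)]
    exact (h.lintegral_norm_pow_le hc hs hst le_rfl hp).trans_lt ENNReal.ofReal_lt_top
  · rw [integral_eq_lintegral_of_nonneg_ae (Eventually.of_forall fun ω => by positivity)
      hm.aestronglyMeasurable]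
    refine ENNReal.toReal_le_of_le_ofReal ?_ (h.lintegral_norm_pow_le hc hs hst hT hp)
    have := momentConst_nonneg n B T p
    positivity

theorem ExpMart.exists_increment_moment_bound (h : ExpMart a b s₀ P) (hc : BoundedCoeff n a b B)
    (θ : Fin n → ℝ) : ∃ K : ℝ, 0 ≤ K ∧ ∀ (s t δ : ℝ) (Z : PathSp n → ℝ), s₀ ≤ s → 0 < δ → δ ≤ 1 →
      t = s + δ ^ 2 → Measurable[canonFiltr n s] Z → (∀ ω, |Z ω| ≤ 1) →
      |∫ ω, Z ω * (θ ⬝ᵥ (Xcan n t ω - Xcan n s ω)) ∂P -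
        ∫ ω, Z ω * (∫ v in Set.Ioc s t, θ ⬝ᵥ b v (Xcan n v ω)) ∂P| ≤ K * δ ^ 3 ∧
      |∫ ω, Z ω * (θ ⬝ᵥ (Xcan n t ω - Xcan n s ω)) ^ 2 ∂P -
        ∫ ω, Z ω * (∫ v in Set.Ioc s t, θ ⬝ᵥ (a v (Xcan n v ω)).mulVec θ) ∂P| ≤ K * δ ^ 3 := by
  set S := ∑ i, |θ i| with hSdef
  have hS : 0 ≤ S := Finset.sum_nonneg fun i _ => abs_nonneg _
  have hB := hc.nonneg
  set C := B * S + B * S ^ 2 with hCdef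
  have hC : 0 ≤ C := by positivity
  set K := (12 + 2 * C + 2 * C ^ 2) * Real.exp (4 * C) * expMomentConst n B (2 * S) with hKdef
  have hEM : 0 ≤ expMomentConst n B (2 * S) := by unfold expMomentConst; positivity
  have hK : 0 ≤ K := by positivity
  refine ⟨K, hK, fun s t δ Z hs hδ hδ1 hst hZ hZ1 => ?_⟩
  have hst' : s ≤ t := by rw [hst]; nlinarith
  have hts : t - s = δ ^ 2 := by rw [hst]; ring
  have hZm : Measurable Z := hZ.mono (canonFiltr_le s) le_rfl
  set x : PathSp n → ℝ := fun ω => θ ⬝ᵥ (Xcan n t ω - Xcan n s ω) with hx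
  set β : PathSp n → ℝ := fun ω => ∫ v in Set.Ioc s t, θ ⬝ᵥ b v (Xcan n v ω) with hβ
  set α : PathSp n → ℝ := fun ω => ∫ v in Set.Ioc s t, θ ⬝ᵥ (a v (Xcan n v ω)).mulVec θ with hα
  have hβb : ∀ ω, |β ω| ≤ C * δ ^ 2 := fun ω => by
    have := abs_pathIntegral_le (G := fun p : ℝ × (Fin n → ℝ) => θ ⬝ᵥ b p.1 p.2)
      (fun p => abs_dotProduct_le_of_le θ _ (hc.bound_b p.1 p.2)) hst' ω
    rw [hts] at this
    refine this.trans ?_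
    gcongr
    rw [hCdef]; nlinarith [mul_nonneg hB (sq_nonneg S)]
  have hαb : ∀ ω, |α ω| ≤ C * δ ^ 2 := fun ω => by
    have := abs_pathIntegral_le
      (G := fun p : ℝ × (Fin n → ℝ) => θ ⬝ᵥ (a p.1 p.2).mulVec θ)
      (fun p => abs_quadForm_le_of_le θ _ (hc.bound_a p.1 p.2)) hst' ω
    rw [hts] at this
    refine this.trans ?_
    gcongr
    rw [hCdef]; nlinarith [mul_nonneg hB hS]
  have hxm : Measurable x :=
    measurable_dotProduct_left ((measurable_Xcan t).sub (measurable_Xcan s)) θ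
  have hβm : Measurable β := measurable_pathIntegral (hc.measurable_drift θ) s t
  have hαm : Measurable α := measurable_pathIntegral (hc.measurable_quad θ) s t
  have hβI : Integrable (fun ω => Z ω * β ω) P :=
    (Integrable.of_bound hβm.aestronglyMeasurable _ (Eventually.of_forall hβb)).bdd_mul
      (c := 1) hZm.aestronglyMeasurable (Eventually.of_forall hZ1)
  have hαI : Integrable (fun ω => Z ω * α ω) P :=
    (Integrable.of_bound hαm.aestronglyMeasurable _ (Eventually.of_forall hαb)).bdd_mul
      (c := 1) hZm.aestronglyMeasurable (Eventually.of_forall hZ1)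
  have hZI : Integrable Z P := Integrable.of_bound hZm.aestronglyMeasurable 1
    (Eventually.of_forall hZ1)
  have hxI0 : Integrable x P := by
    have h1 := (h.integrable_norm_pow hc hs hst' (p := 1) one_ne_zero).1
    refine (h1.const_mul S).mono' hxm.aestronglyMeasurable (Eventually.of_forall fun ω => ?_)
    rw [Real.norm_eq_abs, pow_one]
    exact abs_dotProduct_le_norm θ (Xcan n t ω - Xcan n s ω)
  have hx2I0 : Integrable (fun ω => x ω ^ 2) P := by
    have h1 := (h.integrable_norm_pow hc hs hst' (p := 2) two_ne_zero).1
    refine (h1.const_mul (S ^ 2)).mono' (hxm.pow_const 2).aestronglyMeasurable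
      (Eventually.of_forall fun ω => ?_)
    have := abs_dotProduct_le_norm θ (Xcan n t ω - Xcan n s ω)
    rw [Real.norm_eq_abs, abs_pow, ← mul_pow]
    exact pow_le_pow_left₀ (abs_nonneg _) this 2
  have hxI : Integrable (fun ω => Z ω * x ω) P :=
    hxI0.bdd_mul (c := 1) hZm.aestronglyMeasurable (Eventually.of_forall hZ1)
  have hx2I : Integrable (fun ω => Z ω * x ω ^ 2) P :=
    hx2I0.bdd_mul (c := 1) hZm.aestronglyMeasurable (Eventually.of_forall hZ1)
  have hE1 : ∀ ω, expIncr a b θ s t ω = Real.exp (x ω - β ω - α ω / 2) := fun ω => by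
    rw [expIncr, hc.integral_compDens, sub_sub]
  have hE2 : ∀ ω, expIncr a b (-θ) s t ω = Real.exp (-x ω + β ω - α ω / 2) := fun ω => by
    rw [expIncr, hc.integral_compDens]
    simp only [neg_dotProduct, mulVec_neg, dotProduct_neg, neg_neg, integral_neg]
    congr 1
    simp only [hx, hβ, hα]
    ring
  have i1 := h.integral_mul_expIncr hc θ hs hst' hZ hZ1
  have i2 := h.integral_mul_expIncr hc (-θ) hs hst' hZ hZ1
  have I1 : Integrable (fun ω => Z ω * expIncr a b θ s t ω) P :=
    (h.integrable_expIncr hc θ hs hst').bdd_mul (c := 1) hZm.aestronglyMeasurable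
      (Eventually.of_forall hZ1)
  have I2 : Integrable (fun ω => Z ω * expIncr a b (-θ) s t ω) P :=
    (h.integrable_expIncr hc (-θ) hs hst').bdd_mul (c := 1) hZm.aestronglyMeasurable
      (Eventually.of_forall hZ1)
  simp only [hE1, hE2] at i1 i2 I1 I2
  obtain ⟨hexI, hexle⟩ := h.integrable_exp_norm_and_le hc hs hδ hδ1 hst
    (c := 2 * S) (by positivity)
  have hdom : ∀ ω, Real.exp (2 * (|x ω| / δ + 2 * C)) ≤
      Real.exp (4 * C) * Real.exp (2 * S / δ * ‖Xcan n t ω - Xcan n s ω‖) := fun ω => by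
    rw [← Real.exp_add]
    refine Real.exp_le_exp.2 ?_
    have : |x ω| / δ ≤ S * ‖Xcan n t ω - Xcan n s ω‖ / δ := by
      gcongr
      exact abs_dotProduct_le_norm θ _
    have h2 : 2 * S / δ * ‖Xcan n t ω - Xcan n s ω‖ =
      2 * (S * ‖Xcan n t ω - Xcan n s ω‖ / δ) := by ring
    rw [h2]; linarith
  have hfin : ∀ F : PathSp n → ℝ, (∀ ω, |F ω| ≤ (12 + 2 * C + 2 * C ^ 2) * δ ^ 3 *
      Real.exp (2 * (|x ω| / δ + 2 * C))) → |∫ ω, Z ω * F ω ∂P| ≤ K * δ ^ 3 := by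
    intro F hF
    have h1 : ∀ ω, ‖Z ω * F ω‖ ≤ (12 + 2 * C + 2 * C ^ 2) * δ ^ 3 * Real.exp (4 * C) *
        Real.exp (2 * S / δ * ‖Xcan n t ω - Xcan n s ω‖) := fun ω => by
      rw [norm_mul]
      calc ‖Z ω‖ * ‖F ω‖ ≤ 1 * ((12 + 2 * C + 2 * C ^ 2) * δ ^ 3 *
            Real.exp (2 * (|x ω| / δ + 2 * C))) := by
            gcongr
            · exact hZ1 ω
            · exact hF ω
        _ ≤ 1 * ((12 + 2 * C + 2 * C ^ 2) * δ ^ 3 * (Real.exp (4 * C) *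
            Real.exp (2 * S / δ * ‖Xcan n t ω - Xcan n s ω‖))) := by
            gcongr; exact hdom ω
        _ = _ := by ring
    have h2 := norm_integral_le_of_norm_le (hexI.const_mul _) (Eventually.of_forall h1)
    rw [integral_const_mul] at h2
    refine h2.trans ?_
    calc _ ≤ (12 + 2 * C + 2 * C ^ 2) * δ ^ 3 * Real.exp (4 * C) * expMomentConst n B (2 * S) := by
          gcongr
      _ = _ := by rw [hKdef]; ring
  have J1 : Integrable (fun ω => Z ω * Real.exp (x ω - β ω - α ω / 2) -
      Z ω * Real.exp (-x ω + β ω - α ω / 2)) P := I1.sub I2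
  have J2 : Integrable (fun ω => Z ω * Real.exp (x ω - β ω - α ω / 2) +
      Z ω * Real.exp (-x ω + β ω - α ω / 2)) P := I1.add I2
  have J3 : Integrable (fun ω => Z ω * x ω - Z ω * β ω) P := hxI.sub hβI
  have J4 : Integrable (fun ω => Z ω * x ω ^ 2 - Z ω * α ω) P := hx2I.sub hαI
  have J5 : Integrable (fun ω => Z ω * Real.exp (x ω - β ω - α ω / 2) +
      Z ω * Real.exp (-x ω + β ω - α ω / 2) - 2 * Z ω) P := J2.sub (hZI.const_mul 2)
  constructor
  · have h3 := hfin (fun ω => Real.exp (x ω - β ω - α ω / 2) - Real.exp (-x ω + β ω - α ω / 2) -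
      2 * (x ω - β ω)) fun ω => (abs_exp_add_exp_sub_le hδ hδ1 hC (hβb ω) (hαb ω)).2
    have h4 : ∫ ω, Z ω * (Real.exp (x ω - β ω - α ω / 2) - Real.exp (-x ω + β ω - α ω / 2) -
        2 * (x ω - β ω)) ∂P = -2 * (∫ ω, Z ω * x ω ∂P - ∫ ω, Z ω * β ω ∂P) := by
      calc _ = ∫ ω, ((Z ω * Real.exp (x ω - β ω - α ω / 2) -
            Z ω * Real.exp (-x ω + β ω - α ω / 2)) - 2 * (Z ω * x ω - Z ω * β ω)) ∂P := by
            congr 1; ext ω; ring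
        _ = _ := by
          rw [integral_sub J1 (J3.const_mul 2), integral_sub I1 I2,
            integral_const_mul, integral_sub hxI hβI, i1, i2]
          ring
    rw [h4, abs_mul] at h3
    norm_num at h3
    linarith [abs_nonneg (∫ ω, Z ω * x ω ∂P - ∫ ω, Z ω * β ω ∂P)]
  · have h3 := hfin (fun ω => Real.exp (x ω - β ω - α ω / 2) + Real.exp (-x ω + β ω - α ω / 2) -
      2 - (x ω ^ 2 - α ω)) fun ω => (abs_exp_add_exp_sub_le hδ hδ1 hC (hβb ω) (hαb ω)).1
    have h4 : ∫ ω, Z ω * (Real.exp (x ω - β ω - α ω / 2) + Real.exp (-x ω + β ω - α ω / 2) -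
        2 - (x ω ^ 2 - α ω)) ∂P = -(∫ ω, Z ω * x ω ^ 2 ∂P - ∫ ω, Z ω * α ω ∂P) := by
      calc _ = ∫ ω, (((Z ω * Real.exp (x ω - β ω - α ω / 2) +
            Z ω * Real.exp (-x ω + β ω - α ω / 2)) - 2 * Z ω) -
            (Z ω * x ω ^ 2 - Z ω * α ω)) ∂P := by
            congr 1; ext ω; ring
        _ = _ := by
          rw [integral_sub J5 J4,
            integral_sub J2 (hZI.const_mul 2), integral_add I1 I2,
            integral_const_mul, integral_sub hx2I hαI, i1, i2]
          ring
    rw [h4, abs_neg] at h3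
    exact h3

end IncrementIdentities

section PartialDerivatives

variable {n : ℕ}

/-- The `i`-th partial derivative. -/
noncomputable def pderivCoord (i : Fin n) (Φ : (Fin n → ℝ) → ℝ) (x : Fin n → ℝ) : ℝ :=
  fderiv ℝ Φ x (Pi.single i 1)

theorem fderiv_apply_eq_sum_pderivCoord (Φ : (Fin n → ℝ) → ℝ) (x w : Fin n → ℝ) :
    fderiv ℝ Φ x w = ∑ i, pderivCoord i Φ x * w i := by
  have h := LinearMap.pi_apply_eq_sum_univ (fderiv ℝ Φ x).toLinearMap w
  simp only [ContinuousLinearMap.coe_coe, smul_eq_mul] at h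
  rw [h]
  refine Finset.sum_congr rfl fun i _ => ?_
  rw [mul_comm, pderivCoord]
  congr 2
  ext j
  simp [Pi.single_apply, eq_comm]

theorem ContDiff.pderivCoord {Φ : (Fin n → ℝ) → ℝ} {m k : WithTop ℕ∞} (h : ContDiff ℝ k Φ)
    (hmk : m + 1 ≤ k) (i : Fin n) : ContDiff ℝ m (pderivCoord i Φ) :=
  (h.fderiv_right hmk).clm_apply contDiff_const

theorem HasCompactSupport.pderivCoord {Φ : (Fin n → ℝ) → ℝ} (h : HasCompactSupport Φ)
    (i : Fin n) : HasCompactSupport (pderivCoord i Φ) :=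
  h.fderiv_apply ℝ _

/-- Uniform bounds on a function and its derivatives, as used in second order expansions. -/
structure TaylorBound (Φ : (Fin n → ℝ) → ℝ) (K : ℝ) : Prop where
  nonneg : 0 ≤ K
  cont : Continuous Φ
  cont₁ : ∀ i, Continuous (pderivCoord i Φ)
  cont₂ : ∀ i j, Continuous (pderivCoord j (pderivCoord i Φ))
  bound : ∀ x, |Φ x| ≤ K
  bound₁ : ∀ i x, |pderivCoord i Φ x| ≤ K
  bound₂ : ∀ i j x, |pderivCoord j (pderivCoord i Φ) x| ≤ K
  lip₁ : ∀ i x x', |pderivCoord i Φ x - pderivCoord i Φ x'| ≤ K * ‖x - x'‖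
  lip₂ : ∀ i j x x',
    |pderivCoord j (pderivCoord i Φ) x - pderivCoord j (pderivCoord i Φ) x'| ≤ K * ‖x - x'‖
  taylor : ∀ x w, |Φ (x + w) - Φ x - ∑ i, pderivCoord i Φ x * w i -
    1 / 2 * ∑ i, ∑ j, pderivCoord j (pderivCoord i Φ) x * (w i * w j)| ≤ K * ‖w‖ ^ 3

theorem abs_le_of_hasDerivAt_of_abs_le {g g' : ℝ → ℝ} {C : ℝ} (h0 : g 0 = 0)
    (hg : ∀ τ, HasDerivAt g (g' τ) τ) (hb : ∀ τ ∈ Set.Icc (0 : ℝ) 1, |g' τ| ≤ C) :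
    ∀ τ ∈ Set.Icc (0 : ℝ) 1, |g τ| ≤ C := by
  intro τ hτ
  have h1 := (convex_Icc (0 : ℝ) 1).norm_image_sub_le_of_norm_hasDerivWithin_le
    (fun x _ => (hg x).hasDerivWithinAt) hb ⟨le_rfl, zero_le_one⟩ hτ
  have hC : 0 ≤ C := (abs_nonneg _).trans (hb 0 ⟨le_rfl, zero_le_one⟩)
  rw [h0, sub_zero, sub_zero, Real.norm_eq_abs, Real.norm_eq_abs, abs_of_nonneg hτ.1] at h1
  exact h1.trans (mul_le_of_le_one_right hC hτ.2)

theorem hasDerivAt_comp_line {Φ : (Fin n → ℝ) → ℝ} (h : Differentiable ℝ Φ) (x w : Fin n → ℝ)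
    (τ : ℝ) : HasDerivAt (fun τ => Φ (x + τ • w))
      (∑ i, pderivCoord i Φ (x + τ • w) * w i) τ := by
  have h1 : HasDerivAt (fun τ : ℝ => x + τ • w) w τ := by
    simpa using ((hasDerivAt_id τ).smul_const w).const_add x
  have h2 := (h (x + τ • w)).hasFDerivAt.comp_hasDerivAt τ h1
  rwa [fderiv_apply_eq_sum_pderivCoord] at h2

theorem exists_taylorBound {Φ : (Fin n → ℝ) → ℝ} (h : ContDiff ℝ 3 Φ) (hs : HasCompactSupport Φ) :
    ∃ K, TaylorBound Φ K := by
  have h1 : ∀ i, ContDiff ℝ 2 (pderivCoord i Φ) := fun i => h.pderivCoord (by norm_num) i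
  have h2 : ∀ i j, ContDiff ℝ 1 (pderivCoord j (pderivCoord i Φ)) := fun i j =>
    (h1 i).pderivCoord (by norm_num) j
  have s1 := fun i => hs.pderivCoord i
  have s2 := fun i j => (s1 i).pderivCoord j
  obtain ⟨c0, hc0⟩ := hs.exists_bound_of_continuous h.continuous
  choose c1 hc1 using fun i => (s1 i).exists_bound_of_continuous (h1 i).continuous
  choose c2 hc2 using fun i j => (s2 i j).exists_bound_of_continuous (h2 i j).continuous
  choose l1 hl1 using fun i =>
    (h1 i).lipschitzWith_of_hasCompactSupport (s1 i) (by norm_num)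
  choose l2 hl2 using fun i j =>
    (h2 i j).lipschitzWith_of_hasCompactSupport (s2 i j) (by norm_num)
  have c0n : 0 ≤ c0 := (norm_nonneg _).trans (hc0 0)
  have c1n : ∀ i, 0 ≤ c1 i := fun i => (norm_nonneg _).trans (hc1 i 0)
  have c2n : ∀ i j, 0 ≤ c2 i j := fun i j => (norm_nonneg _).trans (hc2 i j 0)
  set M := ∑ i, ∑ j, (l2 i j : ℝ) with hM
  have hMn : 0 ≤ M := by positivity
  set K := c0 + ∑ i, c1 i + ∑ i, ∑ j, c2 i j + ∑ i, (l1 i : ℝ) + M with hK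
  have k1 : 0 ≤ ∑ i, c1 i := Finset.sum_nonneg fun i _ => c1n i
  have k2 : 0 ≤ ∑ i, ∑ j, c2 i j := Finset.sum_nonneg fun i _ => Finset.sum_nonneg fun j _ => c2n i j
  have k3 : 0 ≤ ∑ i, (l1 i : ℝ) := by positivity
  have hl2' : ∀ i j x x', |pderivCoord j (pderivCoord i Φ) x - pderivCoord j (pderivCoord i Φ) x'| ≤
      l2 i j * ‖x - x'‖ := fun i j x x' => by
    have := (hl2 i j).dist_le_mul x x'
    rwa [dist_eq_norm, dist_eq_norm] at this
  refine ⟨K, ⟨by positivity, h.continuous, fun i => (h1 i).continuous,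
    fun i j => (h2 i j).continuous, ?_, ?_, ?_, ?_, ?_, ?_⟩⟩
  · intro x; have := hc0 x; rw [Real.norm_eq_abs] at this; linarith
  · intro i x
    have := hc1 i x
    rw [Real.norm_eq_abs] at this
    have := Finset.single_le_sum (f := c1) (fun j _ => c1n j) (Finset.mem_univ i)
    linarith
  · intro i j x
    have h3 := hc2 i j x
    rw [Real.norm_eq_abs] at h3
    have h4 := Finset.single_le_sum (f := c2 i) (fun j _ => c2n i j) (Finset.mem_univ j)
    have h5 := Finset.single_le_sum (f := fun i => ∑ j, c2 i j)
      (fun i _ => Finset.sum_nonneg fun j _ => c2n i j) (Finset.mem_univ i)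
    beta_reduce at h5
    linarith
  · intro i x x'
    have h3 := (hl1 i).dist_le_mul x x'
    rw [dist_eq_norm, dist_eq_norm, Real.norm_eq_abs] at h3
    refine h3.trans (mul_le_mul_of_nonneg_right ?_ (norm_nonneg _))
    have := Finset.single_le_sum (f := fun i => (l1 i : ℝ)) (fun j _ => (l1 j).2)
      (Finset.mem_univ i)
    beta_reduce at this
    linarith
  · intro i j x x'
    refine (hl2' i j x x').trans (mul_le_mul_of_nonneg_right ?_ (norm_nonneg _))
    have h4 := Finset.single_le_sum (f := fun j => (l2 i j : ℝ)) (fun j _ => (l2 i j).2)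
      (Finset.mem_univ j)
    have h5 := Finset.single_le_sum (f := fun i => ∑ j, (l2 i j : ℝ))
      (fun i _ => Finset.sum_nonneg fun j _ => (l2 i j).2) (Finset.mem_univ i)
    beta_reduce at h4 h5
    linarith
  · intro x w
    set g0 := ∑ i, pderivCoord i Φ x * w i with hg0
    set g1 := ∑ i, ∑ j, pderivCoord j (pderivCoord i Φ) x * (w i * w j) with hg1
    have d2 : ∀ τ ∈ Set.Icc (0 : ℝ) 1,
        |(∑ i, (∑ j, pderivCoord j (pderivCoord i Φ) (x + τ • w) * w j) * w i) - g1| ≤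
          M * ‖w‖ ^ 3 := by
      intro τ hτ
      have e1 : (∑ i, (∑ j, pderivCoord j (pderivCoord i Φ) (x + τ • w) * w j) * w i) - g1 =
          ∑ i, ∑ j, (pderivCoord j (pderivCoord i Φ) (x + τ • w) -
            pderivCoord j (pderivCoord i Φ) x) * (w i * w j) := by
        rw [hg1, ← Finset.sum_sub_distrib]
        refine Finset.sum_congr rfl fun i _ => ?_
        rw [Finset.sum_mul, ← Finset.sum_sub_distrib]
        exact Finset.sum_congr rfl fun j _ => by ring
      rw [e1, hM, Finset.sum_mul]
      refine (Finset.abs_sum_le_sum_abs _ _).trans (Finset.sum_le_sum fun i _ => ?_)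
      rw [Finset.sum_mul]
      refine (Finset.abs_sum_le_sum_abs _ _).trans (Finset.sum_le_sum fun j _ => ?_)
      rw [abs_mul, abs_mul]
      have e2 : ‖x + τ • w - x‖ ≤ ‖w‖ := by
        rw [add_sub_cancel_left, norm_smul, Real.norm_eq_abs, abs_of_nonneg hτ.1]
        exact mul_le_of_le_one_left (norm_nonneg _) hτ.2
      calc _ ≤ (l2 i j * ‖w‖) * (‖w‖ * ‖w‖) := by
            gcongr
            · exact (hl2' i j _ _).trans (by gcongr)
            · exact norm_le_pi_norm w i
            · exact norm_le_pi_norm w j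
        _ = _ := by ring
    have d1 := abs_le_of_hasDerivAt_of_abs_le
      (g := fun τ => (∑ i, pderivCoord i Φ (x + τ • w) * w i) - g0 - τ * g1)
      (g' := fun τ => (∑ i, (∑ j, pderivCoord j (pderivCoord i Φ) (x + τ • w) * w j) * w i) - g1)
      (by simp [hg0]) (fun τ => by
        have e1 := HasDerivAt.fun_sum (u := Finset.univ) fun i _ =>
          (hasDerivAt_comp_line ((h1 i).differentiable (by norm_num)) x w τ).mul_const (w i)
        simpa using (e1.sub_const g0).fun_sub ((hasDerivAt_id τ).mul_const g1)) d2
    have d0 := abs_le_of_hasDerivAt_of_abs_le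
      (g := fun τ => Φ (x + τ • w) - Φ x - τ * g0 - 1 / 2 * τ ^ 2 * g1)
      (g' := fun τ => (∑ i, pderivCoord i Φ (x + τ • w) * w i) - g0 - τ * g1)
      (by simp) (fun τ => by
        have e1 := hasDerivAt_comp_line (h.differentiable (by norm_num)) x w τ
        have e2 : HasDerivAt (fun τ : ℝ => 1 / 2 * τ ^ 2 * g1) (τ * g1) τ := by
          refine (((hasDerivAt_pow 2 τ).const_mul (1 / 2 : ℝ)).mul_const g1).congr_deriv ?_
          push_cast
          ring
        simpa using ((e1.sub_const (Φ x)).fun_sub ((hasDerivAt_id τ).mul_const g0)).fun_sub e2) d1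
    have := d0 1 ⟨zero_le_one, le_rfl⟩
    simp only [one_smul, one_mul, one_pow, mul_one] at this
    refine this.trans (mul_le_mul_of_nonneg_right ?_ (by positivity))
    linarith

theorem eq_of_abs_sub_le_pow {F : ℝ → ℝ} {s₀ K : ℝ}
    (h : ∀ s δ, s₀ ≤ s → 0 < δ → δ ≤ 1 → |F (s + δ ^ 2) - F s| ≤ K * δ ^ 3) {s t : ℝ}
    (hs : s₀ ≤ s) (hst : s ≤ t) : F t = F s := by
  have h' : ∀ u v, s₀ ≤ u → u ≤ v → v ≤ u + 1 → |F v - F u| ≤ K * √(v - u) * (v - u) := by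
    intro u v hu huv hv
    rcases huv.eq_or_lt with rfl | huv
    · simp
    have hδ : 0 < √(v - u) := Real.sqrt_pos.2 (by linarith)
    have hsq : √(v - u) ^ 2 = v - u := Real.sq_sqrt (by linarith)
    have h1 : √(v - u) ≤ 1 := Real.sqrt_le_one.2 (by linarith)
    have := h u _ hu hδ h1
    rw [hsq, add_sub_cancel] at this
    calc _ ≤ _ := this
      _ = K * √(v - u) * √(v - u) ^ 2 := by ring
      _ = _ := by rw [hsq]
  have hmid : ∀ x ∈ Set.Icc s t, ∀ y ∈ Set.Icc s t, |y - x| ≤ 1 →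
      |F y - F x| ≤ K * √|y - x| * |y - x| := by
    intro x hx y hy hxy
    rcases le_total x y with hle | hle
    · rw [abs_of_nonneg (sub_nonneg.2 hle)] at hxy ⊢
      exact h' x y (hs.trans hx.1) hle (by linarith)
    · rw [abs_sub_comm y x, abs_of_nonneg (sub_nonneg.2 hle)] at hxy ⊢
      rw [abs_sub_comm]
      exact h' y x (hs.trans hy.1) hle (by linarith)
  have htend : ∀ x, Tendsto (fun y : ℝ => K * √|y - x|) (𝓝 x) (𝓝 0) := fun x => by
    have : Continuous fun y : ℝ => K * √|y - x| := by fun_prop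
    simpa using this.tendsto x
  have hderiv : ∀ x ∈ Set.Icc s t, HasDerivWithinAt F 0 (Set.Icc s t) x := by
    intro x hx
    rw [hasDerivWithinAt_iff_isLittleO, Asymptotics.isLittleO_iff]
    intro c hc
    have h1 : ∀ᶠ y in 𝓝[Set.Icc s t] x, K * √|y - x| < c :=
      (htend x).eventually (gt_mem_nhds hc) |>.filter_mono nhdsWithin_le_nhds
    have h2 : ∀ᶠ y in 𝓝[Set.Icc s t] x, |y - x| < 1 := by
      have : Tendsto (fun y : ℝ => |y - x|) (𝓝 x) (𝓝 0) := by
        have : Continuous fun y : ℝ => |y - x| := by fun_prop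
        simpa using this.tendsto x
      exact (this.eventually (gt_mem_nhds zero_lt_one)).filter_mono nhdsWithin_le_nhds
    filter_upwards [h1, h2, self_mem_nhdsWithin] with y hy1 hy2 hy3
    simp only [smul_zero, sub_zero, Real.norm_eq_abs]
    exact (hmid x hx y hy3 hy2.le).trans (mul_le_mul_of_nonneg_right hy1.le (abs_nonneg _))
  have := (convex_Icc s t).norm_image_sub_le_of_norm_hasDerivWithin_le hderiv
    (C := 0) (by simp) (Set.left_mem_Icc.2 hst) (Set.right_mem_Icc.2 hst)
  rw [zero_mul] at this
  exact sub_eq_zero.1 (norm_le_zero_iff.1 this)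

end PartialDerivatives

section ItoFormula

open scoped ENNReal NNReal

variable {n : ℕ} [MeasurableSpace (PathSp n)] [BorelSpace (PathSp n)]
  {a : ℝ → (Fin n → ℝ) → Matrix (Fin n) (Fin n) ℝ}
  {b : ℝ → (Fin n → ℝ) → (Fin n → ℝ)} {B s₀ : ℝ} {P : Measure (PathSp n)}
  [IsProbabilityMeasure P]

/-- The generator with coefficients `a`, `b` applied to `Φ`. -/
noncomputable def genL (a : ℝ → (Fin n → ℝ) → Matrix (Fin n) (Fin n) ℝ)
    (b : ℝ → (Fin n → ℝ) → (Fin n → ℝ)) (Φ : (Fin n → ℝ) → ℝ) (p : ℝ × (Fin n → ℝ)) : ℝ :=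
  ∑ i, b p.1 p.2 i * pderivCoord i Φ p.2 +
    1 / 2 * ∑ i, ∑ j, a p.1 p.2 i j * pderivCoord j (pderivCoord i Φ) p.2

omit [MeasurableSpace (PathSp n)] [BorelSpace (PathSp n)] in
theorem BoundedCoeff.measurable_genL (hc : BoundedCoeff n a b B) {Φ : (Fin n → ℝ) → ℝ} {K : ℝ}
    (hΦ : TaylorBound Φ K) : Measurable (genL a b Φ) := by
  refine (Finset.measurable_sum _ fun i _ => (hc.meas_b i).mul
    ((hΦ.cont₁ i).measurable.comp measurable_snd)).add (Measurable.const_mul ?_ _)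
  exact Finset.measurable_sum _ fun i _ => Finset.measurable_sum _ fun j _ => (hc.meas_a i j).mul
    ((hΦ.cont₂ i j).measurable.comp measurable_snd)

omit [MeasurableSpace (PathSp n)] [BorelSpace (PathSp n)] in
theorem BoundedCoeff.abs_genL_le (hc : BoundedCoeff n a b B) {Φ : (Fin n → ℝ) → ℝ} {K : ℝ}
    (hΦ : TaylorBound Φ K) (p : ℝ × (Fin n → ℝ)) :
    |genL a b Φ p| ≤ n * (B * K) + 1 / 2 * (n * (n * (B * K))) := by
  have hB := hc.nonneg
  have hK := hΦ.nonneg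
  refine (abs_add_le _ _).trans (add_le_add ?_ ?_)
  · refine (Finset.abs_sum_le_sum_abs _ _).trans ?_
    refine (Finset.sum_le_card_nsmul _ _ (B * K) fun i _ => ?_).trans (by simp)
    rw [abs_mul]
    exact mul_le_mul (hc.bound_b _ _ i) (hΦ.bound₁ i _) (abs_nonneg _) hB
  · rw [abs_mul, abs_of_pos (by norm_num : (0 : ℝ) < 1 / 2)]
    refine mul_le_mul_of_nonneg_left ?_ (by norm_num)
    refine (Finset.abs_sum_le_sum_abs _ _).trans ?_
    refine (Finset.sum_le_card_nsmul _ _ (n * (B * K)) fun i _ => ?_).trans (by simp)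
    refine (Finset.abs_sum_le_sum_abs _ _).trans ?_
    refine (Finset.sum_le_card_nsmul _ _ (B * K) fun j _ => ?_).trans (by simp)
    rw [abs_mul]
    exact mul_le_mul (hc.bound_a _ _ i j) (hΦ.bound₂ i j _) (abs_nonneg _) hB

/-- Fubini for bounded functionals of the path. -/
theorem integrable_path_prod (s t : ℝ) {G : ℝ × (Fin n → ℝ) → ℝ} (hG : Measurable G) {C : ℝ}
    (hC : ∀ p, |G p| ≤ C) :
    Integrable (fun p : ℝ × PathSp n => G (p.1, Xcan n p.1 p.2))
      ((volume.restrict (Set.Ioc s t)).prod P) :=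
  Integrable.of_bound (measurable_pathIntegrand hG).aestronglyMeasurable C
    (Eventually.of_forall fun _ => hC _)

theorem integral_pathIntegral_swap (s t : ℝ) {G : ℝ × (Fin n → ℝ) → ℝ} (hG : Measurable G) {C : ℝ}
    (hC : ∀ p, |G p| ≤ C) :
    ∫ ω, (∫ v in Set.Ioc s t, G (v, Xcan n v ω)) ∂P =
      ∫ v in Set.Ioc s t, (∫ ω, G (v, Xcan n v ω) ∂P) :=
  (integral_integral_swap (integrable_path_prod s t hG hC)).symm

theorem integrable_pathIntegral (s t : ℝ) {G : ℝ × (Fin n → ℝ) → ℝ} (hG : Measurable G) {C : ℝ}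
    (hC : ∀ p, |G p| ≤ C) :
    Integrable (fun ω => ∫ v in Set.Ioc s t, G (v, Xcan n v ω)) P :=
  (integrable_path_prod s t hG hC).integral_prod_right

theorem integrable_of_abs_le_norm_incr_pow (h : ExpMart a b s₀ P) (hc : BoundedCoeff n a b B)
    {s t : ℝ} (hs : s₀ ≤ s) (hst : s ≤ t) {p : ℕ} (hp : p ≠ 0) {Y : PathSp n → ℝ}
    (hY : Measurable Y) {C : ℝ} (hle : ∀ ω, |Y ω| ≤ C * ‖Xcan n t ω - Xcan n s ω‖ ^ p) :
    Integrable Y P :=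
  ((h.integrable_norm_pow hc hs hst hp).1.const_mul C).mono' hY.aestronglyMeasurable
    (Eventually.of_forall hle)

theorem ExpMart.exists_coord_increment_bound (h : ExpMart a b s₀ P) (hc : BoundedCoeff n a b B)
    (hsym : ∀ u x, (a u x).IsSymm) :
    ∃ K : ℝ, 0 ≤ K ∧ ∀ (s t δ M : ℝ) (Z : PathSp n → ℝ), s₀ ≤ s → 0 < δ → δ ≤ 1 →
      t = s + δ ^ 2 → Measurable[canonFiltr n s] Z → (∀ ω, |Z ω| ≤ M) →
      (∀ i, |∫ ω, Z ω * ((Xcan n t ω - Xcan n s ω) i -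
        ∫ v in Set.Ioc s t, b v (Xcan n v ω) i) ∂P| ≤ K * M * δ ^ 3) ∧
      ∀ i j, |∫ ω, Z ω * ((Xcan n t ω - Xcan n s ω) i * (Xcan n t ω - Xcan n s ω) j -
        ∫ v in Set.Ioc s t, a v (Xcan n v ω) i j) ∂P| ≤ K * M * δ ^ 3 := by
  choose K₁ hK₁ h₁ using fun i : Fin n => h.exists_increment_moment_bound hc (Pi.single i 1)
  choose K₂ hK₂ h₂ using fun i j : Fin n =>
    h.exists_increment_moment_bound hc (Pi.single i 1 + Pi.single j 1)
  set K := 2 * ∑ i, K₁ i + ∑ i, ∑ j, K₂ i j with hK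
  have s1 : ∀ i, K₁ i ≤ ∑ i, K₁ i := fun i =>
    Finset.single_le_sum (fun j _ => hK₁ j) (Finset.mem_univ i)
  have s2 : ∀ i j, K₂ i j ≤ ∑ i, ∑ j, K₂ i j := fun i j =>
    (Finset.single_le_sum (f := K₂ i) (fun j _ => hK₂ i j) (Finset.mem_univ j)).trans
      (Finset.single_le_sum (f := fun i => ∑ j, K₂ i j)
        (fun i _ => Finset.sum_nonneg fun j _ => hK₂ i j) (Finset.mem_univ i))
  have p1 : 0 ≤ ∑ i, K₁ i := Finset.sum_nonneg fun i _ => hK₁ i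
  have p2 : 0 ≤ ∑ i, ∑ j, K₂ i j :=
    Finset.sum_nonneg fun i _ => Finset.sum_nonneg fun j _ => hK₂ i j
  refine ⟨K, by positivity, fun s t δ M Z hs hδ hδ1 hst hZ hM => ?_⟩
  have hst' : s ≤ t := by rw [hst]; nlinarith
  have hZm : Measurable Z := hZ.mono (canonFiltr_le s) le_rfl
  have hM0 : 0 ≤ M := (abs_nonneg _).trans
    (hM (Classical.choice (nonempty_of_isProbabilityMeasure P)))
  have hδ3 : 0 ≤ δ ^ 3 := by positivity
  rcases hM0.eq_or_lt with rfl | hMp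
  · have : ∀ ω, Z ω = 0 := fun ω => abs_nonpos_iff.1 (hM ω)
    simp [this]
  have hmΔ : ∀ i, Measurable fun ω : PathSp n => (Xcan n t ω - Xcan n s ω) i := fun i =>
    (measurable_pi_apply i).comp ((measurable_Xcan t).sub (measurable_Xcan s))
  have hΔle : ∀ i (ω : PathSp n), |(Xcan n t ω - Xcan n s ω) i| ≤ ‖Xcan n t ω - Xcan n s ω‖ :=
    fun i ω => norm_le_pi_norm (Xcan n t ω - Xcan n s ω) i
  have iΔ : ∀ i, Integrable (fun ω => (Xcan n t ω - Xcan n s ω) i) P := fun i =>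
    integrable_of_abs_le_norm_incr_pow h hc hs hst' (p := 1) one_ne_zero (hmΔ i) (C := 1)
      fun ω => by simpa using hΔle i ω
  have iΔΔ : ∀ i j, Integrable (fun ω => (Xcan n t ω - Xcan n s ω) i *
      (Xcan n t ω - Xcan n s ω) j) P := fun i j =>
    integrable_of_abs_le_norm_incr_pow h hc hs hst' (p := 2) two_ne_zero ((hmΔ i).mul (hmΔ j))
      (C := 1) fun ω => by
        rw [abs_mul, one_mul, sq]
        exact mul_le_mul (hΔle i ω) (hΔle j ω) (abs_nonneg _) (norm_nonneg _)
  have ib : ∀ i, Integrable (fun ω => ∫ v in Set.Ioc s t, b v (Xcan n v ω) i) P := fun i =>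
    integrable_pathIntegral (G := fun p => b p.1 p.2 i) s t (hc.meas_b i) fun p => hc.bound_b _ _ i
  have ia : ∀ i j, Integrable (fun ω => ∫ v in Set.Ioc s t, a v (Xcan n v ω) i j) P := fun i j =>
    integrable_pathIntegral (G := fun p => a p.1 p.2 i j) s t (hc.meas_a i j)
      fun p => hc.bound_a _ _ i j
  have zint : ∀ {Y : PathSp n → ℝ}, Integrable Y P → Integrable (fun ω => Z ω * Y ω) P :=
    fun hY => hY.bdd_mul hZm.aestronglyMeasurable (Eventually.of_forall hM)
  -- normalised weight
  set W : PathSp n → ℝ := fun ω => Z ω / M with hW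
  have hZW : ∀ ω, Z ω = M * W ω := fun ω => by rw [hW]; field_simp
  have hWm : Measurable[canonFiltr n s] W := hZ.div_const M
  have hW1 : ∀ ω, |W ω| ≤ 1 := fun ω => by
    rw [hW, abs_div, abs_of_pos hMp]; exact (div_le_one hMp).2 (hM ω)
  have wint : ∀ {Y : PathSp n → ℝ}, Integrable Y P → Integrable (fun ω => W ω * Y ω) P :=
    fun hY => hY.bdd_mul (hWm.mono (canonFiltr_le s) le_rfl).aestronglyMeasurable
      (Eventually.of_forall hW1)
  have iaω : ∀ i j (ω : PathSp n),
      IntegrableOn (fun v => a v (Xcan n v ω) i j) (Set.Ioc s t) := fun i j ω =>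
    integrableOn_path (G := fun p => a p.1 p.2 i j) (hc.meas_a i j)
      (fun p => hc.bound_a _ _ i j) s t ω
  have scale : ∀ (Y : PathSp n → ℝ) (c : ℝ), |∫ ω, W ω * Y ω ∂P| ≤ c * δ ^ 3 → c ≤ K →
      |∫ ω, Z ω * Y ω ∂P| ≤ K * M * δ ^ 3 := by
    intro Y c hY hcK
    have e : ∫ ω, Z ω * Y ω ∂P = M * ∫ ω, W ω * Y ω ∂P := by
      rw [← integral_const_mul]
      refine integral_congr_ae (Eventually.of_forall fun ω => ?_)
      simp only [hZW, mul_assoc]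
    rw [e, abs_mul, abs_of_pos hMp]
    calc M * |∫ ω, W ω * Y ω ∂P| ≤ M * (K * δ ^ 3) := by gcongr; exact hY.trans (by gcongr)
      _ = _ := by ring
  have hd1 : ∀ i (ω : PathSp n), W ω * ((Xcan n t ω - Xcan n s ω) i) =
      W ω * (Pi.single i 1 ⬝ᵥ (Xcan n t ω - Xcan n s ω)) := fun i ω => by simp
  refine ⟨fun i => scale _ (K₁ i) ?_ (by linarith [s1 i]), fun i j => scale _ ((K₁ i + K₁ j + K₂ i j) / 2) ?_
    (by linarith [s1 i, s1 j, s2 i j])⟩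
  · have := (h₁ i s t δ W hs hδ hδ1 hst hWm hW1).1
    simp only [single_one_dotProduct] at this
    have e : ∫ ω, W ω * ((Xcan n t ω - Xcan n s ω) i -
        ∫ v in Set.Ioc s t, b v (Xcan n v ω) i) ∂P =
        ∫ ω, W ω * ((Xcan n t ω - Xcan n s ω) i) ∂P -
          ∫ ω, W ω * (∫ v in Set.Ioc s t, b v (Xcan n v ω) i) ∂P := by
      rw [← integral_sub (wint (iΔ i)) (wint (ib i))]
      simp only [mul_sub]
    rwa [e]
  · have q1 := (h₁ i s t δ W hs hδ hδ1 hst hWm hW1).2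
    have q2 := (h₁ j s t δ W hs hδ hδ1 hst hWm hW1).2
    have q3 := (h₂ i j s t δ W hs hδ hδ1 hst hWm hW1).2
    have ee : ∀ v x, (Pi.single i 1 + Pi.single j 1 : Fin n → ℝ) ⬝ᵥ
        (a v x).mulVec (Pi.single i 1 + Pi.single j 1) =
        a v x i i + a v x j j + 2 * a v x i j := fun v x => by
      have hs := (hsym v x).apply i j
      simp only [add_dotProduct, mulVec_add, single_one_dotProduct, Pi.add_apply,
        mulVec_single_one, Matrix.col_apply]
      rw [hs]; ring
    simp only [single_one_dotProduct, mulVec_single_one, Matrix.col_apply] at q1 q2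
    simp only [ee, add_dotProduct, single_one_dotProduct] at q3
    have e1 : ∀ ω : PathSp n, ∫ v in Set.Ioc s t, (a v (Xcan n v ω) i i + a v (Xcan n v ω) j j +
        2 * a v (Xcan n v ω) i j) = (∫ v in Set.Ioc s t, a v (Xcan n v ω) i i) +
        (∫ v in Set.Ioc s t, a v (Xcan n v ω) j j) +
        2 * ∫ v in Set.Ioc s t, a v (Xcan n v ω) i j := fun ω => by
      have J : IntegrableOn (fun v => a v (Xcan n v ω) i i + a v (Xcan n v ω) j j)
        (Set.Ioc s t) := (iaω i i ω).add (iaω j j ω)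
      rw [integral_add J ((iaω i j ω).const_mul 2),
        integral_add (iaω i i ω) (iaω j j ω), integral_const_mul]
    simp only [e1] at q3
    have iΔs : ∀ i, Integrable (fun ω => ((Xcan n t ω - Xcan n s ω) i) ^ 2) P := fun i => by
      simpa only [sq] using iΔΔ i i
    have iq : Integrable (fun ω => ((Xcan n t ω - Xcan n s ω) i +
        (Xcan n t ω - Xcan n s ω) j) ^ 2) P := by
      have := ((iΔs i).add ((iΔΔ i j).const_mul 2)).add (iΔs j)
      refine this.congr (Eventually.of_forall fun ω => ?_)
      simp only [Pi.add_apply]; ring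
    rw [← integral_sub (wint (iΔs i)) (wint (ia i i))] at q1
    rw [← integral_sub (wint (iΔs j)) (wint (ia j j))] at q2
    have ias : Integrable (fun ω => (∫ v in Set.Ioc s t, a v (Xcan n v ω) i i) +
        (∫ v in Set.Ioc s t, a v (Xcan n v ω) j j) +
        2 * ∫ v in Set.Ioc s t, a v (Xcan n v ω) i j) P :=
      ((ia i i).add (ia j j)).add ((ia i j).const_mul 2)
    rw [← integral_sub (wint iq) (wint ias)] at q3
    set D1 : PathSp n → ℝ := fun ω => W ω * (Xcan n t ω - Xcan n s ω) i ^ 2 -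
      W ω * ∫ v in Set.Ioc s t, a v (Xcan n v ω) i i with hD1
    set D2 : PathSp n → ℝ := fun ω => W ω * (Xcan n t ω - Xcan n s ω) j ^ 2 -
      W ω * ∫ v in Set.Ioc s t, a v (Xcan n v ω) j j with hD2
    have I1 : Integrable D1 P := (wint (iΔs i)).sub (wint (ia i i))
    have I2 : Integrable D2 P := (wint (iΔs j)).sub (wint (ia j j))
    set D3 : PathSp n → ℝ := fun ω => W ω * ((Xcan n t ω - Xcan n s ω) i +
        (Xcan n t ω - Xcan n s ω) j) ^ 2 - W ω * ((∫ v in Set.Ioc s t, a v (Xcan n v ω) i i) +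
        (∫ v in Set.Ioc s t, a v (Xcan n v ω) j j) +
        2 * ∫ v in Set.Ioc s t, a v (Xcan n v ω) i j) with hD3
    have I3 : Integrable D3 P := (wint iq).sub (wint ias)
    have e : ∫ ω, W ω * ((Xcan n t ω - Xcan n s ω) i * (Xcan n t ω - Xcan n s ω) j -
        ∫ v in Set.Ioc s t, a v (Xcan n v ω) i j) ∂P =
        (∫ ω, D3 ω ∂P - ∫ ω, D1 ω ∂P - ∫ ω, D2 ω ∂P) / 2 := by
      have J : Integrable (fun ω => D3 ω - D1 ω) P := I3.sub I1
      rw [← integral_sub I3 I1, ← integral_sub J I2, ← integral_div]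
      refine integral_congr_ae (Eventually.of_forall fun ω => ?_)
      simp only [hD1, hD2, hD3]
      ring
    rw [e, abs_div, abs_of_pos (two_pos : (0 : ℝ) < 2)]
    have := (abs_sub (∫ ω, D3 ω ∂P - ∫ ω, D1 ω ∂P) (∫ ω, D2 ω ∂P)).trans
      (add_le_add (abs_sub _ _) le_rfl)
    linarith

end ItoFormula

section ItoExpectation

open scoped ENNReal NNReal

variable {n : ℕ} [MeasurableSpace (PathSp n)] [BorelSpace (PathSp n)]
  {a : ℝ → (Fin n → ℝ) → Matrix (Fin n) (Fin n) ℝ}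
  {b : ℝ → (Fin n → ℝ) → (Fin n → ℝ)} {B s₀ : ℝ} {P : Measure (PathSp n)}
  [IsProbabilityMeasure P]

/-- The integrated distance between `X_v` and `X_s`. -/
theorem ExpMart.integral_path_dist_le (h : ExpMart a b s₀ P) (hc : BoundedCoeff n a b B)
    {s t δ : ℝ} (hs : s₀ ≤ s) (hδ : 0 < δ) (hδ1 : δ ≤ 1) (hst : t = s + δ ^ 2) :
    Integrable (fun ω => ∫ v in Set.Ioc s t, ‖Xcan n v ω - Xcan n s ω‖) P ∧
    ∫ ω, (∫ v in Set.Ioc s t, ‖Xcan n v ω - Xcan n s ω‖) ∂P ≤ momentConst n B 1 1 * δ ^ 3 := by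
  have hst' : s ≤ t := by rw [hst]; nlinarith
  have hm : Measurable fun p : ℝ × PathSp n => ‖Xcan n p.1 p.2 - Xcan n s p.2‖ :=
    (measurable_Xcan_uncurry.sub ((measurable_Xcan s).comp measurable_snd)).norm
  have hb : ∀ v ∈ Set.Ioc s t, ∫ ω, ‖Xcan n v ω - Xcan n s ω‖ ∂P ≤ momentConst n B 1 1 * δ := by
    intro v hv
    have h1 := (h.integrable_norm_pow hc hs hv.1.le one_ne_zero).2 1 (by nlinarith [hv.2])
    simp only [pow_one] at h1
    refine h1.trans (mul_le_mul_of_nonneg_left ?_ (momentConst_nonneg n B 1 1))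
    rw [Real.sqrt_le_left hδ.le]
    linarith [hv.2]
  have hint : Integrable (fun p : ℝ × PathSp n => ‖Xcan n p.1 p.2 - Xcan n s p.2‖)
      ((volume.restrict (Set.Ioc s t)).prod P) := by
    rw [integrable_prod_iff hm.aestronglyMeasurable]
    constructor
    · filter_upwards [ae_restrict_mem measurableSet_Ioc] with v hv
      simpa using (h.integrable_norm_pow hc hs hv.1.le one_ne_zero).1
    · refine Measure.integrableOn_of_bounded (M := momentConst n B 1 1 * δ) (by simp)
        hm.norm.stronglyMeasurable.integral_prod_right.aestronglyMeasurable ?_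
      filter_upwards [ae_restrict_mem measurableSet_Ioc] with v hv
      rw [Real.norm_eq_abs, abs_of_nonneg (integral_nonneg fun _ => norm_nonneg _)]
      simpa using hb v hv
  refine ⟨hint.integral_prod_right, ?_⟩
  rw [← integral_integral_swap hint]
  calc _ ≤ ∫ v in Set.Ioc s t, momentConst n B 1 1 * δ := by
        exact setIntegral_mono_on hint.integral_prod_left (integrable_const _) measurableSet_Ioc hb
    _ = _ := by
        rw [setIntegral_const, hst]
        simp
        rw [max_eq_left (by positivity)]
        ring

omit [MeasurableSpace (PathSp n)] [BorelSpace (PathSp n)] in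
theorem abs_pathIntegral_mul_sub_le {g : ℝ × (Fin n → ℝ) → ℝ} (hg : Measurable g) {B K : ℝ}
    (hgB : ∀ p, |g p| ≤ B) {ψ : (Fin n → ℝ) → ℝ} (hψ : Continuous ψ) (hψK : ∀ x, |ψ x| ≤ K)
    (hlip : ∀ x x', |ψ x - ψ x'| ≤ K * ‖x - x'‖) (s t : ℝ) (ω : PathSp n) :
    |ψ (Xcan n s ω) * (∫ v in Set.Ioc s t, g (v, Xcan n v ω)) -
      ∫ v in Set.Ioc s t, g (v, Xcan n v ω) * ψ (Xcan n v ω)| ≤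
      B * K * ∫ v in Set.Ioc s t, ‖Xcan n v ω - Xcan n s ω‖ := by
  have hB : 0 ≤ B := (abs_nonneg _).trans (hgB 0)
  have i1 := integrableOn_path hg hgB s t ω
  have i2 : IntegrableOn (fun v => g (v, Xcan n v ω) * ψ (Xcan n v ω)) (Set.Ioc s t) :=
    integrableOn_path (G := fun p => g p * ψ p.2) (hg.mul (hψ.measurable.comp measurable_snd))
      (C := B * K) (fun p => by
        rw [abs_mul]; exact mul_le_mul (hgB p) (hψK _) (abs_nonneg _) hB) s t ω
  have i3 : IntegrableOn (fun v => ‖Xcan n v ω - Xcan n s ω‖) (Set.Ioc s t) :=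
    (((continuous_Xcan_time ω).sub continuous_const).norm.continuousOn.integrableOn_Icc).mono_set
      Set.Ioc_subset_Icc_self
  rw [← integral_const_mul, ← integral_sub (i1.const_mul _) i2, ← integral_const_mul]
  refine (norm_integral_le_integral_norm (G := ℝ) _).trans ?_
  refine integral_mono ((i1.const_mul _).sub i2).norm (i3.const_mul _) fun v => ?_
  simp only [Real.norm_eq_abs]
  rw [show ψ (Xcan n s ω) * g (v, Xcan n v ω) - g (v, Xcan n v ω) * ψ (Xcan n v ω) =
    g (v, Xcan n v ω) * (ψ (Xcan n s ω) - ψ (Xcan n v ω)) by ring, abs_mul, mul_assoc]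
  refine mul_le_mul (hgB _) ?_ (abs_nonneg _) hB
  rw [abs_sub_comm]
  exact hlip _ _

/-- The expectation form of Itô's formula. -/
theorem ExpMart.ito (h : ExpMart a b s₀ P) (hs₀ : 0 ≤ s₀) (hc : BoundedCoeff n a b B)
    (hsym : ∀ u x, (a u x).IsSymm) {Φ : (Fin n → ℝ) → ℝ} {K : ℝ} (hΦ : TaylorBound Φ K)
    {s t : ℝ} (hs : s₀ ≤ s) (hst : s ≤ t) :
    ∫ ω, Φ (Xcan n t ω) ∂P - ∫ ω, Φ (Xcan n s ω) ∂P =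
      ∫ v in Set.Ioc s t, (∫ ω, genL a b Φ (v, Xcan n v ω) ∂P) := by
  have hGm := hc.measurable_genL hΦ
  have hGb := hc.abs_genL_le hΦ
  have hK := hΦ.nonneg
  have hB := hc.nonneg
  rw [← integral_pathIntegral_swap s t hGm hGb]
  have iΦ : ∀ u, Integrable (fun ω => Φ (Xcan n u ω)) P := fun u =>
    Integrable.of_bound (hΦ.cont.measurable.comp (measurable_Xcan u)).aestronglyMeasurable K
      (Eventually.of_forall fun ω => hΦ.bound _)
  have iG : ∀ s t, Integrable (fun ω => ∫ v in Set.Ioc s t, genL a b Φ (v, Xcan n v ω)) P :=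
    fun s t => integrable_pathIntegral s t hGm hGb
  obtain ⟨K', hK', hinc⟩ := h.exists_coord_increment_bound hc hsym
  set F : ℝ → ℝ := fun u => ∫ ω, Φ (Xcan n u ω) ∂P -
    ∫ ω, (∫ v in Set.Ioc s₀ u, genL a b Φ (v, Xcan n v ω)) ∂P with hF
  set m3 := momentConst n B 1 3
  set m1 := momentConst n B 1 1
  have hm3 : 0 ≤ m3 := momentConst_nonneg n B 1 3
  have hm1 : 0 ≤ m1 := momentConst_nonneg n B 1 1
  have key : F t = F s := by
    refine eq_of_abs_sub_le_pow (s₀ := s₀) (K := K * m3 + ∑ _i : Fin n, K' * K +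
      1 / 2 * (∑ _i : Fin n, ∑ _j : Fin n, K' * K) +
      (∑ _i : Fin n, B * K + 1 / 2 * ∑ _i : Fin n, ∑ _j : Fin n, B * K) * m1) ?_ hs hst
    intro s δ hs hδ hδ1
    obtain ⟨t, ht⟩ : ∃ t, t = s + δ ^ 2 := ⟨_, rfl⟩
    rw [← ht]
    have hst : s ≤ t := by rw [ht]; nlinarith
    have hadd : ∫ ω, (∫ v in Set.Ioc s₀ t, genL a b Φ (v, Xcan n v ω)) ∂P =
        ∫ ω, (∫ v in Set.Ioc s₀ s, genL a b Φ (v, Xcan n v ω)) ∂P +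
        ∫ ω, (∫ v in Set.Ioc s t, genL a b Φ (v, Xcan n v ω)) ∂P := by
      rw [← integral_add (iG _ _) (iG _ _)]
      exact integral_congr_ae (Eventually.of_forall fun ω => pathIntegral_add hGm hGb hs hst ω)
    set Δ : PathSp n → Fin n → ℝ := fun ω => Xcan n t ω - Xcan n s ω with hΔ
    have hmΔ : Measurable Δ := (measurable_Xcan t).sub (measurable_Xcan s)
    have hmΔi : ∀ i, Measurable fun ω => Δ ω i := fun i => (measurable_pi_apply i).comp hmΔ
    have hΔle : ∀ i ω, |Δ ω i| ≤ ‖Δ ω‖ := fun i ω => norm_le_pi_norm (Δ ω) i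
    have iΔ : ∀ i, Integrable (fun ω => Δ ω i) P := fun i =>
      integrable_of_abs_le_norm_incr_pow h hc hs hst (p := 1) one_ne_zero (hmΔi i) (C := 1)
        fun ω => by simpa using hΔle i ω
    have iΔΔ : ∀ i j, Integrable (fun ω => Δ ω i * Δ ω j) P := fun i j =>
      integrable_of_abs_le_norm_incr_pow h hc hs hst (p := 2) two_ne_zero
        ((hmΔi i).mul (hmΔi j)) (C := 1) fun ω => by
          rw [abs_mul, one_mul, sq]
          exact mul_le_mul (hΔle i ω) (hΔle j ω) (abs_nonneg _) (norm_nonneg _)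
    have ib : ∀ i, Integrable (fun ω => ∫ v in Set.Ioc s t, b v (Xcan n v ω) i) P := fun i =>
      integrable_pathIntegral (G := fun p => b p.1 p.2 i) s t (hc.meas_b i)
        fun p => hc.bound_b _ _ i
    have ia : ∀ i j, Integrable (fun ω => ∫ v in Set.Ioc s t, a v (Xcan n v ω) i j) P :=
      fun i j => integrable_pathIntegral (G := fun p => a p.1 p.2 i j) s t (hc.meas_a i j)
        fun p => hc.bound_a _ _ i j
    set Z1 : Fin n → PathSp n → ℝ := fun i ω => pderivCoord i Φ (Xcan n s ω) with hZ1
    set Z2 : Fin n → Fin n → PathSp n → ℝ :=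
      fun i j ω => pderivCoord j (pderivCoord i Φ) (Xcan n s ω) with hZ2
    have mX : ∀ {ψ : (Fin n → ℝ) → ℝ}, Continuous ψ →
        Measurable fun ω : PathSp n => ψ (Xcan n s ω) :=
      fun hψ => hψ.measurable.comp (measurable_Xcan s)
    set R : PathSp n → ℝ := fun ω => Φ (Xcan n t ω) - Φ (Xcan n s ω) - ∑ i, Z1 i ω * Δ ω i -
      1 / 2 * ∑ i, ∑ j, Z2 i j ω * (Δ ω i * Δ ω j) with hR
    have hRle : ∀ ω, |R ω| ≤ K * ‖Δ ω‖ ^ 3 := fun ω => by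
      have := hΦ.taylor (Xcan n s ω) (Δ ω)
      rwa [hΔ, add_sub_cancel] at this
    have iZ1 : ∀ i {Y : PathSp n → ℝ}, Integrable Y P → Integrable (fun ω => Z1 i ω * Y ω) P :=
      fun i Y hY => hY.bdd_mul (mX (hΦ.cont₁ i)).aestronglyMeasurable
        (Eventually.of_forall fun ω => hΦ.bound₁ i _)
    have iZ2 : ∀ i j {Y : PathSp n → ℝ}, Integrable Y P →
        Integrable (fun ω => Z2 i j ω * Y ω) P :=
      fun i j Y hY => hY.bdd_mul (mX (hΦ.cont₂ i j)).aestronglyMeasurable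
        (Eventually.of_forall fun ω => hΦ.bound₂ i j _)
    have iS1 : Integrable (fun ω => ∑ i, Z1 i ω * Δ ω i) P :=
      integrable_finsetSum _ fun i _ => iZ1 i (iΔ i)
    have iS2 : Integrable (fun ω => ∑ i, ∑ j, Z2 i j ω * (Δ ω i * Δ ω j)) P :=
      integrable_finsetSum _ fun i _ => integrable_finsetSum _ fun j _ => iZ2 i j (iΔΔ i j)
    have iΦΦ : Integrable (fun ω => Φ (Xcan n t ω) - Φ (Xcan n s ω)) P := (iΦ t).sub (iΦ s)
    have iΦ1 : Integrable (fun ω => Φ (Xcan n t ω) - Φ (Xcan n s ω) - ∑ i, Z1 i ω * Δ ω i) P :=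
      iΦΦ.sub iS1
    have iR : Integrable R P := iΦ1.sub (iS2.const_mul _)
    -- the five pieces
    set A1 : PathSp n → ℝ := fun ω => ∑ i, Z1 i ω * (Δ ω i -
      ∫ v in Set.Ioc s t, b v (Xcan n v ω) i) with hA1
    set A2 : PathSp n → ℝ := fun ω => ∑ i, ∑ j, Z2 i j ω * (Δ ω i * Δ ω j -
      ∫ v in Set.Ioc s t, a v (Xcan n v ω) i j) with hA2
    set D : PathSp n → ℝ := fun ω => ∫ v in Set.Ioc s t, ‖Xcan n v ω - Xcan n s ω‖ with hD
    have iA1' : ∀ i, Integrable (fun ω => Z1 i ω * (Δ ω i -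
        ∫ v in Set.Ioc s t, b v (Xcan n v ω) i)) P := fun i => iZ1 i ((iΔ i).sub (ib i))
    have iA2' : ∀ i j, Integrable (fun ω => Z2 i j ω * (Δ ω i * Δ ω j -
        ∫ v in Set.Ioc s t, a v (Xcan n v ω) i j)) P := fun i j =>
      iZ2 i j ((iΔΔ i j).sub (ia i j))
    have iA1 : Integrable A1 P := integrable_finsetSum _ fun i _ => iA1' i
    have iA2 : Integrable A2 P :=
      integrable_finsetSum _ fun i _ => integrable_finsetSum _ fun j _ => iA2' i j
    obtain ⟨iD, hDle⟩ := h.integral_path_dist_le hc hs hδ hδ1 ht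
    set c4 := ∑ _i : Fin n, B * K + 1 / 2 * ∑ _i : Fin n, ∑ _j : Fin n, B * K with hc4
    set E : PathSp n → ℝ := fun ω => (Φ (Xcan n t ω) - Φ (Xcan n s ω)) -
      (∫ v in Set.Ioc s t, genL a b Φ (v, Xcan n v ω)) with hE
    have hEle : ∀ ω, |E ω - R ω - A1 ω - 1 / 2 * A2 ω| ≤ c4 * D ω := by
      intro ω
      have e1 : ∫ v in Set.Ioc s t, genL a b Φ (v, Xcan n v ω) =
          ∑ i, (∫ v in Set.Ioc s t, b v (Xcan n v ω) i * pderivCoord i Φ (Xcan n v ω)) +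
          1 / 2 * ∑ i, ∑ j, ∫ v in Set.Ioc s t,
            a v (Xcan n v ω) i j * pderivCoord j (pderivCoord i Φ) (Xcan n v ω) := by
        have j1 : ∀ i, IntegrableOn
            (fun v => b v (Xcan n v ω) i * pderivCoord i Φ (Xcan n v ω)) (Set.Ioc s t) := fun i =>
          integrableOn_path (G := fun p => b p.1 p.2 i * pderivCoord i Φ p.2) (C := B * K)
            ((hc.meas_b i).mul ((hΦ.cont₁ i).measurable.comp measurable_snd)) (fun p => by
              rw [abs_mul]
              exact mul_le_mul (hc.bound_b _ _ i) (hΦ.bound₁ i _) (abs_nonneg _) hB) s t ω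
        have j2 : ∀ i j, IntegrableOn
            (fun v => a v (Xcan n v ω) i j * pderivCoord j (pderivCoord i Φ) (Xcan n v ω))
            (Set.Ioc s t) := fun i j =>
          integrableOn_path (G := fun p => a p.1 p.2 i j * pderivCoord j (pderivCoord i Φ) p.2)
            (C := B * K)
            ((hc.meas_a i j).mul ((hΦ.cont₂ i j).measurable.comp measurable_snd)) (fun p => by
              rw [abs_mul]
              exact mul_le_mul (hc.bound_a _ _ i j) (hΦ.bound₂ i j _) (abs_nonneg _) hB) s t ω
        unfold genL
        rw [integral_add (integrable_finsetSum _ fun i _ => j1 i)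
          ((integrable_finsetSum _ fun i _ => integrable_finsetSum _ fun j _ =>
            j2 i j).const_mul _), integral_const_mul, integral_finsetSum _ fun i _ => j1 i,
          integral_finsetSum _ fun i _ => integrable_finsetSum _ fun j _ => j2 i j]
        congr 2
        exact Finset.sum_congr rfl fun i _ => integral_finsetSum _ fun j _ => j2 i j
      have e2 : E ω - R ω - A1 ω - 1 / 2 * A2 ω =
          ∑ i, (Z1 i ω * (∫ v in Set.Ioc s t, b v (Xcan n v ω) i) -
            ∫ v in Set.Ioc s t, b v (Xcan n v ω) i * pderivCoord i Φ (Xcan n v ω)) +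
          1 / 2 * ∑ i, ∑ j, (Z2 i j ω * (∫ v in Set.Ioc s t, a v (Xcan n v ω) i j) -
            ∫ v in Set.Ioc s t,
              a v (Xcan n v ω) i j * pderivCoord j (pderivCoord i Φ) (Xcan n v ω)) := by
        simp only [hE, hR, hA1, hA2, e1, mul_sub, Finset.sum_sub_distrib]
        ring
      rw [e2, hc4, add_mul, mul_assoc (1 / 2), Finset.sum_mul, Finset.sum_mul]
      refine (abs_add_le _ _).trans (add_le_add ?_ ?_)
      · refine (Finset.abs_sum_le_sum_abs _ _).trans (Finset.sum_le_sum fun i _ => ?_)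
        exact abs_pathIntegral_mul_sub_le (g := fun p => b p.1 p.2 i) (hc.meas_b i)
          (fun p => hc.bound_b _ _ i) (hΦ.cont₁ i) (hΦ.bound₁ i) (hΦ.lip₁ i) s t ω
      · rw [abs_mul, abs_of_pos (by norm_num : (0 : ℝ) < 1 / 2)]
        refine mul_le_mul_of_nonneg_left ?_ (by norm_num)
        refine (Finset.abs_sum_le_sum_abs _ _).trans (Finset.sum_le_sum fun i _ => ?_)
        rw [Finset.sum_mul]
        refine (Finset.abs_sum_le_sum_abs _ _).trans (Finset.sum_le_sum fun j _ => ?_)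
        exact abs_pathIntegral_mul_sub_le (g := fun p => a p.1 p.2 i j) (hc.meas_a i j)
          (fun p => hc.bound_a _ _ i j) (hΦ.cont₂ i j) (hΦ.bound₂ i j) (hΦ.lip₂ i j) s t ω
    have iE : Integrable E P := iΦΦ.sub (iG s t)
    have iER : Integrable (fun ω => E ω - R ω) P := iE.sub iR
    have iERA : Integrable (fun ω => E ω - R ω - A1 ω) P := iER.sub iA1
    have b1 : |∫ ω, R ω ∂P| ≤ K * m3 * δ ^ 3 := by
      have h3 := (h.integrable_norm_pow hc hs hst (p := 3) (by norm_num))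
      have h4 := h3.2 1 (by rw [ht]; nlinarith)
      rw [show t - s = δ ^ 2 by rw [ht]; ring, Real.sqrt_sq hδ.le] at h4
      calc |∫ ω, R ω ∂P| ≤ ∫ ω, K * ‖Δ ω‖ ^ 3 ∂P :=
            (norm_integral_le_integral_norm _).trans
              (integral_mono iR.norm (h3.1.const_mul K) hRle)
        _ = K * ∫ ω, ‖Δ ω‖ ^ 3 ∂P := integral_const_mul _ _
        _ ≤ K * (m3 * δ ^ 3) := by gcongr
        _ = _ := by ring
    have b2 : |∫ ω, A1 ω ∂P| ≤ (∑ _i : Fin n, K' * K) * δ ^ 3 := by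
      rw [hA1, integral_finsetSum _ fun i _ => iA1' i, Finset.sum_mul]
      refine (Finset.abs_sum_le_sum_abs _ _).trans (Finset.sum_le_sum fun i _ => ?_)
      exact (hinc s t δ K (Z1 i) hs hδ hδ1 ht
        ((hΦ.cont₁ i).measurable.comp (measurable_Xcan_canonFiltr (hs₀.trans hs) le_rfl))
        (fun ω => hΦ.bound₁ i _)).1 i
    have b3 : |∫ ω, A2 ω ∂P| ≤ (∑ _i : Fin n, ∑ _j : Fin n, K' * K) * δ ^ 3 := by
      rw [hA2, integral_finsetSum _ fun i _ => integrable_finsetSum _ fun j _ => iA2' i j,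
        Finset.sum_mul]
      refine (Finset.abs_sum_le_sum_abs _ _).trans (Finset.sum_le_sum fun i _ => ?_)
      rw [integral_finsetSum _ fun j _ => iA2' i j, Finset.sum_mul]
      refine (Finset.abs_sum_le_sum_abs _ _).trans (Finset.sum_le_sum fun j _ => ?_)
      exact (hinc s t δ K (Z2 i j) hs hδ hδ1 ht
        ((hΦ.cont₂ i j).measurable.comp (measurable_Xcan_canonFiltr (hs₀.trans hs) le_rfl))
        (fun ω => hΦ.bound₂ i j _)).2 i j
    have b4 : |∫ ω, (E ω - R ω - A1 ω - 1 / 2 * A2 ω) ∂P| ≤ c4 * (m1 * δ ^ 3) := by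
      have hc4' : 0 ≤ c4 := by positivity
      calc _ ≤ ∫ ω, c4 * D ω ∂P := (norm_integral_le_integral_norm _).trans
              (integral_mono (iERA.sub (iA2.const_mul _)).norm (iD.const_mul c4) hEle)
        _ = c4 * ∫ ω, D ω ∂P := integral_const_mul _ _
        _ ≤ _ := by gcongr
    have e0 : F t - F s = ∫ ω, (E ω - R ω - A1 ω - 1 / 2 * A2 ω) ∂P + ∫ ω, R ω ∂P +
        ∫ ω, A1 ω ∂P + 1 / 2 * ∫ ω, A2 ω ∂P := by
      rw [integral_sub iERA (iA2.const_mul _), integral_sub iER iA1, integral_sub iE iR,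
        integral_const_mul, hE, integral_sub iΦΦ (iG s t), integral_sub (iΦ t) (iΦ s)]
      simp only [hF]
      rw [hadd]
      ring
    rw [e0]
    have t1 := abs_add_le (∫ ω, (E ω - R ω - A1 ω - 1 / 2 * A2 ω) ∂P + ∫ ω, R ω ∂P +
        ∫ ω, A1 ω ∂P) (1 / 2 * ∫ ω, A2 ω ∂P)
    have t2 := abs_add_le (∫ ω, (E ω - R ω - A1 ω - 1 / 2 * A2 ω) ∂P + ∫ ω, R ω ∂P) (∫ ω, A1 ω ∂P)
    have t3 := abs_add_le (∫ ω, (E ω - R ω - A1 ω - 1 / 2 * A2 ω) ∂P) (∫ ω, R ω ∂P)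
    have t4 : |1 / 2 * ∫ ω, A2 ω ∂P| ≤
        1 / 2 * ((∑ _i : Fin n, ∑ _j : Fin n, K' * K) * δ ^ 3) := by
      rw [abs_mul, abs_of_pos (by norm_num : (0 : ℝ) < 1 / 2)]
      gcongr
    linarith
  simp only [hF] at key
  have hadd : ∫ ω, (∫ v in Set.Ioc s₀ t, genL a b Φ (v, Xcan n v ω)) ∂P =
      ∫ ω, (∫ v in Set.Ioc s₀ s, genL a b Φ (v, Xcan n v ω)) ∂P +
      ∫ ω, (∫ v in Set.Ioc s t, genL a b Φ (v, Xcan n v ω)) ∂P := by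
    rw [← integral_add (iG _ _) (iG _ _)]
    exact integral_congr_ae (Eventually.of_forall fun ω => pathIntegral_add hGm hGb hs hst ω)
  linarith

end ItoExpectation

section GaussianWeights

open scoped ENNReal NNReal

variable {n : ℕ}

theorem integrable_exp_neg_mul_dotProduct {b : ℝ} (hb : 0 < b) :
    Integrable (fun v : Fin n → ℝ => Real.exp (-b * (v ⬝ᵥ v))) := by
  have h := (GaussianFourier.integrable_cexp_neg_mul_sum_add (ι := Fin n) (b := (b : ℂ))
    (by simpa using hb) 0).norm
  refine h.congr (Eventually.of_forall fun v => ?_)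
  show ‖Complex.exp _‖ = Real.exp (-b * (v ⬝ᵥ v))
  rw [Complex.norm_exp]
  simp [dotProduct, sq, ← Complex.ofReal_mul, ← Complex.ofReal_sum]

theorem integral_exp_neg_mul_cos {b : ℝ} (hb : 0 < b) (z : Fin n → ℝ) :
    ∫ v : Fin n → ℝ, Real.exp (-b * (v ⬝ᵥ v)) * Real.cos (v ⬝ᵥ z) =
      (Real.pi / b) ^ ((n : ℝ) / 2) * Real.exp (-(z ⬝ᵥ z) / (4 * b)) := by
  have hi := GaussianFourier.integrable_cexp_neg_mul_sum_add (ι := Fin n) (b := (b : ℂ))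
    (by simpa using hb) (fun i => Complex.I * z i)
  have h := GaussianFourier.integral_cexp_neg_mul_sum_add (ι := Fin n) (b := (b : ℂ))
    (by simpa using hb) (fun i => Complex.I * z i)
  have h1 := congrArg Complex.re h
  rw [← Complex.reCLM_apply, ← ContinuousLinearMap.integral_comp_comm _ hi] at h1
  have e1 : ∀ v : Fin n → ℝ, Complex.reCLM (Complex.exp (-(b : ℂ) * ∑ i, (v i : ℂ) ^ 2 +
      ∑ i, Complex.I * z i * v i)) = Real.exp (-b * (v ⬝ᵥ v)) * Real.cos (v ⬝ᵥ z) := by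
    intro v
    have : (-(b : ℂ) * ∑ i, (v i : ℂ) ^ 2 + ∑ i, Complex.I * z i * v i) =
        ((-b * (v ⬝ᵥ v) : ℝ) : ℂ) + ((v ⬝ᵥ z : ℝ) : ℂ) * Complex.I := by
      simp only [dotProduct, Complex.ofReal_mul, Complex.ofReal_neg, Complex.ofReal_sum,
        Finset.sum_mul, sq]
      congr 1
      exact Finset.sum_congr rfl fun i _ => by ring
    rw [this, Complex.exp_add, ← Complex.ofReal_exp, Complex.reCLM_apply, Complex.re_ofReal_mul,
      Complex.exp_ofReal_mul_I_re]
  simp only [e1] at h1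
  rw [h1]
  have e2 : ((Real.pi : ℂ) / b) ^ ((Fintype.card (Fin n) : ℂ) / 2) =
      (((Real.pi / b) ^ ((n : ℝ) / 2) : ℝ) : ℂ) := by
    rw [Complex.ofReal_cpow (by positivity)]
    simp
  have e3 : (∑ i, (Complex.I * (z i : ℂ)) ^ 2) / (4 * (b : ℂ)) =
      ((-(z ⬝ᵥ z) / (4 * b) : ℝ) : ℂ) := by
    simp only [dotProduct, Complex.ofReal_div, Complex.ofReal_neg, Complex.ofReal_sum,
      Complex.ofReal_mul, Complex.ofReal_ofNat]
    rw [← Finset.sum_neg_distrib]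
    congr 1
    exact Finset.sum_congr rfl fun i _ => by rw [mul_pow, Complex.I_sq]; ring
  rw [e2, e3, ← Complex.ofReal_exp, ← Complex.ofReal_mul, Complex.ofReal_re]

/-- Weights on the frequency side: a negative Sobolev order with a Gaussian regularisation. -/
noncomputable def freqWt (k : ℕ) (r : ℝ) (ξ : Fin n → ℝ) : ℝ :=
  ((1 + ξ ⬝ᵥ ξ) ^ k)⁻¹ * Real.exp (-r * (ξ ⬝ᵥ ξ))

theorem dotProduct_self_nonneg_real (ξ : Fin n → ℝ) : 0 ≤ ξ ⬝ᵥ ξ :=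
  Finset.sum_nonneg fun i _ => mul_self_nonneg (ξ i)

theorem measurable_dotProduct_self : Measurable fun ξ : Fin n → ℝ => ξ ⬝ᵥ ξ :=
  Finset.measurable_sum _ fun i _ => (measurable_pi_apply i).mul (measurable_pi_apply i)

theorem measurable_freqWt (k : ℕ) :
    Measurable fun p : ℝ × (Fin n → ℝ) => freqWt k p.1 p.2 := by
  have h : Measurable fun p : ℝ × (Fin n → ℝ) => p.2 ⬝ᵥ p.2 :=
    measurable_dotProduct_self.comp measurable_snd
  exact ((h.const_add 1).pow_const k).inv.mul (Real.measurable_exp.comp (measurable_fst.neg.mul h))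

theorem freqWt_nonneg (k : ℕ) (r : ℝ) (ξ : Fin n → ℝ) : 0 ≤ freqWt k r ξ := by
  have := dotProduct_self_nonneg_real ξ
  unfold freqWt
  positivity

theorem freqWt_le_exp (k : ℕ) (r : ℝ) (ξ : Fin n → ℝ) :
    freqWt k r ξ ≤ Real.exp (-r * (ξ ⬝ᵥ ξ)) := by
  have := dotProduct_self_nonneg_real ξ
  refine mul_le_of_le_one_left (Real.exp_pos _).le (inv_le_one_of_one_le₀ (one_le_pow₀ ?_))
  linarith

theorem integrable_freqWt (k : ℕ) {r : ℝ} (hr : 0 < r) :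
    Integrable (freqWt (n := n) k r) := by
  refine (integrable_exp_neg_mul_dotProduct hr).mono'
    ((measurable_freqWt k).comp measurable_prodMk_left).aestronglyMeasurable
    (Eventually.of_forall fun ξ => ?_)
  rw [Real.norm_eq_abs, abs_of_nonneg (freqWt_nonneg k r ξ)]
  exact freqWt_le_exp k r ξ

theorem integral_exp_neg_mul_Ioi_zero {q : ℝ} (hq : 0 < q) :
    ∫ u in Set.Ioi (0 : ℝ), Real.exp (-q * u) = q⁻¹ := by
  have := integral_exp_mul_Ioi (a := -q) (by linarith) 0
  rw [this]; simp

/-- The frequency weights are of positive type. -/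
theorem integral_freqWt_cos_nonneg (k : ℕ) {r : ℝ} (hr : 0 < r) (z : Fin n → ℝ) :
    0 ≤ ∫ ξ, freqWt k r ξ * Real.cos (ξ ⬝ᵥ z) := by
  induction k generalizing r with
  | zero =>
    simp only [freqWt, pow_zero, inv_one, one_mul]
    rw [integral_exp_neg_mul_cos hr]
    positivity
  | succ k ih =>
    have e : ∀ ξ : Fin n → ℝ, freqWt (k + 1) r ξ * Real.cos (ξ ⬝ᵥ z) =
        ∫ u in Set.Ioi (0 : ℝ), Real.exp (-u) * (freqWt k (r + u) ξ * Real.cos (ξ ⬝ᵥ z)) := by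
      intro ξ
      have hq := dotProduct_self_nonneg_real ξ
      have : ∀ u : ℝ, Real.exp (-u) * (freqWt k (r + u) ξ * Real.cos (ξ ⬝ᵥ z)) =
          Real.exp (-(1 + ξ ⬝ᵥ ξ) * u) * (freqWt k r ξ * Real.cos (ξ ⬝ᵥ z)) := fun u => by
        unfold freqWt
        rw [show -(r + u) * (ξ ⬝ᵥ ξ) = -r * (ξ ⬝ᵥ ξ) + -u * (ξ ⬝ᵥ ξ) by ring, Real.exp_add,
          show -(1 + ξ ⬝ᵥ ξ) * u = -u + -u * (ξ ⬝ᵥ ξ) by ring, Real.exp_add]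
        ring
      simp only [this]
      rw [integral_mul_const, integral_exp_neg_mul_Ioi_zero (by linarith)]
      unfold freqWt
      rw [pow_succ, mul_inv]
      ring
    simp only [e]
    have hint : Integrable (fun p : (Fin n → ℝ) × ℝ => Real.exp (-p.2) *
        (freqWt k (r + p.2) p.1 * Real.cos (p.1 ⬝ᵥ z)))
        (volume.prod (volume.restrict (Set.Ioi (0 : ℝ)))) := by
      have hdom : Integrable (fun p : (Fin n → ℝ) × ℝ => Real.exp (-r * (p.1 ⬝ᵥ p.1)) *
          Real.exp (-p.2)) (volume.prod (volume.restrict (Set.Ioi (0 : ℝ)))) :=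
        (integrable_exp_neg_mul_dotProduct hr).mul_prod (integrableOn_exp_neg_Ioi 0)
      refine hdom.mono' ?_ ?_
      · refine Measurable.aestronglyMeasurable ?_
        refine (Real.measurable_exp.comp measurable_snd.neg).mul (((measurable_freqWt k).comp
          ((measurable_snd.const_add r).prodMk measurable_fst)).mul
          (Real.measurable_cos.comp ?_))
        exact Finset.measurable_sum _ fun i _ =>
          ((measurable_pi_apply i).comp measurable_fst).mul_const _
      · have : ∀ᵐ p : (Fin n → ℝ) × ℝ ∂(volume.prod (volume.restrict (Set.Ioi (0 : ℝ)))),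
            p.2 ∈ Set.Ioi (0 : ℝ) :=
          Measure.quasiMeasurePreserving_snd.ae (ae_restrict_mem measurableSet_Ioi)
        filter_upwards [this] with p hp
        rw [norm_mul, norm_mul, Real.norm_eq_abs, Real.norm_eq_abs, Real.norm_eq_abs,
          abs_of_nonneg (Real.exp_pos _).le, abs_of_nonneg (freqWt_nonneg _ _ _), mul_comm]
        refine mul_le_mul_of_nonneg_right ?_ (Real.exp_pos _).le
        have hq := dotProduct_self_nonneg_real p.1
        calc _ ≤ freqWt k (r + p.2) p.1 * 1 := by
              gcongr
              · exact freqWt_nonneg _ _ _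
              · exact Real.abs_cos_le_one _
          _ ≤ Real.exp (-(r + p.2) * (p.1 ⬝ᵥ p.1)) := by rw [mul_one]; exact freqWt_le_exp _ _ _
          _ ≤ _ := Real.exp_le_exp.2 (by nlinarith [Set.mem_Ioi.1 hp])
    rw [integral_integral_swap hint]
    refine setIntegral_nonneg measurableSet_Ioi fun u hu => ?_
    rw [integral_const_mul]
    exact mul_nonneg (Real.exp_pos _).le (ih (add_pos hr hu))

end GaussianWeights

section FourierEnergy

open scoped ENNReal NNReal

variable {n : ℕ} {Ω : Type*} [MeasurableSpace Ω] {μ : Measure Ω} [IsFiniteMeasure μ]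
  {X : Ω → Fin n → ℝ} {G g : Ω → ℝ} {M : ℝ}

/-- The trigonometric integral of the weighted law of `X`. -/
noncomputable def trigInt (μ : Measure Ω) (X : Ω → Fin n → ℝ) (G : Ω → ℝ) (ξ : Fin n → ℝ)
    (c : ℝ) : ℝ :=
  ∫ ω, G ω * Real.cos (ξ ⬝ᵥ X ω + c) ∂μ

/-- The squared modulus of the Fourier transform of the weighted law of `X`. -/
noncomputable def fourierSq (μ : Measure Ω) (X : Ω → Fin n → ℝ) (G : Ω → ℝ) (ξ : Fin n → ℝ) : ℝ :=
  trigInt μ X G ξ 0 ^ 2 + trigInt μ X G ξ (Real.pi / 2) ^ 2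

omit [IsFiniteMeasure μ] in
theorem fourierSq_nonneg (ξ : Fin n → ℝ) : 0 ≤ fourierSq μ X G ξ := by
  unfold fourierSq; positivity

theorem measurable_dotProduct_pair :
    Measurable fun p : (Fin n → ℝ) × (Fin n → ℝ) => p.1 ⬝ᵥ p.2 :=
  Finset.measurable_sum _ fun i _ => ((measurable_pi_apply i).comp measurable_fst).mul
    ((measurable_pi_apply i).comp measurable_snd)

theorem integral_freqWt_fourierSq (hX : Measurable X) (hG : Measurable G) (hM : ∀ ω, |G ω| ≤ M)
    (k : ℕ) {r : ℝ} (hr : 0 < r) :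
    ∫ ξ, freqWt k r ξ * fourierSq μ X G ξ = ∫ p : Ω × Ω, G p.1 * G p.2 *
      (∫ ξ, freqWt k r ξ * Real.cos (ξ ⬝ᵥ (X p.1 - X p.2))) ∂(μ.prod μ) := by
  have hcos : ∀ (ξ : Fin n → ℝ) (c : ℝ), Integrable (fun ω => G ω * Real.cos (ξ ⬝ᵥ X ω + c)) μ := by
    intro ξ c
    refine Integrable.of_bound (hG.mul (Real.measurable_cos.comp
      ((measurable_dotProduct_left hX ξ).add_const c))).aestronglyMeasurable M
      (Eventually.of_forall fun ω => ?_)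
    rw [Real.norm_eq_abs, abs_mul]
    exact (mul_le_of_le_one_right (abs_nonneg _) (Real.abs_cos_le_one _)).trans (hM ω)
  have e1 : ∀ ξ, fourierSq μ X G ξ =
      ∫ p : Ω × Ω, G p.1 * G p.2 * Real.cos (ξ ⬝ᵥ (X p.1 - X p.2)) ∂(μ.prod μ) := by
    intro ξ
    unfold fourierSq trigInt
    rw [sq, sq, ← integral_prod_mul, ← integral_prod_mul,
      ← integral_add ((hcos ξ 0).mul_prod (hcos ξ 0)) ((hcos ξ _).mul_prod (hcos ξ _))]
    refine integral_congr_ae (Eventually.of_forall fun p => ?_)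
    simp only [add_zero, Real.cos_add_pi_div_two, dotProduct_sub, Real.cos_sub]
    ring
  have e2 : ∀ p : Ω × Ω, G p.1 * G p.2 *
      (∫ ξ, freqWt k r ξ * Real.cos (ξ ⬝ᵥ (X p.1 - X p.2))) =
      ∫ ξ, freqWt k r ξ * (G p.1 * G p.2 * Real.cos (ξ ⬝ᵥ (X p.1 - X p.2))) := fun p => by
    rw [← integral_const_mul]
    exact integral_congr_ae (Eventually.of_forall fun ξ => by ring)
  simp only [e1, e2, ← integral_const_mul]
  refine integral_integral_swap ?_
  have hdom : Integrable (fun q : (Fin n → ℝ) × (Ω × Ω) => freqWt k r q.1 * (M * M))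
      (volume.prod (μ.prod μ)) := (integrable_freqWt k hr).mul_prod (integrable_const _)
  refine hdom.mono' ?_ (Eventually.of_forall fun q => ?_)
  · refine Measurable.aestronglyMeasurable ?_
    refine (((measurable_freqWt k).comp measurable_prodMk_left).comp measurable_fst).mul
      (((hG.comp (measurable_fst.comp measurable_snd)).mul
        (hG.comp (measurable_snd.comp measurable_snd))).mul (Real.measurable_cos.comp ?_))
    exact measurable_dotProduct_pair.comp (measurable_fst.prodMk
      ((hX.comp (measurable_fst.comp measurable_snd)).sub
        (hX.comp (measurable_snd.comp measurable_snd))))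
  · simp only [Function.uncurry, norm_mul, Real.norm_eq_abs, abs_of_nonneg (freqWt_nonneg k r _)]
    refine mul_le_mul_of_nonneg_left ?_ (freqWt_nonneg _ _ _)
    have hM0 : 0 ≤ M := (abs_nonneg _).trans (hM q.2.1)
    calc _ ≤ M * M * 1 := by
          gcongr
          · exact hM _
          · exact hM _
          · exact Real.abs_cos_le_one _
      _ = _ := mul_one _

/-- Domination: weighted Fourier energies are monotone in the modulus of the density. -/
theorem integral_freqWt_fourierSq_mono (hX : Measurable X) (hG : Measurable G) (hg : Measurable g)
    (hM : ∀ ω, g ω ≤ M) (hGg : ∀ ω, |G ω| ≤ g ω) (k : ℕ) {r : ℝ} (hr : 0 < r) :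
    ∫ ξ, freqWt k r ξ * fourierSq μ X G ξ ≤ ∫ ξ, freqWt k r ξ * fourierSq μ X g ξ := by
  have hg0 : ∀ ω, 0 ≤ g ω := fun ω => (abs_nonneg _).trans (hGg ω)
  have hgM : ∀ ω, |g ω| ≤ M := fun ω => by rw [abs_of_nonneg (hg0 ω)]; exact hM ω
  have hGM : ∀ ω, |G ω| ≤ M := fun ω => (hGg ω).trans (hM ω)
  rw [integral_freqWt_fourierSq hX hG hGM k hr, integral_freqWt_fourierSq hX hg hgM k hr]
  set κ : Ω × Ω → ℝ := fun p => ∫ ξ, freqWt k r ξ * Real.cos (ξ ⬝ᵥ (X p.1 - X p.2)) with hκ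
  have hκ0 : ∀ p, 0 ≤ κ p := fun p => integral_freqWt_cos_nonneg k hr _
  have hκm : Measurable κ := by
    have : Measurable fun q : (Ω × Ω) × (Fin n → ℝ) =>
        freqWt k r q.2 * Real.cos (q.2 ⬝ᵥ (X q.1.1 - X q.1.2)) :=
      (((measurable_freqWt k).comp measurable_prodMk_left).comp measurable_snd).mul
        (Real.measurable_cos.comp (measurable_dotProduct_pair.comp (measurable_snd.prodMk
          ((hX.comp (measurable_fst.comp measurable_fst)).sub
            (hX.comp (measurable_snd.comp measurable_fst))))))
    exact this.stronglyMeasurable.integral_prod_right.measurable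
  have hκb : ∀ p, |κ p| ≤ ∫ ξ, freqWt (n := n) k r ξ := fun p => by
    refine (norm_integral_le_integral_norm _).trans (integral_mono_of_nonneg
      (Eventually.of_forall fun ξ => norm_nonneg
        (freqWt k r ξ * Real.cos (ξ ⬝ᵥ (X p.1 - X p.2)))) (integrable_freqWt k hr)
      (Eventually.of_forall fun ξ => ?_))
    simp only [norm_mul, Real.norm_eq_abs, abs_of_nonneg (freqWt_nonneg k r ξ)]
    exact mul_le_of_le_one_right (freqWt_nonneg _ _ _) (Real.abs_cos_le_one _)
  have hint : ∀ H : Ω → ℝ, Measurable H → (∀ ω, |H ω| ≤ M) →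
      Integrable (fun p : Ω × Ω => H p.1 * H p.2 * κ p) (μ.prod μ) := fun H hH hHM => by
    refine Integrable.of_bound (((hH.comp measurable_fst).mul
      (hH.comp measurable_snd)).mul hκm).aestronglyMeasurable
      (M * M * ∫ ξ, freqWt (n := n) k r ξ) (Eventually.of_forall fun p => ?_)
    have hM0 : 0 ≤ M := (abs_nonneg _).trans (hHM p.1)
    rw [norm_mul, norm_mul]
    exact mul_le_mul (mul_le_mul (hHM _) (hHM _) (norm_nonneg _) hM0) (hκb p) (norm_nonneg _)
      (by positivity)
  refine integral_mono (hint G hG hGM) (hint g hg hgM) fun p => ?_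
  refine mul_le_mul_of_nonneg_right ?_ (hκ0 p)
  calc G p.1 * G p.2 ≤ |G p.1 * G p.2| := le_abs_self _
    _ = |G p.1| * |G p.2| := abs_mul _ _
    _ ≤ _ := mul_le_mul (hGg _) (hGg _) (abs_nonneg _) (hg0 _)

end FourierEnergy

section EnergyODE

/-- Energy estimate for a linear ordinary differential equation in integrated form. -/
theorem integral_sq_weighted_le {τ₀ τ₁ κ C m₀ : ℝ} (h01 : τ₀ ≤ τ₁) (hκ : 0 < κ) (j : ℕ)
    {m h : ℝ → ℝ} (hh : Measurable h) (hC : ∀ v, |h v| ≤ C)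
    (hm : ∀ v, τ₀ ≤ v → m v = m₀ + ∫ w in Set.Ioc τ₀ v, h w) :
    ∫ v in Set.Ioc τ₀ τ₁, ((v - τ₀) ^ (j + 1) * m v) ^ 2 ≤ (κ ^ 2)⁻¹ *
      ∫ v in Set.Ioc τ₀ τ₁, ((j + 1) * (v - τ₀) ^ j * m v + (v - τ₀) ^ (j + 1) * h v +
        κ * ((v - τ₀) ^ (j + 1) * m v)) ^ 2 := by
  set M : ℝ → ℝ := fun v => m₀ + ∫ w in τ₀..v, h w with hM
  have hint : IntervalIntegrable h volume τ₀ τ₁ :=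
    (intervalIntegrable_const (c := C)).mono_fun hh.aestronglyMeasurable
      (Eventually.of_forall fun v => by
        simp only [Real.norm_eq_abs]
        exact (hC v).trans (le_abs_self C))
  have hint2 : IntervalIntegrable (fun v => h v ^ 2) volume τ₀ τ₁ :=
    (intervalIntegrable_const (c := C ^ 2)).mono_fun (hh.pow_const 2).aestronglyMeasurable
      (Eventually.of_forall fun v => by
        show |h v ^ 2| ≤ |C ^ 2|
        rw [abs_pow, abs_pow]
        exact pow_le_pow_left₀ (abs_nonneg _) ((hC v).trans (le_abs_self C)) 2)
  have acI : AbsolutelyContinuousOnInterval (fun v => ∫ w in τ₀..v, h w) τ₀ τ₁ :=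
    hint.absolutelyContinuousOnInterval_intervalIntegral Set.left_mem_uIcc
  have acM : AbsolutelyContinuousOnInterval M τ₀ τ₁ := by
    refine AbsolutelyContinuousOnInterval.add ?_ acI
    exact (contDiff_const (c := m₀)).contDiffOn.absolutelyContinuousOnInterval
  have acp : AbsolutelyContinuousOnInterval (fun v => (v - τ₀) ^ (j + 1)) τ₀ τ₁ :=
    ((contDiff_id.sub contDiff_const).pow (j + 1)).contDiffOn.absolutelyContinuousOnInterval
  set Y : ℝ → ℝ := fun v => (v - τ₀) ^ (j + 1) * M v with hY
  have acY : AbsolutelyContinuousOnInterval Y τ₀ τ₁ := acp.fun_mul acM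
  set G : ℝ → ℝ := fun v => (j + 1) * (v - τ₀) ^ j * M v + (v - τ₀) ^ (j + 1) * h v + κ * Y v with hG
  have hd : ∀ᵐ v, v ∈ Set.uIcc τ₀ τ₁ → deriv Y v = G v - κ * Y v := by
    filter_upwards [hint.ae_hasDerivAt_integral] with v hv hmem
    have h1 : HasDerivAt M (h v) v := (hv hmem τ₀ Set.left_mem_uIcc).const_add m₀
    have h2 : HasDerivAt (fun v : ℝ => (v - τ₀) ^ (j + 1)) ((j + 1) * (v - τ₀) ^ j) v := by
      have := ((hasDerivAt_id v).sub_const τ₀).fun_pow (j + 1)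
      simpa using this
    rw [hY, (h2.fun_mul h1).deriv]
    simp only [hG]
    ring
  have cM := acM.continuousOn
  have cY := acY.continuousOn
  have iY2 : IntervalIntegrable (fun v => Y v ^ 2) volume τ₀ τ₁ := (cY.pow 2).intervalIntegrable
  have iG2 : IntervalIntegrable (fun v => G v ^ 2) volume τ₀ τ₁ := by
    have cA : ContinuousOn (fun v => (j + 1) * (v - τ₀) ^ j * M v + κ * Y v) (Set.uIcc τ₀ τ₁) :=
      (ContinuousOn.mul (by fun_prop) cM).add (cY.const_smul κ)
    have e : (fun v => G v ^ 2) = fun v => ((j + 1) * (v - τ₀) ^ j * M v + κ * Y v) ^ 2 +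
        (2 * ((j + 1) * (v - τ₀) ^ j * M v + κ * Y v) * (v - τ₀) ^ (j + 1)) * h v +
        ((v - τ₀) ^ (j + 1)) ^ 2 * h v ^ 2 := by
      funext v; simp only [hG]; ring
    rw [e]
    refine ((cA.pow 2).intervalIntegrable.add (hint.continuousOn_mul ?_)).add
      (hint2.continuousOn_mul (by fun_prop))
    exact (continuousOn_const.mul cA).mul (by fun_prop)
  have key := acY.integral_deriv_mul_eq_sub acY
  have hY0 : Y τ₀ = 0 := by simp [hY]
  have hle : ∫ v in τ₀..τ₁, (deriv Y v * Y v + Y v * deriv Y v) ≤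
      ∫ v in τ₀..τ₁, (κ⁻¹ * G v ^ 2 - κ * Y v ^ 2) := by
    refine intervalIntegral.integral_mono_ae_restrict h01 ?_ ((iG2.const_mul _).sub (iY2.const_mul _)) ?_
    · exact (acY.intervalIntegrable_deriv.mul_continuousOn cY).add
        (acY.intervalIntegrable_deriv.continuousOn_mul cY)
    · have hd' := (ae_restrict_iff' (μ := volume) (measurableSet_Icc (a := τ₀) (b := τ₁))).2
        (by simpa [Set.uIcc_of_le h01] using hd)
      filter_upwards [hd'] with v hv
      rw [hv]
      have : 0 ≤ κ⁻¹ * (G v - κ * Y v) ^ 2 := by positivity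
      have e : κ⁻¹ * (G v - κ * Y v) ^ 2 = κ⁻¹ * G v ^ 2 - 2 * G v * Y v + κ * Y v ^ 2 := by
        field_simp
        ring
      linarith
  rw [key, hY0, mul_zero, sub_zero, intervalIntegral.integral_sub (iG2.const_mul _)
    (iY2.const_mul _), intervalIntegral.integral_const_mul, intervalIntegral.integral_const_mul]
    at hle
  have hfin : ∫ v in τ₀..τ₁, Y v ^ 2 ≤ (κ ^ 2)⁻¹ * ∫ v in τ₀..τ₁, G v ^ 2 := by
    have h1 : κ * ∫ v in τ₀..τ₁, Y v ^ 2 ≤ κ⁻¹ * ∫ v in τ₀..τ₁, G v ^ 2 := by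
      nlinarith [mul_self_nonneg (Y τ₁)]
    have h2 := mul_le_mul_of_nonneg_left h1 (inv_pos.2 hκ).le
    rw [← mul_assoc, inv_mul_cancel₀ hκ.ne', one_mul] at h2
    refine h2.trans (le_of_eq ?_)
    rw [← mul_assoc, sq, mul_inv]
  rw [intervalIntegral.integral_of_le h01, intervalIntegral.integral_of_le h01] at hfin
  have em : ∀ v ∈ Set.Ioc τ₀ τ₁, m v = M v := fun v hv => by
    rw [hm v hv.1.le]
    simp only [hM]
    rw [intervalIntegral.integral_of_le hv.1.le]
  have e1 : ∫ v in Set.Ioc τ₀ τ₁, ((v - τ₀) ^ (j + 1) * m v) ^ 2 =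
      ∫ v in Set.Ioc τ₀ τ₁, Y v ^ 2 :=
    setIntegral_congr_fun measurableSet_Ioc fun v hv => by simp only [em v hv, hY]
  have e2 : ∫ v in Set.Ioc τ₀ τ₁, ((j + 1) * (v - τ₀) ^ j * m v + (v - τ₀) ^ (j + 1) * h v +
      κ * ((v - τ₀) ^ (j + 1) * m v)) ^ 2 = ∫ v in Set.Ioc τ₀ τ₁, G v ^ 2 :=
    setIntegral_congr_fun measurableSet_Ioc fun v hv => by simp only [em v hv, hY, hG]
  rw [e1, e2]
  exact hfin

end EnergyODE

section TrigTest

variable {n : ℕ}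

theorem contDiff_dotProduct_left (ξ : Fin n → ℝ) {k : WithTop ℕ∞} :
    ContDiff ℝ k fun x : Fin n → ℝ => ξ ⬝ᵥ x := by
  unfold dotProduct
  fun_prop

theorem contDiff_cos_wave (ξ : Fin n → ℝ) (c : ℝ) {k : WithTop ℕ∞} :
    ContDiff ℝ k fun x : Fin n → ℝ => Real.cos (ξ ⬝ᵥ x + c) :=
  Real.contDiff_cos.comp ((contDiff_dotProduct_left ξ).add contDiff_const)

theorem pderivCoord_mul_cos_wave {χ : (Fin n → ℝ) → ℝ} (hχ : Differentiable ℝ χ) (ξ : Fin n → ℝ)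
    (c : ℝ) (i : Fin n) :
    pderivCoord i (fun x => χ x * Real.cos (ξ ⬝ᵥ x + c)) = fun x =>
      pderivCoord i χ x * Real.cos (ξ ⬝ᵥ x + c) +
        ξ i * (χ x * Real.cos (ξ ⬝ᵥ x + (c + Real.pi / 2))) := by
  funext x
  have hl : HasFDerivAt (fun x : Fin n → ℝ => ξ ⬝ᵥ x + c)
      (∑ j, ξ j • ContinuousLinearMap.proj (R := ℝ) (φ := fun _ : Fin n => ℝ) j) x := by
    refine HasFDerivAt.add_const c ?_
    unfold dotProduct
    exact HasFDerivAt.fun_sum fun j _ => (hasFDerivAt_apply j x).const_mul (ξ j)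
  have h := (hχ x).hasFDerivAt.fun_mul (hl.cos)
  unfold pderivCoord
  rw [h.fderiv, ← add_assoc, Real.cos_add_pi_div_two]
  simp [Pi.single_apply]
  ring

theorem exists_taylorBound_mul_cos_wave {χ : (Fin n → ℝ) → ℝ} (hχ : ContDiff ℝ 3 χ)
    (hs : HasCompactSupport χ) (ξ : Fin n → ℝ) (c : ℝ) :
    ∃ K, TaylorBound (fun x => χ x * Real.cos (ξ ⬝ᵥ x + c)) K :=
  exists_taylorBound (hχ.mul (contDiff_cos_wave ξ c)) hs.mul_right

/-- First order part of the generator applied to an oscillating test function. -/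
noncomputable def waveCoeff₁ (a : ℝ → (Fin n → ℝ) → Matrix (Fin n) (Fin n) ℝ)
    (b : ℝ → (Fin n → ℝ) → (Fin n → ℝ)) (χ : (Fin n → ℝ) → ℝ) (i : Fin n)
    (p : ℝ × (Fin n → ℝ)) : ℝ :=
  b p.1 p.2 i * χ p.2 + 1 / 2 * ∑ j, (a p.1 p.2 i j + a p.1 p.2 j i) * pderivCoord j χ p.2

theorem sum_sum_wave_identity (A D : Fin n → Fin n → ℝ) (d ξ : Fin n → ℝ) (u C₀ C₁ : ℝ) :
    ∑ i, ∑ j, A i j * (D i j * C₀ + (ξ j * d i + ξ i * d j) * C₁ - ξ i * ξ j * (u * C₀)) =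
      C₀ * (∑ i, ∑ j, A i j * D i j) + C₁ * (∑ i, ξ i * ∑ j, (A i j + A j i) * d j) -
        ∑ i, ∑ j, ξ i * ξ j * (A i j * u * C₀) := by
  have s1 : ∑ i, ξ i * ∑ j, (A i j + A j i) * d j =
      ∑ i, ∑ j, A i j * (ξ j * d i + ξ i * d j) := by
    have : ∑ i, ∑ j, A i j * (ξ j * d i) = ∑ i, ∑ j, A j i * (ξ i * d j) := Finset.sum_comm
    simp only [mul_add, Finset.sum_add_distrib, this]
    rw [← Finset.sum_add_distrib]
    refine Finset.sum_congr rfl fun i _ => ?_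
    rw [Finset.mul_sum, ← Finset.sum_add_distrib]
    exact Finset.sum_congr rfl fun j _ => by ring
  rw [s1]
  simp only [Finset.mul_sum, ← Finset.sum_add_distrib, ← Finset.sum_sub_distrib]
  exact Finset.sum_congr rfl fun i _ => Finset.sum_congr rfl fun j _ => by ring

theorem genL_mul_cos_wave (a : ℝ → (Fin n → ℝ) → Matrix (Fin n) (Fin n) ℝ)
    (b : ℝ → (Fin n → ℝ) → (Fin n → ℝ)) {χ : (Fin n → ℝ) → ℝ} (hχ : ContDiff ℝ 3 χ)
    (ξ : Fin n → ℝ) (c : ℝ) (p : ℝ × (Fin n → ℝ)) :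
    genL a b (fun x => χ x * Real.cos (ξ ⬝ᵥ x + c)) p =
      genL a b χ p * Real.cos (ξ ⬝ᵥ p.2 + c) +
      ∑ i, ξ i * (waveCoeff₁ a b χ i p * Real.cos (ξ ⬝ᵥ p.2 + (c + Real.pi / 2))) -
      1 / 2 * ∑ i, ∑ j, ξ i * ξ j * (a p.1 p.2 i j * χ p.2 * Real.cos (ξ ⬝ᵥ p.2 + c)) := by
  have h1 := hχ.differentiable (by norm_num)
  have h2 : ∀ i j, pderivCoord j (pderivCoord i (fun x => χ x * Real.cos (ξ ⬝ᵥ x + c))) p.2 =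
      pderivCoord j (pderivCoord i χ) p.2 * Real.cos (ξ ⬝ᵥ p.2 + c) +
      (ξ j * pderivCoord i χ p.2 + ξ i * pderivCoord j χ p.2) *
        Real.cos (ξ ⬝ᵥ p.2 + (c + Real.pi / 2)) -
      ξ i * ξ j * (χ p.2 * Real.cos (ξ ⬝ᵥ p.2 + c)) := by
    intro i j
    have hd : Differentiable ℝ (pderivCoord i χ) :=
      (hχ.pderivCoord (m := 1) (by norm_num) i).differentiable (by norm_num)
    have e2 : pderivCoord j (fun x => pderivCoord i χ x * Real.cos (ξ ⬝ᵥ x + c) +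
        ξ i * (χ x * Real.cos (ξ ⬝ᵥ x + (c + Real.pi / 2)))) p.2 =
        pderivCoord j (fun x => pderivCoord i χ x * Real.cos (ξ ⬝ᵥ x + c)) p.2 +
        ξ i * pderivCoord j (fun x => χ x * Real.cos (ξ ⬝ᵥ x + (c + Real.pi / 2))) p.2 := by
      have d1 : DifferentiableAt ℝ (fun x => pderivCoord i χ x * Real.cos (ξ ⬝ᵥ x + c)) p.2 :=
        (hd.mul ((contDiff_cos_wave (k := 1) ξ c).differentiable (by norm_num))) _
      have d2 : DifferentiableAt ℝ (fun x => χ x * Real.cos (ξ ⬝ᵥ x + (c + Real.pi / 2))) p.2 :=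
        (h1.mul ((contDiff_cos_wave (k := 1) ξ _).differentiable (by norm_num))) _
      unfold pderivCoord at d1 ⊢
      rw [fderiv_fun_add d1 (d2.const_mul _), fderiv_const_mul d2]
      simp
    rw [pderivCoord_mul_cos_wave h1, e2, pderivCoord_mul_cos_wave hd, pderivCoord_mul_cos_wave h1]
    have e3 : Real.cos (ξ ⬝ᵥ p.2 + (c + Real.pi / 2 + Real.pi / 2)) = -Real.cos (ξ ⬝ᵥ p.2 + c) := by
      rw [show ξ ⬝ᵥ p.2 + (c + Real.pi / 2 + Real.pi / 2) = ξ ⬝ᵥ p.2 + c + Real.pi by ring,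
        Real.cos_add_pi]
    simp only [e3]
    ring
  set C0 := Real.cos (ξ ⬝ᵥ p.2 + c)
  set C1 := Real.cos (ξ ⬝ᵥ p.2 + (c + Real.pi / 2)) with hC1
  unfold genL
  simp only [h2]
  simp only [pderivCoord_mul_cos_wave h1]
  unfold waveCoeff₁
  rw [sum_sum_wave_identity (fun i j => a p.1 p.2 i j)
    (fun i j => pderivCoord j (pderivCoord i χ) p.2) (fun i => pderivCoord i χ p.2) ξ]
  have s2 : ∑ i, ξ i * ((b p.1 p.2 i * χ p.2 + 1 / 2 * ∑ j, (a p.1 p.2 i j + a p.1 p.2 j i) *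
      pderivCoord j χ p.2) * C1) = C1 * ∑ i, ξ i * (b p.1 p.2 i * χ p.2) + 1 / 2 * C1 *
      ∑ i, ξ i * ∑ j, (a p.1 p.2 i j + a p.1 p.2 j i) * pderivCoord j χ p.2 := by
    rw [Finset.mul_sum, Finset.mul_sum, ← Finset.sum_add_distrib]
    exact Finset.sum_congr rfl fun i _ => by ring
  have s3 : ∑ i, b p.1 p.2 i * (pderivCoord i χ p.2 * C0 + ξ i * (χ p.2 * C1)) =
      C0 * ∑ i, b p.1 p.2 i * pderivCoord i χ p.2 + C1 * ∑ i, ξ i * (b p.1 p.2 i * χ p.2) := by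
    rw [Finset.mul_sum, Finset.mul_sum, ← Finset.sum_add_distrib]
    exact Finset.sum_congr rfl fun i _ => by ring
  rw [s2, s3]
  ring

end TrigTest

section PathFourier

open scoped ENNReal NNReal

variable {n : ℕ} [MeasurableSpace (PathSp n)] [BorelSpace (PathSp n)]
  {P : Measure (PathSp n)} [IsProbabilityMeasure P] {H H' : ℝ × (Fin n → ℝ) → ℝ} {M : ℝ}

/-- Trigonometric integrals along the canonical process. -/
noncomputable def pathTrig (P : Measure (PathSp n)) (H : ℝ × (Fin n → ℝ) → ℝ) (ξ : Fin n → ℝ)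
    (c v : ℝ) : ℝ :=
  trigInt P (Xcan n v) (fun ω => H (v, Xcan n v ω)) ξ c

/-- Squared Fourier transform of the weighted law of the canonical process. -/
noncomputable def pathFsq (P : Measure (PathSp n)) (H : ℝ × (Fin n → ℝ) → ℝ) (ξ : Fin n → ℝ)
    (v : ℝ) : ℝ :=
  fourierSq P (Xcan n v) (fun ω => H (v, Xcan n v ω)) ξ

omit [BorelSpace (PathSp n)] [IsProbabilityMeasure P] in
theorem pathFsq_eq (ξ : Fin n → ℝ) (v : ℝ) :
    pathFsq P H ξ v = pathTrig P H ξ 0 v ^ 2 + pathTrig P H ξ (Real.pi / 2) v ^ 2 := rfl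

theorem measurable_section_path (hH : Measurable H) (v : ℝ) :
    Measurable fun ω => H (v, Xcan n v ω) :=
  hH.comp (measurable_const.prodMk (measurable_Xcan v))

theorem integrable_pathTrig (hH : Measurable H) {v : ℝ} (hM : ∀ x, |H (v, x)| ≤ M)
    (ξ : Fin n → ℝ) (c : ℝ) :
    Integrable (fun ω => H (v, Xcan n v ω) * Real.cos (ξ ⬝ᵥ Xcan n v ω + c)) P := by
  refine Integrable.of_bound ((measurable_section_path hH v).mul (Real.measurable_cos.comp
    ((measurable_dotProduct_left (measurable_Xcan v) ξ).add_const c))).aestronglyMeasurable M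
    (Eventually.of_forall fun ω => ?_)
  rw [Real.norm_eq_abs, abs_mul]
  exact (mul_le_of_le_one_right (abs_nonneg _) (Real.abs_cos_le_one _)).trans (hM _)

omit [BorelSpace (PathSp n)] in
theorem abs_pathTrig_le {v : ℝ} (hM : ∀ x, |H (v, x)| ≤ M) (ξ : Fin n → ℝ) (c : ℝ) :
    |pathTrig P H ξ c v| ≤ M := by
  have := norm_integral_le_of_norm_le_const (μ := P) (C := M)
    (f := fun ω => H (v, Xcan n v ω) * Real.cos (ξ ⬝ᵥ Xcan n v ω + c))
    (Eventually.of_forall fun ω => by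
      rw [Real.norm_eq_abs, abs_mul]
      exact (mul_le_of_le_one_right (abs_nonneg _) (Real.abs_cos_le_one _)).trans (hM _))
  rw [probReal_univ, mul_one] at this
  exact this

omit [BorelSpace (PathSp n)] [IsProbabilityMeasure P] in
theorem pathFsq_nonneg (ξ : Fin n → ℝ) (v : ℝ) : 0 ≤ pathFsq P H ξ v := fourierSq_nonneg ξ

omit [BorelSpace (PathSp n)] in
theorem pathFsq_le {v : ℝ} (hM : ∀ x, |H (v, x)| ≤ M) (ξ : Fin n → ℝ) :
    pathFsq P H ξ v ≤ 2 * M ^ 2 := by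
  have h1 := sq_le_sq' (abs_le.1 (abs_pathTrig_le (P := P) hM ξ 0)).1
    (abs_le.1 (abs_pathTrig_le (P := P) hM ξ 0)).2
  have h2 := sq_le_sq' (abs_le.1 (abs_pathTrig_le (P := P) hM ξ (Real.pi / 2))).1
    (abs_le.1 (abs_pathTrig_le (P := P) hM ξ (Real.pi / 2))).2
  rw [pathFsq_eq]
  linarith

theorem measurable_pathTrig (hH : Measurable H) (c : ℝ) :
    Measurable fun p : (Fin n → ℝ) × ℝ => pathTrig P H p.1 c p.2 := by
  have hX : Measurable fun q : ((Fin n → ℝ) × ℝ) × PathSp n => Xcan n q.1.2 q.2 :=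
    measurable_Xcan_uncurry.comp ((measurable_snd.comp measurable_fst).prodMk measurable_snd)
  have : Measurable fun q : ((Fin n → ℝ) × ℝ) × PathSp n =>
      H (q.1.2, Xcan n q.1.2 q.2) * Real.cos (q.1.1 ⬝ᵥ Xcan n q.1.2 q.2 + c) :=
    (hH.comp ((measurable_snd.comp measurable_fst).prodMk hX)).mul (Real.measurable_cos.comp
      ((measurable_dotProduct_pair.comp ((measurable_fst.comp measurable_fst).prodMk hX)).add_const
        c))
  exact (this.stronglyMeasurable.integral_prod_right (ν := P)).measurable

theorem measurable_pathFsq (hH : Measurable H) :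
    Measurable fun p : (Fin n → ℝ) × ℝ => pathFsq P H p.1 p.2 :=
  ((measurable_pathTrig hH 0).pow_const 2).add ((measurable_pathTrig hH _).pow_const 2)

theorem integrableOn_pathFsq (hH : Measurable H) {τ₀ τ₁ : ℝ}
    (hM : ∀ v ∈ Set.Ioc τ₀ τ₁, ∀ x, |H (v, x)| ≤ M) (ξ : Fin n → ℝ) :
    IntegrableOn (pathFsq P H ξ) (Set.Ioc τ₀ τ₁) := by
  refine Measure.integrableOn_of_bounded (M := 2 * M ^ 2) (by simp)
    ((measurable_pathFsq hH).comp measurable_prodMk_left).aestronglyMeasurable ?_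
  refine (ae_restrict_iff' measurableSet_Ioc).2 (Eventually.of_forall fun v hv => ?_)
  rw [Real.norm_eq_abs, abs_of_nonneg (pathFsq_nonneg _ _)]
  exact pathFsq_le (hM v hv) ξ

omit [BorelSpace (PathSp n)] [IsProbabilityMeasure P] in
theorem pathTrig_const_mul (s : ℝ → ℝ) (ξ : Fin n → ℝ) (c v : ℝ) :
    pathTrig P (fun p => s p.1 * H p) ξ c v = s v * pathTrig P H ξ c v := by
  unfold pathTrig trigInt
  rw [← integral_const_mul]
  exact integral_congr_ae (Eventually.of_forall fun ω => by ring)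

omit [BorelSpace (PathSp n)] [IsProbabilityMeasure P] in
theorem pathTrig_add_pi (ξ : Fin n → ℝ) (c v : ℝ) :
    pathTrig P H ξ (c + Real.pi) v = -pathTrig P H ξ c v := by
  unfold pathTrig trigInt
  rw [← integral_neg]
  refine integral_congr_ae (Eventually.of_forall fun ω => ?_)
  simp only [← add_assoc, Real.cos_add_pi]
  ring

/-- The weighted Fourier energy on a time interval. -/
noncomputable def fourierEnergy (P : Measure (PathSp n)) (τ₀ τ₁ : ℝ) (k : ℕ) (r : ℝ)
    (H : ℝ × (Fin n → ℝ) → ℝ) : ℝ≥0∞ :=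
  ∫⁻ v in Set.Ioc τ₀ τ₁, ∫⁻ ξ, ENNReal.ofReal (freqWt k r ξ * pathFsq P H ξ v)

theorem lintegral_freqWt_pathFsq (hH : Measurable H) {v : ℝ} (hM : ∀ x, |H (v, x)| ≤ M) (k : ℕ)
    {r : ℝ} (hr : 0 < r) :
    ∫⁻ ξ, ENNReal.ofReal (freqWt k r ξ * pathFsq P H ξ v) =
      ENNReal.ofReal (∫ ξ, freqWt k r ξ * pathFsq P H ξ v) := by
  rw [ofReal_integral_eq_lintegral_ofReal]
  · refine ((integrable_freqWt k hr).mul_const (2 * M ^ 2)).mono'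
      (((measurable_freqWt k).comp measurable_prodMk_left).mul ((measurable_pathFsq hH).comp
        measurable_prodMk_right)).aestronglyMeasurable (Eventually.of_forall fun ξ => ?_)
    rw [Real.norm_eq_abs, abs_of_nonneg (mul_nonneg (freqWt_nonneg _ _ _) (pathFsq_nonneg _ _))]
    exact mul_le_mul_of_nonneg_left (pathFsq_le hM ξ) (freqWt_nonneg _ _ _)
  · exact Eventually.of_forall fun ξ => mul_nonneg (freqWt_nonneg _ _ _) (pathFsq_nonneg _ _)

theorem fourierEnergy_mono (hH : Measurable H) (hH' : Measurable H') {τ₀ τ₁ : ℝ}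
    (hM : ∀ v ∈ Set.Ioc τ₀ τ₁, ∀ x, H' (v, x) ≤ M)
    (hle : ∀ v ∈ Set.Ioc τ₀ τ₁, ∀ x, |H (v, x)| ≤ H' (v, x)) (k : ℕ) {r : ℝ} (hr : 0 < r) :
    fourierEnergy P τ₀ τ₁ k r H ≤ fourierEnergy P τ₀ τ₁ k r H' := by
  refine setLIntegral_mono' measurableSet_Ioc fun v hv => ?_
  rw [lintegral_freqWt_pathFsq hH (fun x => (hle v hv x).trans (hM v hv x)) k hr,
    lintegral_freqWt_pathFsq hH' (fun x => ?_) k hr]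
  · exact ENNReal.ofReal_le_ofReal (integral_freqWt_fourierSq_mono (measurable_Xcan v)
      (measurable_section_path hH v) (measurable_section_path hH' v) (fun ω => hM v hv _)
      (fun ω => hle v hv _) k hr)
  · exact M
  · rw [abs_of_nonneg ((abs_nonneg _).trans (hle v hv x))]
    exact hM v hv x

omit [BorelSpace (PathSp n)] [IsProbabilityMeasure P] in
theorem fourierEnergy_const_mul (C : ℝ) (τ₀ τ₁ : ℝ) (k : ℕ) (r : ℝ) :
    fourierEnergy P τ₀ τ₁ k r (fun p => C * H p) =
      ENNReal.ofReal (C ^ 2) * fourierEnergy P τ₀ τ₁ k r H := by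
  unfold fourierEnergy
  rw [← lintegral_const_mul' _ _ ENNReal.ofReal_ne_top]
  refine lintegral_congr fun v => ?_
  rw [← lintegral_const_mul' _ _ ENNReal.ofReal_ne_top]
  refine lintegral_congr fun ξ => ?_
  rw [← ENNReal.ofReal_mul (sq_nonneg C)]
  congr 1
  have h := fun c => pathTrig_const_mul (P := P) (H := H) (fun _ => C) ξ c v
  rw [pathFsq_eq, pathFsq_eq, h, h]
  ring

theorem fourierEnergy_eq_swap (hH : Measurable H) (τ₀ τ₁ : ℝ) (k : ℕ) (r : ℝ) :
    fourierEnergy P τ₀ τ₁ k r H =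
      ∫⁻ ξ, ∫⁻ v in Set.Ioc τ₀ τ₁, ENNReal.ofReal (freqWt k r ξ * pathFsq P H ξ v) := by
  unfold fourierEnergy
  refine lintegral_lintegral_swap (Measurable.aemeasurable ?_)
  exact ENNReal.measurable_ofReal.comp ((((measurable_freqWt k).comp measurable_prodMk_left).comp
    measurable_snd).mul ((measurable_pathFsq hH).comp measurable_swap))

omit [BorelSpace (PathSp n)] in
theorem fourierEnergy_le {τ₀ τ₁ : ℝ}
    (hM : ∀ v ∈ Set.Ioc τ₀ τ₁, ∀ x, |H (v, x)| ≤ M) (k : ℕ) {r : ℝ} {J : ℝ≥0∞}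
    (hw : ∫⁻ ξ : Fin n → ℝ, ENNReal.ofReal (freqWt k r ξ) ≤ J) :
    fourierEnergy P τ₀ τ₁ k r H ≤ J * ENNReal.ofReal (2 * M ^ 2) * ENNReal.ofReal (τ₁ - τ₀) := by
  calc fourierEnergy P τ₀ τ₁ k r H
      ≤ ∫⁻ v in Set.Ioc τ₀ τ₁, J * ENNReal.ofReal (2 * M ^ 2) := by
        refine setLIntegral_mono' measurableSet_Ioc fun v hv => ?_
        calc _ ≤ ∫⁻ ξ : Fin n → ℝ, ENNReal.ofReal (freqWt k r ξ) * ENNReal.ofReal (2 * M ^ 2) := by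
              refine lintegral_mono fun ξ => ?_
              rw [← ENNReal.ofReal_mul (freqWt_nonneg _ _ _)]
              exact ENNReal.ofReal_le_ofReal
                (mul_le_mul_of_nonneg_left (pathFsq_le (hM v hv) ξ) (freqWt_nonneg _ _ _))
          _ ≤ _ := by
              rw [lintegral_mul_const' _ _ ENNReal.ofReal_ne_top]
              gcongr
    _ = _ := by rw [setLIntegral_const, Real.volume_Ioc]

end PathFourier

section WaveEnergy

open scoped ENNReal NNReal

variable {n : ℕ}

theorem sq_wave_sum_le (t₀ : ℝ) (t₁ : Fin n → ℝ) (t₂ : Fin n → Fin n → ℝ) (ξ : Fin n → ℝ) :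
    (t₀ + ∑ i, ξ i * t₁ i + 1 / 2 * ∑ i, ∑ j, ξ i * ξ j * t₂ i j) ^ 2 ≤
      3 * (t₀ ^ 2 + (ξ ⬝ᵥ ξ) * ∑ i, t₁ i ^ 2 +
        (ξ ⬝ᵥ ξ) ^ 2 / 4 * ∑ i, ∑ j, t₂ i j ^ 2) := by
  have hq : ξ ⬝ᵥ ξ = ∑ i, ξ i ^ 2 := Finset.sum_congr rfl fun i _ => (sq _).symm
  have hq0 : 0 ≤ ξ ⬝ᵥ ξ := dotProduct_self_nonneg_real ξ
  have h1 : (∑ i, ξ i * t₁ i) ^ 2 ≤ (ξ ⬝ᵥ ξ) * ∑ i, t₁ i ^ 2 := by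
    rw [hq]; exact Finset.sum_mul_sq_le_sq_mul_sq _ _ _
  have h2 : (∑ i, ∑ j, ξ i * ξ j * t₂ i j) ^ 2 ≤ (ξ ⬝ᵥ ξ) ^ 2 * ∑ i, ∑ j, t₂ i j ^ 2 := by
    have e : ∑ i, ∑ j, ξ i * ξ j * t₂ i j = ∑ i, ξ i * ∑ j, ξ j * t₂ i j :=
      Finset.sum_congr rfl fun i _ => by
        rw [Finset.mul_sum]; exact Finset.sum_congr rfl fun j _ => by ring
    rw [e]
    refine (Finset.sum_mul_sq_le_sq_mul_sq _ _ _).trans ?_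
    rw [← hq, sq (ξ ⬝ᵥ ξ), mul_assoc]
    refine mul_le_mul_of_nonneg_left ?_ hq0
    rw [Finset.mul_sum]
    refine Finset.sum_le_sum fun i _ => ?_
    rw [hq]; exact Finset.sum_mul_sq_le_sq_mul_sq _ _ _
  set x := ∑ i, ξ i * t₁ i
  set y := ∑ i, ∑ j, ξ i * ξ j * t₂ i j
  nlinarith [sq_nonneg (t₀ - x), sq_nonneg (t₀ - 1 / 2 * y), sq_nonneg (x - 1 / 2 * y)]

variable {a : ℝ → (Fin n → ℝ) → Matrix (Fin n) (Fin n) ℝ}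
  {b : ℝ → (Fin n → ℝ) → (Fin n → ℝ)} {B : ℝ} {χ : (Fin n → ℝ) → ℝ} {K : ℝ}

theorem BoundedCoeff.measurable_waveCoeff₁ (hc : BoundedCoeff n a b B) (hχ : TaylorBound χ K)
    (i : Fin n) : Measurable (waveCoeff₁ a b χ i) :=
  ((hc.meas_b i).mul (hχ.cont.measurable.comp measurable_snd)).add
    ((Finset.measurable_sum _ fun j _ => ((hc.meas_a i j).add (hc.meas_a j i)).mul
      ((hχ.cont₁ j).measurable.comp measurable_snd)).const_mul _)

theorem BoundedCoeff.abs_waveCoeff₁_le (hc : BoundedCoeff n a b B) (hχ : TaylorBound χ K)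
    (i : Fin n) (p : ℝ × (Fin n → ℝ)) : |waveCoeff₁ a b χ i p| ≤ B * K + n * (B * K) := by
  have hB := hc.nonneg
  have hK := hχ.nonneg
  refine (abs_add_le _ _).trans (add_le_add ?_ ?_)
  · rw [abs_mul]
    exact mul_le_mul (hc.bound_b _ _ _) (hχ.bound _) (abs_nonneg _) hB
  · rw [abs_mul, abs_of_nonneg (by norm_num : (0 : ℝ) ≤ 1 / 2)]
    have : |∑ j, (a p.1 p.2 i j + a p.1 p.2 j i) * pderivCoord j χ p.2| ≤ n * (2 * B * K) := by
      refine (Finset.abs_sum_le_sum_abs _ _).trans ?_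
      refine (Finset.sum_le_card_nsmul _ _ (2 * B * K) fun j _ => ?_).trans (by simp)
      rw [abs_mul]
      refine mul_le_mul ?_ (hχ.bound₁ _ _) (abs_nonneg _) (by positivity)
      refine (abs_add_le _ _).trans ?_
      linarith [hc.bound_a p.1 p.2 i j, hc.bound_a p.1 p.2 j i]
    nlinarith

/-- A cutoff in space, degenerating at the initial time. -/
def timeCut (τ₀ : ℝ) (j : ℕ) (χ : (Fin n → ℝ) → ℝ) (p : ℝ × (Fin n → ℝ)) : ℝ :=
  (p.1 - τ₀) ^ j * χ p.2

/-- Zeroth order source term of the frequency-localised equation. -/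
noncomputable def waveSrc₀ (a : ℝ → (Fin n → ℝ) → Matrix (Fin n) (Fin n) ℝ)
    (b : ℝ → (Fin n → ℝ) → (Fin n → ℝ)) (τ₀ : ℝ) (j : ℕ) (χ : (Fin n → ℝ) → ℝ)
    (p : ℝ × (Fin n → ℝ)) : ℝ :=
  (j + 1) * ((p.1 - τ₀) ^ j * χ p.2) + (p.1 - τ₀) ^ (j + 1) * (genL a b χ p + χ p.2)

/-- First order source term of the frequency-localised equation. -/
noncomputable def waveSrc₁ (a : ℝ → (Fin n → ℝ) → Matrix (Fin n) (Fin n) ℝ)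
    (b : ℝ → (Fin n → ℝ) → (Fin n → ℝ)) (τ₀ : ℝ) (j : ℕ) (χ : (Fin n → ℝ) → ℝ) (i : Fin n)
    (p : ℝ × (Fin n → ℝ)) : ℝ :=
  (p.1 - τ₀) ^ (j + 1) * waveCoeff₁ a b χ i p

/-- Second order source term of the frequency-localised equation. -/
noncomputable def waveSrc₂ (a : ℝ → (Fin n → ℝ) → Matrix (Fin n) (Fin n) ℝ)
    (a₀ : Matrix (Fin n) (Fin n) ℝ) (τ₀ : ℝ) (j : ℕ) (χ : (Fin n → ℝ) → ℝ) (i i' : Fin n)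
    (p : ℝ × (Fin n → ℝ)) : ℝ :=
  (p.1 - τ₀) ^ (j + 1) * ((a₀ i i' - a p.1 p.2 i i') * χ p.2)

theorem measurable_timePow (τ₀ : ℝ) (j : ℕ) :
    Measurable fun p : ℝ × (Fin n → ℝ) => (p.1 - τ₀) ^ j :=
  (measurable_fst.sub_const τ₀).pow_const j

theorem measurable_timeCut (hχ : Continuous χ) (τ₀ : ℝ) (j : ℕ) : Measurable (timeCut τ₀ j χ) :=
  (measurable_timePow τ₀ j).mul (hχ.measurable.comp measurable_snd)

theorem BoundedCoeff.measurable_waveSrc₀ (hc : BoundedCoeff n a b B) (hχ : TaylorBound χ K)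
    (τ₀ : ℝ) (j : ℕ) : Measurable (waveSrc₀ a b τ₀ j χ) :=
  ((measurable_timeCut hχ.cont τ₀ j).const_mul _).add ((measurable_timePow τ₀ (j + 1)).mul
    ((hc.measurable_genL hχ).add (hχ.cont.measurable.comp measurable_snd)))

theorem BoundedCoeff.measurable_waveSrc₁ (hc : BoundedCoeff n a b B) (hχ : TaylorBound χ K)
    (τ₀ : ℝ) (j : ℕ) (i : Fin n) : Measurable (waveSrc₁ a b τ₀ j χ i) :=
  (measurable_timePow τ₀ (j + 1)).mul (hc.measurable_waveCoeff₁ hχ i)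

theorem BoundedCoeff.measurable_waveSrc₂ (hc : BoundedCoeff n a b B) (hχ : Continuous χ)
    (a₀ : Matrix (Fin n) (Fin n) ℝ) (τ₀ : ℝ) (j : ℕ) (i i' : Fin n) :
    Measurable (waveSrc₂ a a₀ τ₀ j χ i i') :=
  (measurable_timePow τ₀ (j + 1)).mul (((hc.meas_a i i').const_sub _).mul
    (hχ.measurable.comp measurable_snd))

/-- A crude constant dominating the lower order source terms. -/
noncomputable def waveConst (n : ℕ) (B K : ℝ) (j : ℕ) : ℝ :=
  (j + 2) * K + (n * (B * K) + 1 / 2 * (n * (n * (B * K)))) + (B * K + n * (B * K))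

theorem BoundedCoeff.abs_waveSrc₀_le (hc : BoundedCoeff n a b B) (hχ : TaylorBound χ K)
    (τ₀ : ℝ) (j : ℕ) (p : ℝ × (Fin n → ℝ)) (h0 : 0 ≤ p.1 - τ₀) (h1 : p.1 - τ₀ ≤ 1) :
    |waveSrc₀ a b τ₀ j χ p| ≤ (p.1 - τ₀) ^ j * waveConst n B K j := by
  have hB := hc.nonneg
  have hK := hχ.nonneg
  have hg := hc.abs_genL_le hχ p
  have hx := hχ.bound p.2
  set s := p.1 - τ₀
  have hs : (0 : ℝ) ≤ s ^ j := pow_nonneg h0 j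
  have hw : waveSrc₀ a b τ₀ j χ p =
      s ^ j * ((j + 1) * χ p.2 + s * (genL a b χ p + χ p.2)) := by
    unfold waveSrc₀; ring
  rw [hw, abs_mul, abs_of_nonneg hs]
  refine mul_le_mul_of_nonneg_left ?_ hs
  have h2 : |s * (genL a b χ p + χ p.2)| ≤ |genL a b χ p| + |χ p.2| := by
    rw [abs_mul, abs_of_nonneg h0]
    exact (mul_le_of_le_one_left (abs_nonneg _) h1).trans (abs_add_le _ _)
  have h3 : |((j : ℝ) + 1) * χ p.2| ≤ (j + 1) * K := by
    rw [abs_mul, abs_of_nonneg (by positivity : (0 : ℝ) ≤ j + 1)]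
    gcongr
  have h4 : 0 ≤ B * K + n * (B * K) := by positivity
  unfold waveConst
  linarith [abs_add_le (((j : ℝ) + 1) * χ p.2) (s * (genL a b χ p + χ p.2))]

theorem BoundedCoeff.abs_waveSrc₁_le (hc : BoundedCoeff n a b B) (hχ : TaylorBound χ K)
    (τ₀ : ℝ) (j : ℕ) (i : Fin n) (p : ℝ × (Fin n → ℝ)) (h0 : 0 ≤ p.1 - τ₀) (h1 : p.1 - τ₀ ≤ 1) :
    |waveSrc₁ a b τ₀ j χ i p| ≤ (p.1 - τ₀) ^ j * waveConst n B K j := by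
  have hB := hc.nonneg
  have hK := hχ.nonneg
  have hs : (0 : ℝ) ≤ (p.1 - τ₀) ^ j := pow_nonneg h0 j
  unfold waveSrc₁
  rw [pow_succ, mul_assoc, abs_mul, abs_of_nonneg hs]
  refine mul_le_mul_of_nonneg_left ?_ hs
  rw [abs_mul, abs_of_nonneg h0]
  refine (mul_le_of_le_one_left (abs_nonneg _) h1).trans
    ((hc.abs_waveCoeff₁_le hχ i p).trans ?_)
  have h4 : (0 : ℝ) ≤ (j + 2) * K + (n * (B * K) + 1 / 2 * (n * (n * (B * K)))) := by positivity
  unfold waveConst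
  linarith

variable [MeasurableSpace (PathSp n)] [BorelSpace (PathSp n)]
  {P : Measure (PathSp n)} [IsProbabilityMeasure P] {τ₀ τ₁ : ℝ} {a₀ : Matrix (Fin n) (Fin n) ℝ}

omit [BorelSpace (PathSp n)] [IsProbabilityMeasure P] in
theorem pathTrig_timeCut (ξ : Fin n → ℝ) (c v : ℝ) (j : ℕ) :
    pathTrig P (timeCut τ₀ j χ) ξ c v =
      (v - τ₀) ^ j * ∫ ω, χ (Xcan n v ω) * Real.cos (ξ ⬝ᵥ Xcan n v ω + c) ∂P :=
  pathTrig_const_mul (P := P) (H := fun p => χ p.2) (fun v => (v - τ₀) ^ j) ξ c v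

theorem BoundedCoeff.wave_rhs_eq (hc : BoundedCoeff n a b B) (hχ : ContDiff ℝ 3 χ)
    (hT : TaylorBound χ K) (j : ℕ) (ξ : Fin n → ℝ) (c v : ℝ) (h0 : 0 ≤ v - τ₀) (h1 : v - τ₀ ≤ 1) :
    (j + 1) * (v - τ₀) ^ j * (∫ ω, χ (Xcan n v ω) * Real.cos (ξ ⬝ᵥ Xcan n v ω + c) ∂P) +
      (v - τ₀) ^ (j + 1) *
        (∫ ω, genL a b (fun x => χ x * Real.cos (ξ ⬝ᵥ x + c)) (v, Xcan n v ω) ∂P) +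
      (1 / 2 * (∑ i, ∑ i', ξ i * ξ i' * a₀ i i') + 1) * ((v - τ₀) ^ (j + 1) *
        ∫ ω, χ (Xcan n v ω) * Real.cos (ξ ⬝ᵥ Xcan n v ω + c) ∂P) =
    pathTrig P (waveSrc₀ a b τ₀ j χ) ξ c v +
      ∑ i, ξ i * pathTrig P (waveSrc₁ a b τ₀ j χ i) ξ (c + Real.pi / 2) v +
      1 / 2 * ∑ i, ∑ i', ξ i * ξ i' * pathTrig P (waveSrc₂ a a₀ τ₀ j χ i i') ξ c v := by
  have hB := hc.nonneg
  have hK := hT.nonneg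
  have iχ : Integrable (fun ω => χ (Xcan n v ω) * Real.cos (ξ ⬝ᵥ Xcan n v ω + c)) P :=
    integrable_pathTrig (H := fun p => χ p.2) (hT.cont.measurable.comp measurable_snd)
      (fun x => hT.bound x) ξ c
  have i0 : Integrable (fun ω => waveSrc₀ a b τ₀ j χ (v, Xcan n v ω) *
      Real.cos (ξ ⬝ᵥ Xcan n v ω + c)) P :=
    integrable_pathTrig (M := (v - τ₀) ^ j * waveConst n B K j) (hc.measurable_waveSrc₀ hT τ₀ j)
      (fun x => hc.abs_waveSrc₀_le hT τ₀ j (v, x) h0 h1) ξ c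
  have i1 : ∀ i, Integrable (fun ω => waveSrc₁ a b τ₀ j χ i (v, Xcan n v ω) *
      Real.cos (ξ ⬝ᵥ Xcan n v ω + (c + Real.pi / 2))) P := fun i =>
    integrable_pathTrig (M := (v - τ₀) ^ j * waveConst n B K j) (hc.measurable_waveSrc₁ hT τ₀ j i)
      (fun x => hc.abs_waveSrc₁_le hT τ₀ j i (v, x) h0 h1) ξ _
  have i2 : ∀ i i', Integrable (fun ω => waveSrc₂ a a₀ τ₀ j χ i i' (v, Xcan n v ω) *
      Real.cos (ξ ⬝ᵥ Xcan n v ω + c)) P := fun i i' =>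
    integrable_pathTrig (M := (v - τ₀) ^ (j + 1) * ((|a₀ i i'| + B) * K))
      (hc.measurable_waveSrc₂ hT.cont a₀ τ₀ j i i')
      (fun x => by
        unfold waveSrc₂
        rw [abs_mul, abs_mul, abs_of_nonneg (pow_nonneg h0 (j + 1))]
        gcongr
        · exact (abs_sub _ _).trans (add_le_add le_rfl (hc.bound_a _ _ _ _))
        · exact hT.bound x) ξ c
  have hpt : ∀ ω, genL a b (fun x => χ x * Real.cos (ξ ⬝ᵥ x + c)) (v, Xcan n v ω) *
      (v - τ₀) ^ (j + 1) =
      (waveSrc₀ a b τ₀ j χ (v, Xcan n v ω) * Real.cos (ξ ⬝ᵥ Xcan n v ω + c) +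
      ∑ i, ξ i * (waveSrc₁ a b τ₀ j χ i (v, Xcan n v ω) *
        Real.cos (ξ ⬝ᵥ Xcan n v ω + (c + Real.pi / 2))) +
      1 / 2 * ∑ i, ∑ i', ξ i * ξ i' * (waveSrc₂ a a₀ τ₀ j χ i i' (v, Xcan n v ω) *
        Real.cos (ξ ⬝ᵥ Xcan n v ω + c))) -
      ((j + 1) * (v - τ₀) ^ j + (1 / 2 * (∑ i, ∑ i', ξ i * ξ i' * a₀ i i') + 1) *
        (v - τ₀) ^ (j + 1)) * (χ (Xcan n v ω) * Real.cos (ξ ⬝ᵥ Xcan n v ω + c)) := by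
    intro ω
    rw [genL_mul_cos_wave a b hχ]
    unfold waveSrc₀ waveSrc₁ waveSrc₂
    set C0 := Real.cos (ξ ⬝ᵥ Xcan n v ω + c)
    set C1 := Real.cos (ξ ⬝ᵥ Xcan n v ω + (c + Real.pi / 2))
    set s := (v - τ₀) with hs
    set x := Xcan n v ω
    have e1 : ∑ i, ξ i * (s ^ (j + 1) * waveCoeff₁ a b χ i (v, x) * C1) =
        s ^ (j + 1) * ∑ i, ξ i * (waveCoeff₁ a b χ i (v, x) * C1) := by
      rw [Finset.mul_sum]; exact Finset.sum_congr rfl fun i _ => by ring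
    have e2 : ∑ i, ∑ i', ξ i * ξ i' * (s ^ (j + 1) * ((a₀ i i' - a v x i i') * χ x) * C0) =
        s ^ (j + 1) * χ x * C0 * (∑ i, ∑ i', ξ i * ξ i' * a₀ i i') -
        s ^ (j + 1) * ∑ i, ∑ i', ξ i * ξ i' * (a v x i i' * χ x * C0) := by
      simp only [Finset.mul_sum, ← Finset.sum_sub_distrib]
      exact Finset.sum_congr rfl fun i _ => Finset.sum_congr rfl fun i' _ => by ring
    simp only [e1, e2]
    ring
  have hmain := integral_congr_ae (ae_of_all P hpt)
  have J1 : Integrable (fun ω => ∑ i, ξ i * (waveSrc₁ a b τ₀ j χ i (v, Xcan n v ω) *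
        Real.cos (ξ ⬝ᵥ Xcan n v ω + (c + Real.pi / 2)))) P :=
    integrable_finsetSum _ fun i _ => (i1 i).const_mul _
  have J2i : ∀ i, Integrable (fun ω => ∑ i', ξ i * ξ i' * (waveSrc₂ a a₀ τ₀ j χ i i' (v, Xcan n v ω) *
        Real.cos (ξ ⬝ᵥ Xcan n v ω + c))) P := fun i =>
    integrable_finsetSum _ fun i' _ => (i2 i i').const_mul _
  have J2 : Integrable (fun ω => 1 / 2 * ∑ i, ∑ i', ξ i * ξ i' *
      (waveSrc₂ a a₀ τ₀ j χ i i' (v, Xcan n v ω) * Real.cos (ξ ⬝ᵥ Xcan n v ω + c))) P :=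
    (integrable_finsetSum _ fun i _ => J2i i).const_mul _
  have J01 : Integrable (fun ω => waveSrc₀ a b τ₀ j χ (v, Xcan n v ω) *
      Real.cos (ξ ⬝ᵥ Xcan n v ω + c) + ∑ i, ξ i * (waveSrc₁ a b τ₀ j χ i (v, Xcan n v ω) *
        Real.cos (ξ ⬝ᵥ Xcan n v ω + (c + Real.pi / 2)))) P := i0.add J1
  have J012 : Integrable (fun ω => waveSrc₀ a b τ₀ j χ (v, Xcan n v ω) *
      Real.cos (ξ ⬝ᵥ Xcan n v ω + c) + ∑ i, ξ i * (waveSrc₁ a b τ₀ j χ i (v, Xcan n v ω) *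
        Real.cos (ξ ⬝ᵥ Xcan n v ω + (c + Real.pi / 2))) + 1 / 2 * ∑ i, ∑ i', ξ i * ξ i' *
      (waveSrc₂ a a₀ τ₀ j χ i i' (v, Xcan n v ω) * Real.cos (ξ ⬝ᵥ Xcan n v ω + c))) P :=
    J01.add J2
  rw [integral_mul_const, integral_sub J012 (iχ.const_mul _), integral_add J01 J2,
    integral_add i0 J1, integral_finsetSum _ fun i _ => (i1 i).const_mul _, integral_const_mul,
    integral_finsetSum _ fun i _ => J2i i, integral_const_mul] at hmain
  have e2 : ∀ i, ∫ ω, ∑ i', ξ i * ξ i' * (waveSrc₂ a a₀ τ₀ j χ i i' (v, Xcan n v ω) *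
        Real.cos (ξ ⬝ᵥ Xcan n v ω + c)) ∂P =
      ∑ i', ξ i * ξ i' * pathTrig P (waveSrc₂ a a₀ τ₀ j χ i i') ξ c v := fun i => by
    rw [integral_finsetSum _ fun i' _ => (i2 i i').const_mul _]
    exact Finset.sum_congr rfl fun i' _ => integral_const_mul _ _
  simp only [e2, integral_const_mul] at hmain
  simp only [pathTrig, trigInt] at hmain ⊢
  linear_combination hmain

end WaveEnergy

section WaveEnergyStep

open scoped ENNReal NNReal

variable {n : ℕ} {a : ℝ → (Fin n → ℝ) → Matrix (Fin n) (Fin n) ℝ}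
  {b : ℝ → (Fin n → ℝ) → (Fin n → ℝ)} {B : ℝ} {χ : (Fin n → ℝ) → ℝ} {K : ℝ}
  [MeasurableSpace (PathSp n)] [BorelSpace (PathSp n)]
  {P : Measure (PathSp n)} [IsProbabilityMeasure P] {τ₀ τ₁ : ℝ} {a₀ : Matrix (Fin n) (Fin n) ℝ}

theorem integrableOn_sq_pathTrig {H : ℝ × (Fin n → ℝ) → ℝ} {M : ℝ} (hH : Measurable H)
    (hM : ∀ v ∈ Set.Ioc τ₀ τ₁, ∀ x, |H (v, x)| ≤ M) (ξ : Fin n → ℝ) (c : ℝ) :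
    IntegrableOn (fun v => pathTrig P H ξ c v ^ 2) (Set.Ioc τ₀ τ₁) := by
  refine Measure.integrableOn_of_bounded (M := M ^ 2) (by simp)
    (((measurable_pathTrig hH c).comp measurable_prodMk_left).pow_const 2).aestronglyMeasurable ?_
  refine (ae_restrict_iff' measurableSet_Ioc).2 (Eventually.of_forall fun v hv => ?_)
  rw [Real.norm_eq_abs, abs_of_nonneg (sq_nonneg _)]
  have := abs_le.1 (abs_pathTrig_le (P := P) (hM v hv) ξ c)
  exact sq_le_sq' this.1 this.2

omit [MeasurableSpace (PathSp n)] [BorelSpace (PathSp n)] in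
theorem BoundedCoeff.abs_waveSrc₂_le (hc : BoundedCoeff n a b B) (hχ : TaylorBound χ K)
    (a₀ : Matrix (Fin n) (Fin n) ℝ)
    (τ₀ : ℝ) (j : ℕ) (i i' : Fin n) (p : ℝ × (Fin n → ℝ)) (h0 : 0 ≤ p.1 - τ₀)
    (h1 : p.1 - τ₀ ≤ 1) :
    |waveSrc₂ a a₀ τ₀ j χ i i' p| ≤ (|a₀ i i'| + B) * K := by
  have hB := hc.nonneg
  have hK := hχ.nonneg
  unfold waveSrc₂
  rw [abs_mul, abs_of_nonneg (pow_nonneg h0 (j + 1))]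
  refine (mul_le_of_le_one_left (abs_nonneg _) (pow_le_one₀ h0 h1)).trans ?_
  rw [abs_mul]
  gcongr
  · exact (abs_sub _ _).trans (add_le_add le_rfl (hc.bound_a _ _ _ _))
  · exact hχ.bound _

omit [MeasurableSpace (PathSp n)] [BorelSpace (PathSp n)] in
theorem waveConst_nonneg (hB : 0 ≤ B) (hK : 0 ≤ K) (j : ℕ) : 0 ≤ waveConst n B K j := by
  unfold waveConst
  positivity

omit [MeasurableSpace (PathSp n)] [BorelSpace (PathSp n)] in
theorem pow_mul_le_self_of_le_one {s w : ℝ} (h0 : 0 ≤ s) (h1 : s ≤ 1) (hw : 0 ≤ w) (j : ℕ) :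
    s ^ j * w ≤ w :=
  mul_le_of_le_one_left hw (pow_le_one₀ h0 h1)

/-- The energy inequality for a single frequency and phase. -/
theorem ExpMart.integral_sq_pathTrig_le (h : ExpMart a b τ₀ P) (hτ : 0 ≤ τ₀)
    (hc : BoundedCoeff n a b B) (hsym : ∀ u x, (a u x).IsSymm) (hχ : ContDiff ℝ 3 χ)
    (hs : HasCompactSupport χ) (hT : TaylorBound χ K) (h01 : τ₀ ≤ τ₁) (h11 : τ₁ ≤ τ₀ + 1) (j : ℕ)
    (ξ : Fin n → ℝ) {κ : ℝ} (hκ : κ = 1 / 2 * (∑ i, ∑ i', ξ i * ξ i' * a₀ i i') + 1)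
    (hκ0 : 0 < κ) (c : ℝ) :
    ∫ v in Set.Ioc τ₀ τ₁, pathTrig P (timeCut τ₀ (j + 1) χ) ξ c v ^ 2 ≤ (κ ^ 2)⁻¹ * (3 *
      ∫ v in Set.Ioc τ₀ τ₁, (pathTrig P (waveSrc₀ a b τ₀ j χ) ξ c v ^ 2 +
        (ξ ⬝ᵥ ξ) * ∑ i, pathTrig P (waveSrc₁ a b τ₀ j χ i) ξ (c + Real.pi / 2) v ^ 2 +
        (ξ ⬝ᵥ ξ) ^ 2 / 4 * ∑ i, ∑ i', pathTrig P (waveSrc₂ a a₀ τ₀ j χ i i') ξ c v ^ 2)) := by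
  have hB := hc.nonneg
  have hK := hT.nonneg
  obtain ⟨K', hT'⟩ := exists_taylorBound_mul_cos_wave hχ hs ξ c
  have hv0 : ∀ v ∈ Set.Ioc τ₀ τ₁, 0 ≤ v - τ₀ := fun v hv => by linarith [hv.1]
  have hv1 : ∀ v ∈ Set.Ioc τ₀ τ₁, v - τ₀ ≤ 1 := fun v hv => by linarith [hv.2]
  have hmeas : Measurable fun w => ∫ ω, genL a b (fun x => χ x * Real.cos (ξ ⬝ᵥ x + c))
      (w, Xcan n w ω) ∂P :=
    (StronglyMeasurable.integral_prod_right
      (measurable_pathIntegrand (hc.measurable_genL hT')).stronglyMeasurable).measurable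
  have hbd : ∀ w, |∫ ω, genL a b (fun x => χ x * Real.cos (ξ ⬝ᵥ x + c)) (w, Xcan n w ω) ∂P| ≤
      n * (B * K') + 1 / 2 * (n * (n * (B * K'))) := fun w => by
    have := norm_integral_le_of_norm_le_const (μ := P)
      (f := fun ω => genL a b (fun x => χ x * Real.cos (ξ ⬝ᵥ x + c)) (w, Xcan n w ω))
      (Eventually.of_forall fun ω => hc.abs_genL_le hT' (w, Xcan n w ω))
    rwa [probReal_univ, mul_one] at this
  have key := integral_sq_weighted_le
    (m := fun v => ∫ ω, χ (Xcan n v ω) * Real.cos (ξ ⬝ᵥ Xcan n v ω + c) ∂P) h01 hκ0 j hmeas hbd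
    (fun v hv => by
      have := h.ito hτ hc hsym hT' le_rfl hv
      exact sub_eq_iff_eq_add'.1 this)
  simp only [← pathTrig_timeCut] at key
  refine key.trans ?_
  rw [← integral_const_mul 3]
  have I0 := integrableOn_sq_pathTrig (P := P) (τ₀ := τ₀) (τ₁ := τ₁)
    (M := waveConst n B K j) (hc.measurable_waveSrc₀ hT τ₀ j)
    (fun v hv x => (hc.abs_waveSrc₀_le hT τ₀ j (v, x) (hv0 v hv) (hv1 v hv)).trans
      (pow_mul_le_self_of_le_one (hv0 v hv) (hv1 v hv) (waveConst_nonneg hB hK j) j)) ξ c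
  have I1 := fun i => integrableOn_sq_pathTrig (P := P) (τ₀ := τ₀) (τ₁ := τ₁)
    (M := waveConst n B K j) (hc.measurable_waveSrc₁ hT τ₀ j i)
    (fun v hv x => (hc.abs_waveSrc₁_le hT τ₀ j i (v, x) (hv0 v hv) (hv1 v hv)).trans
      (pow_mul_le_self_of_le_one (hv0 v hv) (hv1 v hv) (waveConst_nonneg hB hK j) j)) ξ
      (c + Real.pi / 2)
  have I2 := fun i i' => integrableOn_sq_pathTrig (P := P) (τ₀ := τ₀) (τ₁ := τ₁)
    (hc.measurable_waveSrc₂ hT.cont a₀ τ₀ j i i')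
    (fun v hv x => hc.abs_waveSrc₂_le hT a₀ τ₀ j i i' (v, x) (hv0 v hv) (hv1 v hv)) ξ c
  have IS : IntegrableOn (fun v => 3 * (pathTrig P (waveSrc₀ a b τ₀ j χ) ξ c v ^ 2 +
        (ξ ⬝ᵥ ξ) * ∑ i, pathTrig P (waveSrc₁ a b τ₀ j χ i) ξ (c + Real.pi / 2) v ^ 2 +
        (ξ ⬝ᵥ ξ) ^ 2 / 4 * ∑ i, ∑ i', pathTrig P (waveSrc₂ a a₀ τ₀ j χ i i') ξ c v ^ 2))
        (Set.Ioc τ₀ τ₁) :=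
    ((I0.add ((integrable_finsetSum _ fun i _ => I1 i).const_mul _)).add
      ((integrable_finsetSum _ fun i _ => integrable_finsetSum _ fun i' _ =>
        I2 i i').const_mul _)).const_mul 3
  refine mul_le_mul_of_nonneg_left ?_ (by positivity)
  refine integral_mono_of_nonneg (Eventually.of_forall fun v => sq_nonneg _) IS ?_
  refine (ae_restrict_iff' measurableSet_Ioc).2 (Eventually.of_forall fun v hv => ?_)
  have e := hc.wave_rhs_eq (P := P) (a₀ := a₀) hχ hT j ξ c v (hv0 v hv) (hv1 v hv)
  simp only [pathTrig_timeCut, hκ]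
  rw [e]
  exact sq_wave_sum_le _ _ _ ξ

/-- The energy inequality for a single frequency. -/
theorem ExpMart.integral_pathFsq_timeCut_le (h : ExpMart a b τ₀ P) (hτ : 0 ≤ τ₀)
    (hc : BoundedCoeff n a b B) (hsym : ∀ u x, (a u x).IsSymm) (hχ : ContDiff ℝ 3 χ)
    (hs : HasCompactSupport χ) (hT : TaylorBound χ K) (h01 : τ₀ ≤ τ₁) (h11 : τ₁ ≤ τ₀ + 1) (j : ℕ)
    (ξ : Fin n → ℝ) {κ : ℝ} (hκ : κ = 1 / 2 * (∑ i, ∑ i', ξ i * ξ i' * a₀ i i') + 1)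
    (hκ0 : 0 < κ) :
    ∫ v in Set.Ioc τ₀ τ₁, pathFsq P (timeCut τ₀ (j + 1) χ) ξ v ≤ (κ ^ 2)⁻¹ * (3 *
      ((∫ v in Set.Ioc τ₀ τ₁, pathFsq P (waveSrc₀ a b τ₀ j χ) ξ v) +
        (ξ ⬝ᵥ ξ) * ∑ i, (∫ v in Set.Ioc τ₀ τ₁, pathFsq P (waveSrc₁ a b τ₀ j χ i) ξ v) +
        (ξ ⬝ᵥ ξ) ^ 2 / 4 * ∑ i, ∑ i', ∫ v in Set.Ioc τ₀ τ₁,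
          pathFsq P (waveSrc₂ a a₀ τ₀ j χ i i') ξ v)) := by
  have hB := hc.nonneg
  have hK := hT.nonneg
  have hv0 : ∀ v ∈ Set.Ioc τ₀ τ₁, 0 ≤ v - τ₀ := fun v hv => by linarith [hv.1]
  have hv1 : ∀ v ∈ Set.Ioc τ₀ τ₁, v - τ₀ ≤ 1 := fun v hv => by linarith [hv.2]
  have I0 := integrableOn_sq_pathTrig (P := P) (τ₀ := τ₀) (τ₁ := τ₁)
    (M := waveConst n B K j) (hc.measurable_waveSrc₀ hT τ₀ j)
    (fun v hv x => (hc.abs_waveSrc₀_le hT τ₀ j (v, x) (hv0 v hv) (hv1 v hv)).trans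
      (pow_mul_le_self_of_le_one (hv0 v hv) (hv1 v hv) (waveConst_nonneg hB hK j) j)) ξ
  have I1 := fun i => integrableOn_sq_pathTrig (P := P) (τ₀ := τ₀) (τ₁ := τ₁)
    (M := waveConst n B K j) (hc.measurable_waveSrc₁ hT τ₀ j i)
    (fun v hv x => (hc.abs_waveSrc₁_le hT τ₀ j i (v, x) (hv0 v hv) (hv1 v hv)).trans
      (pow_mul_le_self_of_le_one (hv0 v hv) (hv1 v hv) (waveConst_nonneg hB hK j) j)) ξ
  have I2 := fun i i' => integrableOn_sq_pathTrig (P := P) (τ₀ := τ₀) (τ₁ := τ₁)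
    (hc.measurable_waveSrc₂ hT.cont a₀ τ₀ j i i')
    (fun v hv x => hc.abs_waveSrc₂_le hT a₀ τ₀ j i i' (v, x) (hv0 v hv) (hv1 v hv)) ξ
  have IT := integrableOn_sq_pathTrig (P := P) (τ₀ := τ₀) (τ₁ := τ₁) (M := K)
    (measurable_timeCut hT.cont τ₀ (j + 1)) (fun v hv x => by
      unfold timeCut
      rw [abs_mul, abs_of_nonneg (pow_nonneg (hv0 v hv) (j + 1))]
      exact (pow_mul_le_self_of_le_one (hv0 v hv) (hv1 v hv) (abs_nonneg _) _).trans
        (hT.bound x)) ξ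
  have split : ∀ c, ∫ v in Set.Ioc τ₀ τ₁, (pathTrig P (waveSrc₀ a b τ₀ j χ) ξ c v ^ 2 +
        (ξ ⬝ᵥ ξ) * ∑ i, pathTrig P (waveSrc₁ a b τ₀ j χ i) ξ (c + Real.pi / 2) v ^ 2 +
        (ξ ⬝ᵥ ξ) ^ 2 / 4 * ∑ i, ∑ i', pathTrig P (waveSrc₂ a a₀ τ₀ j χ i i') ξ c v ^ 2) =
      (∫ v in Set.Ioc τ₀ τ₁, pathTrig P (waveSrc₀ a b τ₀ j χ) ξ c v ^ 2) +
        (ξ ⬝ᵥ ξ) * ∑ i, (∫ v in Set.Ioc τ₀ τ₁,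
          pathTrig P (waveSrc₁ a b τ₀ j χ i) ξ (c + Real.pi / 2) v ^ 2) +
        (ξ ⬝ᵥ ξ) ^ 2 / 4 * ∑ i, ∑ i', ∫ v in Set.Ioc τ₀ τ₁,
          pathTrig P (waveSrc₂ a a₀ τ₀ j χ i i') ξ c v ^ 2 := by
    intro c
    have J1 : IntegrableOn (fun v => (ξ ⬝ᵥ ξ) *
        ∑ i, pathTrig P (waveSrc₁ a b τ₀ j χ i) ξ (c + Real.pi / 2) v ^ 2) (Set.Ioc τ₀ τ₁) :=
      (integrable_finsetSum _ fun i _ => I1 i (c + Real.pi / 2)).const_mul _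
    have J2i : ∀ i, IntegrableOn (fun v =>
        ∑ i', pathTrig P (waveSrc₂ a a₀ τ₀ j χ i i') ξ c v ^ 2) (Set.Ioc τ₀ τ₁) := fun i =>
      integrable_finsetSum _ fun i' _ => I2 i i' c
    have J2 : IntegrableOn (fun v => (ξ ⬝ᵥ ξ) ^ 2 / 4 *
        ∑ i, ∑ i', pathTrig P (waveSrc₂ a a₀ τ₀ j χ i i') ξ c v ^ 2) (Set.Ioc τ₀ τ₁) :=
      (integrable_finsetSum _ fun i _ => J2i i).const_mul _
    have J01 : IntegrableOn (fun v => pathTrig P (waveSrc₀ a b τ₀ j χ) ξ c v ^ 2 + (ξ ⬝ᵥ ξ) *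
        ∑ i, pathTrig P (waveSrc₁ a b τ₀ j χ i) ξ (c + Real.pi / 2) v ^ 2) (Set.Ioc τ₀ τ₁) :=
      (I0 c).add J1
    rw [integral_add J01 J2, integral_add (I0 c) J1, integral_const_mul, integral_const_mul,
      integral_finsetSum _ fun i _ => I1 i (c + Real.pi / 2), integral_finsetSum _ fun i _ => J2i i]
    congr 2
    exact Finset.sum_congr rfl fun i _ => integral_finsetSum _ fun i' _ => I2 i i' c
  have h1 := h.integral_sq_pathTrig_le hτ hc hsym hχ hs hT h01 h11 j ξ hκ hκ0 0
  have h2 := h.integral_sq_pathTrig_le hτ hc hsym hχ hs hT h01 h11 j ξ hκ hκ0 (Real.pi / 2)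
  rw [split] at h1 h2
  have epi : ∀ i v, pathTrig P (waveSrc₁ a b τ₀ j χ i) ξ (Real.pi / 2 + Real.pi / 2) v ^ 2 =
      pathTrig P (waveSrc₁ a b τ₀ j χ i) ξ 0 v ^ 2 := fun i v => by
    rw [add_halves, ← zero_add Real.pi, pathTrig_add_pi, neg_sq]
  simp only [epi, zero_add] at h1 h2
  simp only [pathFsq_eq]
  have s0 := integral_add (I0 0) (I0 (Real.pi / 2))
  have s1 := fun i => integral_add (I1 i 0) (I1 i (Real.pi / 2))
  have s2 := fun i i' => integral_add (I2 i i' 0) (I2 i i' (Real.pi / 2))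
  have sT := integral_add (IT 0) (IT (Real.pi / 2))
  simp only [s0, s1, s2, sT, Finset.sum_add_distrib]
  refine (add_le_add h1 h2).trans (le_of_eq ?_)
  ring

end WaveEnergyStep

section WaveAbsorption

open scoped ENNReal NNReal

variable {n : ℕ} {a : ℝ → (Fin n → ℝ) → Matrix (Fin n) (Fin n) ℝ}
  {b : ℝ → (Fin n → ℝ) → (Fin n → ℝ)} {B : ℝ} {χ : (Fin n → ℝ) → ℝ} {K : ℝ}
  [MeasurableSpace (PathSp n)] [BorelSpace (PathSp n)]
  {P : Measure (PathSp n)} [IsProbabilityMeasure P] {τ₀ τ₁ : ℝ} {a₀ : Matrix (Fin n) (Fin n) ℝ}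
  {H : ℝ × (Fin n → ℝ) → ℝ} {M : ℝ}

theorem fourierEnergy_eq_lintegral (hH : Measurable H)
    (hM : ∀ v ∈ Set.Ioc τ₀ τ₁, ∀ x, |H (v, x)| ≤ M) (k : ℕ) (r : ℝ) :
    fourierEnergy P τ₀ τ₁ k r H =
      ∫⁻ ξ, ENNReal.ofReal (freqWt k r ξ * ∫ v in Set.Ioc τ₀ τ₁, pathFsq P H ξ v) := by
  rw [fourierEnergy_eq_swap hH]
  refine lintegral_congr fun ξ => ?_
  rw [← integral_const_mul, ofReal_integral_eq_lintegral_ofReal]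
  · exact (integrableOn_pathFsq hH hM ξ).const_mul _
  · exact Eventually.of_forall fun v => mul_nonneg (freqWt_nonneg _ _ _) (pathFsq_nonneg _ _)

theorem measurable_freqWt_mul_integral_pathFsq (hH : Measurable H) (k : ℕ) (r : ℝ) :
    Measurable fun ξ =>
      ENNReal.ofReal (freqWt k r ξ * ∫ v in Set.Ioc τ₀ τ₁, pathFsq P H ξ v) :=
  ENNReal.measurable_ofReal.comp (((measurable_freqWt k).comp measurable_prodMk_left).mul
    (measurable_pathFsq hH).stronglyMeasurable.integral_prod_right.measurable)

omit [MeasurableSpace (PathSp n)] [BorelSpace (PathSp n)] in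
theorem freqWt_mul_energy_le {c₀ κ q w I I₀ I₁ I₂ : ℝ} (hc₀ : 0 < c₀) (hq : 0 ≤ q) (hw : 0 ≤ w)
    (hκ : c₀ * (1 + q) ≤ κ) (h0 : 0 ≤ I₀) (h1 : 0 ≤ I₁) (h2 : 0 ≤ I₂)
    (hI : I ≤ (κ ^ 2)⁻¹ * (3 * (I₀ + q * I₁ + q ^ 2 / 4 * I₂))) :
    w * I ≤ 3 * (c₀ ^ 2)⁻¹ * (w * (1 + q)⁻¹ * I₀ + w * (1 + q)⁻¹ * I₁ + w * I₂) := by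
  have hq1 : 0 < 1 + q := by linarith
  have hp : 0 < c₀ * (1 + q) := by positivity
  have hκ2 : (κ ^ 2)⁻¹ ≤ (c₀ ^ 2)⁻¹ * ((1 + q) ^ 2)⁻¹ := by
    rw [← mul_inv, ← mul_pow]
    exact inv_anti₀ (by positivity) (pow_le_pow_left₀ hp.le hκ 2)
  have e1 : ((1 + q) ^ 2)⁻¹ * I₀ ≤ (1 + q)⁻¹ * I₀ := by
    refine mul_le_mul_of_nonneg_right (inv_anti₀ hq1 ?_) h0
    nlinarith
  have e2 : ((1 + q) ^ 2)⁻¹ * (q * I₁) ≤ (1 + q)⁻¹ * I₁ := by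
    rw [← mul_assoc]
    refine mul_le_mul_of_nonneg_right ?_ h1
    rw [inv_mul_le_iff₀ (by positivity), sq, mul_assoc, mul_inv_cancel₀ hq1.ne']
    linarith
  have e3 : ((1 + q) ^ 2)⁻¹ * (q ^ 2 / 4 * I₂) ≤ I₂ := by
    rw [← mul_assoc]
    refine mul_le_of_le_one_left h2 ?_
    rw [inv_mul_le_iff₀ (by positivity)]
    nlinarith
  calc w * I ≤ w * ((c₀ ^ 2)⁻¹ * ((1 + q) ^ 2)⁻¹ * (3 * (I₀ + q * I₁ + q ^ 2 / 4 * I₂))) := by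
        refine mul_le_mul_of_nonneg_left (hI.trans ?_) hw
        exact mul_le_mul_of_nonneg_right hκ2 (by positivity)
    _ = 3 * (c₀ ^ 2)⁻¹ * w * (((1 + q) ^ 2)⁻¹ * I₀ + ((1 + q) ^ 2)⁻¹ * (q * I₁) +
          ((1 + q) ^ 2)⁻¹ * (q ^ 2 / 4 * I₂)) := by ring
    _ ≤ 3 * (c₀ ^ 2)⁻¹ * w * ((1 + q)⁻¹ * I₀ + (1 + q)⁻¹ * I₁ + I₂) := by
        refine mul_le_mul_of_nonneg_left ?_ (by positivity)
        linarith
    _ = _ := by ring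

omit [MeasurableSpace (PathSp n)] [BorelSpace (PathSp n)] in
theorem freqWt_succ (k : ℕ) (r : ℝ) (ξ : Fin n → ℝ) :
    freqWt (k + 1) r ξ = freqWt k r ξ * (1 + ξ ⬝ᵥ ξ)⁻¹ := by
  unfold freqWt
  rw [pow_succ, mul_inv]
  ring

/-- The energy inequality, gaining two derivatives on lower order terms. -/
theorem ExpMart.fourierEnergy_timeCut_succ_le (h : ExpMart a b τ₀ P) (hτ : 0 ≤ τ₀)
    (hc : BoundedCoeff n a b B) (hsym : ∀ u x, (a u x).IsSymm) (hχ : ContDiff ℝ 3 χ)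
    (hs : HasCompactSupport χ) (hT : TaylorBound χ K) (h01 : τ₀ ≤ τ₁) (h11 : τ₁ ≤ τ₀ + 1)
    {c₀ : ℝ} (hc₀ : 0 < c₀) (hc₁ : c₀ ≤ 1)
    (hell : ∀ ξ : Fin n → ℝ, c₀ * (ξ ⬝ᵥ ξ) ≤ 1 / 2 * (∑ i, ∑ i', ξ i * ξ i' * a₀ i i'))
    (j k : ℕ) (r : ℝ) :
    fourierEnergy P τ₀ τ₁ k r (timeCut τ₀ (j + 1) χ) ≤ ENNReal.ofReal (3 * (c₀ ^ 2)⁻¹) *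
      (fourierEnergy P τ₀ τ₁ (k + 1) r (waveSrc₀ a b τ₀ j χ) +
        ∑ i, fourierEnergy P τ₀ τ₁ (k + 1) r (waveSrc₁ a b τ₀ j χ i) +
        ∑ i, ∑ i', fourierEnergy P τ₀ τ₁ k r (waveSrc₂ a a₀ τ₀ j χ i i')) := by
  have hB := hc.nonneg
  have hK := hT.nonneg
  have hv0 : ∀ v ∈ Set.Ioc τ₀ τ₁, 0 ≤ v - τ₀ := fun v hv => by linarith [hv.1]
  have hv1 : ∀ v ∈ Set.Ioc τ₀ τ₁, v - τ₀ ≤ 1 := fun v hv => by linarith [hv.2]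
  have m0 := hc.measurable_waveSrc₀ hT τ₀ j
  have m1 := hc.measurable_waveSrc₁ hT τ₀ j
  have m2 := hc.measurable_waveSrc₂ hT.cont a₀ τ₀ j
  rw [fourierEnergy_eq_lintegral (M := K) (measurable_timeCut hT.cont τ₀ (j + 1)) (fun v hv x => by
      unfold timeCut
      rw [abs_mul, abs_of_nonneg (pow_nonneg (hv0 v hv) (j + 1))]
      exact (pow_mul_le_self_of_le_one (hv0 v hv) (hv1 v hv) (abs_nonneg _) _).trans
        (hT.bound x)),
    fourierEnergy_eq_lintegral m0 (M := waveConst n B K j)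
      (fun v hv x => (hc.abs_waveSrc₀_le hT τ₀ j (v, x) (hv0 v hv) (hv1 v hv)).trans
      (pow_mul_le_self_of_le_one (hv0 v hv) (hv1 v hv) (waveConst_nonneg hB hK j) j))]
  have E1 := fun i => fourierEnergy_eq_lintegral (P := P) (τ₀ := τ₀) (τ₁ := τ₁) (m1 i)
    (M := waveConst n B K j)
    (fun v hv x => (hc.abs_waveSrc₁_le hT τ₀ j i (v, x) (hv0 v hv) (hv1 v hv)).trans
      (pow_mul_le_self_of_le_one (hv0 v hv) (hv1 v hv) (waveConst_nonneg hB hK j) j)) (k + 1) r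
  have E2 := fun i i' => fourierEnergy_eq_lintegral (P := P) (τ₀ := τ₀) (τ₁ := τ₁) (m2 i i')
    (fun v hv x => hc.abs_waveSrc₂_le hT a₀ τ₀ j i i' (v, x) (hv0 v hv) (hv1 v hv)) k r
  simp only [E1, E2]
  have M0 := measurable_freqWt_mul_integral_pathFsq (P := P) (τ₀ := τ₀) (τ₁ := τ₁) m0 (k + 1) r
  have M1 := fun i =>
    measurable_freqWt_mul_integral_pathFsq (P := P) (τ₀ := τ₀) (τ₁ := τ₁) (m1 i) (k + 1) r
  have M2 := fun i i' =>
    measurable_freqWt_mul_integral_pathFsq (P := P) (τ₀ := τ₀) (τ₁ := τ₁) (m2 i i') k r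
  have L2 : ∀ i, ∑ i', ∫⁻ ξ, ENNReal.ofReal (freqWt k r ξ *
      ∫ v in Set.Ioc τ₀ τ₁, pathFsq P (waveSrc₂ a a₀ τ₀ j χ i i') ξ v) =
      ∫⁻ ξ, ∑ i', ENNReal.ofReal (freqWt k r ξ *
        ∫ v in Set.Ioc τ₀ τ₁, pathFsq P (waveSrc₂ a a₀ τ₀ j χ i i') ξ v) := fun i =>
    (lintegral_finsetSum _ fun i' _ => M2 i i').symm
  simp only [L2]
  rw [← lintegral_finsetSum _ fun i _ => M1 i,
    ← lintegral_finsetSum _ fun i _ => Finset.measurable_sum _ fun i' _ => M2 i i',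
    ← lintegral_add_left M0]
  have M01 : Measurable fun ξ => ENNReal.ofReal (freqWt (k + 1) r ξ *
      ∫ v in Set.Ioc τ₀ τ₁, pathFsq P (waveSrc₀ a b τ₀ j χ) ξ v) +
      ∑ i, ENNReal.ofReal (freqWt (k + 1) r ξ *
        ∫ v in Set.Ioc τ₀ τ₁, pathFsq P (waveSrc₁ a b τ₀ j χ i) ξ v) :=
    M0.add (Finset.measurable_sum _ fun i _ => M1 i)
  rw [← lintegral_add_left M01, ← lintegral_const_mul' _ _ ENNReal.ofReal_ne_top]
  refine lintegral_mono fun ξ => ?_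
  have hq : 0 ≤ ξ ⬝ᵥ ξ := dotProduct_self_nonneg_real ξ
  have hκ : c₀ * (1 + ξ ⬝ᵥ ξ) ≤ 1 / 2 * (∑ i, ∑ i', ξ i * ξ i' * a₀ i i') + 1 := by
    linarith [hell ξ]
  have hκ0 : 0 < 1 / 2 * (∑ i, ∑ i', ξ i * ξ i' * a₀ i i') + 1 :=
    lt_of_lt_of_le (by positivity) hκ
  have hI := h.integral_pathFsq_timeCut_le hτ hc hsym hχ hs hT h01 h11 j ξ rfl hκ0
  have n0 : ∀ H : ℝ × (Fin n → ℝ) → ℝ, 0 ≤ ∫ v in Set.Ioc τ₀ τ₁, pathFsq P H ξ v := fun H =>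
    integral_nonneg fun v => pathFsq_nonneg _ _
  have hw := freqWt_nonneg (n := n) k r ξ
  have hw1 := freqWt_nonneg (n := n) (k + 1) r ξ
  have fin := freqWt_mul_energy_le hc₀ hq hw hκ (n0 _) (Finset.sum_nonneg fun i _ => n0 _)
    (Finset.sum_nonneg fun i _ => Finset.sum_nonneg fun i' _ => n0 _) hI
  rw [← freqWt_succ] at fin
  refine (ENNReal.ofReal_le_ofReal fin).trans (le_of_eq ?_)
  rw [ENNReal.ofReal_mul (by positivity), Finset.mul_sum, Finset.mul_sum]
  simp only [Finset.mul_sum]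
  rw [ENNReal.ofReal_add, ENNReal.ofReal_add, ENNReal.ofReal_sum_of_nonneg,
    ENNReal.ofReal_sum_of_nonneg]
  · congr 2
    refine Finset.sum_congr rfl fun i _ => ?_
    rw [ENNReal.ofReal_sum_of_nonneg]
    exact fun i' _ => mul_nonneg hw (n0 _)
  · exact fun i _ => Finset.sum_nonneg fun i' _ => mul_nonneg hw (n0 _)
  · exact fun i _ => mul_nonneg hw1 (n0 _)
  · exact mul_nonneg hw1 (n0 _)
  · exact Finset.sum_nonneg fun i _ => mul_nonneg hw1 (n0 _)
  · exact add_nonneg (mul_nonneg hw1 (n0 _)) (Finset.sum_nonneg fun i _ => mul_nonneg hw1 (n0 _))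
  · exact Finset.sum_nonneg fun i _ => Finset.sum_nonneg fun i' _ => mul_nonneg hw (n0 _)

omit [MeasurableSpace (PathSp n)] [BorelSpace (PathSp n)] in
theorem pderivCoord_eq_zero_of_notMem_tsupport {Φ : (Fin n → ℝ) → ℝ} {x : Fin n → ℝ}
    (hx : x ∉ tsupport Φ) (i : Fin n) : pderivCoord i Φ x = 0 := by
  unfold pderivCoord
  have : fderiv ℝ Φ x = 0 := by
    by_contra hne
    exact hx (support_fderiv_subset ℝ hne)
  rw [this]; rfl

omit [MeasurableSpace (PathSp n)] [BorelSpace (PathSp n)] in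
theorem tsupport_pderivCoord_subset (Φ : (Fin n → ℝ) → ℝ) (i : Fin n) :
    tsupport (pderivCoord i Φ) ⊆ tsupport Φ :=
  closure_minimal (fun _ hx => by_contra fun hn => hx (pderivCoord_eq_zero_of_notMem_tsupport hn i))
    isClosed_closure

omit [MeasurableSpace (PathSp n)] [BorelSpace (PathSp n)] in
theorem waveSrc₀_eq_zero {p : ℝ × (Fin n → ℝ)} (hx : p.2 ∉ tsupport χ) (j : ℕ) :
    waveSrc₀ a b τ₀ j χ p = 0 := by
  have h0 : χ p.2 = 0 := image_eq_zero_of_notMem_tsupport hx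
  have h1 := fun i => pderivCoord_eq_zero_of_notMem_tsupport hx i
  have h2 := fun i i' => pderivCoord_eq_zero_of_notMem_tsupport
    (fun hm => hx (tsupport_pderivCoord_subset χ i hm)) i'
  unfold waveSrc₀ genL
  simp [h0, h1, h2]

omit [MeasurableSpace (PathSp n)] [BorelSpace (PathSp n)] in
theorem waveSrc₁_eq_zero {p : ℝ × (Fin n → ℝ)} (hx : p.2 ∉ tsupport χ) (j : ℕ) (i : Fin n) :
    waveSrc₁ a b τ₀ j χ i p = 0 := by
  have h0 : χ p.2 = 0 := image_eq_zero_of_notMem_tsupport hx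
  have h1 := fun i => pderivCoord_eq_zero_of_notMem_tsupport hx i
  unfold waveSrc₁ waveCoeff₁
  simp [h0, h1]

/-- The energy inequality with the top order error absorbed. -/
theorem ExpMart.fourierEnergy_timeCut_succ_le_of_close (h : ExpMart a b τ₀ P) (hτ : 0 ≤ τ₀)
    (hc : BoundedCoeff n a b B) (hsym : ∀ u x, (a u x).IsSymm) (hχ : ContDiff ℝ 3 χ)
    (hs : HasCompactSupport χ) (hT : TaylorBound χ K) (hχ0 : ∀ x, 0 ≤ χ x)
    (h01 : τ₀ ≤ τ₁) (h11 : τ₁ ≤ τ₀ + 1) {c₀ : ℝ} (hc₀ : 0 < c₀) (hc₁ : c₀ ≤ 1)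
    (hell : ∀ ξ : Fin n → ℝ, c₀ * (ξ ⬝ᵥ ξ) ≤ 1 / 2 * (∑ i, ∑ i', ξ i * ξ i' * a₀ i i'))
    {ε : ℝ} (hε : 3 * (c₀ ^ 2)⁻¹ * (n * (n * ε ^ 2)) ≤ 1 / 2)
    (hclose : ∀ v ∈ Set.Ioc τ₀ τ₁, ∀ x ∈ tsupport χ, ∀ i i', |a₀ i i' - a v x i i'| ≤ ε)
    {χ' : (Fin n → ℝ) → ℝ} {K' : ℝ} (hT' : TaylorBound χ' K') (hχ'0 : ∀ x, 0 ≤ χ' x)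
    (hχ' : ∀ x ∈ tsupport χ, χ' x = 1) (j k : ℕ) {r : ℝ} (hr : 0 < r) :
    fourierEnergy P τ₀ τ₁ k r (timeCut τ₀ (j + 1) χ) ≤
      ENNReal.ofReal (6 * (c₀ ^ 2)⁻¹ * ((n + 1) * waveConst n B K j ^ 2)) *
        fourierEnergy P τ₀ τ₁ (k + 1) r (timeCut τ₀ j χ') := by
  have hB := hc.nonneg
  have hK := hT.nonneg
  have hv0 : ∀ v ∈ Set.Ioc τ₀ τ₁, 0 ≤ v - τ₀ := fun v hv => by linarith [hv.1]
  have hv1 : ∀ v ∈ Set.Ioc τ₀ τ₁, v - τ₀ ≤ 1 := fun v hv => by linarith [hv.2]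
  have hW := waveConst_nonneg (n := n) hB hK j
  set W := waveConst n B K j with hWdef
  set X := fourierEnergy P τ₀ τ₁ k r (timeCut τ₀ (j + 1) χ) with hX
  set Y := fourierEnergy P τ₀ τ₁ (k + 1) r (timeCut τ₀ j χ') with hY
  have hTb : ∀ v ∈ Set.Ioc τ₀ τ₁, ∀ x, |timeCut τ₀ (j + 1) χ (v, x)| ≤ K := fun v hv x => by
    unfold timeCut
    rw [abs_mul, abs_of_nonneg (pow_nonneg (hv0 v hv) (j + 1))]
    exact (pow_mul_le_self_of_le_one (hv0 v hv) (hv1 v hv) (abs_nonneg _) _).trans (hT.bound x)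
  have hTb' : ∀ v ∈ Set.Ioc τ₀ τ₁, ∀ x, W * timeCut τ₀ j χ' (v, x) ≤ W * K' := fun v hv x => by
    refine mul_le_mul_of_nonneg_left ?_ hW
    unfold timeCut
    exact (pow_mul_le_self_of_le_one (hv0 v hv) (hv1 v hv) (hχ'0 _) _).trans
      ((le_abs_self _).trans (hT'.bound x))
  have hdom : ∀ (H : ℝ × (Fin n → ℝ) → ℝ), Measurable H → (∀ p, p.2 ∉ tsupport χ → H p = 0) →
      (∀ v ∈ Set.Ioc τ₀ τ₁, ∀ x, |H (v, x)| ≤ (v - τ₀) ^ j * W) →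
      fourierEnergy P τ₀ τ₁ (k + 1) r H ≤ ENNReal.ofReal (W ^ 2) * Y := by
    intro H hH hz hb
    rw [hY, ← fourierEnergy_const_mul]
    refine fourierEnergy_mono hH ((measurable_timeCut hT'.cont τ₀ j).const_mul W) hTb'
      (fun v hv x => ?_) _ hr
    by_cases hx : x ∈ tsupport χ
    · refine (hb v hv x).trans (le_of_eq ?_)
      unfold timeCut
      rw [hχ' x hx]; ring
    · rw [hz (v, x) hx, abs_zero]
      exact mul_nonneg hW (mul_nonneg (pow_nonneg (hv0 v hv) j) (hχ'0 x))
  have b0 : fourierEnergy P τ₀ τ₁ (k + 1) r (waveSrc₀ a b τ₀ j χ) ≤ ENNReal.ofReal (W ^ 2) * Y :=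
    hdom _ (hc.measurable_waveSrc₀ hT τ₀ j) (fun p hp => waveSrc₀_eq_zero hp j)
      fun v hv x => hc.abs_waveSrc₀_le hT τ₀ j (v, x) (hv0 v hv) (hv1 v hv)
  have b1 : ∀ i, fourierEnergy P τ₀ τ₁ (k + 1) r (waveSrc₁ a b τ₀ j χ i) ≤
      ENNReal.ofReal (W ^ 2) * Y := fun i =>
    hdom _ (hc.measurable_waveSrc₁ hT τ₀ j i) (fun p hp => waveSrc₁_eq_zero hp j i)
      fun v hv x => hc.abs_waveSrc₁_le hT τ₀ j i (v, x) (hv0 v hv) (hv1 v hv)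
  have b2 : ∀ i i', fourierEnergy P τ₀ τ₁ k r (waveSrc₂ a a₀ τ₀ j χ i i') ≤
      ENNReal.ofReal (ε ^ 2) * X := fun i i' => by
    rw [hX, ← sq_abs, ← fourierEnergy_const_mul]
    refine fourierEnergy_mono (M := |ε| * K) (hc.measurable_waveSrc₂ hT.cont a₀ τ₀ j i i')
      ((measurable_timeCut hT.cont τ₀ (j + 1)).const_mul _) (fun v hv x =>
        mul_le_mul_of_nonneg_left ((le_abs_self _).trans (hTb v hv x)) (abs_nonneg _))
      (fun v hv x => ?_) _ hr
    unfold waveSrc₂ timeCut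
    have hp := pow_nonneg (hv0 v hv) (j + 1)
    by_cases hx : x ∈ tsupport χ
    · rw [abs_mul, abs_mul, abs_of_nonneg hp, abs_of_nonneg (hχ0 x),
        mul_left_comm |ε|]
      exact mul_le_mul_of_nonneg_left (mul_le_mul_of_nonneg_right
        ((hclose v hv x hx i i').trans (le_abs_self _)) (hχ0 x)) hp
    · simp [image_eq_zero_of_notMem_tsupport hx]
  have main := h.fourierEnergy_timeCut_succ_le hτ hc hsym hχ hs hT h01 h11 hc₀ hc₁ hell j k r
  have hXtop : X ≠ ⊤ := by
    have hJ : ∫⁻ ξ : Fin n → ℝ, ENNReal.ofReal (freqWt k r ξ) ≠ ⊤ :=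
      (integrable_freqWt k hr).lintegral_lt_top.ne
    refine ne_top_of_le_ne_top ?_ (fourierEnergy_le (P := P) hTb k le_rfl)
    exact ENNReal.mul_ne_top (ENNReal.mul_ne_top hJ ENNReal.ofReal_ne_top) ENNReal.ofReal_ne_top
  have step : X ≤ ENNReal.ofReal (3 * (c₀ ^ 2)⁻¹ * ((n + 1) * W ^ 2)) * Y +
      ENNReal.ofReal (1 / 2) * X := by
    refine main.trans ?_
    calc _ ≤ ENNReal.ofReal (3 * (c₀ ^ 2)⁻¹) * (ENNReal.ofReal (W ^ 2) * Y +
          ∑ _i : Fin n, ENNReal.ofReal (W ^ 2) * Y +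
          ∑ _i : Fin n, ∑ _i' : Fin n, ENNReal.ofReal (ε ^ 2) * X) := by
          gcongr
          · exact b1 _
          · exact b2 _ _
      _ = ENNReal.ofReal (3 * (c₀ ^ 2)⁻¹ * ((n + 1) * W ^ 2)) * Y +
          ENNReal.ofReal (3 * (c₀ ^ 2)⁻¹ * (n * (n * ε ^ 2))) * X := by
          simp only [Finset.sum_const, Finset.card_univ, Fintype.card_fin, nsmul_eq_mul]
          have e1 : ENNReal.ofReal (3 * (c₀ ^ 2)⁻¹ * ((n + 1) * W ^ 2)) =
              ENNReal.ofReal (3 * (c₀ ^ 2)⁻¹) * ((n + 1) * ENNReal.ofReal (W ^ 2)) := by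
            rw [ENNReal.ofReal_mul (by positivity), ENNReal.ofReal_mul (by positivity : (0 : ℝ) ≤ n + 1),
              ENNReal.ofReal_add (by positivity) (by positivity), ENNReal.ofReal_one,
              ENNReal.ofReal_natCast]
          have e2 : ENNReal.ofReal (3 * (c₀ ^ 2)⁻¹ * (n * (n * ε ^ 2))) =
              ENNReal.ofReal (3 * (c₀ ^ 2)⁻¹) * (n * (n * ENNReal.ofReal (ε ^ 2))) := by
            rw [ENNReal.ofReal_mul (by positivity), ENNReal.ofReal_mul (by positivity : (0 : ℝ) ≤ n),
              ENNReal.ofReal_mul (by positivity : (0 : ℝ) ≤ n), ENNReal.ofReal_natCast]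
          rw [e1, e2]
          ring
      _ ≤ _ := by gcongr
  have hhalf : ENNReal.ofReal (1 / 2) * X + ENNReal.ofReal (1 / 2) * X = X := by
    rw [← add_mul, ← ENNReal.ofReal_add (by norm_num) (by norm_num)]
    norm_num
  have hfin : ENNReal.ofReal (1 / 2) * X ≠ ⊤ := ENNReal.mul_ne_top ENNReal.ofReal_ne_top hXtop
  have half_le : ENNReal.ofReal (1 / 2) * X ≤
      ENNReal.ofReal (3 * (c₀ ^ 2)⁻¹ * ((n + 1) * W ^ 2)) * Y := by
    refine (ENNReal.add_le_add_iff_right hfin).1 ?_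
    rw [hhalf]; exact step
  calc X = ENNReal.ofReal (1 / 2) * X + ENNReal.ofReal (1 / 2) * X := hhalf.symm
    _ ≤ _ := add_le_add half_le half_le
    _ = _ := by
      rw [← add_mul, ← ENNReal.ofReal_add (by positivity) (by positivity)]
      congr 2; ring

end WaveAbsorption

section StaticDensity

open scoped ENNReal NNReal

theorem ENNReal.sq_lintegral_mul_le {α : Type*} [MeasurableSpace α] {μ : Measure α}
    {f g : α → ℝ≥0∞} (hf : AEMeasurable f μ) (hg : AEMeasurable g μ) :
    (∫⁻ x, f x * g x ∂μ) ^ 2 ≤ (∫⁻ x, f x ^ 2 ∂μ) * ∫⁻ x, g x ^ 2 ∂μ := by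
  have h := ENNReal.lintegral_mul_le_Lp_mul_Lq μ Real.HolderConjugate.two_two hf hg
  simp only [Pi.mul_apply, ENNReal.rpow_two] at h
  have e : ∀ x : ℝ≥0∞, (x ^ ((1 : ℝ) / 2)) ^ 2 = x := fun x => by
    rw [← ENNReal.rpow_two, ← ENNReal.rpow_mul]
    norm_num
  calc _ ≤ _ := pow_le_pow_left' h 2
    _ = _ := by rw [mul_pow, e, e]

variable {n : ℕ}

theorem volume_closedBall_pi (x : Fin n → ℝ) {h : ℝ} (hh : 0 ≤ h) :
    volume (Metric.closedBall x h) = ENNReal.ofReal ((2 * h) ^ n) := by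
  rw [Real.volume_pi_closedBall x hh, Fintype.card_fin]

theorem dotProduct_self_le_card_mul_norm_sq (w : Fin n → ℝ) : w ⬝ᵥ w ≤ n * ‖w‖ ^ 2 := by
  refine (Finset.sum_le_card_nsmul _ _ (‖w‖ ^ 2) fun i _ => ?_).trans (by simp)
  rw [← sq, ← sq_abs]
  exact pow_le_pow_left₀ (abs_nonneg _) (norm_le_pi_norm w i) 2

variable {Ω : Type*} [MeasurableSpace Ω] {μ : Measure Ω} [IsFiniteMeasure μ]
  {X : Ω → Fin n → ℝ} {G : Ω → ℝ} {M : ℝ}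

/-- The mass of the weighted law of `X` near a point. -/
noncomputable def ballMass (μ : Measure Ω) (X : Ω → Fin n → ℝ) (G : Ω → ℝ) (h : ℝ)
    (z : Fin n → ℝ) : ℝ≥0∞ :=
  ∫⁻ ω, ENNReal.ofReal (G ω) * (Metric.closedBall (X ω) h).indicator (fun _ => 1) z ∂μ

theorem lintegral_sq_lintegral_mul_eq {β : Type*} [MeasurableSpace β] {ν : Measure β}
    [SFinite ν] {g : Ω → ℝ≥0∞} (hg : Measurable g) (hg' : ∀ ω, g ω ≠ ⊤) {k : Ω → β → ℝ≥0∞}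
    (hk : Measurable fun p : Ω × β => k p.1 p.2) :
    ∫⁻ z, (∫⁻ ω, g ω * k ω z ∂μ) ^ 2 ∂ν =
      ∫⁻ ω, ∫⁻ ω', g ω * g ω' * ∫⁻ z, k ω z * k ω' z ∂ν ∂μ ∂μ := by
  have hk1 : ∀ z, Measurable fun ω => k ω z := fun z =>
    hk.comp (measurable_id.prodMk measurable_const)
  have hgk : ∀ z, Measurable fun ω => g ω * k ω z := fun z => hg.mul (hk1 z)
  have mF : Measurable fun q : (β × Ω) × Ω =>
      g q.1.2 * g q.2 * (k q.1.2 q.1.1 * k q.2 q.1.1) := by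
    refine Measurable.mul ((hg.comp (measurable_snd.comp measurable_fst)).mul
      (hg.comp measurable_snd)) (Measurable.mul ?_ ?_)
    · exact hk.comp ((measurable_snd.comp measurable_fst).prodMk
        (measurable_fst.comp measurable_fst))
    · exact hk.comp (measurable_snd.prodMk (measurable_fst.comp measurable_fst))
  have e1 : ∀ z, (∫⁻ ω, g ω * k ω z ∂μ) ^ 2 =
      ∫⁻ ω, ∫⁻ ω', g ω * g ω' * (k ω z * k ω' z) ∂μ ∂μ := by
    intro z
    rw [sq, ← lintegral_mul_const _ (hgk z)]
    refine lintegral_congr fun ω => ?_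
    rw [← lintegral_const_mul _ (hgk z)]
    exact lintegral_congr fun ω' => by ring
  have mI : Measurable fun p : β × Ω =>
      ∫⁻ ω', g p.2 * g ω' * (k p.2 p.1 * k ω' p.1) ∂μ := mF.lintegral_prod_right'
  rw [lintegral_congr e1, lintegral_lintegral_swap mI.aemeasurable]
  refine lintegral_congr fun ω => ?_
  have mF2 : Measurable fun q : β × Ω => g ω * g q.2 * (k ω q.1 * k q.2 q.1) :=
    mF.comp ((measurable_fst.prodMk measurable_const).prodMk measurable_snd)
  rw [lintegral_lintegral_swap mF2.aemeasurable]
  refine lintegral_congr fun ω' => ?_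
  exact lintegral_const_mul' _ _ (ENNReal.mul_ne_top (hg' ω) (hg' ω'))

theorem lintegral_closedBall_indicator_mul_le (x x' : Fin n → ℝ) {h : ℝ} (hh : 0 ≤ h) :
    ∫⁻ z, (Metric.closedBall x h).indicator (fun _ => (1 : ℝ≥0∞)) z *
        (Metric.closedBall x' h).indicator (fun _ => 1) z ≤
      ENNReal.ofReal ((2 * h) ^ n) *
        (Metric.closedBall x (2 * h)).indicator (fun _ => 1) x' := by
  by_cases hd : x' ∈ Metric.closedBall x (2 * h)
  · rw [Set.indicator_of_mem hd, mul_one, ← volume_closedBall_pi x hh,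
      ← lintegral_indicator_one measurableSet_closedBall]
    refine lintegral_mono fun z => mul_le_of_le_one_right' ?_
    exact Set.indicator_le_self' (by simp) _
  · rw [Set.indicator_of_notMem hd, mul_zero, nonpos_iff_eq_zero]
    refine (lintegral_congr fun z => ?_).trans lintegral_zero
    by_cases h1 : z ∈ Metric.closedBall x h
    · by_cases h2 : z ∈ Metric.closedBall x' h
      · exfalso
        refine hd ?_
        rw [Metric.mem_closedBall] at *
        have := dist_triangle_left x' x z
        linarith
      · rw [Set.indicator_of_notMem h2, mul_zero]
    · rw [Set.indicator_of_notMem h1, zero_mul]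

theorem measurable_indicator_closedBall (hX : Measurable X) {Z : Ω → Fin n → ℝ}
    (hZ : Measurable Z) (h : ℝ) :
    Measurable fun ω => (Metric.closedBall (X ω) h).indicator (fun _ => (1 : ℝ≥0∞)) (Z ω) := by
  have : (fun ω => (Metric.closedBall (X ω) h).indicator (fun _ => (1 : ℝ≥0∞)) (Z ω)) =
      {ω | dist (Z ω) (X ω) ≤ h}.indicator fun _ => 1 := by
    ext p
    simp only [Set.indicator, Metric.mem_closedBall, Set.mem_ofPred_eq]
  rw [this]
  exact measurable_const.indicator (measurableSet_le (hZ.dist hX) measurable_const)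

theorem lintegral_sq_ballMass_le_prod (hX : Measurable X) (hG : Measurable G) {h : ℝ}
    (hh : 0 ≤ h) :
    ∫⁻ z, ballMass μ X G h z ^ 2 ≤ ENNReal.ofReal ((2 * h) ^ n) * ∫⁻ ω, ∫⁻ ω',
      ENNReal.ofReal (G ω) * ENNReal.ofReal (G ω') *
        (Metric.closedBall (X ω) (2 * h)).indicator (fun _ => 1) (X ω') ∂μ ∂μ := by
  unfold ballMass
  rw [lintegral_sq_lintegral_mul_eq hG.ennreal_ofReal (fun _ => ENNReal.ofReal_ne_top)
    (measurable_indicator_closedBall (hX.comp measurable_fst) measurable_snd h), ← lintegral_const_mul' _ _ ENNReal.ofReal_ne_top]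
  refine lintegral_mono fun ω => ?_
  rw [← lintegral_const_mul' _ _ ENNReal.ofReal_ne_top]
  refine lintegral_mono fun ω' => ?_
  rw [mul_left_comm]
  exact mul_le_mul_right (lintegral_closedBall_indicator_mul_le _ _ hh) _

/-- The local square mass is controlled by the Gaussian Fourier energy. -/
theorem lintegral_sq_ballMass_le (hX : Measurable X) (hG : Measurable G) (hG0 : ∀ ω, 0 ≤ G ω)
    (hM : ∀ ω, |G ω| ≤ M) {h : ℝ} (hh : 0 < h) :
    ∫⁻ z, ballMass μ X G h z ^ 2 ≤ ENNReal.ofReal (((2 * h) ^ n) ^ 2) *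
      (ENNReal.ofReal (Real.exp n) *
        ENNReal.ofReal (∫ ξ, freqWt 0 (h ^ 2) ξ * fourierSq μ X G ξ)) := by
  have hr : 0 < h ^ 2 := by positivity
  refine (lintegral_sq_ballMass_le_prod hX hG hh.le).trans ?_
  set w : Ω × Ω → ℝ := fun p => Real.exp (-((X p.1 - X p.2) ⬝ᵥ (X p.1 - X p.2)) / (4 * h ^ 2))
    with hw
  have hker : ∀ p : Ω × Ω, ∫ ξ : Fin n → ℝ, freqWt 0 (h ^ 2) ξ * Real.cos (ξ ⬝ᵥ (X p.1 - X p.2)) =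
      (Real.pi / h ^ 2) ^ ((n : ℝ) / 2) * w p := fun p => by
    rw [hw, ← integral_exp_neg_mul_cos hr]
    simp only [freqWt, pow_zero, inv_one, one_mul]
  rw [integral_freqWt_fourierSq hX hG hM 0 hr]
  simp only [hker]
  have hmw : Measurable w := by
    refine Real.measurable_exp.comp (Measurable.div_const (Measurable.neg ?_) _)
    exact measurable_dotProduct_self.comp ((hX.comp measurable_fst).sub (hX.comp measurable_snd))
  have hw0 : ∀ p, 0 ≤ w p := fun p => (Real.exp_pos _).le
  have hw1 : ∀ p, w p ≤ 1 := fun p => Real.exp_le_one_iff.2 (div_nonpos_of_nonpos_of_nonneg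
    (neg_nonpos.2 (dotProduct_self_nonneg_real _)) (by positivity))
  set γ : ℝ := (Real.pi / h ^ 2) ^ ((n : ℝ) / 2) with hγ
  have hγ0 : 0 ≤ γ := by positivity
  have hγ1 : 1 ≤ (2 * h) ^ n * γ := by
    have e : γ = (√Real.pi / h) ^ n := by
      rw [hγ, div_eq_mul_inv (n : ℝ) 2, mul_comm, Real.rpow_mul (by positivity),
        Real.rpow_natCast, ← one_div, ← Real.sqrt_eq_rpow, Real.sqrt_div Real.pi_pos.le,
        Real.sqrt_sq hh.le]
    rw [e, ← mul_pow]
    refine one_le_pow₀ ?_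
    rw [mul_assoc, mul_div_cancel₀ _ hh.ne']
    have : 1 ≤ √Real.pi := Real.one_le_sqrt.2 (by linarith [Real.pi_gt_three])
    linarith
  have hint : Integrable (fun p : Ω × Ω => G p.1 * G p.2 * (γ * w p)) (μ.prod μ) := by
    refine Integrable.of_bound (C := M * M * (γ * 1)) (((hG.comp measurable_fst).mul
      (hG.comp measurable_snd)).mul (hmw.const_mul γ)).aestronglyMeasurable
      (Eventually.of_forall fun p => ?_)
    have hM0 : 0 ≤ M := (abs_nonneg _).trans (hM p.1)
    rw [Real.norm_eq_abs, abs_mul, abs_mul, abs_of_nonneg (mul_nonneg hγ0 (hw0 p))]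
    exact mul_le_mul (mul_le_mul (hM _) (hM _) (abs_nonneg _) hM0)
      (mul_le_mul_of_nonneg_left (hw1 p) hγ0) (mul_nonneg hγ0 (hw0 p)) (by positivity)
  have hmeas : Measurable fun p : Ω × Ω => ENNReal.ofReal (G p.1 * G p.2 * (γ * w p)) :=
    (((hG.comp measurable_fst).mul (hG.comp measurable_snd)).mul
      (hmw.const_mul γ)).ennreal_ofReal
  rw [ofReal_integral_eq_lintegral_ofReal hint (Eventually.of_forall fun p =>
      mul_nonneg (mul_nonneg (hG0 _) (hG0 _)) (mul_nonneg hγ0 (hw0 p))),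
    lintegral_prod _ hmeas.aemeasurable, sq,
    ENNReal.ofReal_mul (by positivity), mul_assoc]
  refine mul_le_mul_right ?_ _
  rw [← lintegral_const_mul' _ _ ENNReal.ofReal_ne_top,
    ← lintegral_const_mul' _ _ ENNReal.ofReal_ne_top]
  refine lintegral_mono fun ω => ?_
  rw [← lintegral_const_mul' _ _ ENNReal.ofReal_ne_top,
    ← lintegral_const_mul' _ _ ENNReal.ofReal_ne_top]
  refine lintegral_mono fun ω' => ?_
  by_cases hd : X ω' ∈ Metric.closedBall (X ω) (2 * h)
  · rw [Set.indicator_of_mem hd, mul_one, ← ENNReal.ofReal_mul (hG0 _),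
      ← ENNReal.ofReal_mul (by positivity), ← ENNReal.ofReal_mul (by positivity)]
    refine ENNReal.ofReal_le_ofReal ?_
    have hexp : 1 ≤ Real.exp n * w (ω, ω') := by
      rw [hw, ← Real.exp_add]
      refine Real.one_le_exp ?_
      have h1 := dotProduct_self_le_card_mul_norm_sq (X ω - X ω')
      have h2 : ‖X ω - X ω'‖ ≤ 2 * h := by
        rw [← dist_eq_norm, dist_comm]; exact hd
      have h3 : ‖X ω - X ω'‖ ^ 2 ≤ 4 * h ^ 2 := by
        have := pow_le_pow_left₀ (norm_nonneg _) h2 2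
        linarith
      have h4 : ((X ω - X ω') ⬝ᵥ (X ω - X ω')) / (4 * h ^ 2) ≤ n := by
        rw [div_le_iff₀ (by positivity)]
        exact h1.trans (mul_le_mul_of_nonneg_left h3 (Nat.cast_nonneg n))
      rw [neg_div]
      linarith
    have hGG : 0 ≤ G ω * G ω' := mul_nonneg (hG0 _) (hG0 _)
    calc G ω * G ω' ≤ G ω * G ω' * (((2 * h) ^ n * γ) * (Real.exp n * w (ω, ω'))) :=
          le_mul_of_one_le_right hGG (one_le_mul_of_one_le_of_one_le hγ1 hexp)
      _ = _ := by ring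
  · rw [Set.indicator_of_notMem hd, mul_zero]
    exact zero_le

end StaticDensity

section Occupation

open scoped ENNReal NNReal

variable {n : ℕ} [MeasurableSpace (PathSp n)] [BorelSpace (PathSp n)]
  {P : Measure (PathSp n)} {H : ℝ × (Fin n → ℝ) → ℝ} {M : ℝ}

theorem measurable_timeXcan :
    Measurable fun p : ℝ × PathSp n => (p.1, Xcan n p.1 p.2) :=
  measurable_fst.prodMk measurable_Xcan_uncurry

/-- The occupation measure of the canonical space-time process over a time interval. -/
noncomputable def occMeas (P : Measure (PathSp n)) (τ₀ τ₁ : ℝ) : Measure (ℝ × (Fin n → ℝ)) :=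
  ((volume.restrict (Set.Ioc τ₀ τ₁)).prod P).map fun p => (p.1, Xcan n p.1 p.2)

theorem lintegral_occMeas [SFinite P] (τ₀ τ₁ : ℝ) {g : ℝ × (Fin n → ℝ) → ℝ≥0∞}
    (hg : Measurable g) :
    ∫⁻ q, g q ∂(occMeas P τ₀ τ₁) = ∫⁻ v in Set.Ioc τ₀ τ₁, ∫⁻ ω, g (v, Xcan n v ω) ∂P := by
  have hm : Measurable fun p : ℝ × PathSp n => g (p.1, Xcan n p.1 p.2) :=
    hg.comp measurable_timeXcan
  rw [occMeas, lintegral_map hg measurable_timeXcan, lintegral_prod _ hm.aemeasurable]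

theorem measurable_ballMass_path [SFinite P] (hH : Measurable H) (h : ℝ) :
    Measurable fun p : ℝ × (Fin n → ℝ) =>
      ballMass P (Xcan n p.1) (fun ω => H (p.1, Xcan n p.1 ω)) h p.2 := by
  have hX : Measurable fun q : (ℝ × (Fin n → ℝ)) × PathSp n => Xcan n q.1.1 q.2 :=
    measurable_Xcan_uncurry.comp ((measurable_fst.comp measurable_fst).prodMk measurable_snd)
  have hHq : Measurable fun q : (ℝ × (Fin n → ℝ)) × PathSp n =>
      ENNReal.ofReal (H (q.1.1, Xcan n q.1.1 q.2)) :=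
    (hH.comp ((measurable_fst.comp measurable_fst).prodMk hX)).ennreal_ofReal
  have hI : Measurable fun q : (ℝ × (Fin n → ℝ)) × PathSp n =>
      (Metric.closedBall (Xcan n q.1.1 q.2) h).indicator (fun _ => (1 : ℝ≥0∞)) q.1.2 :=
    measurable_indicator_closedBall hX (measurable_snd.comp measurable_fst) h
  have hm : Measurable fun q : (ℝ × (Fin n → ℝ)) × PathSp n =>
      ENNReal.ofReal (H (q.1.1, Xcan n q.1.1 q.2)) *
        (Metric.closedBall (Xcan n q.1.1 q.2) h).indicator (fun _ => (1 : ℝ≥0∞)) q.1.2 :=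
    hHq.mul hI
  exact hm.lintegral_prod_right'

omit [MeasurableSpace (PathSp n)] [BorelSpace (PathSp n)] in
theorem measurable_sectionBall {A : Set (ℝ × (Fin n → ℝ))} (hA : MeasurableSet A) (h : ℝ) :
    Measurable fun q : ℝ × (Fin n → ℝ) => ∫⁻ z, A.indicator (fun _ => (1 : ℝ≥0∞)) (q.1, z) *
      (Metric.closedBall q.2 h).indicator (fun _ => 1) z := by
  have h1 : Measurable fun p : (ℝ × (Fin n → ℝ)) × (Fin n → ℝ) =>
      A.indicator (fun _ => (1 : ℝ≥0∞)) (p.1.1, p.2) :=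
    (measurable_const.indicator hA).comp
      ((measurable_fst.comp measurable_fst).prodMk measurable_snd)
  have h2 : Measurable fun p : (ℝ × (Fin n → ℝ)) × (Fin n → ℝ) =>
      (Metric.closedBall p.1.2 h).indicator (fun _ => (1 : ℝ≥0∞)) p.2 :=
    measurable_indicator_closedBall (measurable_snd.comp measurable_fst) measurable_snd h
  have hm : Measurable fun p : (ℝ × (Fin n → ℝ)) × (Fin n → ℝ) =>
      A.indicator (fun _ => (1 : ℝ≥0∞)) (p.1.1, p.2) *
        (Metric.closedBall p.1.2 h).indicator (fun _ => 1) p.2 := h1.mul h2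
  exact hm.lintegral_prod_right'

theorem lintegral_occMeas_sectionBall [SFinite P] (hH : Measurable H) {A : Set (ℝ × (Fin n → ℝ))}
    (hA : MeasurableSet A) (τ₀ τ₁ h : ℝ) :
    ∫⁻ q, ENNReal.ofReal (H q) * (∫⁻ z, A.indicator (fun _ => (1 : ℝ≥0∞)) (q.1, z) *
        (Metric.closedBall q.2 h).indicator (fun _ => 1) z) ∂(occMeas P τ₀ τ₁) =
      ∫⁻ v in Set.Ioc τ₀ τ₁, ∫⁻ z, A.indicator (fun _ => (1 : ℝ≥0∞)) (v, z) *
        ballMass P (Xcan n v) (fun ω => H (v, Xcan n v ω)) h z := by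
  rw [lintegral_occMeas τ₀ τ₁ (g := fun q : ℝ × (Fin n → ℝ) => ENNReal.ofReal (H q) *
    (∫⁻ z, A.indicator (fun _ => (1 : ℝ≥0∞)) (q.1, z) *
        (Metric.closedBall q.2 h).indicator (fun _ => 1) z))
    (hH.ennreal_ofReal.mul (measurable_sectionBall hA h))]
  refine lintegral_congr fun v => ?_
  have hX := measurable_Xcan (n := n) v
  have hHv := measurable_section_path hH v
  have hA' : Measurable fun z => A.indicator (fun _ => (1 : ℝ≥0∞)) (v, z) :=
    (measurable_const.indicator hA).comp measurable_prodMk_left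
  have hK : Measurable fun p : PathSp n × (Fin n → ℝ) =>
      (Metric.closedBall (Xcan n v p.1) h).indicator (fun _ => (1 : ℝ≥0∞)) p.2 :=
    measurable_indicator_closedBall (hX.comp measurable_fst) measurable_snd h
  have hF : Measurable fun p : PathSp n × (Fin n → ℝ) => ENNReal.ofReal (H (v, Xcan n v p.1)) *
      (A.indicator (fun _ => (1 : ℝ≥0∞)) (v, p.2) *
        (Metric.closedBall (Xcan n v p.1) h).indicator (fun _ => 1) p.2) :=
    (hHv.ennreal_ofReal.comp measurable_fst).mul ((hA'.comp measurable_snd).mul hK)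
  calc _ = ∫⁻ ω, (∫⁻ z : Fin n → ℝ, ENNReal.ofReal (H (v, Xcan n v ω)) *
          (A.indicator (fun _ => (1 : ℝ≥0∞)) (v, z) *
          (Metric.closedBall (Xcan n v ω) h).indicator (fun _ => 1) z)) ∂P :=
        lintegral_congr fun ω => (lintegral_const_mul' _ _ ENNReal.ofReal_ne_top).symm
    _ = ∫⁻ z : Fin n → ℝ, ∫⁻ ω, ENNReal.ofReal (H (v, Xcan n v ω)) *
          (A.indicator (fun _ => (1 : ℝ≥0∞)) (v, z) *
          (Metric.closedBall (Xcan n v ω) h).indicator (fun _ => 1) z) ∂P :=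
        lintegral_lintegral_swap hF.aemeasurable
    _ = _ := by
        refine lintegral_congr fun z => ?_
        unfold ballMass
        have hne : A.indicator (fun _ => (1 : ℝ≥0∞)) (v, z) ≠ ⊤ :=
          ne_top_of_le_ne_top ENNReal.one_ne_top (Set.indicator_le_self' (by simp) _)
        rw [← lintegral_const_mul' _ _ hne]
        exact lintegral_congr fun ω => by ring

variable [IsProbabilityMeasure P]

theorem sq_lintegral_occMeas_sectionBall_le (hH : Measurable H) {τ₀ τ₁ : ℝ}
    (hH0 : ∀ v ∈ Set.Ioc τ₀ τ₁, ∀ x, 0 ≤ H (v, x))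
    (hM : ∀ v ∈ Set.Ioc τ₀ τ₁, ∀ x, |H (v, x)| ≤ M) {A : Set (ℝ × (Fin n → ℝ))}
    (hA : MeasurableSet A) {h : ℝ} (hh : 0 < h) :
    (∫⁻ q, ENNReal.ofReal (H q) * (∫⁻ z, A.indicator (fun _ => (1 : ℝ≥0∞)) (q.1, z) *
        (Metric.closedBall q.2 h).indicator (fun _ => 1) z) ∂(occMeas P τ₀ τ₁)) ^ 2 ≤
      volume A * (ENNReal.ofReal (((2 * h) ^ n) ^ 2) *
        (ENNReal.ofReal (Real.exp n) * fourierEnergy P τ₀ τ₁ 0 (h ^ 2) H)) := by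
  have hr : 0 < h ^ 2 := by positivity
  have mA : Measurable (A.indicator (fun _ => (1 : ℝ≥0∞))) := measurable_const.indicator hA
  have mb := measurable_ballMass_path (P := P) hH h
  set κ := (volume.restrict (Set.Ioc τ₀ τ₁)).prod (volume : Measure (Fin n → ℝ)) with hκ
  have hprod : Measurable fun p : ℝ × (Fin n → ℝ) => A.indicator (fun _ => (1 : ℝ≥0∞)) p *
      ballMass P (Xcan n p.1) (fun ω => H (p.1, Xcan n p.1 ω)) h p.2 := mA.mul mb
  have mb2 : Measurable fun p : ℝ × (Fin n → ℝ) =>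
      ballMass P (Xcan n p.1) (fun ω => H (p.1, Xcan n p.1 ω)) h p.2 ^ 2 := mb.pow_const 2
  rw [lintegral_occMeas_sectionBall hH hA, ← lintegral_prod (μ := volume.restrict (Set.Ioc τ₀ τ₁))
    (ν := volume) _ hprod.aemeasurable]
  refine (ENNReal.sq_lintegral_mul_le mA.aemeasurable mb.aemeasurable).trans ?_
  refine mul_le_mul' ?_ ?_
  · calc _ = ∫⁻ p, A.indicator (fun _ => (1 : ℝ≥0∞)) p ∂κ := by
          refine lintegral_congr fun p => ?_
          by_cases hp : p ∈ A <;> simp [hp]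
      _ = κ A := by rw [lintegral_indicator hA]; simp
      _ ≤ volume A := by
          have : κ ≤ volume := by
            rw [hκ, Measure.volume_eq_prod]
            exact Measure.prod_mono Measure.restrict_le_self le_rfl
          exact this A
  · rw [lintegral_prod _ mb2.aemeasurable, fourierEnergy,
      ← lintegral_const_mul' _ _ ENNReal.ofReal_ne_top,
      ← lintegral_const_mul' _ _ ENNReal.ofReal_ne_top]
    refine setLIntegral_mono' measurableSet_Ioc fun v hv => ?_
    rw [lintegral_freqWt_pathFsq hH (hM v hv) 0 hr]
    exact lintegral_sq_ballMass_le (measurable_Xcan v) (measurable_section_path hH v)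
      (fun ω => hH0 v hv _) (fun ω => hM v hv _) hh

end Occupation

section OccupationBound

open scoped ENNReal NNReal

variable {n : ℕ} [MeasurableSpace (PathSp n)] [BorelSpace (PathSp n)]
  {P : Measure (PathSp n)} [IsProbabilityMeasure P] {H : ℝ × (Fin n → ℝ) → ℝ} {M : ℝ}

theorem ENNReal.sq_le_iff_le_rpow_half {x y : ℝ≥0∞} : x ^ 2 ≤ y ↔ x ≤ y ^ ((1 : ℝ) / 2) := by
  rw [one_div, ENNReal.le_rpow_inv_iff (by norm_num), ENNReal.rpow_two]

omit [MeasurableSpace (PathSp n)] [BorelSpace (PathSp n)] in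
theorem sectionBall_eq_of_closedBall_subset {A : Set (ℝ × (Fin n → ℝ))} {q : ℝ × (Fin n → ℝ)}
    {h : ℝ} (hh : 0 ≤ h) (hsub : ∀ z ∈ Metric.closedBall q.2 h, (q.1, z) ∈ A) :
    ∫⁻ z, A.indicator (fun _ => (1 : ℝ≥0∞)) (q.1, z) *
      (Metric.closedBall q.2 h).indicator (fun _ => 1) z = ENNReal.ofReal ((2 * h) ^ n) := by
  rw [← volume_closedBall_pi q.2 hh, ← lintegral_indicator_one measurableSet_closedBall]
  refine lintegral_congr fun z => ?_
  by_cases hz : z ∈ Metric.closedBall q.2 h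
  · rw [Set.indicator_of_mem hz, Set.indicator_of_mem (hsub z hz), Set.indicator_of_mem hz]
    simp
  · rw [Set.indicator_of_notMem hz, Set.indicator_of_notMem hz, mul_zero]

theorem sq_lintegral_occMeas_le_of_isOpen (hH : Measurable H) {τ₀ τ₁ : ℝ}
    (hH0 : ∀ v ∈ Set.Ioc τ₀ τ₁, ∀ x, 0 ≤ H (v, x))
    (hM : ∀ v ∈ Set.Ioc τ₀ τ₁, ∀ x, |H (v, x)| ≤ M) {C : ℝ≥0∞}
    (hC : ∀ r : ℝ, 0 < r → r ≤ 1 → fourierEnergy P τ₀ τ₁ 0 r H ≤ C)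
    {A : Set (ℝ × (Fin n → ℝ))} (hA : IsOpen A) :
    (∫⁻ q, ENNReal.ofReal (H q) * A.indicator (fun _ => (1 : ℝ≥0∞)) q ∂(occMeas P τ₀ τ₁)) ^ 2 ≤
      volume A * (ENNReal.ofReal (Real.exp n) * C) := by
  set h : ℕ → ℝ := fun m => 1 / ((m : ℝ) + 1) with hh
  have h0 : ∀ m, 0 < h m := fun m => Nat.one_div_pos_of_nat
  have h1 : ∀ m, h m ≤ 1 := fun m => by
    rw [hh]
    exact div_le_one_of_le₀ (by linarith [(Nat.cast_nonneg m : (0 : ℝ) ≤ m)]) (by positivity)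
  have hlim : Tendsto h atTop (𝓝 0) := tendsto_one_div_add_atTop_nhds_zero_nat
  set S : ℕ → ℝ × (Fin n → ℝ) → ℝ≥0∞ := fun m q =>
    ∫⁻ z, A.indicator (fun _ => (1 : ℝ≥0∞)) (q.1, z) *
      (Metric.closedBall q.2 (h m)).indicator (fun _ => 1) z with hS
  set γ : ℕ → ℝ≥0∞ := fun m => ENNReal.ofReal ((2 * h m) ^ n) with hγ
  have hγ0 : ∀ m, γ m ≠ 0 := fun m => by
    have := h0 m
    simp only [hγ, ne_eq, ENNReal.ofReal_eq_zero, not_le]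
    positivity
  have hγt : ∀ m, γ m ≠ ⊤ := fun m => ENNReal.ofReal_ne_top
  have mS : ∀ m, Measurable (S m) := fun m => measurable_sectionBall hA.measurableSet (h m)
  have mHS : ∀ m, Measurable fun q => ENNReal.ofReal (H q) * S m q := fun m =>
    hH.ennreal_ofReal.mul (mS m)
  have mF : ∀ m, Measurable fun q => ENNReal.ofReal (H q) * S m q * (γ m)⁻¹ := fun m =>
    (mHS m).mul_const _
  have hbd : ∀ m, ∫⁻ q, ENNReal.ofReal (H q) * S m q * (γ m)⁻¹ ∂(occMeas P τ₀ τ₁) ≤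
      (volume A * (ENNReal.ofReal (Real.exp n) * C)) ^ ((1 : ℝ) / 2) := by
    intro m
    rw [← ENNReal.sq_le_iff_le_rpow_half, lintegral_mul_const _ (mHS m), mul_pow]
    have hkey := sq_lintegral_occMeas_sectionBall_le (P := P) hH hH0 hM hA.measurableSet (h0 m)
    have hen := hC (h m ^ 2) (pow_pos (h0 m) 2) (pow_le_one₀ (h0 m).le (h1 m))
    calc _ ≤ volume A * (γ m ^ 2 * (ENNReal.ofReal (Real.exp n) * C)) * (γ m)⁻¹ ^ 2 := by
          refine mul_le_mul_left (hkey.trans ?_) _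
          rw [hγ]
          simp only
          rw [← ENNReal.ofReal_pow (by have := h0 m; positivity)]
          gcongr
      _ = volume A * (ENNReal.ofReal (Real.exp n) * C) * (γ m * (γ m)⁻¹) ^ 2 := by ring
      _ = _ := by rw [ENNReal.mul_inv_cancel (hγ0 m) (hγt m)]; simp
  rw [ENNReal.sq_le_iff_le_rpow_half]
  calc _ ≤ ∫⁻ q, liminf (fun m => ENNReal.ofReal (H q) * S m q * (γ m)⁻¹) atTop
          ∂(occMeas P τ₀ τ₁) := by
        refine lintegral_mono fun q => ?_
        by_cases hq : q ∈ A
        · obtain ⟨ρ, hρ, hball⟩ := Metric.isOpen_iff.1 hA q hq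
          have hev : ∀ᶠ m in atTop, ENNReal.ofReal (H q) =
              ENNReal.ofReal (H q) * S m q * (γ m)⁻¹ := by
            filter_upwards [hlim.eventually (gt_mem_nhds hρ)] with m hm
            have : S m q = γ m := by
              refine sectionBall_eq_of_closedBall_subset (h0 m).le fun z hz => hball ?_
              rw [Metric.mem_ball, Prod.dist_eq]
              simp only [dist_self]
              exact max_lt hρ (lt_of_le_of_lt hz hm)
            rw [this, mul_assoc, ENNReal.mul_inv_cancel (hγ0 m) (hγt m), mul_one]
          rw [Set.indicator_of_mem hq, mul_one, (tendsto_const_nhds.congr' hev).liminf_eq]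
        · rw [Set.indicator_of_notMem hq, mul_zero]
          exact zero_le
    _ ≤ liminf (fun m => ∫⁻ q, ENNReal.ofReal (H q) * S m q * (γ m)⁻¹ ∂(occMeas P τ₀ τ₁)) atTop :=
        lintegral_liminf_le mF
    _ ≤ _ := liminf_le_of_frequently_le' (Frequently.of_forall hbd)

theorem sq_lintegral_occMeas_le (hH : Measurable H) {τ₀ τ₁ : ℝ}
    (hH0 : ∀ v ∈ Set.Ioc τ₀ τ₁, ∀ x, 0 ≤ H (v, x))
    (hM : ∀ v ∈ Set.Ioc τ₀ τ₁, ∀ x, |H (v, x)| ≤ M) {C : ℝ≥0∞} (hC0 : C ≠ 0) (hCt : C ≠ ⊤)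
    (hC : ∀ r : ℝ, 0 < r → r ≤ 1 → fourierEnergy P τ₀ τ₁ 0 r H ≤ C)
    (A : Set (ℝ × (Fin n → ℝ))) :
    (∫⁻ q, ENNReal.ofReal (H q) * A.indicator (fun _ => (1 : ℝ≥0∞)) q ∂(occMeas P τ₀ τ₁)) ^ 2 ≤
      volume A * (ENNReal.ofReal (Real.exp n) * C) := by
  have e0 : ENNReal.ofReal (Real.exp n) * C ≠ 0 := mul_ne_zero (by
    rw [ne_eq, ENNReal.ofReal_eq_zero, not_le]; positivity) hC0
  have et : ENNReal.ofReal (Real.exp n) * C ≠ ⊤ := ENNReal.mul_ne_top ENNReal.ofReal_ne_top hCt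
  rw [← ENNReal.div_le_iff_le_mul (Or.inl e0) (Or.inl et), Set.measure_eq_iInf_isOpen A]
  refine le_iInf₂ fun U hU => le_iInf fun hUo => ?_
  rw [ENNReal.div_le_iff_le_mul (Or.inl e0) (Or.inl et)]
  refine le_trans ?_ (sq_lintegral_occMeas_le_of_isOpen hH hH0 hM hC hUo)
  gcongr

end OccupationBound

section LocalEnergy

open scoped ENNReal NNReal

variable {n : ℕ}

theorem exists_contDiff_bump {K U : Set (Fin n → ℝ)} (hK : IsCompact K) (hU : IsOpen U)
    (hKU : K ⊆ U) : ∃ χ : (Fin n → ℝ) → ℝ, ContDiff ℝ 3 χ ∧ HasCompactSupport χ ∧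
      tsupport χ ⊆ U ∧ (∀ x, 0 ≤ χ x) ∧ (∀ x, χ x ≤ 1) ∧ ∀ x ∈ K, χ x = 1 := by
  obtain ⟨L, hL, hKL, hLU⟩ := exists_compact_between hK hU hKU
  obtain ⟨f, hf1, hf0, hf⟩ := exists_contMDiffMap_one_nhds_of_subset_interior
    (modelWithCornersSelf ℝ (Fin n → ℝ)) (n := 3) hK.isClosed hKL
  have hsupp : tsupport f ⊆ L :=
    closure_minimal (fun x hx => by_contra fun hxL => hx (hf0 x hxL)) hL.isClosed
  exact ⟨f, contMDiff_iff_contDiff.1 f.contMDiff, hL.of_isClosed_subset (isClosed_tsupport _) hsupp,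
    hsupp.trans hLU, fun x => (hf x).1, fun x => (hf x).2,
    fun x hx => (hf1.self_of_nhdsSet x hx)⟩

theorem norm_sq_le_dotProduct_self (ξ : Fin n → ℝ) : ‖ξ‖ ^ 2 ≤ ξ ⬝ᵥ ξ := by
  have h : ‖ξ‖ ≤ √(ξ ⬝ᵥ ξ) := by
    refine (pi_norm_le_iff_of_nonneg (Real.sqrt_nonneg _)).2 fun i => ?_
    rw [Real.norm_eq_abs]
    refine Real.abs_le_sqrt ?_
    rw [sq]
    exact Finset.single_le_sum (f := fun i => ξ i * ξ i) (fun i _ => mul_self_nonneg _)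
      (Finset.mem_univ i)
  calc _ ≤ √(ξ ⬝ᵥ ξ) ^ 2 := pow_le_pow_left₀ (norm_nonneg _) h 2
    _ = _ := Real.sq_sqrt (dotProduct_self_nonneg_real ξ)

theorem exists_lintegral_freqWt_le (n : ℕ) : ∃ J : ℝ≥0∞, J ≠ ⊤ ∧ ∀ k, n + 1 ≤ k → ∀ r : ℝ, 0 < r →
    ∫⁻ ξ : Fin n → ℝ, ENNReal.ofReal (freqWt k r ξ) ≤ J := by
  have hI := integrable_rpow_neg_one_add_norm_sq (E := Fin n → ℝ) (μ := volume)
    (r := 2 * ((n : ℝ) + 1)) (by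
      rw [Module.finrank_fin_fun]
      linarith [(Nat.cast_nonneg n : (0 : ℝ) ≤ n)])
  refine ⟨_, hI.lintegral_lt_top.ne, fun k hk r hr => lintegral_mono fun ξ => ?_⟩
  refine ENNReal.ofReal_le_ofReal ?_
  have hq := dotProduct_self_nonneg_real ξ
  have hexp : -(2 * ((n : ℝ) + 1)) / 2 = -((n + 1 : ℕ) : ℝ) := by push_cast; ring
  rw [hexp, Real.rpow_neg (by positivity), Real.rpow_natCast]
  unfold freqWt
  calc _ ≤ ((1 + ξ ⬝ᵥ ξ) ^ k)⁻¹ := mul_le_of_le_one_right (by positivity)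
        (Real.exp_le_one_iff.2 (by nlinarith))
    _ ≤ _ := by
        refine inv_anti₀ (by positivity) ?_
        calc (1 + ‖ξ‖ ^ 2) ^ (n + 1) ≤ (1 + ξ ⬝ᵥ ξ) ^ (n + 1) :=
              pow_le_pow_left₀ (by positivity) (by linarith [norm_sq_le_dotProduct_self ξ]) _
          _ ≤ _ := pow_le_pow_right₀ (by linarith) hk

theorem exists_ellipticity_const (A : Matrix (Fin n) (Fin n) ℝ)
    (hA : ∀ θ : Fin n → ℝ, θ ≠ 0 → 0 < θ ⬝ᵥ A.mulVec θ) :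
    ∃ c : ℝ, 0 < c ∧ c ≤ 1 ∧
      ∀ ξ : Fin n → ℝ, c * (ξ ⬝ᵥ ξ) ≤ 1 / 2 * (∑ i, ∑ i', ξ i * ξ i' * A i i') := by
  have hsum : ∀ ξ : Fin n → ℝ, ξ ⬝ᵥ A.mulVec ξ = ∑ i, ∑ i', ξ i * ξ i' * A i i' := fun ξ => by
    simp only [dotProduct, mulVec, Finset.mul_sum]
    exact Finset.sum_congr rfl fun i _ => Finset.sum_congr rfl fun j _ => by ring
  have hcont : Continuous fun ξ : Fin n → ℝ => ∑ i, ∑ i', ξ i * ξ i' * A i i' := by fun_prop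
  obtain ⟨m, hm, hmin⟩ : ∃ m : ℝ, 0 < m ∧ ∀ ξ : Fin n → ℝ, ‖ξ‖ = 1 →
      m ≤ ∑ i, ∑ i', ξ i * ξ i' * A i i' := by
    rcases (Metric.sphere (0 : Fin n → ℝ) 1).eq_empty_or_nonempty with he | hne
    · refine ⟨1, one_pos, fun ξ hξ => ?_⟩
      have : ξ ∈ Metric.sphere (0 : Fin n → ℝ) 1 := by simpa using hξ
      simp [he] at this
    · obtain ⟨ξ₀, h0, hmin⟩ := (isCompact_sphere (0 : Fin n → ℝ) 1).exists_isMinOn hne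
        hcont.continuousOn
      refine ⟨_, ?_, fun ξ hξ => hmin (by simpa using hξ)⟩
      refine lt_of_lt_of_eq (hA ξ₀ fun h => ?_) (hsum ξ₀)
      rw [h] at h0
      simp at h0
  have hn : (0 : ℝ) < n + 1 := by positivity
  refine ⟨min 1 (m / (2 * (n + 1))), lt_min one_pos (by positivity), min_le_left _ _, fun ξ => ?_⟩
  have hq := dotProduct_self_nonneg_real ξ
  rcases eq_or_ne ξ 0 with rfl | hξ
  · simp
  have hnorm : 0 < ‖ξ‖ := norm_pos_iff.2 hξ
  have h1 := hmin (‖ξ‖⁻¹ • ξ) (by rw [norm_smul, norm_inv, norm_norm, inv_mul_cancel₀ hnorm.ne'])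
  have h2 : ∑ i, ∑ i', (‖ξ‖⁻¹ • ξ) i * (‖ξ‖⁻¹ • ξ) i' * A i i' =
      (‖ξ‖ ^ 2)⁻¹ * ∑ i, ∑ i', ξ i * ξ i' * A i i' := by
    simp only [Pi.smul_apply, smul_eq_mul, Finset.mul_sum]
    exact Finset.sum_congr rfl fun i _ => Finset.sum_congr rfl fun j _ => by
      rw [← inv_pow]; ring
  rw [h2, inv_mul_eq_div, le_div_iff₀ (by positivity)] at h1
  have h3 : ξ ⬝ᵥ ξ ≤ (n + 1) * ‖ξ‖ ^ 2 :=
    (dotProduct_self_le_card_mul_norm_sq ξ).trans (by nlinarith [sq_nonneg ‖ξ‖])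
  calc min 1 (m / (2 * (n + 1))) * (ξ ⬝ᵥ ξ) ≤ m / (2 * (n + 1)) * ((n + 1) * ‖ξ‖ ^ 2) :=
        mul_le_mul (min_le_right _ _) h3 hq (by positivity)
    _ = 1 / 2 * (m * ‖ξ‖ ^ 2) := by field_simp
    _ ≤ _ := by linarith

variable [MeasurableSpace (PathSp n)] [BorelSpace (PathSp n)]
  {a : ℝ → (Fin n → ℝ) → Matrix (Fin n) (Fin n) ℝ} {b : ℝ → (Fin n → ℝ) → Fin n → ℝ}
  {B τ₀ τ₁ : ℝ} {a₀ : Matrix (Fin n) (Fin n) ℝ}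

theorem exists_fourierEnergy_timeCut_bound (hτ : 0 ≤ τ₀)
    (hc : BoundedCoeff n a b B) (hsym : ∀ u x, (a u x).IsSymm)
    (h01 : τ₀ ≤ τ₁) (h11 : τ₁ ≤ τ₀ + 1) {c₀ : ℝ} (hc₀ : 0 < c₀) (hc₁ : c₀ ≤ 1)
    (hell : ∀ ξ : Fin n → ℝ, c₀ * (ξ ⬝ᵥ ξ) ≤ 1 / 2 * (∑ i, ∑ i', ξ i * ξ i' * a₀ i i'))
    {ε : ℝ} (hε : 3 * (c₀ ^ 2)⁻¹ * (n * (n * ε ^ 2)) ≤ 1 / 2) {U : Set (Fin n → ℝ)}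
    (hU : IsOpen U)
    (hclose : ∀ v ∈ Set.Ioc τ₀ τ₁, ∀ x ∈ U, ∀ i i', |a₀ i i' - a v x i i'| ≤ ε) (j : ℕ) :
    ∀ k, n + 1 ≤ k + j → ∀ χ : (Fin n → ℝ) → ℝ, ContDiff ℝ 3 χ → HasCompactSupport χ →
      tsupport χ ⊆ U → (∀ x, 0 ≤ χ x) → ∃ C : ℝ≥0∞, C ≠ ⊤ ∧
        ∀ P : Measure (PathSp n), IsProbabilityMeasure P → ExpMart a b τ₀ P → ∀ r : ℝ, 0 < r →
          fourierEnergy P τ₀ τ₁ k r (timeCut τ₀ j χ) ≤ C := by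
  induction j with
  | zero =>
    intro k hk χ hχ hs hχU hχ0
    obtain ⟨K, hT⟩ := exists_taylorBound hχ hs
    obtain ⟨J, hJ, hJle⟩ := exists_lintegral_freqWt_le n
    refine ⟨J * ENNReal.ofReal (2 * K ^ 2) * ENNReal.ofReal (τ₁ - τ₀),
      ENNReal.mul_ne_top (ENNReal.mul_ne_top hJ ENNReal.ofReal_ne_top) ENNReal.ofReal_ne_top,
      fun P _ _ r hr => ?_⟩
    refine fourierEnergy_le (fun v _ x => ?_) k
      (hJle k (by simpa using hk) r hr)
    simpa [timeCut] using hT.bound x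
  | succ j ih =>
    intro k hk χ hχ hs hχU hχ0
    obtain ⟨K, hT⟩ := exists_taylorBound hχ hs
    obtain ⟨χ', hχ', hs', hχU', hχ0', -, hone⟩ := exists_contDiff_bump hs hU hχU
    obtain ⟨K', hT'⟩ := exists_taylorBound hχ' hs'
    obtain ⟨C, hC, hCle⟩ := ih (k + 1) (by omega) χ' hχ' hs' hχU' hχ0'
    refine ⟨ENNReal.ofReal (6 * (c₀ ^ 2)⁻¹ * ((n + 1) * waveConst n B K j ^ 2)) * C,
      ENNReal.mul_ne_top ENNReal.ofReal_ne_top hC, fun P _ hP r hr => ?_⟩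
    refine (hP.fourierEnergy_timeCut_succ_le_of_close hτ hc hsym hχ hs hT hχ0 h01 h11 hc₀ hc₁
      hell hε (fun v hv x hx => hclose v hv x (hχU hx)) hT' hχ0' hone j k hr).trans ?_
    exact mul_le_mul_right (hCle P ‹_› hP r hr) _

end LocalEnergy

section CompactOccupation

open scoped ENNReal NNReal

variable {n : ℕ} [MeasurableSpace (PathSp n)]
  {a : ℝ → (Fin n → ℝ) → Matrix (Fin n) (Fin n) ℝ} {b : ℝ → (Fin n → ℝ) → Fin n → ℝ}
  {B s : ℝ}

theorem ExpMart.mono {s₀ s₁ : ℝ} {P : Measure (PathSp n)} (h : ExpMart a b s₀ P) (h01 : s₀ ≤ s₁) :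
    ExpMart a b s₁ P := fun θ s t hs hst Z hZ => h θ s t (h01.trans hs) hst Z hZ

variable [BorelSpace (PathSp n)]

theorem occMeas_apply {P : Measure (PathSp n)} [SFinite P] (τ₀ τ₁ : ℝ)
    {A : Set (ℝ × (Fin n → ℝ))} (hA : MeasurableSet A) :
    occMeas P τ₀ τ₁ A =
      ∫⁻ v in Set.Ioc τ₀ τ₁, ∫⁻ ω, A.indicator (fun _ => (1 : ℝ≥0∞)) (v, Xcan n v ω) ∂P := by
  rw [← lintegral_occMeas τ₀ τ₁ (measurable_const.indicator hA), lintegral_indicator hA]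
  simp

theorem occMeas_le_occMeas {P : Measure (PathSp n)} [SFinite P] {τ₀ τ₁ : ℝ} (s T : ℝ)
    {A : Set (ℝ × (Fin n → ℝ))} (hA : MeasurableSet A) (hsub : ∀ q ∈ A, q.1 ∈ Set.Ioc τ₀ τ₁) :
    occMeas P s T A ≤ occMeas P τ₀ τ₁ A := by
  rw [occMeas_apply s T hA, occMeas_apply τ₀ τ₁ hA, ← lintegral_indicator (s := Set.Ioc τ₀ τ₁)
    measurableSet_Ioc (fun v => ∫⁻ ω, A.indicator (fun _ => (1 : ℝ≥0∞)) (v, Xcan n v ω) ∂P)]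
  refine (setLIntegral_le_lintegral _ _).trans (lintegral_mono fun v => ?_)
  by_cases hv : v ∈ Set.Ioc τ₀ τ₁
  · rw [Set.indicator_of_mem hv]
  · rw [Set.indicator_of_notMem hv, nonpos_iff_eq_zero]
    refine (lintegral_congr fun ω => ?_).trans lintegral_zero
    exact Set.indicator_of_notMem (fun h => hv (hsub _ h)) _

theorem exists_local_occMeas_bound (hc : BoundedCoeff n a b B) (hsym : ∀ u x, (a u x).IsSymm)
    (hcont : Continuous fun p : ℝ × (Fin n → ℝ) => a p.1 p.2)
    (hell : ∀ u x (θ : Fin n → ℝ), θ ≠ 0 → 0 < θ ⬝ᵥ (a u x).mulVec θ) (hs : 0 ≤ s)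
    {p₀ : ℝ × (Fin n → ℝ)} (hp₀ : s < p₀.1) :
    ∃ W : Set (ℝ × (Fin n → ℝ)), p₀ ∈ W ∧ IsOpen W ∧ ∃ C : ℝ≥0∞, C ≠ ⊤ ∧
      ∀ P : Measure (PathSp n), IsProbabilityMeasure P → ExpMart a b s P → ∀ T : ℝ,
        ∀ A : Set (ℝ × (Fin n → ℝ)), MeasurableSet A → A ⊆ W →
          occMeas P s T A ≤ C * volume A ^ ((1 : ℝ) / 2) := by
  obtain ⟨v₀, x₀⟩ := p₀
  simp only at hp₀
  obtain ⟨c₀, hc₀, hc₁, hell₀⟩ := exists_ellipticity_const (a v₀ x₀) (hell v₀ x₀)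
  set ε : ℝ := c₀ / (3 * (n + 1)) with hε
  have hn : (0 : ℝ) ≤ n := Nat.cast_nonneg n
  have hε0 : 0 < ε := by positivity
  have hεle : 3 * (c₀ ^ 2)⁻¹ * (n * (n * ε ^ 2)) ≤ 1 / 2 := by
    have e : 3 * (c₀ ^ 2)⁻¹ * (n * (n * ε ^ 2)) = (n : ℝ) ^ 2 / (3 * (n + 1) ^ 2) := by
      rw [hε]; field_simp
    rw [e, div_le_iff₀ (by positivity)]
    nlinarith
  have hev : ∀ᶠ p : ℝ × (Fin n → ℝ) in 𝓝 (v₀, x₀), ∀ i i',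
      |a v₀ x₀ i i' - a p.1 p.2 i i'| < ε := by
    rw [eventually_all]
    intro i
    rw [eventually_all]
    intro i'
    have h1 : Continuous fun p : ℝ × (Fin n → ℝ) => |a v₀ x₀ i i' - a p.1 p.2 i i'| :=
      (continuous_const.sub (hcont.matrix_elem i i')).abs
    exact h1.continuousAt.eventually_lt continuousAt_const (by simpa using hε0)
  obtain ⟨ρ, hρ, hball⟩ := Metric.eventually_nhds_iff_ball.1 hev
  set δ : ℝ := min (ρ / 2) (min ((v₀ - s) / 2) (1 / 4)) with hδ
  have hδ0 : 0 < δ := lt_min (by positivity) (lt_min (by linarith) (by norm_num))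
  have hδ1 : δ ≤ ρ / 2 := min_le_left _ _
  have hδ2 : δ ≤ (v₀ - s) / 2 := (min_le_right _ _).trans (min_le_left _ _)
  have hδ3 : δ ≤ 1 / 4 := (min_le_right _ _).trans (min_le_right _ _)
  obtain ⟨χ, hχ, hχs, hχU, hχ0, -, hχ1⟩ := exists_contDiff_bump
    (isCompact_closedBall x₀ (δ / 2)) (Metric.isOpen_ball (x := x₀) (ε := δ))
    (Metric.closedBall_subset_ball (by linarith))
  have hclose : ∀ v ∈ Set.Ioc (v₀ - δ) (v₀ + δ), ∀ x ∈ Metric.ball x₀ δ, ∀ i i',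
      |a v₀ x₀ i i' - a v x i i'| ≤ ε := by
    intro v hv x hx i i'
    refine (hball (v, x) ?_ i i').le
    rw [Metric.mem_ball, Prod.dist_eq, max_lt_iff]
    constructor
    · simp only [Real.dist_eq]
      rw [abs_lt]
      constructor <;> linarith [hv.1, hv.2]
    · simp only
      rw [Metric.mem_ball] at hx
      linarith
  obtain ⟨C, hC, hCle⟩ := exists_fourierEnergy_timeCut_bound (b := b) (τ₀ := v₀ - δ)
    (τ₁ := v₀ + δ) (by linarith) hc hsym (by linarith) (by linarith) hc₀ hc₁ hell₀ hεle
    Metric.isOpen_ball hclose (n + 1) 0 (by simp) χ hχ hχs hχU hχ0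
  obtain ⟨K, hT⟩ := exists_taylorBound hχ hχs
  set d : ℝ≥0∞ := ENNReal.ofReal ((δ / 2) ^ (n + 1)) with hd
  have hd0 : d ≠ 0 := by
    rw [hd, ne_eq, ENNReal.ofReal_eq_zero, not_le]; positivity
  set E : ℝ≥0∞ := (ENNReal.ofReal (Real.exp n) * (C + 1)) ^ ((1 : ℝ) / 2) with hE
  have hEt : E ≠ ⊤ := ENNReal.rpow_ne_top_of_nonneg (by norm_num)
    (ENNReal.mul_ne_top ENNReal.ofReal_ne_top (ENNReal.add_ne_top.2 ⟨hC, ENNReal.one_ne_top⟩))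
  refine ⟨Metric.ball (v₀, x₀) (δ / 2), Metric.mem_ball_self (by positivity), Metric.isOpen_ball,
    d⁻¹ * E, ENNReal.mul_ne_top (ENNReal.inv_ne_top.2 hd0) hEt, fun P _ hP T A hA hAW => ?_⟩
  have hW : ∀ q ∈ A, (v₀ - δ / 2 < q.1 ∧ q.1 < v₀ + δ / 2) ∧ dist q.2 x₀ < δ / 2 := by
    intro q hq
    have := hAW hq
    rw [Metric.mem_ball, Prod.dist_eq, max_lt_iff, Real.dist_eq, abs_lt] at this
    exact ⟨⟨by linarith [this.1.1], by linarith [this.1.2]⟩, this.2⟩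
  refine (occMeas_le_occMeas (τ₀ := v₀ - δ) (τ₁ := v₀ + δ) s T hA fun q hq =>
    ⟨by linarith [(hW q hq).1.1], by linarith [(hW q hq).1.2]⟩).trans ?_
  have hv0 : ∀ v ∈ Set.Ioc (v₀ - δ) (v₀ + δ), 0 ≤ v - (v₀ - δ) := fun v hv => by linarith [hv.1]
  have hv1 : ∀ v ∈ Set.Ioc (v₀ - δ) (v₀ + δ), v - (v₀ - δ) ≤ 1 := fun v hv => by linarith [hv.2]
  have key := sq_lintegral_occMeas_le (P := P) (measurable_timeCut hT.cont (v₀ - δ) (n + 1))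
    (τ₀ := v₀ - δ) (τ₁ := v₀ + δ) (M := K)
    (fun v hv x => mul_nonneg (pow_nonneg (hv0 v hv) _) (hχ0 x))
    (fun v hv x => by
      unfold timeCut
      rw [abs_mul, abs_of_nonneg (pow_nonneg (hv0 v hv) (n + 1))]
      exact (pow_mul_le_self_of_le_one (hv0 v hv) (hv1 v hv) (abs_nonneg _) _).trans (hT.bound x))
    (C := C + 1) (by simp) (ENNReal.add_ne_top.2 ⟨hC, ENNReal.one_ne_top⟩)
    (fun r hr _ => (hCle P ‹_› (hP.mono (by linarith)) r hr).trans le_self_add) A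
  rw [ENNReal.sq_le_iff_le_rpow_half, ENNReal.mul_rpow_of_nonneg _ _ (by norm_num)] at key
  rw [mul_assoc, ← ENNReal.mul_le_iff_le_inv hd0 ENNReal.ofReal_ne_top, mul_comm E]
  refine le_trans ?_ key
  have e1 : occMeas P (v₀ - δ) (v₀ + δ) A =
      ∫⁻ q, A.indicator (fun _ => (1 : ℝ≥0∞)) q ∂(occMeas P (v₀ - δ) (v₀ + δ)) := by
    rw [lintegral_indicator hA]; simp
  rw [e1, ← lintegral_const_mul' _ _ ENNReal.ofReal_ne_top]
  refine lintegral_mono fun q => ?_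
  by_cases hq : q ∈ A
  · obtain ⟨⟨h1, h2⟩, h3⟩ := hW q hq
    refine mul_le_mul_left (ENNReal.ofReal_le_ofReal ?_) _
    unfold timeCut
    rw [hχ1 q.2 h3.le, mul_one]
    exact pow_le_pow_left₀ (by positivity) (by linarith) _
  · simp [hq]

theorem exists_compact_occMeas_bound (hc : BoundedCoeff n a b B) (hsym : ∀ u x, (a u x).IsSymm)
    (hcont : Continuous fun p : ℝ × (Fin n → ℝ) => a p.1 p.2)
    (hell : ∀ u x (θ : Fin n → ℝ), θ ≠ 0 → 0 < θ ⬝ᵥ (a u x).mulVec θ) (hs : 0 ≤ s)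
    {K : Set (ℝ × (Fin n → ℝ))} (hK : IsCompact K) (hKs : ∀ p ∈ K, s < p.1) :
    ∃ C : ℝ≥0∞, C ≠ ⊤ ∧
      ∀ P : Measure (PathSp n), IsProbabilityMeasure P → ExpMart a b s P → ∀ T : ℝ,
        ∀ A : Set (ℝ × (Fin n → ℝ)), MeasurableSet A → A ⊆ K →
          occMeas P s T A ≤ C * volume A ^ ((1 : ℝ) / 2) := by
  suffices h : ∃ S : Set (ℝ × (Fin n → ℝ)), MeasurableSet S ∧ K ⊆ S ∧ ∃ C : ℝ≥0∞, C ≠ ⊤ ∧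
      ∀ P : Measure (PathSp n), IsProbabilityMeasure P → ExpMart a b s P → ∀ T : ℝ,
        ∀ A : Set (ℝ × (Fin n → ℝ)), MeasurableSet A → A ⊆ S →
          occMeas P s T A ≤ C * volume A ^ ((1 : ℝ) / 2) by
    obtain ⟨S, -, hKS, C, hC, h⟩ := h
    exact ⟨C, hC, fun P hP hm T A hA hAK => h P hP hm T A hA (hAK.trans hKS)⟩
  refine hK.induction_on (p := fun K => ∃ S : Set (ℝ × (Fin n → ℝ)), MeasurableSet S ∧ K ⊆ S ∧
      ∃ C : ℝ≥0∞, C ≠ ⊤ ∧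
      ∀ P : Measure (PathSp n), IsProbabilityMeasure P → ExpMart a b s P → ∀ T : ℝ,
        ∀ A : Set (ℝ × (Fin n → ℝ)), MeasurableSet A → A ⊆ S →
          occMeas P s T A ≤ C * volume A ^ ((1 : ℝ) / 2)) ?_ ?_ ?_ ?_
  · refine ⟨∅, MeasurableSet.empty, subset_rfl, 0, ENNReal.zero_ne_top, fun P _ _ T A _ hA => ?_⟩
    rw [Set.subset_empty_iff.1 hA]
    simp
  · rintro K₁ K₂ h12 ⟨S, hS, hKS, h⟩
    exact ⟨S, hS, h12.trans hKS, h⟩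
  · rintro K₁ K₂ ⟨S₁, hS₁, hK₁, C₁, hC₁, h₁⟩ ⟨S₂, hS₂, hK₂, C₂, hC₂, h₂⟩
    refine ⟨S₁ ∪ S₂, hS₁.union hS₂, Set.union_subset_union hK₁ hK₂, C₁ + C₂,
      ENNReal.add_ne_top.2 ⟨hC₁, hC₂⟩, fun P hP hm T A hA hAS => ?_⟩
    have hsplit : A = A ∩ S₁ ∪ A ∩ S₂ := by
      rw [← Set.inter_union_distrib_left, Set.inter_eq_left.2 hAS]
    calc occMeas P s T A ≤ occMeas P s T (A ∩ S₁) + occMeas P s T (A ∩ S₂) := by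
          conv_lhs => rw [hsplit]
          exact measure_union_le _ _
      _ ≤ C₁ * volume A ^ ((1 : ℝ) / 2) + C₂ * volume A ^ ((1 : ℝ) / 2) := by
          refine add_le_add
            ((h₁ P hP hm T _ (hA.inter hS₁) Set.inter_subset_right).trans ?_)
            ((h₂ P hP hm T _ (hA.inter hS₂) Set.inter_subset_right).trans ?_) <;>
          · gcongr
            exact Set.inter_subset_left
      _ = _ := by rw [add_mul]
  · intro p hp
    obtain ⟨W, hpW, hW, C, hC, h⟩ := exists_local_occMeas_bound hc hsym hcont hell hs (hKs p hp)
    exact ⟨W, mem_nhdsWithin_of_mem_nhds (hW.mem_nhds hpW), W, hW.measurableSet, subset_rfl, C,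
      hC, h⟩

end CompactOccupation

section DyadicChaining

open scoped ENNReal NNReal

theorem tendsto_natFloor_mul_two_pow_div (u : ℝ) (hu : 0 ≤ u) (m : ℕ) :
    Tendsto (fun k : ℕ => (⌊u * 2 ^ (m + k)⌋₊ : ℝ) / 2 ^ (m + k)) atTop (𝓝 u) := by
  have h1 : Tendsto (fun k : ℕ => (2 : ℝ) ^ (m + k)) atTop atTop :=
    (tendsto_pow_atTop_atTop_of_one_lt one_lt_two).comp
      (tendsto_atTop_mono (fun k => Nat.le_add_left k m) tendsto_id)
  exact (tendsto_nat_floor_mul_div_atTop hu).comp h1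

theorem natFloor_mul_two_pow_succ (u : ℝ) (hu : 0 ≤ u) (m : ℕ) :
    ⌊u * 2 ^ (m + 1)⌋₊ = 2 * ⌊u * 2 ^ m⌋₊ ∨ ⌊u * 2 ^ (m + 1)⌋₊ = 2 * ⌊u * 2 ^ m⌋₊ + 1 := by
  have h0 : 0 ≤ u * 2 ^ m := by positivity
  have h1 := Nat.floor_le h0
  have h2 := Nat.lt_floor_add_one (u * 2 ^ m)
  have h3 : 2 * ⌊u * 2 ^ m⌋₊ ≤ ⌊u * 2 ^ (m + 1)⌋₊ := by
    refine Nat.le_floor ?_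
    push_cast; rw [pow_succ]; linarith
  have h4 : ⌊u * 2 ^ (m + 1)⌋₊ < 2 * ⌊u * 2 ^ m⌋₊ + 2 := by
    refine (Nat.floor_lt (by positivity)).2 ?_
    push_cast; rw [pow_succ]; linarith
  omega

/-- A path whose dyadic increments on `[0, N)` are at most `(9/10)^m` from level `m₀` on has an
explicit modulus of continuity. -/
theorem norm_sub_le_of_dyadic {E : Type*} [NormedAddCommGroup E] {g : ℝ → E} (hg : Continuous g)
    {N m₀ : ℕ} (h : ∀ m, m₀ ≤ m → ∀ i : ℕ, i < N * 2 ^ m →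
      ‖g (((i + 1 : ℕ) : ℝ) / 2 ^ m) - g ((i : ℝ) / 2 ^ m)‖ ≤ (9 / 10) ^ m)
    {m : ℕ} (hm : m₀ ≤ m) {u v : ℝ} (hu : 0 ≤ u) (huv : u ≤ v) (hv : v < N)
    (hd : v - u ≤ (1 / 2) ^ m) : ‖g v - g u‖ ≤ 19 * (9 / 10) ^ m := by
  have key : ∀ w : ℝ, 0 ≤ w → w < N → dist (g ((⌊w * 2 ^ m⌋₊ : ℝ) / 2 ^ m)) (g w) ≤
      9 * (9 / 10) ^ m := by
    intro w hw hwN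
    have h1 := dist_le_of_le_geometric_of_tendsto₀ (9 / 10 : ℝ) ((9 / 10) ^ (m + 1)) (by norm_num)
      (f := fun k : ℕ => g ((⌊w * 2 ^ (m + k)⌋₊ : ℝ) / 2 ^ (m + k))) (fun k => ?_)
      ((hg.tendsto w).comp (tendsto_natFloor_mul_two_pow_div w hw m))
    · refine h1.trans (le_of_eq ?_)
      rw [pow_succ]; norm_num; ring
    · have hb : ((⌊w * 2 ^ (m + k)⌋₊ : ℝ) / 2 ^ (m + k)) =
          ((2 * ⌊w * 2 ^ (m + k)⌋₊ : ℕ) : ℝ) / 2 ^ (m + k + 1) := by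
        push_cast; rw [pow_succ]; field_simp
      have hlt : 2 * ⌊w * 2 ^ (m + k)⌋₊ < N * 2 ^ (m + k + 1) := by
        have : ⌊w * 2 ^ (m + k)⌋₊ < N * 2 ^ (m + k) := by
          refine (Nat.floor_lt (by positivity)).2 ?_
          push_cast
          gcongr
        rw [pow_succ]; nlinarith
      have hpow : (9 / 10 : ℝ) ^ (m + 1) * (9 / 10) ^ k = (9 / 10) ^ (m + k + 1) := by
        rw [← pow_add]; congr 1; ring
      show dist (g ((⌊w * 2 ^ (m + k)⌋₊ : ℝ) / 2 ^ (m + k)))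
        (g ((⌊w * 2 ^ (m + k + 1)⌋₊ : ℝ) / 2 ^ (m + k + 1))) ≤ _
      rw [hb, hpow]
      rcases natFloor_mul_two_pow_succ w hw (m + k) with h2 | h2
      · rw [h2, dist_self]; positivity
      · rw [h2, dist_comm, dist_eq_norm]
        exact h _ (by omega) _ hlt
  have hp : (0 : ℝ) < 2 ^ m := by positivity
  have hv0 : 0 ≤ v := hu.trans huv
  have hd' : v * 2 ^ m - u * 2 ^ m ≤ 1 := by
    rw [one_div, inv_pow, ← one_div, le_div_iff₀ hp] at hd; linarith
  have hfl : ⌊v * 2 ^ m⌋₊ = ⌊u * 2 ^ m⌋₊ ∨ ⌊v * 2 ^ m⌋₊ = ⌊u * 2 ^ m⌋₊ + 1 := by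
    have h3 : ⌊u * 2 ^ m⌋₊ ≤ ⌊v * 2 ^ m⌋₊ := Nat.floor_mono (by gcongr)
    have h4 : ⌊v * 2 ^ m⌋₊ < ⌊u * 2 ^ m⌋₊ + 2 := by
      refine (Nat.floor_lt (by positivity)).2 ?_
      push_cast
      linarith [Nat.lt_floor_add_one (u * 2 ^ m)]
    omega
  have hmid : dist (g ((⌊v * 2 ^ m⌋₊ : ℝ) / 2 ^ m)) (g ((⌊u * 2 ^ m⌋₊ : ℝ) / 2 ^ m)) ≤
      (9 / 10) ^ m := by
    rcases hfl with h5 | h5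
    · rw [h5, dist_self]; positivity
    · rw [h5, dist_eq_norm]
      refine h m hm _ ((Nat.floor_lt (by positivity)).2 ?_)
      push_cast
      gcongr
      exact huv.trans_lt hv
  have ku := key u hu (huv.trans_lt hv)
  have kv := key v (hu.trans huv) hv
  rw [dist_comm] at kv
  rw [← dist_eq_norm]
  linarith [dist_triangle4 (g v) (g ((⌊v * 2 ^ m⌋₊ : ℝ) / 2 ^ m))
    (g ((⌊u * 2 ^ m⌋₊ : ℝ) / 2 ^ m)) (g u)]

variable {n : ℕ}

/-- Paths in `[0,∞)` starting in the ball of radius `R` with a prescribed modulus of continuity. -/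
def modulusSet (n : ℕ) (R : ℝ) (M : ℕ → ℕ) : Set (↥(Set.Ici (0 : ℝ)) → (Fin n → ℝ)) :=
  {f | ‖f ⟨0, Set.mem_Ici.2 le_rfl⟩‖ ≤ R ∧ ∀ N m : ℕ, M N ≤ m → ∀ u v : ↥(Set.Ici (0 : ℝ)),
    u ≤ v → (v : ℝ) < N → (v : ℝ) - u ≤ (1 / 2) ^ m → ‖f v - f u‖ ≤ 19 * (9 / 10) ^ m}

theorem exists_modulus_delta (M : ℕ → ℕ) (x₀ : ↥(Set.Ici (0 : ℝ))) {ε : ℝ} (hε : 0 < ε) :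
    ∃ V ∈ 𝓝 x₀, ∀ x ∈ V, ∀ R, ∀ f ∈ modulusSet n R M, dist (f x₀) (f x) < ε := by
  obtain ⟨N, hN⟩ := exists_nat_gt ((x₀ : ℝ) + 1)
  have ht : Tendsto (fun m : ℕ => 19 * (9 / 10 : ℝ) ^ m) atTop (𝓝 (19 * 0)) :=
    (tendsto_pow_atTop_nhds_zero_of_lt_one (by norm_num) (by norm_num)).const_mul _
  rw [mul_zero] at ht
  obtain ⟨m, hmε, hmM⟩ := ((ht.eventually (gt_mem_nhds hε)).and (eventually_ge_atTop (M N))).exists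
  have hp1 : (1 / 2 : ℝ) ^ m ≤ 1 := pow_le_one₀ (by norm_num) (by norm_num)
  refine ⟨Metric.ball x₀ ((1 / 2) ^ m), Metric.ball_mem_nhds _ (by positivity), ?_⟩
  intro x hx R f hf
  rw [Metric.mem_ball, Subtype.dist_eq, Real.dist_eq] at hx
  have hx' := abs_lt.1 hx
  refine lt_of_le_of_lt ?_ hmε
  rcases le_total x₀ x with hle | hle
  · rw [dist_comm, dist_eq_norm]
    exact hf.2 N m hmM x₀ x hle (by linarith) (by linarith)
  · rw [dist_eq_norm]
    exact hf.2 N m hmM x x₀ hle (by linarith) (by linarith)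

theorem modulusSet_norm_le {R : ℝ} {M : ℕ → ℕ} {f : ↥(Set.Ici (0 : ℝ)) → (Fin n → ℝ)}
    (hf : f ∈ modulusSet n R M) (N : ℕ) (k : ℕ) : ∀ u : ↥(Set.Ici (0 : ℝ)), (u : ℝ) < N →
      (u : ℝ) ≤ k * (1 / 2) ^ M N → ‖f u‖ ≤ R + k * (19 * (9 / 10) ^ M N) := by
  induction k with
  | zero =>
    intro u _ hu
    have : u = ⟨0, Set.mem_Ici.2 le_rfl⟩ := by
      apply Subtype.ext; apply le_antisymm _ u.2; simpa using hu
    rw [this]; simpa using hf.1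
  | succ k ih =>
    intro u huN hu
    have hp : (0 : ℝ) < (1 / 2) ^ M N := by positivity
    have hu0 : (0 : ℝ) ≤ u := u.2
    push_cast at hu
    let w : ↥(Set.Ici (0 : ℝ)) := ⟨max (u - (1 / 2) ^ M N) 0, Set.mem_Ici.2 (le_max_right _ _)⟩
    have hwu : w ≤ u := Subtype.coe_le_coe.1 (max_le (by linarith) hu0)
    have h1 := ih w ((Subtype.coe_le_coe.2 hwu).trans_lt huN)
      (max_le (by linarith) (by positivity))
    have h2 := hf.2 N (M N) le_rfl w u hwu huN
      (by have : (u : ℝ) - (1 / 2) ^ M N ≤ w := le_max_left _ _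
          linarith)
    have h3 : ‖f u‖ ≤ ‖f w‖ + ‖f u - f w‖ := by
      simpa using norm_add_le (f w) (f u - f w)
    push_cast
    linarith

theorem isCompact_modulusSet (R : ℝ) (M : ℕ → ℕ) : IsCompact (modulusSet n R M) := by
  have hcl : IsClosed (modulusSet n R M) := by
    have : modulusSet n R M = {f | ‖f ⟨0, Set.mem_Ici.2 le_rfl⟩‖ ≤ R} ∩
        ⋂ (N : ℕ) (m : ℕ) (_ : M N ≤ m) (u : ↥(Set.Ici (0 : ℝ))) (v : ↥(Set.Ici (0 : ℝ)))
          (_ : u ≤ v) (_ : (v : ℝ) < N) (_ : (v : ℝ) - u ≤ (1 / 2) ^ m),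
          {f | ‖f v - f u‖ ≤ 19 * (9 / 10) ^ m} := by
      ext f; simp [modulusSet]
    rw [this]
    refine IsClosed.inter (isClosed_le (continuous_apply _).norm continuous_const) ?_
    refine isClosed_iInter fun N => isClosed_iInter fun m => isClosed_iInter fun _ =>
      isClosed_iInter fun u => isClosed_iInter fun v => isClosed_iInter fun _ =>
      isClosed_iInter fun _ => isClosed_iInter fun _ => ?_
    exact isClosed_le ((continuous_apply v).sub (continuous_apply u)).norm continuous_const
  have hb : ∀ u : ↥(Set.Ici (0 : ℝ)), ∃ C : ℝ, ∀ f ∈ modulusSet n R M, ‖f u‖ ≤ C := by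
    intro u
    obtain ⟨N, hN⟩ := exists_nat_gt (u : ℝ)
    obtain ⟨k, hk⟩ := exists_nat_ge ((u : ℝ) / (1 / 2) ^ M N)
    exact ⟨_, fun f hf => modulusSet_norm_le hf N k u hN ((div_le_iff₀ (by positivity)).1 hk)⟩
  choose C hC using hb
  refine (isCompact_univ_pi fun u => isCompact_closedBall (0 : Fin n → ℝ) (C u)).of_isClosed_subset
    hcl fun f hf u _ => ?_
  simpa using hC u f hf

theorem isCompact_modulusSet_paths (R : ℝ) (M : ℕ → ℕ) :
    IsCompact {ω : PathSp n | ⇑ω ∈ modulusSet n R M} := by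
  refine ArzelaAscoli.isCompact_of_equicontinuous _ ?_ ?_
  · convert isCompact_modulusSet (n := n) R M using 1
    ext f
    constructor
    · rintro ⟨ω, hω, rfl⟩; exact hω
    · intro hf
      have hfc : Continuous f := by
        rw [continuous_iff_continuousAt]
        intro x₀
        rw [Metric.continuousAt_iff']
        intro ε hε
        obtain ⟨V, hV, h⟩ := exists_modulus_delta (n := n) M x₀ hε
        filter_upwards [hV] with x hx
        rw [dist_comm]
        exact h x hx R f hf
      exact ⟨⟨f, hfc⟩, hf, rfl⟩
  · intro x₀
    rw [Metric.equicontinuousAt_iff_right]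
    intro ε hε
    obtain ⟨V, hV, h⟩ := exists_modulus_delta (n := n) M x₀ hε
    filter_upwards [hV] with x hx
    intro i
    exact h x hx R _ i.2

end DyadicChaining

section Tightness

open scoped ENNReal NNReal

variable {n : ℕ} [MeasurableSpace (PathSp n)] [BorelSpace (PathSp n)]

/-- Paths with some large dyadic increment of level `m` on `[0, N)`. -/
def dyadicBad (n N m : ℕ) : Set (PathSp n) :=
  ⋃ i ∈ Finset.range (N * 2 ^ m), {ω | (9 / 10) ^ m <
    ‖Xcan n (((i + 1 : ℕ) : ℝ) / 2 ^ m) ω - Xcan n ((i : ℝ) / 2 ^ m) ω‖}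

theorem measure_dyadicBad_le {P : Measure (PathSp n)} {C : ℝ}
    (h : ∀ s t : ℝ, 0 ≤ s → s ≤ t → t - s ≤ 1 →
      ∫⁻ ω, ENNReal.ofReal (‖Xcan n t ω - Xcan n s ω‖ ^ 4) ∂P ≤ ENNReal.ofReal (C * (t - s) ^ 2))
    (N m : ℕ) : P (dyadicBad n N m) ≤ ENNReal.ofReal (N * C * (5000 / 6561) ^ m) := by
  have h1 : ∀ i : ℕ, P {ω | (9 / 10) ^ m <
      ‖Xcan n (((i + 1 : ℕ) : ℝ) / 2 ^ m) ω - Xcan n ((i : ℝ) / 2 ^ m) ω‖} ≤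
      ENNReal.ofReal (C * ((1 / 2) ^ m) ^ 2 / ((9 / 10) ^ m) ^ 4) := by
    intro i
    have hdiff : ((i + 1 : ℕ) : ℝ) / 2 ^ m - (i : ℝ) / 2 ^ m = (1 / 2) ^ m := by
      push_cast
      rw [← sub_div, add_sub_cancel_left, one_div, one_div, inv_pow]
    have hpos : (0 : ℝ) < ((9 / 10) ^ m) ^ 4 := by positivity
    have hm : AEMeasurable (fun ω => ENNReal.ofReal
        (‖Xcan n (((i + 1 : ℕ) : ℝ) / 2 ^ m) ω - Xcan n ((i : ℝ) / 2 ^ m) ω‖ ^ 4)) P :=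
      ((((measurable_Xcan _).sub (measurable_Xcan _)).norm.pow_const 4).ennreal_ofReal).aemeasurable
    have h2 := meas_ge_le_lintegral_div hm (ε := ENNReal.ofReal (((9 / 10) ^ m) ^ 4))
      (by simpa using hpos) ENNReal.ofReal_ne_top
    have h3 := h ((i : ℝ) / 2 ^ m) (((i + 1 : ℕ) : ℝ) / 2 ^ m) (by positivity)
      (by rw [← sub_nonneg, hdiff]; positivity)
      (by rw [hdiff]; exact pow_le_one₀ (by norm_num) (by norm_num))
    rw [hdiff] at h3
    refine (measure_mono fun ω hω => ?_).trans (h2.trans ?_)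
    · exact ENNReal.ofReal_le_ofReal (pow_le_pow_left₀ (by positivity) (le_of_lt hω) 4)
    · rw [ENNReal.ofReal_div_of_pos hpos]
      exact ENNReal.div_le_div_right h3 _
  refine (measure_biUnion_finset_le _ _).trans ((Finset.sum_le_sum fun i _ => h1 i).trans ?_)
  rw [Finset.sum_const, Finset.card_range, nsmul_eq_mul, ← ENNReal.ofReal_natCast,
    ← ENNReal.ofReal_mul (by positivity)]
  refine ENNReal.ofReal_le_ofReal (le_of_eq ?_)
  push_cast
  have e1 : ((1 / 2 : ℝ) ^ m) ^ 2 = (1 / 4) ^ m := by rw [← pow_mul, mul_comm, pow_mul]; norm_num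
  have e2 : ((9 / 10 : ℝ) ^ m) ^ 4 = (6561 / 10000) ^ m := by
    rw [← pow_mul, mul_comm, pow_mul]; norm_num
  have e3 : (5000 / 6561 : ℝ) ^ m = 2 ^ m * (1 / 4) ^ m / (6561 / 10000) ^ m := by
    rw [← mul_pow, ← div_pow]; norm_num
  rw [e1, e2, e3]
  ring

theorem measure_iUnion_dyadicBad_le {P : Measure (PathSp n)} {C : ℝ} (hC : 0 ≤ C)
    (h : ∀ s t : ℝ, 0 ≤ s → s ≤ t → t - s ≤ 1 →
      ∫⁻ ω, ENNReal.ofReal (‖Xcan n t ω - Xcan n s ω‖ ^ 4) ∂P ≤ ENNReal.ofReal (C * (t - s) ^ 2))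
    (N m₀ : ℕ) : P (⋃ j, dyadicBad n N (m₀ + j)) ≤
      ENNReal.ofReal (N * C * (6561 / 1561) * (5000 / 6561) ^ m₀) := by
  have hs : HasSum (fun j : ℕ => N * C * (5000 / 6561) ^ m₀ * (5000 / 6561 : ℝ) ^ j)
      (N * C * (5000 / 6561) ^ m₀ * (1 - 5000 / 6561)⁻¹) :=
    (hasSum_geometric_of_lt_one (by norm_num) (by norm_num)).mul_left _
  refine (measure_iUnion_le _).trans ((ENNReal.tsum_le_tsum fun j =>
    measure_dyadicBad_le h N (m₀ + j)).trans (le_of_eq ?_))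
  have h2 : ∀ j : ℕ, ENNReal.ofReal (N * C * (5000 / 6561) ^ (m₀ + j)) =
      ENNReal.ofReal (N * C * (5000 / 6561) ^ m₀ * (5000 / 6561 : ℝ) ^ j) := by
    intro j; rw [pow_add]; ring_nf
  simp_rw [h2]
  rw [← ENNReal.ofReal_tsum_of_nonneg (fun j => by positivity) hs.summable, hs.tsum_eq]
  congr 1
  norm_num
  ring

/-- Kolmogorov's tightness criterion on path space. -/
theorem isTightMeasureSet_of_moment {S : Set (Measure (PathSp n))} {R C : ℝ} (hC : 0 ≤ C)
    (h0 : ∀ P ∈ S, ∀ᵐ ω ∂P, ‖Xcan n 0 ω‖ ≤ R)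
    (h : ∀ P ∈ S, ∀ s t : ℝ, 0 ≤ s → s ≤ t → t - s ≤ 1 →
      ∫⁻ ω, ENNReal.ofReal (‖Xcan n t ω - Xcan n s ω‖ ^ 4) ∂P ≤
        ENNReal.ofReal (C * (t - s) ^ 2)) : IsTightMeasureSet S := by
  rw [isTightMeasureSet_iff_exists_isCompact_measure_compl_le]
  intro ε hε
  obtain ⟨ε', hε'0, hε'⟩ := ENNReal.exists_pos_sum_of_countable hε.ne' ℕ
  have hM : ∀ N : ℕ, ∃ m₀ : ℕ, ENNReal.ofReal (N * C * (6561 / 1561) * (5000 / 6561) ^ m₀) ≤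
      ε' N := by
    intro N
    have ht : Tendsto (fun m : ℕ => N * C * (6561 / 1561) * (5000 / 6561 : ℝ) ^ m) atTop
        (𝓝 (N * C * (6561 / 1561) * 0)) :=
      (tendsto_pow_atTop_nhds_zero_of_lt_one (by norm_num) (by norm_num)).const_mul _
    rw [mul_zero] at ht
    obtain ⟨m, hm⟩ := (ht.eventually (gt_mem_nhds (NNReal.coe_pos.2 (hε'0 N)))).exists
    refine ⟨m, ?_⟩
    rw [← ENNReal.ofReal_coe_nnreal]
    exact ENNReal.ofReal_le_ofReal hm.le
  choose M hM using hM
  refine ⟨_, isCompact_modulusSet_paths (n := n) R M, fun P hP => ?_⟩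
  have hsub : {ω : PathSp n | ⇑ω ∈ modulusSet n R M}ᶜ ⊆
      {ω | ¬ ‖Xcan n 0 ω‖ ≤ R} ∪ ⋃ N, ⋃ j, dyadicBad n N (M N + j) := by
    intro ω hω
    by_contra hcon
    simp only [Set.mem_union, Set.mem_iUnion, not_or, not_exists, dyadicBad, Finset.mem_range,
      Set.mem_ofPred_eq, not_lt, not_not] at hcon
    refine hω ⟨?_, fun N m hm u v huv hv hd => ?_⟩
    · have := hcon.1
      simpa [Xcan] using this
    · have := norm_sub_le_of_dyadic (continuous_Xcan_time ω) (N := N) (m₀ := M N)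
        (fun m hm i hi => ?_) hm u.2 huv hv hd
      · have hX : ∀ w : ↥(Set.Ici (0 : ℝ)), Xcan n w ω = ω w := fun w => by
          unfold Xcan; congr 1; exact Subtype.ext (max_eq_left w.2)
        rwa [hX, hX] at this
      · obtain ⟨j, rfl⟩ := Nat.exists_eq_add_of_le hm
        exact hcon.2 N j i hi
  calc P _ ≤ _ := measure_mono hsub
    _ ≤ P {ω | ¬ ‖Xcan n 0 ω‖ ≤ R} + P (⋃ N, ⋃ j, dyadicBad n N (M N + j)) :=
        measure_union_le _ _
    _ ≤ 0 + ∑' N, (ε' N : ℝ≥0∞) := by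
        refine add_le_add (le_of_eq (h0 P hP)) ((measure_iUnion_le _).trans
          (ENNReal.tsum_le_tsum fun N => ?_))
        exact (measure_iUnion_dyadicBad_le hC (h P hP) N (M N)).trans (hM N)
    _ ≤ ε := by rw [zero_add]; exact hε'.le

variable {a : ℝ → (Fin n → ℝ) → Matrix (Fin n) (Fin n) ℝ} {b : ℝ → (Fin n → ℝ) → (Fin n → ℝ)}
  {B : ℝ}

/-- Laws solving the exponential martingale property, started from a bounded set, are tight. -/
theorem BoundedCoeff.isTightMeasureSet (hc : BoundedCoeff n a b B) (R : ℝ) :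
    IsTightMeasureSet {P : Measure (PathSp n) | IsProbabilityMeasure P ∧ ∃ s y, 0 ≤ s ∧ ‖y‖ ≤ R ∧
      (∀ᵐ ω ∂P, ∀ u ≤ s, Xcan n u ω = y) ∧ ExpMart a b s P} := by
  refine isTightMeasureSet_of_moment (R := R) (momentConst_nonneg n B 1 4) ?_ ?_
  · rintro P ⟨_, s, y, hs, hy, hfr, _⟩
    filter_upwards [hfr] with ω hω
    rw [hω 0 hs]; exact hy
  · rintro P ⟨hP, s, y, hs, hy, hfr, hE⟩ u v hu huv huv1
    refine (hE.lintegral_norm_pow_le_of_frozen hc hfr huv huv1 (by norm_num)).trans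
      (ENNReal.ofReal_le_ofReal (le_of_eq ?_))
    have : √(v - u) ^ 4 = (v - u) ^ 2 := by
      rw [show 4 = 2 * 2 from rfl, pow_mul, Real.sq_sqrt (by linarith)]
    rw [this]

end Tightness

section WeakConvergence

open scoped ENNReal NNReal

variable {Ω ι : Type*} [TopologicalSpace Ω] [MeasurableSpace Ω] [OpensMeasurableSpace Ω]
  {U : Filter ι} {P : ι → ProbabilityMeasure Ω} {P' : ProbabilityMeasure Ω}

theorem tendsto_integral_of_bounded_continuous (hP : Tendsto P U (𝓝 P')) {F : Ω → ℝ}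
    (hF : Continuous F) {M : ℝ} (hM : ∀ ω, |F ω| ≤ M) :
    Tendsto (fun i => ∫ ω, F ω ∂(P i : Measure Ω)) U (𝓝 (∫ ω, F ω ∂(P' : Measure Ω))) :=
  (ProbabilityMeasure.tendsto_iff_forall_integral_tendsto.1 hP)
    (BoundedContinuousFunction.ofNormedAddCommGroup F hF M hM)

/-- Lower semicontinuity of `P ↦ ∫ F dP` for nonnegative continuous `F`. -/
theorem lintegral_ofReal_le_of_tendsto [NeBot U] (hP : Tendsto P U (𝓝 P')) {F : Ω → ℝ}
    (hF : Continuous F) (hF0 : ∀ ω, 0 ≤ F ω) {K : ℝ≥0∞}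
    (hK : ∀ᶠ i in U, ∫⁻ ω, ENNReal.ofReal (F ω) ∂(P i : Measure Ω) ≤ K) :
    ∫⁻ ω, ENNReal.ofReal (F ω) ∂(P' : Measure Ω) ≤ K := by
  have hc : ∀ k : ℕ, Continuous fun ω => min (F ω) k := fun k => hF.min continuous_const
  have h0 : ∀ (k : ℕ) ω, 0 ≤ min (F ω) k := fun k ω => le_min (hF0 ω) k.cast_nonneg
  have hb : ∀ (k : ℕ) ω, |min (F ω) k| ≤ k := fun k ω => by
    rw [abs_of_nonneg (h0 k ω)]; exact min_le_right _ _
  have hconv : ∀ (k : ℕ) (R : ProbabilityMeasure Ω),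
      ∫⁻ ω, ENNReal.ofReal (min (F ω) k) ∂(R : Measure Ω) =
        ENNReal.ofReal (∫ ω, min (F ω) k ∂(R : Measure Ω)) := fun k R =>
    (ofReal_integral_eq_lintegral_ofReal (Integrable.of_bound (hc k).measurable.aestronglyMeasurable
      (k : ℝ) (ae_of_all _ (hb k))) (ae_of_all _ (h0 k))).symm
  have hk : ∀ k : ℕ, ∫⁻ ω, ENNReal.ofReal (min (F ω) k) ∂(P' : Measure Ω) ≤ K := by
    intro k
    rw [hconv]
    refine le_of_tendsto ((ENNReal.continuous_ofReal.tendsto _).comp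
      (tendsto_integral_of_bounded_continuous hP (hc k) (hb k))) ?_
    filter_upwards [hK] with i hi
    show ENNReal.ofReal (∫ ω, min (F ω) k ∂(P i : Measure Ω)) ≤ K
    rw [← hconv]
    exact (lintegral_mono fun ω => ENNReal.ofReal_le_ofReal (min_le_left _ _)).trans hi
  have hmono : Monotone fun (k : ℕ) ω => ENNReal.ofReal (min (F ω) k) := fun k l hkl ω =>
    ENNReal.ofReal_le_ofReal (min_le_min_left _ (Nat.cast_le.2 hkl))
  have hlim : ∀ ω, Tendsto (fun k : ℕ => ENNReal.ofReal (min (F ω) k)) atTop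
      (𝓝 (ENNReal.ofReal (F ω))) := by
    intro ω
    refine tendsto_const_nhds.congr' ?_
    filter_upwards [eventually_ge_atTop ⌈F ω⌉₊] with k hk
    rw [min_eq_left ((Nat.le_ceil _).trans (Nat.cast_le.2 hk))]
  exact le_of_tendsto (lintegral_tendsto_of_tendsto_of_monotone
    (fun k => ((hc k).measurable.ennreal_ofReal).aemeasurable)
    (ae_of_all _ fun ω => fun k l hkl => hmono hkl ω) (ae_of_all _ hlim)) (Eventually.of_forall hk)

omit [TopologicalSpace Ω] [MeasurableSpace Ω] [OpensMeasurableSpace Ω] in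
theorem tendsto_of_approx {x : ι → ℝ} {x' : ℝ} (h : ∀ ε : ℝ, 0 < ε → ∃ (z : ι → ℝ) (z' : ℝ),
    Tendsto z U (𝓝 z') ∧ (∀ᶠ i in U, |x i - z i| ≤ ε) ∧ |x' - z'| ≤ ε) : Tendsto x U (𝓝 x') := by
  rw [Metric.tendsto_nhds]
  intro ε hε
  obtain ⟨z, z', hz, h1, h2⟩ := h (ε / 4) (by positivity)
  filter_upwards [h1, Metric.tendsto_nhds.1 hz (ε / 4) (by positivity)] with i hi hz
  rw [Real.dist_eq] at hz ⊢
  have e : x i - x' = (x i - z i) + (z i - z') - (x' - z') := by ring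
  rw [e]
  linarith [abs_sub ((x i - z i) + (z i - z')) (x' - z'), abs_add_le (x i - z i) (z i - z')]

omit [TopologicalSpace Ω] [OpensMeasurableSpace Ω] in
theorem integrable_of_sq {μ : Measure Ω} [IsFiniteMeasure μ] {F : Ω → ℝ} (hF : Measurable F)
    {K : ℝ} (hK : ∫⁻ ω, ENNReal.ofReal (F ω ^ 2) ∂μ ≤ ENNReal.ofReal K) :
    Integrable (fun ω => F ω ^ 2) μ ∧ Integrable F μ ∧ ∫ ω, F ω ^ 2 ∂μ ≤ max K 0 := by
  have h2 : Integrable (fun ω => F ω ^ 2) μ := by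
    refine ⟨(hF.pow_const 2).aestronglyMeasurable, ?_⟩
    rw [hasFiniteIntegral_iff_ofReal (ae_of_all _ fun ω => sq_nonneg _)]
    exact hK.trans_lt ENNReal.ofReal_lt_top
  refine ⟨h2, ((integrable_const (1 : ℝ)).add h2).mono' hF.aestronglyMeasurable
    (ae_of_all _ fun ω => ?_), ?_⟩
  · show ‖F ω‖ ≤ 1 + F ω ^ 2
    rw [Real.norm_eq_abs, ← sq_abs]
    nlinarith [sq_nonneg (|F ω| - 1), sq_nonneg (|F ω|)]
  · rw [integral_eq_lintegral_of_nonneg_ae (ae_of_all _ fun ω => sq_nonneg _)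
      (hF.pow_const 2).aestronglyMeasurable]
    refine (ENNReal.toReal_mono ENNReal.ofReal_ne_top hK).trans (le_of_eq ?_)
    rw [ENNReal.toReal_ofReal']

/-- Convergence of integrals of a continuous function under a uniform second moment bound. -/
theorem tendsto_integral_of_sq_le [NeBot U] (hP : Tendsto P U (𝓝 P')) {F : Ω → ℝ}
    (hF : Continuous F) {K : ℝ} (hK : ∀ᶠ i in U,
      ∫⁻ ω, ENNReal.ofReal (F ω ^ 2) ∂(P i : Measure Ω) ≤ ENNReal.ofReal K) :
    Tendsto (fun i => ∫ ω, F ω ∂(P i : Measure Ω)) U (𝓝 (∫ ω, F ω ∂(P' : Measure Ω))) := by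
  have hK' := lintegral_ofReal_le_of_tendsto hP (hF.pow 2) (fun ω => sq_nonneg _) hK
  refine tendsto_of_approx fun ε hε => ?_
  set R : ℝ := (max K 0 + 1) / ε with hR
  have hRpos : 0 < R := by positivity
  have hc : Continuous fun ω => max (-R) (min (F ω) R) :=
    continuous_const.max (hF.min continuous_const)
  have hb : ∀ ω, |max (-R) (min (F ω) R)| ≤ R := fun ω =>
    abs_le.2 ⟨le_max_left _ _, max_le (by linarith) (min_le_right _ _)⟩
  have hdiff : ∀ ω, |F ω - max (-R) (min (F ω) R)| ≤ F ω ^ 2 / R := by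
    intro ω
    rw [le_div_iff₀ hRpos]
    rcases le_total (F ω) R with h1 | h1
    · rw [min_eq_left h1]
      rcases le_total (-R) (F ω) with h2 | h2
      · rw [max_eq_right h2, sub_self, abs_zero, zero_mul]; positivity
      · rw [max_eq_left h2, abs_of_nonpos (by linarith)]; nlinarith
    · rw [min_eq_right h1, max_eq_right (by linarith), abs_of_nonneg (by linarith)]; nlinarith
  have hest : ∀ S : ProbabilityMeasure Ω,
      ∫⁻ ω, ENNReal.ofReal (F ω ^ 2) ∂(S : Measure Ω) ≤ ENNReal.ofReal K →
      |∫ ω, F ω ∂(S : Measure Ω) - ∫ ω, max (-R) (min (F ω) R) ∂(S : Measure Ω)| ≤ ε := by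
    intro S hS
    obtain ⟨i2, i1, hle⟩ := integrable_of_sq hF.measurable hS
    have ib : Integrable (fun ω => max (-R) (min (F ω) R)) (S : Measure Ω) :=
      Integrable.of_bound hc.measurable.aestronglyMeasurable R (ae_of_all _ hb)
    rw [← integral_sub i1 ib, ← Real.norm_eq_abs]
    refine (norm_integral_le_of_norm_le (i2.div_const R) (ae_of_all _ hdiff)).trans ?_
    rw [integral_div, div_le_iff₀ hRpos, hR, mul_div_cancel₀ _ hε.ne']
    linarith
  exact ⟨_, _, tendsto_integral_of_bounded_continuous hP hc hb,
    hK.mono fun i hi => hest (P i) hi, hest P' hK'⟩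

end WeakConvergence

section OccupationLimit

open scoped ENNReal NNReal

variable {n : ℕ}

theorem continuous_pathIntegral {g : ℝ × (Fin n → ℝ) → ℝ} (hg : Continuous g) {G : ℝ}
    (hG : ∀ p, |g p| ≤ G) (s t : ℝ) :
    Continuous fun ω : PathSp n => ∫ v in Set.Ioc s t, g (v, Xcan n v ω) := by
  refine continuous_of_dominated (bound := fun _ => G) (fun ω => ?_)
    (fun ω => ae_of_all _ fun v => hG _) (integrable_const G) (ae_of_all _ fun v => ?_)
  · exact (hg.comp (continuous_id.prodMk (continuous_Xcan_time ω))).aestronglyMeasurable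
  · exact hg.comp (continuous_const.prodMk (continuous_Xcan v))

variable [MeasurableSpace (PathSp n)] [BorelSpace (PathSp n)]

theorem lintegral_ofReal_pathIntegral (P : Measure (PathSp n)) [SFinite P]
    {g : ℝ × (Fin n → ℝ) → ℝ} (hg : Measurable g) (hg0 : ∀ p, 0 ≤ g p) {G : ℝ}
    (hG : ∀ p, |g p| ≤ G) (s t : ℝ) :
    ∫⁻ ω, ENNReal.ofReal (∫ v in Set.Ioc s t, g (v, Xcan n v ω)) ∂P =
      ∫⁻ q, ENNReal.ofReal (g q) ∂(occMeas P s t) := by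
  rw [lintegral_occMeas s t hg.ennreal_ofReal, lintegral_lintegral_swap]
  · refine lintegral_congr fun ω => ?_
    exact ofReal_integral_eq_lintegral_ofReal (integrableOn_path hg hG s t ω)
      (ae_of_all _ fun v => hg0 _)
  · have J : Measurable (fun p : ℝ × PathSp n => ENNReal.ofReal (g (p.1, Xcan n p.1 p.2))) :=
      (measurable_pathIntegrand hg).ennreal_ofReal
    exact J.aemeasurable

theorem occMeas_univ (P : Measure (PathSp n)) [IsProbabilityMeasure P] (s t : ℝ) :
    occMeas P s t Set.univ = ENNReal.ofReal (t - s) := by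
  rw [occMeas_apply s t MeasurableSet.univ]
  simp

instance isFiniteMeasure_occMeas (P : Measure (PathSp n)) [IsProbabilityMeasure P] (s t : ℝ) :
    IsFiniteMeasure (occMeas P s t) :=
  ⟨by rw [occMeas_univ]; exact ENNReal.ofReal_lt_top⟩

variable {ι : Type*} {U : Filter ι} {P : ι → ProbabilityMeasure (PathSp n)}
  {P' : ProbabilityMeasure (PathSp n)}

theorem occMeas_isOpen_le_of_tendsto [NeBot U] (hP : Tendsto P U (𝓝 P')) {s t : ℝ}
    {V : Set (ℝ × (Fin n → ℝ))} (hV : IsOpen V) {K : ℝ≥0∞}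
    (h : ∀ᶠ i in U, occMeas (P i : Measure (PathSp n)) s t V ≤ K) :
    occMeas (P' : Measure (PathSp n)) s t V ≤ K := by
  have hF : IsClosed Vᶜ := hV.isClosed_compl
  let φ : ℕ → ℝ × (Fin n → ℝ) → ℝ := fun k q => 1 - (hF.apprSeq k q : ℝ)
  have hφc : ∀ k, Continuous (φ k) := fun k =>
    continuous_const.sub (NNReal.continuous_coe.comp (hF.apprSeq k).continuous)
  have hle1 : ∀ k q, (hF.apprSeq k q : ℝ) ≤ 1 := fun k q => by
    exact_mod_cast HasOuterApproxClosed.apprSeq_apply_le_one hF k q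
  have hφ0 : ∀ k q, 0 ≤ φ k q := fun k q => sub_nonneg.2 (hle1 k q)
  have hφ1 : ∀ k q, φ k q ≤ 1 := fun k q => sub_le_self _ (NNReal.coe_nonneg _)
  have hφb : ∀ k q, |φ k q| ≤ 1 := fun k q => by rw [abs_of_nonneg (hφ0 k q)]; exact hφ1 k q
  have hφV : ∀ k q, ENNReal.ofReal (φ k q) ≤ V.indicator (fun _ => (1 : ℝ≥0∞)) q := by
    intro k q
    by_cases hq : q ∈ V
    · rw [Set.indicator_of_mem hq]
      exact ENNReal.ofReal_le_one.2 (hφ1 k q)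
    · have : φ k q = 0 := by
        show 1 - (hF.apprSeq k q : ℝ) = 0
        rw [HasOuterApproxClosed.apprSeq_apply_eq_one hF k hq]; simp
      rw [this]; simp
  have hk : ∀ k, ∫⁻ q, ENNReal.ofReal (φ k q) ∂(occMeas (P' : Measure (PathSp n)) s t) ≤ K := by
    intro k
    rw [← lintegral_ofReal_pathIntegral _ (hφc k).measurable (hφ0 k) (hφb k)]
    refine lintegral_ofReal_le_of_tendsto hP (continuous_pathIntegral (hφc k) (hφb k) s t)
      (fun ω => integral_nonneg fun v => hφ0 k _) ?_
    filter_upwards [h] with i hi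
    rw [lintegral_ofReal_pathIntegral _ (hφc k).measurable (hφ0 k) (hφb k)]
    refine (lintegral_mono (hφV k)).trans ?_
    exact (lintegral_indicator_one hV.measurableSet).trans_le hi
  have hlim : ∀ q, Tendsto (fun k => ENNReal.ofReal (φ k q)) atTop
      (𝓝 (V.indicator (fun _ => (1 : ℝ≥0∞)) q)) := by
    intro q
    have h1 := tendsto_pi_nhds.1 (HasOuterApproxClosed.tendsto_apprSeq hF) q
    have h2 : Tendsto (fun k => φ k q) atTop
        (𝓝 (1 - ((Vᶜ.indicator (fun _ => (1 : ℝ≥0)) q : ℝ≥0) : ℝ))) :=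
      ((NNReal.continuous_coe.tendsto _).comp h1).const_sub 1
    suffices h3 : V.indicator (fun _ => (1 : ℝ≥0∞)) q =
        ENNReal.ofReal (1 - ((Vᶜ.indicator (fun _ => (1 : ℝ≥0)) q : ℝ≥0) : ℝ)) by
      rw [h3]
      exact (ENNReal.continuous_ofReal.tendsto _).comp h2
    by_cases hq : q ∈ V
    · rw [Set.indicator_of_mem hq, Set.indicator_of_notMem (by simpa using hq)]; simp
    · rw [Set.indicator_of_notMem hq, Set.indicator_of_mem (by simpa using hq)]; simp
  refine (lintegral_indicator_one hV.measurableSet).symm.trans_le ?_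
  exact le_of_tendsto (tendsto_lintegral_of_dominated_convergence (fun _ => 1)
    (fun k => (hφc k).measurable.ennreal_ofReal)
    (fun k => ae_of_all _ fun q => ENNReal.ofReal_le_one.2 (hφ1 k q))
    (by simp) (ae_of_all _ hlim)) (Eventually.of_forall hk)

/-- An occupation density bound on an open set survives weak limits. -/
theorem occMeas_le_of_tendsto [NeBot U] (hP : Tendsto P U (𝓝 P')) {s t : ℝ}
    {O : Set (ℝ × (Fin n → ℝ))} (hO : IsOpen O) {C : ℝ≥0∞} (hC : C ≠ ⊤)
    (h : ∀ᶠ i in U, ∀ A, MeasurableSet A → A ⊆ O →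
      occMeas (P i : Measure (PathSp n)) s t A ≤ C * volume A ^ ((1 : ℝ) / 2))
    {A : Set (ℝ × (Fin n → ℝ))} (hAO : A ⊆ O) :
    occMeas (P' : Measure (PathSp n)) s t A ≤ C * volume A ^ ((1 : ℝ) / 2) := by
  have hε : ∀ ε : ℝ≥0∞, ε ≠ 0 → occMeas (P' : Measure (PathSp n)) s t A ≤
      C * (volume A + ε) ^ ((1 : ℝ) / 2) := by
    intro ε hε
    obtain ⟨V, hAV, hV, hVle⟩ := Set.exists_isOpen_le_add A volume hε
    refine (measure_mono (Set.subset_inter hAV hAO)).trans ?_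
    refine occMeas_isOpen_le_of_tendsto hP (hV.inter hO) ?_
    filter_upwards [h] with i hi
    refine (hi _ (hV.inter hO).measurableSet Set.inter_subset_right).trans ?_
    gcongr
    exact (measure_mono Set.inter_subset_left).trans hVle
  have ht : Tendsto (fun k : ℕ => C * (volume A + ((k : ℝ≥0∞))⁻¹) ^ ((1 : ℝ) / 2)) atTop
      (𝓝 (C * (volume A + 0) ^ ((1 : ℝ) / 2))) := by
    refine ENNReal.Tendsto.const_mul ?_ (Or.inr hC)
    exact ((ENNReal.continuous_rpow_const).tendsto _).comp
      (ENNReal.tendsto_inv_nat_nhds_zero.const_add _)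
  rw [add_zero] at ht
  exact ge_of_tendsto ht (Eventually.of_forall fun k =>
    hε _ (ENNReal.inv_ne_zero.2 (ENNReal.natCast_ne_top k)))

end OccupationLimit

section OccupationApprox

open scoped ENNReal NNReal

variable {n : ℕ}

theorem IsCompact.exists_norm_Xcan_le {𝒦 : Set (PathSp n)} (h : IsCompact 𝒦) (s t : ℝ) :
    ∃ R : ℝ, ∀ v ∈ Set.Icc s t, ∀ ω ∈ 𝒦, ‖Xcan n v ω‖ ≤ R := by
  obtain ⟨R, hR⟩ := ((isCompact_Icc (a := s) (b := t)).prod h).exists_bound_of_continuousOn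
    (continuous_Xcan_uncurry (n := n)).continuousOn
  exact ⟨R, fun v hv ω hω => hR (v, ω) ⟨hv, hω⟩⟩

variable [MeasurableSpace (PathSp n)] [BorelSpace (PathSp n)]

theorem occMeas_compl_le {P : Measure (PathSp n)} [IsProbabilityMeasure P] {𝒦 : Set (PathSp n)}
    {s t R : ℝ} (hR : ∀ v ∈ Set.Icc s t, ∀ ω ∈ 𝒦, ‖Xcan n v ω‖ ≤ R) {ε : ℝ≥0∞}
    (hε : P 𝒦ᶜ ≤ ε) :
    occMeas P s t (Set.Icc s t ×ˢ Metric.closedBall 0 R)ᶜ ≤ ENNReal.ofReal (t - s) * ε := by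
  have hm : MeasurableSet (Set.Icc s t ×ˢ Metric.closedBall (0 : Fin n → ℝ) R)ᶜ :=
    (measurableSet_Icc.prod Metric.isClosed_closedBall.measurableSet).compl
  rw [occMeas_apply s t hm]
  calc _ ≤ ∫⁻ _ in Set.Ioc s t, ε := by
        refine setLIntegral_mono measurable_const fun v hv => ?_
        refine le_trans (lintegral_mono fun ω => ?_)
          ((lintegral_indicator_one_le (μ := P) 𝒦ᶜ).trans hε)
        by_cases hω : ω ∈ 𝒦
        · have h1 := hR v ⟨hv.1.le, hv.2⟩ ω hω
          rw [Set.indicator_of_notMem]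
          · exact zero_le
          · simp only [Set.mem_compl_iff, not_not]
            exact ⟨⟨hv.1.le, hv.2⟩, by simpa using h1⟩
        · rw [Set.indicator_of_mem (show ω ∈ 𝒦ᶜ from hω)]
          exact Set.indicator_le_self' (fun _ _ => zero_le) _
    _ = _ := by simp [mul_comm]

theorem exists_small_of_rpow {D C : ℝ≥0∞} (hD : D ≠ ⊤) (hC : C ≠ ⊤) {ε : ℝ≥0∞} (hε : ε ≠ 0) :
    ∃ δ : ℝ, 0 < δ ∧ ENNReal.ofReal δ * D + C * ENNReal.ofReal δ ^ ((1 : ℝ) / 2) ≤ ε := by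
  have h0 : Tendsto (fun k : ℕ => ENNReal.ofReal (1 / ((k : ℝ) + 1))) atTop (𝓝 0) := by
    have := (ENNReal.continuous_ofReal.tendsto 0).comp tendsto_one_div_add_atTop_nhds_zero_nat
    simpa [Function.comp_def] using this
  have ht : Tendsto (fun k : ℕ => ENNReal.ofReal (1 / ((k : ℝ) + 1)) * D +
      C * ENNReal.ofReal (1 / ((k : ℝ) + 1)) ^ ((1 : ℝ) / 2)) atTop
      (𝓝 (0 * D + C * 0 ^ ((1 : ℝ) / 2))) :=
    (ENNReal.Tendsto.mul_const h0 (Or.inr hD)).add (ENNReal.Tendsto.const_mul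
      (((ENNReal.continuous_rpow_const).tendsto _).comp h0) (Or.inr hC))
  have hz : (0 : ℝ≥0∞) * D + C * 0 ^ ((1 : ℝ) / 2) = 0 := by
    rw [ENNReal.zero_rpow_of_pos (by norm_num)]; simp
  rw [hz] at ht
  obtain ⟨k, hk⟩ := (ht.eventually (gt_mem_nhds (pos_iff_ne_zero.2 hε))).exists
  exact ⟨1 / ((k : ℝ) + 1), by positivity, hk.le⟩

/-- A bounded measurable function can be approximated by continuous ones in the mean over the
occupation measures of a tight family with a uniform occupation density bound. -/
theorem exists_continuous_approx_occMeas {S : Set (Measure (PathSp n))} (hS : IsTightMeasureSet S)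
    (hprob : ∀ P ∈ S, IsProbabilityMeasure P) {s t : ℝ}
    (hocc : ∀ R : ℝ, ∃ C : ℝ≥0∞, C ≠ ⊤ ∧ ∀ P ∈ S, ∀ A, MeasurableSet A →
      A ⊆ Set.Icc s t ×ˢ Metric.closedBall 0 R → occMeas P s t A ≤ C * volume A ^ ((1 : ℝ) / 2))
    {g : ℝ × (Fin n → ℝ) → ℝ} (hg : Measurable g) {G : ℝ} (hG : ∀ p, |g p| ≤ G)
    {ε : ℝ≥0∞} (hε : ε ≠ 0) :
    ∃ g' : ℝ × (Fin n → ℝ) → ℝ, Continuous g' ∧ (∀ p, |g' p| ≤ G) ∧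
      ∀ P ∈ S, ∫⁻ q, ENNReal.ofReal |g q - g' q| ∂(occMeas P s t) ≤ ε := by
  have hG0 : 0 ≤ G := (abs_nonneg _).trans (hG 0)
  set D : ℝ≥0∞ := ENNReal.ofReal (t - s) with hD
  set M : ℝ≥0∞ := ENNReal.ofReal (2 * G) with hM
  have hε2 : ε / 2 ≠ 0 := (ENNReal.half_pos hε).ne'
  obtain ⟨ε₁, hε₁, hε₁le⟩ : ∃ ε₁ : ℝ≥0∞, 0 < ε₁ ∧ M * (D * ε₁) ≤ ε / 2 := by
    obtain ⟨δ, hδ, hle⟩ := exists_small_of_rpow (D := M * D) (C := 0)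
      (ENNReal.mul_ne_top ENNReal.ofReal_ne_top ENNReal.ofReal_ne_top) ENNReal.zero_ne_top hε2
    refine ⟨ENNReal.ofReal δ, ENNReal.ofReal_pos.2 hδ, le_trans (le_of_eq ?_) hle⟩
    rw [zero_mul, add_zero]; ring
  obtain ⟨𝒦, h𝒦, h𝒦S⟩ := isTightMeasureSet_iff_exists_isCompact_measure_compl_le.1 hS ε₁ hε₁
  obtain ⟨R, hR⟩ := h𝒦.exists_norm_Xcan_le s t
  obtain ⟨C, hC, hCS⟩ := hocc R
  obtain ⟨δ, hδ, hδle⟩ := exists_small_of_rpow (D := D) (C := M * C) ENNReal.ofReal_ne_top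
    (ENNReal.mul_ne_top ENNReal.ofReal_ne_top hC) hε2
  set K : Set (ℝ × (Fin n → ℝ)) := Set.Icc s t ×ˢ Metric.closedBall 0 R with hK
  have hKc : IsCompact K := isCompact_Icc.prod (isCompact_closedBall _ _)
  have hKm : MeasurableSet K := hKc.measurableSet
  have : IsFiniteMeasure (volume.restrict K) :=
    ⟨by rw [Measure.restrict_apply_univ]; exact hKc.measure_lt_top⟩
  have hgi : Integrable g (volume.restrict K) :=
    Integrable.of_bound hg.aestronglyMeasurable G (ae_of_all _ hG)
  obtain ⟨g₀, hg₀, -⟩ := hgi.exists_boundedContinuous_lintegral_sub_le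
    (ε := ENNReal.ofReal (δ * δ)) (by simpa using mul_pos hδ hδ)
  have hg'c : Continuous fun p => max (-G) (min (g₀ p) G) :=
    continuous_const.max (g₀.continuous.min continuous_const)
  have hg'b : ∀ p, |max (-G) (min (g₀ p) G)| ≤ G := fun p =>
    abs_le.2 ⟨le_max_left _ _, max_le (by linarith) (min_le_right _ _)⟩
  have hclamp : ∀ p, |g p - max (-G) (min (g₀ p) G)| ≤ |g p - g₀ p| := by
    intro p
    have h1 : g p = max (-G) (min (g p) G) := by
      rw [min_eq_left (abs_le.1 (hG p)).2, max_eq_right (abs_le.1 (hG p)).1]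
    conv_lhs => rw [h1]
    rw [max_comm, max_comm (-G)]
    exact (abs_max_sub_max_le_abs _ _ _).trans ((abs_min_sub_min_le_max _ _ _ _).trans (by simp))
  refine ⟨_, hg'c, hg'b, fun P hP => ?_⟩
  have := hprob P hP
  set g' : ℝ × (Fin n → ℝ) → ℝ := fun p => max (-G) (min (g₀ p) G) with hg'
  have hdm : Measurable fun p => ENNReal.ofReal |g p - g' p| :=
    ((hg.sub hg'c.measurable).norm).ennreal_ofReal
  set A : Set (ℝ × (Fin n → ℝ)) := {p | ENNReal.ofReal δ ≤ ENNReal.ofReal |g p - g' p|} ∩ K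
  have hAm : MeasurableSet A := (measurableSet_le measurable_const hdm).inter hKm
  have hδ0 : ENNReal.ofReal δ ≠ 0 := by simpa using hδ
  have hvolA : volume A ≤ ENNReal.ofReal δ := by
    have h1 := mul_meas_ge_le_lintegral (μ := volume.restrict K) hdm (ENNReal.ofReal δ)
    rw [Measure.restrict_apply (measurableSet_le measurable_const hdm)] at h1
    have h2 : ENNReal.ofReal δ * volume A ≤ ENNReal.ofReal δ * ENNReal.ofReal δ := by
      rw [← ENNReal.ofReal_mul hδ.le]
      refine h1.trans (le_trans (lintegral_mono fun p => ?_) hg₀)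
      rw [← ofReal_norm]
      exact ENNReal.ofReal_le_ofReal (hclamp p)
    exact (ENNReal.mul_le_mul_iff_right hδ0 ENNReal.ofReal_ne_top).1 h2
  have hpt : ∀ p, ENNReal.ofReal |g p - g' p| ≤ ENNReal.ofReal δ +
      (Kᶜ.indicator (fun _ => M) p + A.indicator (fun _ => M) p) := by
    intro p
    have hle : ENNReal.ofReal |g p - g' p| ≤ M := ENNReal.ofReal_le_ofReal (by
      linarith [abs_sub (g p) (g' p), hG p, hg'b p])
    by_cases hpK : p ∈ K
    · by_cases hpA : ENNReal.ofReal δ ≤ ENNReal.ofReal |g p - g' p|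
      · rw [Set.indicator_of_mem (show p ∈ A from ⟨hpA, hpK⟩)]
        exact hle.trans (le_add_self.trans le_add_self)
      · exact (not_le.1 hpA).le.trans le_self_add
    · rw [Set.indicator_of_mem (show p ∈ Kᶜ from hpK)]
      exact hle.trans (le_self_add.trans le_add_self)
  have m1 : Measurable (Kᶜ.indicator fun _ : ℝ × (Fin n → ℝ) => M) :=
    measurable_const.indicator hKm.compl
  calc ∫⁻ q, ENNReal.ofReal |g q - g' q| ∂(occMeas P s t)
      ≤ ∫⁻ q, (ENNReal.ofReal δ + (Kᶜ.indicator (fun _ => M) q + A.indicator (fun _ => M) q))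
          ∂(occMeas P s t) := lintegral_mono hpt
    _ = ENNReal.ofReal δ * D + (M * occMeas P s t Kᶜ + M * occMeas P s t A) := by
        rw [lintegral_add_left measurable_const, lintegral_add_left m1,
          lintegral_indicator_const hKm.compl, lintegral_indicator_const hAm, lintegral_const,
          occMeas_univ]
    _ ≤ ENNReal.ofReal δ * D + (M * (D * ε₁) + M * (C * ENNReal.ofReal δ ^ ((1 : ℝ) / 2))) := by
        gcongr
        · exact occMeas_compl_le hR (h𝒦S P hP)
        · refine (hCS P hP A hAm Set.inter_subset_right).trans ?_
          gcongr
    _ = M * (D * ε₁) + (ENNReal.ofReal δ * D + M * C * ENNReal.ofReal δ ^ ((1 : ℝ) / 2)) := by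
        ring
    _ ≤ ε / 2 + ε / 2 := add_le_add hε₁le hδle
    _ = ε := ENNReal.add_halves ε

end OccupationApprox

section ExponentialLimit

open scoped ENNReal NNReal

variable {n : ℕ}

theorem abs_exp_sub_exp_le {x y m : ℝ} (hx : x ≤ m) (hy : y ≤ m) :
    |Real.exp x - Real.exp y| ≤ Real.exp m * |x - y| := by
  have key : ∀ x y : ℝ, x ≤ m → y ≤ x → |Real.exp x - Real.exp y| ≤ Real.exp m * |x - y| := by
    intro x y hx hyx
    rw [abs_of_nonneg (sub_nonneg.2 (Real.exp_le_exp.2 hyx)), abs_of_nonneg (sub_nonneg.2 hyx)]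
    have h1 : Real.exp y = Real.exp x * Real.exp (y - x) := by rw [← Real.exp_add]; ring_nf
    have h2 := Real.add_one_le_exp (y - x)
    calc Real.exp x - Real.exp y = Real.exp x * (1 - Real.exp (y - x)) := by rw [h1]; ring
      _ ≤ Real.exp x * (x - y) := mul_le_mul_of_nonneg_left (by linarith) (Real.exp_pos x).le
      _ ≤ Real.exp m * (x - y) := by
          have := Real.exp_le_exp.2 hx
          have : 0 ≤ x - y := by linarith
          gcongr
  rcases le_total y x with h | h
  · exact key x y hx h
  · rw [abs_sub_comm, abs_sub_comm x]; exact key y x hy h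

theorem abs_mul_exp_sub_le {z M x p q L d η : ℝ} (hz : |z| ≤ M) (hp : |p| ≤ L) (hq : |q| ≤ L)
    (hd : |p - q| ≤ d) (hη : 0 < η) :
    |z * Real.exp (x - p) - z * Real.exp (x - q)| ≤
      M * Real.exp L * (η * Real.exp x ^ 2 + 2 * L / η * d) := by
  have hM : 0 ≤ M := (abs_nonneg z).trans hz
  have hL : 0 ≤ L := (abs_nonneg p).trans hp
  have h1 : |Real.exp (x - p) - Real.exp (x - q)| ≤ Real.exp L * (Real.exp x * |p - q|) := by
    have h2 := abs_exp_sub_exp_le (x := x - p) (y := x - q) (m := L + x)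
      (by linarith [(abs_le.1 hp).1]) (by linarith [(abs_le.1 hq).1])
    rw [Real.exp_add, show x - p - (x - q) = -(p - q) by ring, abs_neg] at h2
    linarith
  have h3 : Real.exp x * |p - q| ≤ η * Real.exp x ^ 2 + 2 * L / η * d := by
    have h4 : |p - q| ≤ 2 * L := by linarith [abs_sub p q]
    have h5 : |p - q| * |p - q| ≤ 2 * L * d := by
      have := abs_nonneg (p - q)
      exact mul_le_mul h4 hd this (by linarith)
    have h6 : 2 * L / η * d = (2 * L * d) / η := by ring
    have h7 : |p - q| * |p - q| / η ≤ 2 * L * d / η := by gcongr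
    have h8 : Real.exp x * |p - q| ≤ η * Real.exp x ^ 2 + |p - q| * |p - q| / η := by
      rw [← sub_nonneg]
      have : η * Real.exp x ^ 2 + |p - q| * |p - q| / η - Real.exp x * |p - q| =
          ((η * Real.exp x - |p - q| / 2) ^ 2 + 3 / 4 * |p - q| ^ 2) / η := by
        field_simp; ring
      rw [this]; positivity
    linarith
  rw [← mul_sub, abs_mul, mul_assoc]
  exact mul_le_mul hz (h1.trans (by gcongr)) (abs_nonneg _) hM

/-- The exponential functional with a general compensator density. -/
noncomputable def expDens (g : ℝ × (Fin n → ℝ) → ℝ) (θ : Fin n → ℝ) (s t : ℝ) (ω : PathSp n) : ℝ :=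
  Real.exp (θ ⬝ᵥ (Xcan n t ω - Xcan n s ω) - ∫ v in Set.Ioc s t, g (v, Xcan n v ω))

theorem continuous_dotProduct_incr (θ : Fin n → ℝ) (s t : ℝ) :
    Continuous fun ω : PathSp n => θ ⬝ᵥ (Xcan n t ω - Xcan n s ω) := by
  unfold dotProduct
  exact continuous_finsetSum _ fun i _ => continuous_const.mul
    ((continuous_apply i).comp ((continuous_Xcan t).sub (continuous_Xcan s)))

variable [MeasurableSpace (PathSp n)] [BorelSpace (PathSp n)]

theorem measurable_expDens {g : ℝ × (Fin n → ℝ) → ℝ} (hg : Measurable g) (θ : Fin n → ℝ) (s t : ℝ) :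
    Measurable (expDens g θ s t) :=
  ((continuous_dotProduct_incr θ s t).measurable.sub (measurable_pathIntegral hg s t)).exp

omit [MeasurableSpace (PathSp n)] [BorelSpace (PathSp n)] in
theorem abs_mul_expDens_le {g : ℝ × (Fin n → ℝ) → ℝ} {G : ℝ} (hG : ∀ p, |g p| ≤ G) {s t : ℝ}
    (hst : s ≤ t) {z M : ℝ} (hz : |z| ≤ M) (θ : Fin n → ℝ) (ω : PathSp n) :
    |z * expDens g θ s t ω| ≤
      M * Real.exp (G * (t - s)) * Real.exp (θ ⬝ᵥ (Xcan n t ω - Xcan n s ω)) := by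
  have h := abs_pathIntegral_le hG hst ω
  have hM : 0 ≤ M := (abs_nonneg z).trans hz
  rw [abs_mul, mul_assoc, ← Real.exp_add, expDens, Real.abs_exp]
  refine mul_le_mul hz (Real.exp_le_exp.2 ?_) (Real.exp_pos _).le hM
  linarith [(abs_le.1 h).1]

theorem integrable_mul_expDens {P : Measure (PathSp n)} [IsProbabilityMeasure P]
    {g : ℝ × (Fin n → ℝ) → ℝ} (hg : Measurable g) {G : ℝ} (hG : ∀ p, |g p| ≤ G) {s t : ℝ}
    (hst : s ≤ t) {Z : PathSp n → ℝ} (hZ : Measurable Z) {M : ℝ} (hM : ∀ ω, |Z ω| ≤ M)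
    {θ : Fin n → ℝ} {K : ℝ}
    (hexp : ∫⁻ ω, ENNReal.ofReal (Real.exp (θ ⬝ᵥ (Xcan n t ω - Xcan n s ω)) ^ 2) ∂P ≤
      ENNReal.ofReal K) :
    Integrable (fun ω => Z ω * expDens g θ s t ω) P :=
  ((integrable_of_sq (continuous_dotProduct_incr θ s t).measurable.exp hexp).2.1.const_mul
    (M * Real.exp (G * (t - s)))).mono' (hZ.mul (measurable_expDens hg θ s t)).aestronglyMeasurable
    (ae_of_all _ fun ω => abs_mul_expDens_le hG hst (hM ω) θ ω)

theorem abs_integral_expDens_sub_le {P : Measure (PathSp n)} [IsProbabilityMeasure P]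
    {g g' : ℝ × (Fin n → ℝ) → ℝ} (hg : Measurable g) (hg' : Measurable g') {G : ℝ}
    (hG : ∀ p, |g p| ≤ G) (hG' : ∀ p, |g' p| ≤ G) {s t : ℝ} (hst : s ≤ t)
    {Z : PathSp n → ℝ} (hZ : Measurable Z) {M : ℝ} (hM : ∀ ω, |Z ω| ≤ M)
    {θ : Fin n → ℝ} {K : ℝ} (hK : 0 ≤ K)
    (hexp : ∫⁻ ω, ENNReal.ofReal (Real.exp (θ ⬝ᵥ (Xcan n t ω - Xcan n s ω)) ^ 2) ∂P ≤
      ENNReal.ofReal K) {ε η : ℝ} (hε : 0 ≤ ε) (hη : 0 < η)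
    (hgg : ∫⁻ q, ENNReal.ofReal |g q - g' q| ∂(occMeas P s t) ≤ ENNReal.ofReal ε) :
    |∫ ω, Z ω * expDens g θ s t ω ∂P - ∫ ω, Z ω * expDens g' θ s t ω ∂P| ≤
      M * Real.exp (G * (t - s)) * (η * K + 2 * (G * (t - s)) / η * ε) := by
  have hM0 : 0 ≤ M := (abs_nonneg _).trans (hM (Classical.choice inferInstance))
  have hL : 0 ≤ G * (t - s) :=
    (abs_nonneg _).trans (abs_pathIntegral_le hG hst (Classical.choice inferInstance))
  obtain ⟨i2, -, hle⟩ := integrable_of_sq (continuous_dotProduct_incr θ s t).measurable.exp hexp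
  rw [max_eq_left hK] at hle
  have hdm : Measurable fun q => |g q - g' q| := (hg.sub hg').norm
  have hdb : ∀ q, |(|g q - g' q|)| ≤ 2 * G := fun q => by
    rw [abs_abs]; linarith [abs_sub (g q) (g' q), hG q, hG' q]
  set d : PathSp n → ℝ := fun ω => ∫ v in Set.Ioc s t, |g (v, Xcan n v ω) - g' (v, Xcan n v ω)|
  have hdmeas : Measurable d := measurable_pathIntegral hdm s t
  have hd0 : ∀ ω, 0 ≤ d ω := fun ω => integral_nonneg fun v => abs_nonneg _
  have hdi : Integrable d P := Integrable.of_bound hdmeas.aestronglyMeasurable _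
    (ae_of_all _ fun ω => abs_pathIntegral_le hdb hst ω)
  have hdle : ∫ ω, d ω ∂P ≤ ε := by
    rw [integral_eq_lintegral_of_nonneg_ae (ae_of_all _ hd0) hdmeas.aestronglyMeasurable]
    refine ENNReal.toReal_le_of_le_ofReal hε (le_trans (le_of_eq ?_) hgg)
    exact lintegral_ofReal_pathIntegral P hdm (fun q => abs_nonneg _) hdb s t
  have hpt : ∀ ω, ‖Z ω * expDens g θ s t ω - Z ω * expDens g' θ s t ω‖ ≤
      M * Real.exp (G * (t - s)) * (η * Real.exp (θ ⬝ᵥ (Xcan n t ω - Xcan n s ω)) ^ 2 +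
        2 * (G * (t - s)) / η * d ω) := by
    intro ω
    refine abs_mul_exp_sub_le (hM ω) (abs_pathIntegral_le hG hst ω) (abs_pathIntegral_le hG' hst ω)
      ?_ hη
    rw [← integral_sub (integrableOn_path hg hG s t ω) (integrableOn_path hg' hG' s t ω)]
    exact abs_integral_le_integral_abs
  rw [← integral_sub (integrable_mul_expDens hg hG hst hZ hM hexp)
    (integrable_mul_expDens hg' hG' hst hZ hM hexp), ← Real.norm_eq_abs]
  have j1 : Integrable (fun ω => η * Real.exp (θ ⬝ᵥ (Xcan n t ω - Xcan n s ω)) ^ 2) P :=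
    i2.const_mul η
  have j2 : Integrable (fun ω => 2 * (G * (t - s)) / η * d ω) P := hdi.const_mul _
  refine (norm_integral_le_of_norm_le ((j1.add j2).const_mul _) (ae_of_all _ hpt)).trans ?_
  rw [integral_const_mul, integral_add' j1 j2, integral_const_mul, integral_const_mul]
  gcongr

variable {ι : Type*} {U : Filter ι} {P : ι → ProbabilityMeasure (PathSp n)}
  {P' : ProbabilityMeasure (PathSp n)}

/-- Passage to the limit in exponential functionals with merely measurable compensators. -/
theorem tendsto_integral_mul_expDens [NeBot U] (hP : Tendsto P U (𝓝 P'))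
    {S : Set (Measure (PathSp n))} (hS : IsTightMeasureSet S)
    (hprob : ∀ P ∈ S, IsProbabilityMeasure P) {s t : ℝ} (hst : s ≤ t)
    (hocc : ∀ R : ℝ, ∃ C : ℝ≥0∞, C ≠ ⊤ ∧ ∀ P ∈ S, ∀ A, MeasurableSet A →
      A ⊆ Set.Icc s t ×ˢ Metric.closedBall 0 R → occMeas P s t A ≤ C * volume A ^ ((1 : ℝ) / 2))
    (hPS : ∀ᶠ i in U, (P i : Measure (PathSp n)) ∈ S) (hP'S : (P' : Measure (PathSp n)) ∈ S)
    {θ : Fin n → ℝ} {K : ℝ} (hK : 0 ≤ K) (hexp : ∀ P ∈ S,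
      ∫⁻ ω, ENNReal.ofReal (Real.exp (θ ⬝ᵥ (Xcan n t ω - Xcan n s ω)) ^ 2) ∂P ≤ ENNReal.ofReal K)
    {g : ℝ × (Fin n → ℝ) → ℝ} (hg : Measurable g) {G : ℝ} (hG : ∀ p, |g p| ≤ G)
    {Z : PathSp n → ℝ} (hZ : Continuous Z) {M : ℝ} (hM : ∀ ω, |Z ω| ≤ M) :
    Tendsto (fun i => ∫ ω, Z ω * expDens g θ s t ω ∂(P i : Measure (PathSp n))) U
      (𝓝 (∫ ω, Z ω * expDens g θ s t ω ∂(P' : Measure (PathSp n)))) := by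
  refine tendsto_of_approx fun ε hε => ?_
  have hM0 : 0 ≤ M := (abs_nonneg _).trans (hM (Classical.choice inferInstance))
  have hL : 0 ≤ G * (t - s) :=
    (abs_nonneg _).trans (abs_pathIntegral_le hG hst (Classical.choice inferInstance))
  set L := G * (t - s) with hLdef
  set W : ℝ := (M + 1) * Real.exp L with hW
  have hWpos : 0 < W := by positivity
  set η : ℝ := ε / (2 * W * (K + 1)) with hη
  have hηpos : 0 < η := by positivity
  set ε₁ : ℝ := η * ε / (2 * W * (2 * L + 1)) with hε₁
  have hε₁pos : 0 < ε₁ := by positivity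
  obtain ⟨g', hg'c, hg'G, hg'⟩ := exists_continuous_approx_occMeas hS hprob hocc hg hG
    (ε := ENNReal.ofReal ε₁) (by simpa using hε₁pos)
  have hfin : M * Real.exp L * (η * K + 2 * L / η * ε₁) ≤ ε := by
    have h1 : M * Real.exp L * (η * K + 2 * L / η * ε₁) ≤ W * (η * K + 2 * L / η * ε₁) := by
      rw [hW]; gcongr; linarith
    have h2 : W * (η * K) ≤ ε / 2 := by
      have : W * (η * K) = ε / 2 * (K / (K + 1)) := by rw [hη]; field_simp
      rw [this]
      exact mul_le_of_le_one_right (by positivity) ((div_le_one (by positivity)).2 (by linarith))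
    have h3 : W * (2 * L / η * ε₁) ≤ ε / 2 := by
      have : W * (2 * L / η * ε₁) = ε / 2 * (2 * L / (2 * L + 1)) := by rw [hε₁]; field_simp
      rw [this]
      exact mul_le_of_le_one_right (by positivity) ((div_le_one (by positivity)).2 (by linarith))
    linarith
  have hest : ∀ μ ∈ S, |∫ ω, Z ω * expDens g θ s t ω ∂μ - ∫ ω, Z ω * expDens g' θ s t ω ∂μ| ≤ ε :=
    fun μ hμ => by
      have := hprob μ hμ
      exact (abs_integral_expDens_sub_le hg hg'c.measurable hG hg'G hst hZ.measurable hM hK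
        (hexp μ hμ) hε₁pos.le hηpos (hg' μ hμ)).trans hfin
  refine ⟨fun i => ∫ ω, Z ω * expDens g' θ s t ω ∂(P i : Measure (PathSp n)), _, ?_,
    hPS.mono fun i hi => hest _ hi, hest _ hP'S⟩
  refine tendsto_integral_of_sq_le (K := (M * Real.exp L) ^ 2 * K) hP
    (hZ.mul (Real.continuous_exp.comp ((continuous_dotProduct_incr θ s t).sub
      (continuous_pathIntegral hg'c hg'G s t)))) ?_
  filter_upwards [hPS] with i hi
  rw [ENNReal.ofReal_mul (by positivity)]
  refine le_trans (lintegral_mono (g := fun ω => ENNReal.ofReal ((M * Real.exp L) ^ 2) *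
    ENNReal.ofReal (Real.exp (θ ⬝ᵥ (Xcan n t ω - Xcan n s ω)) ^ 2)) fun ω => ?_) ?_
  · beta_reduce
    rw [← ENNReal.ofReal_mul (sq_nonneg (M * Real.exp L)), ← mul_pow]
    refine ENNReal.ofReal_le_ofReal ?_
    rw [← sq_abs]
    exact pow_le_pow_left₀ (abs_nonneg _) (abs_mul_expDens_le hg'G hst (hM ω) θ ω) 2
  · rw [lintegral_const_mul' _ _ ENNReal.ofReal_ne_top]
    gcongr
    exact hexp _ hi

end ExponentialLimit

section Stopping

open scoped ENNReal NNReal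

variable {n : ℕ}

theorem eq_of_Xcan_rat_eq {ω ω' : PathSp n} (h : ∀ q : ℚ, Xcan n q ω = Xcan n q ω') : ω = ω' := by
  have h1 : (fun u => Xcan n u ω) = fun u => Xcan n u ω' :=
    Rat.denseRange_cast.equalizer (continuous_Xcan_time ω) (continuous_Xcan_time ω') (funext h)
  ext1 u
  have h2 := congrFun h1 u.1
  have h3 : max u.1 0 = u.1 := max_eq_left u.2
  simpa only [Xcan, h3] using h2

/-- The path stopped at time `s`. -/
noncomputable def stopPath (s : ℝ) (ω : PathSp n) : PathSp n where
  toFun u := Xcan n (min u.1 s) ω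
  continuous_toFun := (continuous_Xcan_time ω).comp
    (continuous_subtype_val.min continuous_const)

theorem Xcan_stopPath {s : ℝ} (hs : 0 ≤ s) (u : ℝ) (ω : PathSp n) :
    Xcan n u (stopPath s ω) = Xcan n (min u s) ω := by
  show ω ⟨max (min (max u 0) s) 0, _⟩ = ω ⟨max (min u s) 0, _⟩
  congr 2
  rcases le_total u 0 with h | h
  · simp [h, h.trans hs, hs]
  · simp [h]

theorem continuous_stopPath (s : ℝ) : Continuous (stopPath (n := n) s) := by
  refine ContinuousMap.continuous_of_continuous_uncurry _ ?_
  exact continuous_Xcan_uncurry.comp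
    (((continuous_subtype_val.comp continuous_snd).min continuous_const).prodMk continuous_fst)

variable [MeasurableSpace (PathSp n)] [BorelSpace (PathSp n)]

theorem measurable_pathSp {α : Type*} {m : MeasurableSpace α} {g : α → PathSp n}
    (hg : ∀ q : ℚ, Measurable fun x => Xcan n q (g x)) : Measurable g := by
  have he : MeasurableEmbedding fun (ω : PathSp n) (q : ℚ) => Xcan n q ω :=
    (continuous_pi fun q : ℚ => continuous_Xcan (q : ℝ)).measurableEmbedding
      fun ω ω' h => eq_of_Xcan_rat_eq fun q => congrFun h q
  rw [← he.measurable_comp_iff]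
  exact measurable_pi_iff.2 hg

theorem measurable_stopPath {s : ℝ} (hs : 0 ≤ s) : Measurable[canonFiltr n s] (stopPath (n := n) s) := by
  refine measurable_pathSp (m := canonFiltr n s) fun q => ?_
  simp only [Xcan_stopPath hs]
  exact measurable_Xcan_canonFiltr hs (min_le_right _ _)

omit [MeasurableSpace (PathSp n)] [BorelSpace (PathSp n)] in
theorem eq_of_stopPath_eq {β : Type*} [MeasurableSpace β] [MeasurableSpace.SeparatesPoints β] {s : ℝ}
    {Z : PathSp n → β} (hZ : Measurable[canonFiltr n s] Z) {ω ω' : PathSp n}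
    (h : ∀ u, 0 ≤ u → u ≤ s → Xcan n u ω = Xcan n u ω') : Z ω = Z ω' := by
  by_contra hne
  obtain ⟨A, hA, h1, h2⟩ := MeasurableSpace.exists_measurableSet_of_ne hne
  obtain ⟨C, -, hC⟩ := hZ hA
  have h3 : (ω ∈ Z ⁻¹' A ↔ ω' ∈ Z ⁻¹' A) := by
    rw [← hC]
    have : (fun u : Set.Icc (0 : ℝ) s => ω ⟨u.1, u.2.1⟩) = fun u => ω' ⟨u.1, u.2.1⟩ := by
      funext u
      have h4 := h u.1 u.2.1 u.2.2
      have h5 : max u.1 0 = u.1 := max_eq_left u.2.1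
      simpa only [Xcan, h5] using h4
    exact iff_of_eq (congrArg (· ∈ C) this)
  exact h2 (h3.1 h1)

omit [MeasurableSpace (PathSp n)] [BorelSpace (PathSp n)] in
theorem comp_stopPath_eq {β : Type*} [MeasurableSpace β] [MeasurableSpace.SeparatesPoints β] {s : ℝ}
    (hs : 0 ≤ s) {Z : PathSp n → β} (hZ : Measurable[canonFiltr n s] Z) (ω : PathSp n) :
    Z (stopPath s ω) = Z ω :=
  eq_of_stopPath_eq hZ fun u _ hu => by rw [Xcan_stopPath hs, min_eq_left hu]

/-- Continuous bounded test functions of the stopped path determine integrals of all functions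
measurable with respect to the past. -/
theorem lintegral_eq_of_forall_integral_eq {μ ν : Measure (PathSp n)} [IsFiniteMeasure μ]
    [IsFiniteMeasure ν] {s : ℝ} (hs : 0 ≤ s)
    (h : ∀ Z : PathSp n → ℝ, Continuous Z → Measurable[canonFiltr n s] Z →
      (∃ M, ∀ ω, |Z ω| ≤ M) → ∫ ω, Z ω ∂μ = ∫ ω, Z ω ∂ν)
    {Z : PathSp n → ℝ≥0∞} (hZ : Measurable[canonFiltr n s] Z) : ∫⁻ ω, Z ω ∂μ = ∫⁻ ω, Z ω ∂ν := by
  have hm : Measurable (stopPath (n := n) s) := (continuous_stopPath s).measurable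
  have he : μ.map (stopPath s) = ν.map (stopPath s) := by
    refine ext_of_forall_integral_eq_of_IsFiniteMeasure fun f => ?_
    rw [integral_map hm.aemeasurable f.continuous.aestronglyMeasurable,
      integral_map hm.aemeasurable f.continuous.aestronglyMeasurable]
    exact h _ (f.continuous.comp (continuous_stopPath s))
      (f.continuous.measurable.comp (measurable_stopPath hs)) ⟨‖f‖, fun ω => f.norm_coe_le_norm _⟩
  have hZm : Measurable Z := hZ.mono (canonFiltr_le s) le_rfl
  have key : ∀ ρ : Measure (PathSp n), ∫⁻ ω, Z ω ∂ρ = ∫⁻ ω, Z ω ∂(ρ.map (stopPath s)) := fun ρ => by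
    rw [lintegral_map hZm hm]
    exact lintegral_congr fun ω => (comp_stopPath_eq hs hZ ω).symm
  rw [key, he, ← key]

end Stopping

section LimitIdentification

open scoped ENNReal NNReal

variable {n : ℕ} [MeasurableSpace (PathSp n)] [BorelSpace (PathSp n)]
  {a : ℝ → (Fin n → ℝ) → Matrix (Fin n) (Fin n) ℝ} {b : ℝ → (Fin n → ℝ) → Fin n → ℝ}
  {B : ℝ}
  {ι : Type*} {U : Filter ι} {P : ι → ProbabilityMeasure (PathSp n)}
  {P' : ProbabilityMeasure (PathSp n)} {s : ι → ℝ} {s' : ℝ} {y : ι → Fin n → ℝ} {y' : Fin n → ℝ}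

theorem ae_frozen_of_tendsto [NeBot U] (hc : BoundedCoeff n a b B) (hP : Tendsto P U (𝓝 P'))
    (hs : Tendsto s U (𝓝 s')) (hy : Tendsto y U (𝓝 y'))
    (hfr : ∀ᶠ i in U, ∀ᵐ ω ∂(P i : Measure (PathSp n)), ∀ u ≤ s i, Xcan n u ω = y i)
    (hE : ∀ᶠ i in U, ExpMart a b (s i) (P i : Measure (PathSp n))) :
    ∀ᵐ ω ∂(P' : Measure (PathSp n)), ∀ u ≤ s', Xcan n u ω = y' := by
  have h1 : ∀ u ≤ s', ∀ᵐ ω ∂(P' : Measure (PathSp n)), Xcan n u ω = y' := by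
    intro u hu
    set K := momentConst n B 1 1 with hKdef
    have hK : 0 ≤ K := momentConst_nonneg n B 1 1
    have hlim : Tendsto (fun i => ‖y i - y'‖ + K * √|s' - s i|) U (𝓝 0) := by
      have e : ‖y' - y'‖ + K * √|s' - s'| = 0 := by simp
      rw [← e]
      exact ((hy.sub tendsto_const_nhds).norm).add
        (((tendsto_const_nhds.sub hs).abs.sqrt).const_mul K)
    have hzero : ∫⁻ ω, ENNReal.ofReal ‖Xcan n u ω - y'‖ ∂(P' : Measure (PathSp n)) ≤ 0 := by
      refine ENNReal.le_of_forall_pos_le_add fun ε hε _ => ?_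
      rw [zero_add]
      refine lintegral_ofReal_le_of_tendsto hP ((continuous_Xcan u).sub continuous_const).norm
        (fun ω => norm_nonneg _) ?_
      have h01 : Tendsto (fun i => |s' - s i|) U (𝓝 0) := by
        have e : |s' - s'| = 0 := by simp
        rw [← e]
        exact (tendsto_const_nhds.sub hs).abs
      filter_upwards [hfr, hE, hlim.eventually_lt_const (NNReal.coe_pos.2 hε),
        h01.eventually_lt_const one_pos] with i hfr hE hlt h1
      have hle : max u (s i) - s i ≤ |s' - s i| := by
        rcases le_total u (s i) with h | h
        · rw [max_eq_right h, sub_self]; exact abs_nonneg _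
        · rw [max_eq_left h]; linarith [le_abs_self (s' - s i)]
      have hmom := hE.lintegral_norm_pow_le hc le_rfl (le_max_right u (s i)) (hle.trans h1.le)
        one_ne_zero
      simp only [pow_one] at hmom
      calc ∫⁻ ω, ENNReal.ofReal ‖Xcan n u ω - y'‖ ∂(P i : Measure (PathSp n))
          ≤ ∫⁻ ω, (ENNReal.ofReal ‖Xcan n (max u (s i)) ω - Xcan n (s i) ω‖ +
              ENNReal.ofReal ‖y i - y'‖) ∂(P i : Measure (PathSp n)) := by
            refine lintegral_mono_ae (hfr.mono fun ω hω => ?_)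
            rw [← ENNReal.ofReal_add (norm_nonneg _) (norm_nonneg _)]
            refine ENNReal.ofReal_le_ofReal ?_
            have e : Xcan n (max u (s i)) ω = Xcan n u ω := by
              rcases le_total u (s i) with h | h
              · rw [max_eq_right h, hω _ le_rfl, hω _ h]
              · rw [max_eq_left h]
            rw [e, hω _ le_rfl]
            exact norm_sub_le_norm_sub_add_norm_sub _ _ _
        _ ≤ ENNReal.ofReal (K * √|s' - s i|) + ENNReal.ofReal ‖y i - y'‖ := by
            rw [lintegral_add_right _ measurable_const, lintegral_const, measure_univ, mul_one]
            gcongr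
            refine hmom.trans (ENNReal.ofReal_le_ofReal ?_)
            gcongr
        _ ≤ ε := by
            rw [← ENNReal.ofReal_add (by positivity) (norm_nonneg _), add_comm,
              ← ENNReal.ofReal_coe_nnreal]
            exact ENNReal.ofReal_le_ofReal hlt.le
    have hm : Measurable fun ω : PathSp n => ENNReal.ofReal ‖Xcan n u ω - y'‖ :=
      (((continuous_Xcan u).sub continuous_const).norm).measurable.ennreal_ofReal
    have h2 := (lintegral_eq_zero_iff hm).1 (le_antisymm hzero zero_le)
    filter_upwards [h2] with ω hω
    have h3 : ‖Xcan n u ω - y'‖ ≤ 0 := ENNReal.ofReal_eq_zero.1 hω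
    exact sub_eq_zero.1 (norm_le_zero_iff.1 h3)
  have h2 : ∀ᵐ ω ∂(P' : Measure (PathSp n)), ∀ q : ℚ, Xcan n (min q s') ω = y' :=
    ae_all_iff.2 fun q => h1 _ (min_le_right _ _)
  filter_upwards [h2] with ω hω u hu
  have h3 : (fun u => Xcan n (min u s') ω) = fun _ => y' :=
    Rat.denseRange_cast.equalizer ((continuous_Xcan_time ω).comp (continuous_id.min continuous_const))
      continuous_const (funext hω)
  have h4 := congrFun h3 u
  simpa [min_eq_left hu] using h4

end LimitIdentification

section MartingaleLimit

open scoped ENNReal NNReal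

/-- Pointwise limits pass through the expectation under a second moment bound. -/
theorem tendsto_integral_of_tendsto_of_sq_le {Ω : Type*} [MeasurableSpace Ω] {μ : Measure Ω}
    [IsProbabilityMeasure μ] {X : ℕ → Ω → ℝ} {X' : Ω → ℝ} (hX : ∀ k, Measurable (X k))
    (hX' : Measurable X') (hlim : ∀ ω, Tendsto (fun k => X k ω) atTop (𝓝 (X' ω))) {K : ℝ}
    (hK : ∀ k, ∫⁻ ω, ENNReal.ofReal (X k ω ^ 2) ∂μ ≤ ENNReal.ofReal K) :
    Tendsto (fun k => ∫ ω, X k ω ∂μ) atTop (𝓝 (∫ ω, X' ω ∂μ)) := by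
  let ρ : ℕ → ProbabilityMeasure ℝ := fun k =>
    ⟨μ.map (X k), Measure.isProbabilityMeasure_map (hX k).aemeasurable⟩
  let ρ' : ProbabilityMeasure ℝ := ⟨μ.map X', Measure.isProbabilityMeasure_map hX'.aemeasurable⟩
  have hρ : Tendsto ρ atTop (𝓝 ρ') := by
    refine ProbabilityMeasure.tendsto_iff_forall_integral_tendsto.2 fun f => ?_
    show Tendsto (fun k => ∫ x, f x ∂(μ.map (X k))) atTop (𝓝 (∫ x, f x ∂(μ.map X')))
    have e : ∀ Y : Ω → ℝ, Measurable Y → ∫ x, f x ∂(μ.map Y) = ∫ ω, f (Y ω) ∂μ := fun Y hY =>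
      integral_map hY.aemeasurable f.continuous.aestronglyMeasurable
    simp only [e _ (hX _), e _ hX']
    refine tendsto_integral_of_dominated_convergence (fun _ => ‖f‖)
      (fun k => (f.continuous.measurable.comp (hX k)).aestronglyMeasurable) (integrable_const _)
      (fun k => ae_of_all _ fun ω => f.norm_coe_le_norm _)
      (ae_of_all _ fun ω => (f.continuous.tendsto _).comp (hlim ω))
  have h := tendsto_integral_of_sq_le (K := K) hρ continuous_id (Eventually.of_forall fun k => by
    show ∫⁻ x, ENNReal.ofReal (x ^ 2) ∂(μ.map (X k)) ≤ _
    rw [lintegral_map (by fun_prop) (hX k)]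
    exact hK k)
  have e1 : ∀ k, ∫ x, id x ∂(ρ k : Measure ℝ) = ∫ ω, X k ω ∂μ := fun k =>
    integral_map (hX k).aemeasurable continuous_id.aestronglyMeasurable
  have e2 : ∫ x, id x ∂(ρ' : Measure ℝ) = ∫ ω, X' ω ∂μ :=
    integral_map hX'.aemeasurable continuous_id.aestronglyMeasurable
  simpa only [e1, e2] using h

variable {n : ℕ} [MeasurableSpace (PathSp n)] [BorelSpace (PathSp n)]
  {a : ℝ → (Fin n → ℝ) → Matrix (Fin n) (Fin n) ℝ} {b : ℝ → (Fin n → ℝ) → Fin n → ℝ}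
  {B : ℝ}

omit [BorelSpace (PathSp n)] in
theorem ExpMart.lintegral_exp_sq_le {s₀ s t : ℝ} {P : Measure (PathSp n)} [IsProbabilityMeasure P]
    (h : ExpMart a b s₀ P) (hc : BoundedCoeff n a b B)
    (θ : Fin n → ℝ) (hs : s₀ ≤ s) (hst : s ≤ t) :
    ∫⁻ ω, ENNReal.ofReal (Real.exp (θ ⬝ᵥ (Xcan n t ω - Xcan n s ω)) ^ 2) ∂P ≤
      ENNReal.ofReal (Real.exp (compBound n B ((2 : ℝ) • θ) * (t - s))) := by
  refine le_trans (le_of_eq (lintegral_congr fun ω => ?_)) (h.lintegral_exp_le hc ((2 : ℝ) • θ) hs hst)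
  rw [← Real.exp_nat_mul, smul_dotProduct]
  norm_num

variable {ι : Type*} {U : Filter ι} {P : ι → ProbabilityMeasure (PathSp n)}
  {P' : ProbabilityMeasure (PathSp n)} {s : ι → ℝ} {s' : ℝ} {y : ι → Fin n → ℝ} {y' : Fin n → ℝ}

theorem lintegral_exp_sq_le_of_tendsto [NeBot U] (hc : BoundedCoeff n a b B)
    (hP : Tendsto P U (𝓝 P')) (hs : Tendsto s U (𝓝 s'))
    (hE : ∀ᶠ i in U, ExpMart a b (s i) (P i : Measure (PathSp n))) (θ : Fin n → ℝ) {u v : ℝ}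
    (hu : s' < u) (huv : u ≤ v) :
    ∫⁻ ω, ENNReal.ofReal (Real.exp (θ ⬝ᵥ (Xcan n v ω - Xcan n u ω)) ^ 2) ∂(P' : Measure (PathSp n)) ≤
      ENNReal.ofReal (Real.exp (compBound n B ((2 : ℝ) • θ) * (v - u))) := by
  refine lintegral_ofReal_le_of_tendsto hP
    ((Real.continuous_exp.comp (continuous_dotProduct_incr θ u v)).pow 2) (fun ω => sq_nonneg _) ?_
  filter_upwards [hE, hs.eventually_lt_const hu] with i hi hlt
  exact hi.lintegral_exp_sq_le hc θ hlt.le huv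

theorem integral_mul_expIncr_of_tendsto_of_lt [NeBot U] (hc : BoundedCoeff n a b B)
    (hsym : ∀ u x, (a u x).IsSymm) (hcont : Continuous fun p : ℝ × (Fin n → ℝ) => a p.1 p.2)
    (hell : ∀ u x (θ : Fin n → ℝ), θ ≠ 0 → 0 < θ ⬝ᵥ (a u x).mulVec θ)
    (hP : Tendsto P U (𝓝 P')) (hs : Tendsto s U (𝓝 s')) (hy : Tendsto y U (𝓝 y'))
    (hs0 : ∀ᶠ i in U, 0 ≤ s i)
    (hfr : ∀ᶠ i in U, ∀ᵐ ω ∂(P i : Measure (PathSp n)), ∀ u ≤ s i, Xcan n u ω = y i)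
    (hE : ∀ᶠ i in U, ExpMart a b (s i) (P i : Measure (PathSp n)))
    (θ : Fin n → ℝ) {u v : ℝ} (hu : s' < u) (huv : u ≤ v) {Z : PathSp n → ℝ} (hZ : Continuous Z)
    (hZm : Measurable[canonFiltr n u] Z) {M : ℝ} (hM : ∀ ω, |Z ω| ≤ M) :
    ∫ ω, Z ω * expIncr a b θ u v ω ∂(P' : Measure (PathSp n)) =
      ∫ ω, Z ω ∂(P' : Measure (PathSp n)) := by
  have hs'0 : 0 ≤ s' := ge_of_tendsto hs hs0
  obtain ⟨r, hr, hru⟩ := exists_between hu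
  obtain ⟨r', hr', hru'⟩ := exists_between hru
  have hr0 : 0 ≤ r := hs'0.trans hr.le
  set S₀ : Set (Measure (PathSp n)) := {P | IsProbabilityMeasure P ∧ ∃ s y, (0 ≤ s ∧ s ≤ r) ∧
    ‖y‖ ≤ ‖y'‖ + 1 ∧ (∀ᵐ ω ∂P, ∀ u ≤ s, Xcan n u ω = y) ∧ ExpMart a b s P} with hS₀
  have hPS₀ : ∀ᶠ i in U, (P i : Measure (PathSp n)) ∈ S₀ := by
    filter_upwards [hs0, hs.eventually_lt_const hr, hfr, hE,
      hy.norm.eventually_lt_const (lt_add_one ‖y'‖)] with i h1 h2 h3 h4 h5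
    exact ⟨inferInstance, s i, y i, ⟨h1, h2.le⟩, h5.le, h3, h4⟩
  have hprob₀ : ∀ μ ∈ S₀, IsProbabilityMeasure μ := fun μ hμ => hμ.1
  have hE₀ : ∀ μ ∈ S₀, ExpMart a b r μ := by
    rintro μ ⟨-, s, y, ⟨-, h1⟩, -, -, h2⟩
    exact h2.mono h1
  have htight : IsTightMeasureSet (insert (P' : Measure (PathSp n)) S₀) := by
    rw [Set.insert_eq]
    refine isTightMeasureSet_singleton.union ((hc.isTightMeasureSet (‖y'‖ + 1)).subset ?_)
    rintro μ ⟨h0, s, y, ⟨h1, -⟩, h2, h3, h4⟩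
    exact ⟨h0, s, y, h1, h2, h3, h4⟩
  have hocc : ∀ R : ℝ, ∃ C : ℝ≥0∞, C ≠ ⊤ ∧ ∀ μ ∈ insert (P' : Measure (PathSp n)) S₀,
      ∀ A, MeasurableSet A → A ⊆ Set.Icc u v ×ˢ Metric.closedBall 0 R →
        occMeas μ u v A ≤ C * volume A ^ ((1 : ℝ) / 2) := by
    intro R
    obtain ⟨C, hC, hCb⟩ := exists_compact_occMeas_bound hc hsym hcont hell hr0
      (K := Set.Icc r' (v + 1) ×ˢ Metric.closedBall (0 : Fin n → ℝ) (R + 1))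
      (isCompact_Icc.prod (isCompact_closedBall _ _)) (fun p hp => hr'.trans_le hp.1.1)
    have h0 : ∀ μ ∈ S₀, ∀ A, MeasurableSet A → A ⊆ Set.Ioo r' (v + 1) ×ˢ
        Metric.ball (0 : Fin n → ℝ) (R + 1) → occMeas μ u v A ≤ C * volume A ^ ((1 : ℝ) / 2) := by
      intro μ hμ A hA hsub
      have := hprob₀ μ hμ
      refine (occMeas_le_occMeas u v hA (τ₀ := r) (τ₁ := v + 1) fun q hq => ?_).trans
        (hCb μ this (hE₀ μ hμ) (v + 1) A hA (hsub.trans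
          (Set.prod_mono Set.Ioo_subset_Icc_self Metric.ball_subset_closedBall)))
      exact ⟨hr'.trans (hsub hq).1.1, (hsub hq).1.2.le⟩
    have hsub2 : Set.Icc u v ×ˢ Metric.closedBall (0 : Fin n → ℝ) R ⊆
        Set.Ioo r' (v + 1) ×ˢ Metric.ball (0 : Fin n → ℝ) (R + 1) :=
      Set.prod_mono (fun x hx => ⟨hru'.trans_le hx.1, hx.2.trans_lt (lt_add_one v)⟩)
        (Metric.closedBall_subset_ball (lt_add_one R))
    refine ⟨C, hC, ?_⟩
    rintro μ (rfl | hμ) A hA hsub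
    · exact occMeas_le_of_tendsto hP (isOpen_Ioo.prod Metric.isOpen_ball) hC
        (hPS₀.mono fun i hi => h0 _ hi) (hsub.trans hsub2)
    · exact h0 μ hμ A hA (hsub.trans hsub2)
  have hlim := tendsto_integral_mul_expDens (θ := θ) hP htight
    (by rintro μ (rfl | hμ); exacts [inferInstance, hprob₀ μ hμ]) huv hocc
    (hPS₀.mono fun i hi => Set.mem_insert_of_mem _ hi) (Set.mem_insert _ _) (Real.exp_pos _).le
    (by
      rintro μ (rfl | hμ)
      · exact lintegral_exp_sq_le_of_tendsto hc hP hs hE θ hu huv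
      · have := hprob₀ μ hμ
        exact (hE₀ μ hμ).lintegral_exp_sq_le hc θ hru.le huv)
    (hc.measurable_compDens θ) (hc.abs_compDens_le θ) hZ hM
  refine tendsto_nhds_unique hlim ((tendsto_integral_of_bounded_continuous hP hZ hM).congr' ?_)
  exact hPS₀.mono fun i hi => ((hE₀ _ hi).integral_mul_expIncr hc θ hru.le huv hZm hM).symm

omit [BorelSpace (PathSp n)] [MeasurableSpace (PathSp n)] in
theorem BoundedCoeff.tendsto_expIncr_left (hc : BoundedCoeff n a b B) (θ : Fin n → ℝ) {u v : ℝ}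
    {r : ℕ → ℝ} (hr : ∀ k, u ≤ r k) (hrv : ∀ k, r k ≤ v) (hlim : Tendsto r atTop (𝓝 u))
    (ω : PathSp n) :
    Tendsto (fun k => expIncr a b θ (r k) v ω) atTop (𝓝 (expIncr a b θ u v ω)) := by
  have hG : 0 ≤ compBound n B θ := compBound_nonneg hc.nonneg θ
  have hsmall : Tendsto (fun k => ∫ w in Set.Ioc u (r k), compDens a b θ (w, Xcan n w ω)) atTop
      (𝓝 0) := by
    refine squeeze_zero_norm (a := fun k => compBound n B θ * (r k - u)) (fun k =>
      abs_pathIntegral_le (hc.abs_compDens_le θ) (hr k) ω) ?_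
    have e : compBound n B θ * (u - u) = 0 := by ring
    rw [← e]
    exact (hlim.sub_const u).const_mul _
  have hX : Tendsto (fun k => θ ⬝ᵥ (Xcan n v ω - Xcan n (r k) ω)) atTop
      (𝓝 (θ ⬝ᵥ (Xcan n v ω - Xcan n u ω))) := by
    have hcont : Continuous fun w => θ ⬝ᵥ (Xcan n v ω - Xcan n w ω) := by
      unfold dotProduct
      exact continuous_finsetSum _ fun i _ => continuous_const.mul
        ((continuous_apply i).comp (continuous_const.sub (continuous_Xcan_time ω)))
    exact (hcont.tendsto u).comp hlim
  have e : ∀ k, expIncr a b θ (r k) v ω = Real.exp (θ ⬝ᵥ (Xcan n v ω - Xcan n (r k) ω) -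
      ((∫ w in Set.Ioc u v, compDens a b θ (w, Xcan n w ω)) -
        ∫ w in Set.Ioc u (r k), compDens a b θ (w, Xcan n w ω))) := fun k => by
    rw [pathIntegral_add (hc.measurable_compDens θ) (hc.abs_compDens_le θ) (hr k) (hrv k) ω,
      add_sub_cancel_left]
    rfl
  simp only [e]
  have h := hX.sub ((tendsto_const_nhds (x := ∫ w in Set.Ioc u v,
    compDens a b θ (w, Xcan n w ω))).sub hsmall)
  rw [sub_zero] at h
  exact (Real.continuous_exp.tendsto _).comp h

theorem expMart_of_tendsto [NeBot U] (hc : BoundedCoeff n a b B)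
    (hsym : ∀ u x, (a u x).IsSymm) (hcont : Continuous fun p : ℝ × (Fin n → ℝ) => a p.1 p.2)
    (hell : ∀ u x (θ : Fin n → ℝ), θ ≠ 0 → 0 < θ ⬝ᵥ (a u x).mulVec θ)
    (hP : Tendsto P U (𝓝 P')) (hs : Tendsto s U (𝓝 s')) (hy : Tendsto y U (𝓝 y'))
    (hs0 : ∀ᶠ i in U, 0 ≤ s i)
    (hfr : ∀ᶠ i in U, ∀ᵐ ω ∂(P i : Measure (PathSp n)), ∀ u ≤ s i, Xcan n u ω = y i)
    (hE : ∀ᶠ i in U, ExpMart a b (s i) (P i : Measure (PathSp n))) :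
    ExpMart a b s' (P' : Measure (PathSp n)) := by
  intro θ u v hu huv Z hZ
  have hu0 : 0 ≤ u := (ge_of_tendsto hs hs0).trans hu
  have key : ∀ W : PathSp n → ℝ, Continuous W → Measurable[canonFiltr n u] W →
      (∃ M, ∀ ω, |W ω| ≤ M) → ∫ ω, W ω * expIncr a b θ u v ω ∂(P' : Measure (PathSp n)) =
        ∫ ω, W ω ∂(P' : Measure (PathSp n)) := by
    rintro W hW hWm ⟨M, hM⟩
    rcases huv.eq_or_lt with rfl | huv
    · refine integral_congr_ae (ae_of_all _ fun ω => ?_)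
      simp [expIncr]
    obtain ⟨r, -, hr, hlim⟩ := exists_seq_strictAnti_tendsto' huv
    have hG : 0 ≤ compBound n B ((2 : ℝ) • θ) := compBound_nonneg hc.nonneg _
    have h := tendsto_integral_of_tendsto_of_sq_le (μ := (P' : Measure (PathSp n)))
      (X := fun k ω => W ω * expIncr a b θ (r k) v ω) (X' := fun ω => W ω * expIncr a b θ u v ω)
      (K := (M * Real.exp (compBound n B θ * (v - u))) ^ 2 *
        Real.exp (compBound n B ((2 : ℝ) • θ) * (v - u)))
      (fun k => hW.measurable.mul (hc.measurable_expIncr θ _ _))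
      (hW.measurable.mul (hc.measurable_expIncr θ _ _))
      (fun ω => (hc.tendsto_expIncr_left θ (fun k => (hr k).1.le) (fun k => (hr k).2.le) hlim
        ω).const_mul _) fun k => by
        rw [ENNReal.ofReal_mul (sq_nonneg _)]
        refine le_trans (lintegral_mono (g := fun ω =>
          ENNReal.ofReal ((M * Real.exp (compBound n B θ * (v - u))) ^ 2) *
          ENNReal.ofReal (Real.exp (θ ⬝ᵥ (Xcan n v ω - Xcan n (r k) ω)) ^ 2)) fun ω => ?_) ?_
        · beta_reduce
          rw [← ENNReal.ofReal_mul (sq_nonneg _), ← mul_pow]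
          refine ENNReal.ofReal_le_ofReal ?_
          rw [← sq_abs]
          refine pow_le_pow_left₀ (abs_nonneg _) ((abs_mul_expDens_le (hc.abs_compDens_le θ)
            (hr k).2.le (hM ω) θ ω).trans ?_) 2
          have := (abs_nonneg _).trans (hM ω)
          have := compBound_nonneg hc.nonneg θ
          have := (hr k).1.le
          gcongr
        · rw [lintegral_const_mul' _ _ ENNReal.ofReal_ne_top]
          gcongr
          refine (lintegral_exp_sq_le_of_tendsto hc hP hs hE θ (hu.trans_lt (hr k).1)
            (hr k).2.le).trans (ENNReal.ofReal_le_ofReal ?_)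
          have := (hr k).1.le
          gcongr
    refine tendsto_nhds_unique h (tendsto_const_nhds.congr fun k => ?_)
    exact (integral_mul_expIncr_of_tendsto_of_lt hc hsym hcont hell hP hs hy hs0 hfr hE θ
      (hu.trans_lt (hr k).1) (hr k).2.le hW (hWm.mono (canonFiltr_mono (hr k).1.le) le_rfl) hM).symm
  have hem := hc.measurable_expIncr θ u v
  have hint : Integrable (expIncr a b θ u v) (P' : Measure (PathSp n)) := by
    have h1 := key (fun _ => 1) continuous_const measurable_const ⟨1, fun _ => by simp⟩
    simp only [one_mul] at h1
    by_contra hcon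
    rw [integral_undef hcon] at h1
    simp at h1
  have hfin : IsFiniteMeasure ((P' : Measure (PathSp n)).withDensity
      fun ω => ENNReal.ofReal (expIncr a b θ u v ω)) :=
    isFiniteMeasure_withDensity_ofReal hint.2
  have hZm : Measurable Z := hZ.mono (canonFiltr_le u) le_rfl
  have hfinal := lintegral_eq_of_forall_integral_eq (μ := (P' : Measure (PathSp n)).withDensity
    fun ω => ENNReal.ofReal (expIncr a b θ u v ω)) (ν := (P' : Measure (PathSp n))) hu0 (by
      intro W hW hWm hM
      rw [← key W hW hWm hM, integral_withDensity_eq_integral_toReal_smul hem.ennreal_ofReal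
        (ae_of_all _ fun ω => ENNReal.ofReal_lt_top)]
      refine integral_congr_ae (ae_of_all _ fun ω => ?_)
      simp only [ENNReal.toReal_ofReal (expIncr_pos θ u v ω).le, smul_eq_mul, mul_comm]) hZ
  rw [← hfinal, lintegral_withDensity_eq_lintegral_mul _ hem.ennreal_ofReal hZm]
  exact lintegral_congr fun ω => mul_comm _ _

end MartingaleLimit

section Feller

open scoped ENNReal NNReal

variable {n : ℕ} [MeasurableSpace (PathSp n)]

/-- A family of unique solutions of the exponential martingale problem, indexed by the starting
time and the starting point. -/
structure ExpMartFamily (a : ℝ → (Fin n → ℝ) → Matrix (Fin n) (Fin n) ℝ)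
    (b : ℝ → (Fin n → ℝ) → Fin n → ℝ) (Q : ℝ → (Fin n → ℝ) → ProbabilityMeasure (PathSp n)) :
    Prop where
  ae_frozen : ∀ s y, 0 ≤ s → ∀ᵐ ω ∂(Q s y : Measure (PathSp n)), ∀ u ≤ s, Xcan n u ω = y
  expMart : ∀ s y, 0 ≤ s → ExpMart a b s (Q s y : Measure (PathSp n))
  unique : ∀ s y (P : ProbabilityMeasure (PathSp n)), 0 ≤ s →
    (∀ᵐ ω ∂(P : Measure (PathSp n)), ∀ u ≤ s, Xcan n u ω = y) →
    ExpMart a b s (P : Measure (PathSp n)) → P = Q s y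

variable [BorelSpace (PathSp n)]
  {a : ℝ → (Fin n → ℝ) → Matrix (Fin n) (Fin n) ℝ} {b : ℝ → (Fin n → ℝ) → Fin n → ℝ}
  {B : ℝ} {Q : ℝ → (Fin n → ℝ) → ProbabilityMeasure (PathSp n)}

theorem ExpMartFamily.tendsto (hQ : ExpMartFamily a b Q) (hc : BoundedCoeff n a b B)
    (hsym : ∀ u x, (a u x).IsSymm) (hcont : Continuous fun p : ℝ × (Fin n → ℝ) => a p.1 p.2)
    (hell : ∀ u x (θ : Fin n → ℝ), θ ≠ 0 → 0 < θ ⬝ᵥ (a u x).mulVec θ)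
    {ι : Type*} {U : Filter ι} {s : ι → ℝ} {s' : ℝ} {y : ι → Fin n → ℝ} {y' : Fin n → ℝ}
    (hs : Tendsto s U (𝓝 s')) (hy : Tendsto y U (𝓝 y')) (hs0 : ∀ᶠ i in U, 0 ≤ s i) :
    Tendsto (fun i => Q (s i) (y i)) U (𝓝 (Q s' y')) := by
  refine (tendsto_iff_ultrafilter _ _ _).2 fun V hV => ?_
  have hsV := hs.mono_left hV
  have hyV := hy.mono_left hV
  have hs0V := hs0.filter_mono hV
  set S : Set (ProbabilityMeasure (PathSp n)) := {P | ∃ s y, 0 ≤ s ∧ ‖y‖ ≤ ‖y'‖ + 1 ∧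
    (∀ᵐ ω ∂(P : Measure (PathSp n)), ∀ u ≤ s, Xcan n u ω = y) ∧
    ExpMart a b s (P : Measure (PathSp n))} with hS
  have htight : IsTightMeasureSet {x | ∃ P ∈ S, ((P : ProbabilityMeasure (PathSp n)) :
      Measure (PathSp n)) = x} := by
    refine (hc.isTightMeasureSet (‖y'‖ + 1)).subset ?_
    rintro _ ⟨P, hP, rfl⟩
    exact ⟨inferInstance, hP⟩
  have hmem : ∀ᶠ i in (V : Filter ι), Q (s i) (y i) ∈ S := by
    filter_upwards [hs0V, hyV.norm.eventually_lt_const (lt_add_one ‖y'‖)] with i h1 h2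
    exact ⟨s i, y i, h1, h2.le, hQ.ae_frozen _ _ h1, hQ.expMart _ _ h1⟩
  obtain ⟨P', -, hP'⟩ := isCompact_iff_ultrafilter_le_nhds.1
    (isCompact_closure_of_isTightMeasureSet htight) (V.map fun i => Q (s i) (y i))
    (le_principal_iff.2 (hmem.mono fun i hi => subset_closure hi))
  have hlim : Tendsto (fun i => Q (s i) (y i)) V (𝓝 P') := hP'
  have hfrV := hs0V.mono fun i hi => hQ.ae_frozen (s i) (y i) hi
  have hEV := hs0V.mono fun i hi => hQ.expMart (s i) (y i) hi
  rwa [hQ.unique s' y' P' (ge_of_tendsto hsV hs0V)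
    (ae_frozen_of_tendsto hc hlim hsV hyV hfrV hEV)
    (expMart_of_tendsto hc hsym hcont hell hlim hsV hyV hs0V hfrV hEV)] at hlim

end Feller

section Growth

open scoped ENNReal NNReal

variable {n : ℕ} [MeasurableSpace (PathSp n)] [BorelSpace (PathSp n)]
  {a : ℝ → (Fin n → ℝ) → Matrix (Fin n) (Fin n) ℝ} {b : ℝ → (Fin n → ℝ) → Fin n → ℝ}
  {B : ℝ}

/-- The constant in the second moment bound for functions of polynomial growth. -/
noncomputable def growthConst (n : ℕ) (B C : ℝ) (m : ℕ) (R T : ℝ) : ℝ :=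
  4 * C ^ 2 * (1 + 2 ^ (2 * m + 1) * (momentConst n B T (2 * m + 2) * √T ^ (2 * m + 2) +
    R ^ (2 * m + 2)))

theorem growthConst_nonneg (n : ℕ) (B C : ℝ) (m : ℕ) (R : ℝ) (T : ℝ) :
    0 ≤ growthConst n B C m R T := by
  have := momentConst_nonneg n B T (2 * m + 2)
  have : 0 ≤ R ^ (2 * m + 2) := Even.pow_nonneg ⟨m + 1, by ring⟩ _
  unfold growthConst
  positivity

theorem sq_le_of_growth {x C z d R : ℝ} {m : ℕ} (hz : 0 ≤ z) (hd : 0 ≤ d) (hR : 0 ≤ R)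
    (hzd : z ≤ d + R) (hx : |x| ≤ C * (1 + z ^ m)) :
    x ^ 2 ≤ 4 * C ^ 2 * (1 + 2 ^ (2 * m + 1) * (d ^ (2 * m + 2) + R ^ (2 * m + 2))) := by
  have h1 : x ^ 2 ≤ (C * (1 + z ^ m)) ^ 2 := by
    rw [← sq_abs]; exact pow_le_pow_left₀ (abs_nonneg _) hx 2
  have h2 : (1 + z ^ m) ^ 2 ≤ 2 * (1 + (z ^ m) ^ 2) := by nlinarith [sq_nonneg (1 - z ^ m)]
  have h3 : (z ^ m) ^ 2 ≤ 1 + z ^ (2 * m + 2) := by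
    rw [← pow_mul, mul_comm m 2]
    rcases le_total z 1 with h | h
    · linarith [pow_le_one₀ (n := 2 * m) hz h, pow_nonneg hz (2 * m + 2)]
    · linarith [pow_le_pow_right₀ h (show 2 * m ≤ 2 * m + 2 by omega)]
  have h4 : z ^ (2 * m + 2) ≤ 2 ^ (2 * m + 1) * (d ^ (2 * m + 2) + R ^ (2 * m + 2)) :=
    (pow_le_pow_left₀ hz hzd _).trans (add_pow_le hd hR (2 * m + 2))
  have h5 : 0 ≤ z ^ (2 * m + 2) := pow_nonneg hz _
  calc x ^ 2 ≤ C ^ 2 * (1 + z ^ m) ^ 2 := by rw [← mul_pow]; exact h1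
    _ ≤ C ^ 2 * (4 * (1 + 2 ^ (2 * m + 1) * (d ^ (2 * m + 2) + R ^ (2 * m + 2)))) := by
        gcongr; linarith
    _ = _ := by ring

theorem ExpMart.lintegral_growth_sq_le {P : Measure (PathSp n)} [IsProbabilityMeasure P]
    {s : ℝ} {y : Fin n → ℝ} (h : ExpMart a b s P) (hc : BoundedCoeff n a b B) (hs : 0 ≤ s)
    (hfr : ∀ᵐ ω ∂P, ∀ u ≤ s, Xcan n u ω = y) {R T : ℝ} (hy : ‖y‖ ≤ R) {u : ℝ} (hu : 0 ≤ u)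
    (huT : u ≤ T) {g : (Fin n → ℝ) → ℝ} {C : ℝ} {m : ℕ}
    (hg : ∀ x, |g x| ≤ C * (1 + ‖x‖ ^ m)) :
    ∫⁻ ω, ENNReal.ofReal (g (Xcan n u ω) ^ 2) ∂P ≤ ENNReal.ofReal (growthConst n B C m R T) := by
  have hR : 0 ≤ R := (norm_nonneg _).trans hy
  have hM := momentConst_nonneg n B T (2 * m + 2)
  have hmom := h.lintegral_norm_pow_le_of_frozen hc hfr hu (by linarith : u - 0 ≤ T)
    (show 2 * m + 2 ≠ 0 by omega)
  rw [sub_zero] at hmom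
  have hm : Measurable fun ω : PathSp n =>
      ENNReal.ofReal (‖Xcan n u ω - Xcan n 0 ω‖ ^ (2 * m + 2)) :=
    ((((continuous_Xcan u).sub (continuous_Xcan 0)).norm).pow _).measurable.ennreal_ofReal
  calc ∫⁻ ω, ENNReal.ofReal (g (Xcan n u ω) ^ 2) ∂P
      ≤ ∫⁻ ω, (ENNReal.ofReal (4 * C ^ 2 * (1 + 2 ^ (2 * m + 1) * R ^ (2 * m + 2))) +
          ENNReal.ofReal (4 * C ^ 2 * 2 ^ (2 * m + 1)) *
            ENNReal.ofReal (‖Xcan n u ω - Xcan n 0 ω‖ ^ (2 * m + 2))) ∂P := by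
        refine lintegral_mono_ae (hfr.mono fun ω hω => ?_)
        rw [← ENNReal.ofReal_mul (by positivity), ← ENNReal.ofReal_add (by positivity)
          (by positivity)]
        refine ENNReal.ofReal_le_ofReal ((sq_le_of_growth (norm_nonneg (Xcan n u ω))
          (norm_nonneg (Xcan n u ω - Xcan n 0 ω)) hR ?_ (hg _)).trans (le_of_eq (by ring)))
        have h1 := norm_sub_norm_le (Xcan n u ω) (Xcan n 0 ω)
        rw [hω 0 hs] at h1 ⊢
        linarith
    _ ≤ ENNReal.ofReal (growthConst n B C m R T) := by
        rw [lintegral_add_left measurable_const, lintegral_const, measure_univ, mul_one,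
          lintegral_const_mul _ hm]
        have h1 : momentConst n B T (2 * m + 2) * √u ^ (2 * m + 2) ≤
          momentConst n B T (2 * m + 2) * √T ^ (2 * m + 2) := by gcongr
        refine (add_le_add le_rfl (mul_le_mul_right (hmom.trans (ENNReal.ofReal_le_ofReal h1))
          _)).trans ?_
        rw [← ENNReal.ofReal_mul (by positivity), ← ENNReal.ofReal_add (by positivity)
          (by positivity)]
        refine ENNReal.ofReal_le_ofReal (le_of_eq ?_)
        unfold growthConst
        ring

end Growth

section ValueFunction

open scoped ENNReal NNReal

variable {n : ℕ} [MeasurableSpace (PathSp n)] [BorelSpace (PathSp n)]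
  {a : ℝ → (Fin n → ℝ) → Matrix (Fin n) (Fin n) ℝ} {b : ℝ → (Fin n → ℝ) → Fin n → ℝ}
  {B : ℝ} {g : ℝ × (Fin n → ℝ) → ℝ} {C : ℝ} {m : ℕ}

theorem ExpMart.integrable_growth_prod {P : Measure (PathSp n)} [IsProbabilityMeasure P]
    {s : ℝ} {y : Fin n → ℝ} (h : ExpMart a b s P) (hc : BoundedCoeff n a b B) (hs : 0 ≤ s)
    (hfr : ∀ᵐ ω ∂P, ∀ u ≤ s, Xcan n u ω = y) (hg : Measurable g)
    (hgrowth : ∀ p, |g p| ≤ C * (1 + ‖p.2‖ ^ m)) {u v : ℝ} (hu : 0 ≤ u) :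
    Integrable (fun p : ℝ × PathSp n => g (p.1, Xcan n p.1 p.2))
      ((volume.restrict (Set.Ioc u v)).prod P) := by
  have hm : Measurable fun p : ℝ × PathSp n => g (p.1, Xcan n p.1 p.2) := measurable_pathIntegrand hg
  refine (integrable_of_sq (K := growthConst n B C m ‖y‖ v * (v - u)) hm ?_).2.1
  rw [lintegral_prod _ ((hm.pow_const 2).ennreal_ofReal.aemeasurable)]
  calc ∫⁻ x in Set.Ioc u v, ∫⁻ ω, ENNReal.ofReal (g (x, Xcan n x ω) ^ 2) ∂P
      ≤ ∫⁻ _ in Set.Ioc u v, ENNReal.ofReal (growthConst n B C m ‖y‖ v) := by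
        refine setLIntegral_mono measurable_const fun x hx => ?_
        exact h.lintegral_growth_sq_le hc hs hfr le_rfl (hu.trans hx.1.le) hx.2
          (g := fun z => g (x, z)) fun z => hgrowth (x, z)
    _ = ENNReal.ofReal (growthConst n B C m ‖y‖ v * (v - u)) := by
        rw [setLIntegral_const, Real.volume_Ioc, ENNReal.ofReal_mul (growthConst_nonneg n B C m _ _)]

theorem ExpMart.integral_growth_swap {P : Measure (PathSp n)} [IsProbabilityMeasure P]
    {s : ℝ} {y : Fin n → ℝ} (h : ExpMart a b s P) (hc : BoundedCoeff n a b B) (hs : 0 ≤ s)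
    (hfr : ∀ᵐ ω ∂P, ∀ u ≤ s, Xcan n u ω = y) (hg : Measurable g)
    (hgrowth : ∀ p, |g p| ≤ C * (1 + ‖p.2‖ ^ m)) {u v : ℝ} (hu : 0 ≤ u) :
    ∫ ω, (∫ x in Set.Ioc u v, g (x, Xcan n x ω)) ∂P =
      ∫ x in Set.Ioc u v, (∫ ω, g (x, Xcan n x ω) ∂P) :=
  (integral_integral_swap (h.integrable_growth_prod hc hs hfr hg hgrowth hu)).symm

theorem ExpMart.abs_integral_growth_le {P : Measure (PathSp n)} [IsProbabilityMeasure P]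
    {s : ℝ} {y : Fin n → ℝ} (h : ExpMart a b s P) (hc : BoundedCoeff n a b B) (hs : 0 ≤ s)
    (hfr : ∀ᵐ ω ∂P, ∀ u ≤ s, Xcan n u ω = y) (hg : Measurable g)
    (hgrowth : ∀ p, |g p| ≤ C * (1 + ‖p.2‖ ^ m)) {R T : ℝ} (hy : ‖y‖ ≤ R) {u : ℝ} (hu : 0 ≤ u)
    (huT : u ≤ T) : |∫ ω, g (u, Xcan n u ω) ∂P| ≤ 1 + growthConst n B C m R T := by
  have hgm : Measurable fun ω : PathSp n => g (u, Xcan n u ω) :=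
    hg.comp (measurable_const.prodMk (measurable_Xcan u))
  obtain ⟨h2, h1, hle⟩ := integrable_of_sq hgm (h.lintegral_growth_sq_le hc hs hfr hy hu huT
    (g := fun z => g (u, z)) fun z => hgrowth (u, z))
  rw [max_eq_left (growthConst_nonneg n B C m R T)] at hle
  have h3 := norm_integral_le_of_norm_le (f := fun ω : PathSp n => g (u, Xcan n u ω))
    ((integrable_const (1 : ℝ)).add h2) (ae_of_all _ fun ω => by
      show |g (u, Xcan n u ω)| ≤ 1 + g (u, Xcan n u ω) ^ 2
      rw [← sq_abs]
      nlinarith [sq_nonneg (|g (u, Xcan n u ω)| - 1), abs_nonneg (g (u, Xcan n u ω))])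
  rw [integral_add' (integrable_const _) h2] at h3
  simp only [integral_const, probReal_univ, one_smul] at h3
  rw [Real.norm_eq_abs] at h3
  linarith

variable {Q : ℝ → (Fin n → ℝ) → ProbabilityMeasure (PathSp n)}

/-- The expected running reward up to time `t` for the process started at time `s` from `y`. -/
noncomputable def valueFun (Q : ℝ → (Fin n → ℝ) → ProbabilityMeasure (PathSp n))
    (g : ℝ × (Fin n → ℝ) → ℝ) (t s : ℝ) (y : Fin n → ℝ) : ℝ :=
  ∫ ω, (∫ u in Set.Ioc s t, g (u, Xcan n u ω)) ∂(Q s y : Measure (PathSp n))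

theorem ExpMartFamily.continuousOn_valueFun (hQ : ExpMartFamily a b Q) (hc : BoundedCoeff n a b B)
    (hsym : ∀ u x, (a u x).IsSymm) (hcont : Continuous fun p : ℝ × (Fin n → ℝ) => a p.1 p.2)
    (hell : ∀ u x (θ : Fin n → ℝ), θ ≠ 0 → 0 < θ ⬝ᵥ (a u x).mulVec θ)
    (hg : Measurable g) (hgc : ∀ u, Continuous fun x => g (u, x))
    (hgrowth : ∀ p, |g p| ≤ C * (1 + ‖p.2‖ ^ m)) (t : ℝ) :
    ContinuousOn (fun p : ℝ × (Fin n → ℝ) => valueFun Q g t p.1 p.2) (Set.Ici 0 ×ˢ Set.univ) := by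
  rintro ⟨s', y'⟩ ⟨hs', -⟩
  set U := 𝓝[Set.Ici 0 ×ˢ Set.univ] ((s', y') : ℝ × (Fin n → ℝ)) with hU
  have hs0 : ∀ᶠ p in U, 0 ≤ p.1 := eventually_mem_nhdsWithin.mono fun p hp => hp.1
  have hs : Tendsto (fun p : ℝ × (Fin n → ℝ) => p.1) U (𝓝 s') :=
    (continuous_fst.tendsto (s', y')).mono_left nhdsWithin_le_nhds
  have hy : Tendsto (fun p : ℝ × (Fin n → ℝ) => p.2) U (𝓝 y') :=
    (continuous_snd.tendsto (s', y')).mono_left nhdsWithin_le_nhds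
  have hR : ∀ᶠ p in U, ‖p.2‖ ≤ ‖y'‖ + 1 :=
    (hy.norm.eventually_lt_const (lt_add_one ‖y'‖)).mono fun p hp => hp.le
  have hNe : NeBot U := mem_closure_iff_nhdsWithin_neBot.1
    (subset_closure (show (s', y') ∈ Set.Ici (0 : ℝ) ×ˢ Set.univ from ⟨hs', Set.mem_univ _⟩))
  have hlim := hQ.tendsto hc hsym hcont hell hs hy hs0
  set φ : ℝ → ℝ × (Fin n → ℝ) → ℝ := fun u p =>
    ∫ ω, g (u, Xcan n u ω) ∂(Q p.1 p.2 : Measure (PathSp n)) with hφ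
  have hrep : ∀ p : ℝ × (Fin n → ℝ), 0 ≤ p.1 → valueFun Q g t p.1 p.2 =
      ∫ u in Set.Ioc 0 t, (Set.Ioi p.1).indicator (fun u => φ u p) u := by
    intro p hp
    rw [valueFun, (hQ.expMart p.1 p.2 hp).integral_growth_swap hc hp (hQ.ae_frozen p.1 p.2 hp) hg
      hgrowth hp, setIntegral_indicator measurableSet_Ioi]
    congr 2
    ext u
    exact ⟨fun h => ⟨⟨hp.trans_lt h.1, h.2⟩, h.1⟩, fun h => ⟨h.2, h.1.2⟩⟩
  have hmeas : ∀ p : ℝ × (Fin n → ℝ), Measurable fun u => φ u p := fun p =>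
    ((measurable_pathIntegrand hg).stronglyMeasurable.integral_prod_right
      (ν := (Q p.1 p.2 : Measure (PathSp n)))).measurable
  show Tendsto (fun p : ℝ × (Fin n → ℝ) => valueFun Q g t p.1 p.2) U (𝓝 (valueFun Q g t s' y'))
  rw [hrep (s', y') hs']
  refine Tendsto.congr' (hs0.mono fun p hp => (hrep p hp).symm) ?_
  refine tendsto_integral_filter_of_dominated_convergence
    (fun _ => 1 + growthConst n B C m (‖y'‖ + 1) t)
    (Eventually.of_forall fun p => ((hmeas p).indicator measurableSet_Ioi).aestronglyMeasurable)
    ?_ (integrable_const _) ?_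
  · filter_upwards [hs0, hR] with p hp hpR
    refine (ae_restrict_mem measurableSet_Ioc).mono fun u hu => ?_
    refine (norm_indicator_le_norm_self _ _).trans ?_
    exact (hQ.expMart p.1 p.2 hp).abs_integral_growth_le hc hp (hQ.ae_frozen p.1 p.2 hp) hg hgrowth
      hpR hu.1.le hu.2
  · have hne : ∀ᵐ u ∂(volume.restrict (Set.Ioc 0 t)), u ≠ s' :=
      ae_restrict_of_ae (Measure.ae_ne volume s')
    filter_upwards [hne, ae_restrict_mem measurableSet_Ioc] with u hu hu0
    rcases lt_or_gt_of_ne hu with h | h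
    · rw [Set.indicator_of_notMem (by simpa using h.le)]
      refine tendsto_const_nhds.congr' ((hs.eventually_const_lt h).mono fun p hp => ?_)
      exact (Set.indicator_of_notMem (show u ∉ Set.Ioi p.1 from hp.le.not_gt) (fun u => φ u p)).symm
    · rw [Set.indicator_of_mem (by simpa using h)]
      have h1 : Tendsto (fun p => φ u p) U (𝓝 (φ u (s', y'))) := by
        refine tendsto_integral_of_sq_le (K := growthConst n B C m (‖y'‖ + 1) t) hlim
          ((hgc u).comp (continuous_Xcan u)) ?_
        filter_upwards [hs0, hR] with p hp hpR
        exact (hQ.expMart p.1 p.2 hp).lintegral_growth_sq_le hc hp (hQ.ae_frozen p.1 p.2 hp) hpR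
          hu0.1.le hu0.2 (g := fun z => g (u, z)) fun z => hgrowth (u, z)
      refine h1.congr' ((hs.eventually_lt_const h).mono fun p hp => ?_)
      exact (Set.indicator_of_mem (show u ∈ Set.Ioi p.1 from hp) (fun u => φ u p)).symm

end ValueFunction

section Pasting

open scoped ENNReal NNReal

variable {n : ℕ}

/-- The path following `ω` until time `s` and the increments of `ω'` afterwards. -/
noncomputable def pastePath (s : ℝ) (ω ω' : PathSp n) : PathSp n where
  toFun u := Xcan n (min u.1 s) ω + (Xcan n (max u.1 s) ω' - Xcan n s ω')
  continuous_toFun :=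
    ((continuous_Xcan_time ω).comp (continuous_subtype_val.min continuous_const)).add
      (((continuous_Xcan_time ω').comp (continuous_subtype_val.max continuous_const)).sub
        continuous_const)

theorem Xcan_pastePath {s : ℝ} (hs : 0 ≤ s) (u : ℝ) (ω ω' : PathSp n) :
    Xcan n u (pastePath s ω ω') = Xcan n (min u s) ω + (Xcan n (max u s) ω' - Xcan n s ω') := by
  show Xcan n (min (max u 0) s) ω + (Xcan n (max (max u 0) s) ω' - Xcan n s ω') = _
  rcases le_total u 0 with h | h
  · rw [max_eq_right h, min_eq_left hs, max_eq_right hs, min_eq_left (h.trans hs),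
      max_eq_right (h.trans hs)]
    simp [Xcan, h]
  · rw [max_eq_left h]

theorem Xcan_pastePath_of_le {s u : ℝ} (hs : 0 ≤ s) (hu : u ≤ s) (ω ω' : PathSp n) :
    Xcan n u (pastePath s ω ω') = Xcan n u ω := by
  rw [Xcan_pastePath hs, min_eq_left hu, max_eq_right hu, sub_self, add_zero]

theorem Xcan_pastePath_of_ge {s u : ℝ} (hs : 0 ≤ s) (hu : s ≤ u) {ω ω' : PathSp n}
    (h : Xcan n s ω' = Xcan n s ω) : Xcan n u (pastePath s ω ω') = Xcan n u ω' := by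
  rw [Xcan_pastePath hs, min_eq_right hu, max_eq_left hu, h, add_sub_cancel]

theorem expIncr_pastePath {a : ℝ → (Fin n → ℝ) → Matrix (Fin n) (Fin n) ℝ}
    {b : ℝ → (Fin n → ℝ) → Fin n → ℝ} (θ : Fin n → ℝ) {s s' t' : ℝ} (hs : 0 ≤ s) (hs' : s ≤ s')
    (ht' : s' ≤ t') {ω ω' : PathSp n} (h : Xcan n s ω' = Xcan n s ω) :
    expIncr a b θ s' t' (pastePath s ω ω') = expIncr a b θ s' t' ω' := by
  unfold expIncr
  rw [Xcan_pastePath_of_ge hs hs' h, Xcan_pastePath_of_ge hs (hs'.trans ht') h]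
  congr 2
  exact setIntegral_congr_fun measurableSet_Ioc fun v hv => by
    simp only [Xcan_pastePath_of_ge hs (hs'.trans hv.1.le) h]

theorem measurable_pastePath_canonFiltr {s s' : ℝ} (hs : 0 ≤ s) (hs' : s ≤ s') (ω : PathSp n) :
    Measurable[canonFiltr n s', canonFiltr n s'] (pastePath s ω) := by
  let _ := canonFiltr n s'
  refine measurable_comap_iff.2 (measurable_pi_iff.2 fun u => ?_)
  exact measurable_const.add (((measurable_Xcan_canonFiltr (hs.trans hs')
    (max_le u.2.2 hs')).sub (measurable_Xcan_canonFiltr (hs.trans hs') hs')))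

variable [MeasurableSpace (PathSp n)] [BorelSpace (PathSp n)]

theorem measurable_pastePath {s : ℝ} (hs : 0 ≤ s) :
    Measurable fun p : PathSp n × PathSp n => pastePath s p.1 p.2 := by
  refine measurable_pathSp fun q => ?_
  simp only [Xcan_pastePath hs]
  exact ((measurable_Xcan _).comp measurable_fst).add
    (((measurable_Xcan _).comp measurable_snd).sub ((measurable_Xcan _).comp measurable_snd))

variable {a : ℝ → (Fin n → ℝ) → Matrix (Fin n) (Fin n) ℝ} {b : ℝ → (Fin n → ℝ) → Fin n → ℝ}
  {B : ℝ} {Q : ℝ → (Fin n → ℝ) → ProbabilityMeasure (PathSp n)}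

theorem measurable_toMeasure_of_continuous
    {q : (Fin n → ℝ) → ProbabilityMeasure (PathSp n)} (hq : Continuous q) :
    Measurable fun y => (q y : Measure (PathSp n)) := by
  refine Measurable.measure_of_isPiSystem_of_isProbabilityMeasure
    (S := {G : Set (PathSp n) | IsOpen G}) BorelSpace.measurable_eq isPiSystem_isOpen fun G hG => ?_
  exact (lowerSemicontinuous_iff_le_liminf.2 fun y =>
    ProbabilityMeasure.le_liminf_measure_open_of_tendsto (hq.tendsto y) hG).measurable

/-- The law of the path pasted at time `s` from `P` and the solutions started afresh at `s`. -/
theorem ExpMartFamily.map_pastePath_eq (hQ : ExpMartFamily a b Q) (hc : BoundedCoeff n a b B)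
    {r s : ℝ} (hr : 0 ≤ r) (hrs : r ≤ s) (y : Fin n → ℝ)
    {κ : ProbabilityTheory.Kernel (PathSp n) (PathSp n)}
    (hκ : ∀ ω, κ ω = (Q s (Xcan n s ω) : Measure (PathSp n))) :
    ((Q r y : Measure (PathSp n)).compProd κ).map (fun p => pastePath s p.1 p.2) =
      (Q r y : Measure (PathSp n)) := by
  have hs : 0 ≤ s := hr.trans hrs
  have hκm : ProbabilityTheory.IsMarkovKernel κ := ⟨fun ω => by rw [hκ]; infer_instance⟩
  set P : Measure (PathSp n) := (Q r y : Measure (PathSp n)) with hP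
  have hpm := measurable_pastePath (n := n) hs
  set μ : Measure (PathSp n) := (P.compProd κ).map (fun p => pastePath s p.1 p.2) with hμ
  have hμp : IsProbabilityMeasure μ := Measure.isProbabilityMeasure_map hpm.aemeasurable
  have hlin : ∀ F : PathSp n → ℝ≥0∞, Measurable F →
      ∫⁻ ω, F ω ∂μ = ∫⁻ ω, (∫⁻ ω', F (pastePath s ω ω') ∂κ ω) ∂P := fun F hF => by
    rw [hμ, lintegral_map hF hpm]
    exact Measure.lintegral_compProd (hF.comp hpm)
  have hfr : ∀ ω, ∀ᵐ ω' ∂κ ω, Xcan n s ω' = Xcan n s ω := fun ω => by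
    rw [hκ]
    exact (hQ.ae_frozen s _ hs).mono fun ω' h => h s le_rfl
  have hpast : ∀ F : PathSp n → ℝ≥0∞, Measurable[canonFiltr n s] F →
      ∫⁻ ω, F ω ∂μ = ∫⁻ ω, F ω ∂P := fun F hF => by
    rw [hlin F (hF.mono (canonFiltr_le s) le_rfl)]
    refine lintegral_congr fun ω => ?_
    have h1 : ∀ ω', F (pastePath s ω ω') = F ω := fun ω' =>
      eq_of_stopPath_eq hF fun u _ hu => Xcan_pastePath_of_le hs hu ω ω'
    simp only [h1, lintegral_const, measure_univ, mul_one]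
  have hfut : ∀ (θ : Fin n → ℝ) (s' t' : ℝ), s ≤ s' → s' ≤ t' → ∀ Z : PathSp n → ℝ≥0∞,
      Measurable[canonFiltr n s'] Z →
      ∫⁻ ω, Z ω * ENNReal.ofReal (expIncr a b θ s' t' ω) ∂μ = ∫⁻ ω, Z ω ∂μ := by
    intro θ s' t' hs' ht' Z hZ
    have hZm : Measurable Z := hZ.mono (canonFiltr_le s') le_rfl
    have hem := hc.measurable_expIncr θ s' t'
    have J : Measurable fun ω => Z ω * ENNReal.ofReal (expIncr a b θ s' t' ω) :=
      hZm.mul hem.ennreal_ofReal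
    rw [hlin _ J, hlin Z hZm]
    refine lintegral_congr fun ω => ?_
    have h1 := hQ.expMart s (Xcan n s ω) hs θ s' t' hs' ht' (fun ω' => Z (pastePath s ω ω'))
      (hZ.comp (measurable_pastePath_canonFiltr hs hs' ω))
    rw [← hκ] at h1
    rw [← h1]
    refine lintegral_congr_ae ((hfr ω).mono fun ω' h => ?_)
    simp only [expIncr_pastePath θ hs hs' ht' h]
  have hE : ExpMart a b r μ := by
    intro θ s' t' hs' ht' Z hZ
    rcases le_total t' s with h | h
    · have h0 : Measurable[canonFiltr n s] Z := hZ.mono (canonFiltr_mono (ht'.trans h)) le_rfl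
      have h1 : Measurable[canonFiltr n s] (expIncr a b θ s' t') :=
        (hc.measurable_expIncr_canonFiltr θ ((hr.trans hs').trans ht') ht').mono
          (canonFiltr_mono h) le_rfl
      have h2 : Measurable[canonFiltr n s]
          fun ω => Z ω * ENNReal.ofReal (expIncr a b θ s' t' ω) := h0.mul h1.ennreal_ofReal
      rw [hpast _ h2, hpast Z h0]
      exact hQ.expMart r y hr θ s' t' hs' ht' Z hZ
    rcases le_total s s' with h' | h'
    · exact hfut θ s' t' h' ht' Z hZ
    · have h0 : Measurable[canonFiltr n s] Z := hZ.mono (canonFiltr_mono h') le_rfl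
      have h1 : Measurable[canonFiltr n s] fun ω => Z ω * ENNReal.ofReal (expIncr a b θ s' s ω) :=
        h0.mul (hc.measurable_expIncr_canonFiltr θ hs h').ennreal_ofReal
      have h2 := hfut θ s t' le_rfl h _ h1
      rw [hpast _ h1, hQ.expMart r y hr θ s' s hs' h' Z hZ, ← hpast Z h0] at h2
      rw [← h2]
      refine lintegral_congr fun ω => ?_
      rw [hc.expIncr_mul θ h' h, ENNReal.ofReal_mul (expIncr_pos θ s' s ω).le, mul_assoc]
  have hF : ∀ᵐ ω ∂μ, ∀ u ≤ r, Xcan n u ω = y := by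
    rw [hμ, ae_map_iff hpm.aemeasurable (isClosed_frozen r y).measurableSet]
    refine Measure.ae_compProd_of_ae_ae
      (hpm (isClosed_frozen r y).measurableSet) ((hQ.ae_frozen r y hr).mono fun ω h => ?_)
    exact ae_of_all _ fun ω' u hu => by
      rw [Xcan_pastePath_of_le hs (hu.trans hrs), h u hu]
  exact congrArg (fun ρ : ProbabilityMeasure (PathSp n) => (ρ : Measure (PathSp n)))
    (hQ.unique r y ⟨μ, hμp⟩ hr hF hE)

end Pasting

section Markov

variable {n : ℕ} [MeasurableSpace (PathSp n)] [BorelSpace (PathSp n)]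
  {a : ℝ → (Fin n → ℝ) → Matrix (Fin n) (Fin n) ℝ} {b : ℝ → (Fin n → ℝ) → Fin n → ℝ}
  {B : ℝ} {Q : ℝ → (Fin n → ℝ) → ProbabilityMeasure (PathSp n)}
  {g : ℝ × (Fin n → ℝ) → ℝ} {C : ℝ} {m : ℕ}

/-- The Markov property for the expected running reward. -/
theorem ExpMartFamily.condExp_eq_valueFun (hQ : ExpMartFamily a b Q) (hc : BoundedCoeff n a b B)
    (hsym : ∀ u x, (a u x).IsSymm) (hcont : Continuous fun p : ℝ × (Fin n → ℝ) => a p.1 p.2)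
    (hell : ∀ u x (θ : Fin n → ℝ), θ ≠ 0 → 0 < θ ⬝ᵥ (a u x).mulVec θ)
    (hg : Measurable g) (hgc : ∀ u, Continuous fun x => g (u, x))
    (hgrowth : ∀ p, |g p| ≤ C * (1 + ‖p.2‖ ^ m)) {r s : ℝ} (hr : 0 ≤ r) (hrs : r ≤ s) (t : ℝ)
    (y : Fin n → ℝ) :
    (Q r y : Measure (PathSp n))[fun ω => ∫ u in Set.Ioc s t, g (u, Xcan n u ω) | canonFiltr n s]
      =ᵐ[(Q r y : Measure (PathSp n))] fun ω => valueFun Q g t s (Xcan n s ω) := by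
  have hs : 0 ≤ s := hr.trans hrs
  have hqc : Continuous (Q s) := continuous_iff_continuousAt.2 fun y' =>
    hQ.tendsto hc hsym hcont hell tendsto_const_nhds tendsto_id (Eventually.of_forall fun _ => hs)
  let κ : ProbabilityTheory.Kernel (PathSp n) (PathSp n) :=
    ⟨fun ω => (Q s (Xcan n s ω) : Measure (PathSp n)),
      (measurable_toMeasure_of_continuous hqc).comp (measurable_Xcan s)⟩
  have hκ : ∀ ω, κ ω = (Q s (Xcan n s ω) : Measure (PathSp n)) := fun ω => rfl
  have hκm : ProbabilityTheory.IsMarkovKernel κ := ⟨fun ω => by rw [hκ]; infer_instance⟩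
  have hmap := hQ.map_pastePath_eq hc hr hrs y hκ
  set P : Measure (PathSp n) := (Q r y : Measure (PathSp n)) with hP
  have hpm := measurable_pastePath (n := n) hs
  set G : PathSp n → ℝ := fun ω => ∫ u in Set.Ioc s t, g (u, Xcan n u ω) with hG
  have hGint : Integrable G P := ((hQ.expMart r y hr).integrable_growth_prod hc hr
    (hQ.ae_frozen r y hr) hg hgrowth hs).integral_prod_right
  have hfr : ∀ ω, ∀ᵐ ω' ∂κ ω, Xcan n s ω' = Xcan n s ω := fun ω => by
    rw [hκ]
    exact (hQ.ae_frozen s _ hs).mono fun ω' h => h s le_rfl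
  have hGp : ∀ ω ω', Xcan n s ω' = Xcan n s ω → G (pastePath s ω ω') = G ω' := fun ω ω' h =>
    setIntegral_congr_fun measurableSet_Ioc fun v hv => by
      simp only [Xcan_pastePath_of_ge hs hv.1.le h]
  have hVm : Measurable[canonFiltr n s] fun ω => valueFun Q g t s (Xcan n s ω) := by
    have h1 : Continuous fun x => valueFun Q g t s x := by
      rw [← continuousOn_univ]
      exact (hQ.continuousOn_valueFun hc hsym hcont hell hg hgc hgrowth t).comp
        (Continuous.continuousOn (by fun_prop : Continuous fun x : Fin n → ℝ => (s, x)))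
        fun x _ => ⟨hs, Set.mem_univ x⟩
    exact h1.measurable.comp (measurable_Xcan_canonFiltr hs le_rfl)
  have key : ∀ F : PathSp n → ℝ, Integrable F P →
      Integrable (fun ω => ∫ ω', F (pastePath s ω ω') ∂κ ω) P ∧
      ∫ ω, F ω ∂P = ∫ ω, (∫ ω', F (pastePath s ω ω') ∂κ ω) ∂P := by
    intro F hF
    have h1 : Integrable F ((P.compProd κ).map fun p => pastePath s p.1 p.2) := by rwa [hmap]
    have h2 : Integrable (fun p : PathSp n × PathSp n => F (pastePath s p.1 p.2)) (P.compProd κ) :=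
      (integrable_map_measure h1.aestronglyMeasurable hpm.aemeasurable).1 h1
    refine ⟨by simpa using Integrable.integral_compProd h2, ?_⟩
    rw [← Measure.integral_compProd h2, ← integral_map hpm.aemeasurable h1.aestronglyMeasurable,
      hmap]
  have hinner : ∀ ω, ∫ ω', G (pastePath s ω ω') ∂κ ω = valueFun Q g t s (Xcan n s ω) := fun ω => by
    rw [valueFun, hκ]
    exact integral_congr_ae ((hfr ω).mono fun ω' h => hGp ω ω' h)
  have hVint : Integrable (fun ω => valueFun Q g t s (Xcan n s ω)) P := by
    simpa only [hinner] using (key G hGint).1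
  refine (ae_eq_condExp_of_forall_setIntegral_eq (canonFiltr_le s) hGint
    (fun A _ _ => hVint.integrableOn) (fun A hA _ => ?_)
    hVm.stronglyMeasurable.aestronglyMeasurable).symm
  have hA' : MeasurableSet A := canonFiltr_le s A hA
  rw [← integral_indicator hA', ← integral_indicator hA', (key _ (hGint.indicator hA')).2]
  refine integral_congr_ae (ae_of_all P fun ω => ?_)
  have hmem : ∀ ω', (pastePath s ω ω' ∈ A) = (ω ∈ A) := fun ω' =>
    eq_of_stopPath_eq (Z := fun ω => ω ∈ A) ((@measurable_mem _ A (canonFiltr n s)).2 hA)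
      fun u _ hu => Xcan_pastePath_of_le hs hu ω ω'
  by_cases h : ω ∈ A
  · simp only [Set.indicator, hmem, h, if_true, hinner]
  · simp only [Set.indicator, hmem, h, if_false, integral_zero]

end Markov

section Coefficients

variable {n : ℕ} {σ : ℝ → (Fin n → ℝ) → Matrix (Fin n) (Fin n) ℝ} {l : ℝ → (Fin n → ℝ) → Fin n → ℝ}

theorem exists_boundedCoeff (hσc : Continuous fun p : ℝ × (Fin n → ℝ) => σ p.1 p.2)
    (hσb : ∃ Cb : ℝ, ∀ (u : ℝ) (x : Fin n → ℝ) (i j : Fin n), |σ u x i j| ≤ Cb)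
    (hlmeas : Measurable fun p : ℝ × (Fin n → ℝ) => l p.1 p.2)
    (hlb : ∃ Bb : ℝ, ∀ (u : ℝ) (x : Fin n → ℝ), ‖l u x‖ ≤ Bb) :
    ∃ B, BoundedCoeff n (fun u x => σ u x * (σ u x)ᵀ) (fun u x => (σ u x).mulVec (l u x)) B := by
  obtain ⟨Cb, hCb⟩ := hσb
  obtain ⟨Bb, hBb⟩ := hlb
  have hσm : ∀ i j, Measurable fun p : ℝ × (Fin n → ℝ) => σ p.1 p.2 i j := fun i j =>
    (hσc.matrix_elem i j).measurable
  have hC : ∀ u x i j, |σ u x i j| ≤ |Cb| := fun u x i j => (hCb u x i j).trans (le_abs_self _)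
  have hL : ∀ u x i, |l u x i| ≤ |Bb| := fun u x i =>
    ((norm_le_pi_norm (l u x) i).trans (hBb u x)).trans (le_abs_self _)
  have hsum : ∀ (v w : Fin n → ℝ) (c d : ℝ), 0 ≤ c → (∀ k, |v k| ≤ c) → (∀ k, |w k| ≤ d) →
      |∑ k, v k * w k| ≤ n * (c * d) := fun v w c d hc hv hw => by
    refine (Finset.abs_sum_le_sum_abs _ _).trans ?_
    refine (Finset.sum_le_sum fun k _ => (abs_mul (v k) (w k)).trans_le
      (mul_le_mul (hv k) (hw k) (abs_nonneg _) hc)).trans_eq ?_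
    simp
  refine ⟨n * (|Cb| * |Cb|) + n * (|Cb| * |Bb|), by positivity, fun i j => ?_, fun i => ?_,
    fun u x i j => ?_, fun u x i => ?_⟩
  · simp only [mul_apply, transpose_apply]
    exact Finset.measurable_sum _ fun k _ => (hσm i k).mul (hσm j k)
  · simp only [mulVec, dotProduct]
    exact Finset.measurable_sum _ fun k _ => (hσm i k).mul (measurable_pi_iff.1 hlmeas k)
  · exact (hsum _ _ _ _ (abs_nonneg _) (fun k => hC u x i k) fun k => hC u x j k).trans
      (le_add_of_nonneg_right (by positivity))
  · exact (hsum _ _ _ _ (abs_nonneg _) (fun k => hC u x i k) fun k => hL u x k).trans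
      (le_add_of_nonneg_left (by positivity))

end Coefficients

/-- **Feller property of the penalty (Proposition `propcont3`).**  Let `f` be a
Carathéodory function with polynomial growth on `[0,t] × ℝⁿ`, `σ` continuous
bounded with `a = σσ*` strictly elliptic, `λ` Borel bounded, and `Q_{s,y}` the
unique solutions of the corresponding martingale problems.  Then there is a
continuous function `L(f)` on `[0,t] × ℝⁿ` with
`E_{Q_{s,y}}[∫_s^t f(u,X_u) du] = L(f)(s,y)`, `L(f)(t,·) = 0`, and for all
`0 ≤ r ≤ s ≤ t` and `y`,
`E_{Q_{r,y}}[∫_s^t f(u,X_u) du | B^r_s] = L(f)(s, X_s)` a.s. -/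
theorem stmt15 (n : ℕ) [MeasurableSpace (PathSp n)] [BorelSpace (PathSp n)]
    (t : ℝ) (ht : 0 < t)
    (f : ℝ → (Fin n → ℝ) → ℝ)
    (hfmeas : Measurable (fun p : ℝ × (Fin n → ℝ) => f p.1 p.2))
    (hfcar : ∀ u : ℝ, Continuous (f u))
    (hfgrowth : ∃ (C : ℝ) (m : ℕ), 0 < C ∧
      ∀ (u : ℝ) (x : Fin n → ℝ), u ∈ Set.Icc 0 t → |f u x| ≤ C * (1 + ‖x‖ ^ m))
    (σ : ℝ → (Fin n → ℝ) → Matrix (Fin n) (Fin n) ℝ)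
    (l : ℝ → (Fin n → ℝ) → (Fin n → ℝ))
    (hσc : Continuous (fun p : ℝ × (Fin n → ℝ) => σ p.1 p.2))
    (hσb : ∃ Cb : ℝ, ∀ (u : ℝ) (x : Fin n → ℝ) (i j : Fin n), |σ u x i j| ≤ Cb)
    (hell : ∀ (u : ℝ) (x θ : Fin n → ℝ), θ ≠ 0 →
      0 < θ ⬝ᵥ ((σ u x * (σ u x)ᵀ).mulVec θ))
    (hlmeas : Measurable (fun p : ℝ × (Fin n → ℝ) => l p.1 p.2))
    (hlb : ∃ Bb : ℝ, ∀ (u : ℝ) (x : Fin n → ℝ), ‖l u x‖ ≤ Bb)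
    (Q : ℝ → (Fin n → ℝ) → Measure (PathSp n))
    (hQp : ∀ s y, IsProbabilityMeasure (Q s y))
    (hQ : ∀ s y, 0 ≤ s → SolvesMPFrom n σ l s y (Q s y))
    (hQuniq : ∀ (s : ℝ) (y : Fin n → ℝ) (P : Measure (PathSp n)), 0 ≤ s →
      IsProbabilityMeasure P → SolvesMPFrom n σ l s y P → P = Q s y) :
    ∃ L : ℝ → (Fin n → ℝ) → ℝ,
      ContinuousOn (fun p : ℝ × (Fin n → ℝ) => L p.1 p.2)
        (Set.Icc 0 t ×ˢ Set.univ) ∧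
      (∀ s ∈ Set.Icc 0 t, ∀ y : Fin n → ℝ,
        ∫ ω, (∫ u in Set.Ioc s t, f u (Xcan n u ω)) ∂(Q s y) = L s y) ∧
      (∀ y : Fin n → ℝ, L t y = 0) ∧
      (∀ r s : ℝ, 0 ≤ r → r ≤ s → s ≤ t → ∀ y : Fin n → ℝ,
        (Q r y)[fun ω => ∫ u in Set.Ioc s t, f u (Xcan n u ω) | canonFiltr n s]
          =ᵐ[Q r y] fun ω => L s (Xcan n s ω)) := by
  obtain ⟨B, hc⟩ := exists_boundedCoeff hσc hσb hlmeas hlb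
  obtain ⟨C, m, hC, hf⟩ := hfgrowth
  have hcont : Continuous fun p : ℝ × (Fin n → ℝ) => σ p.1 p.2 * (σ p.1 p.2)ᵀ :=
    hσc.matrix_mul hσc.matrix_transpose
  have hsym : ∀ u x, (σ u x * (σ u x)ᵀ).IsSymm := fun u x => isSymm_mul_transpose_self _
  set Q' : ℝ → (Fin n → ℝ) → ProbabilityMeasure (PathSp n) := fun s y => ⟨Q s y, hQp s y⟩ with hQ'
  have hfam : ExpMartFamily (fun u x => σ u x * (σ u x)ᵀ) (fun u x => (σ u x).mulVec (l u x)) Q' :=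
    { ae_frozen := fun s y hs => (hQ s y hs).ae_frozen
      expMart := fun s y hs => (hQ s y hs).expMart hc hs
      unique := fun s y P hs hfr h =>
        Subtype.ext (hQuniq s y P hs inferInstance (h.solvesMPFrom hc hs hfr)) }
  set g : ℝ × (Fin n → ℝ) → ℝ := (Set.Icc 0 t ×ˢ Set.univ).indicator fun p => f p.1 p.2 with hg
  have hgm : Measurable g := hfmeas.indicator (measurableSet_Icc.prod MeasurableSet.univ)
  have hgf : ∀ u ∈ Set.Icc 0 t, ∀ x, g (u, x) = f u x := fun u hu x =>
    Set.indicator_of_mem (show (u, x) ∈ Set.Icc 0 t ×ˢ Set.univ from ⟨hu, Set.mem_univ x⟩) _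
  have hg0 : ∀ u ∉ Set.Icc 0 t, ∀ x, g (u, x) = 0 := fun u hu x =>
    Set.indicator_of_notMem (fun h => hu h.1) _
  have hgc : ∀ u, Continuous fun x => g (u, x) := fun u => by
    by_cases hu : u ∈ Set.Icc 0 t
    · simpa only [hgf u hu] using hfcar u
    · simpa only [hg0 u hu] using continuous_const
  have hgrowth : ∀ p, |g p| ≤ C * (1 + ‖p.2‖ ^ m) := fun p => by
    by_cases hu : p.1 ∈ Set.Icc 0 t
    · exact (congrArg abs (hgf p.1 hu p.2)).trans_le (hf p.1 p.2 hu)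
    · refine (congrArg abs (hg0 p.1 hu p.2)).trans_le ?_
      rw [abs_zero]
      positivity
  have hpath : ∀ s, 0 ≤ s → ∀ ω : PathSp n,
      ∫ u in Set.Ioc s t, f u (Xcan n u ω) = ∫ u in Set.Ioc s t, g (u, Xcan n u ω) :=
    fun s hs ω => setIntegral_congr_fun measurableSet_Ioc fun u hu =>
      (hgf u ⟨hs.trans hu.1.le, hu.2⟩ _).symm
  refine ⟨valueFun Q' g t, ?_, fun s hs y => ?_, fun y => ?_, fun r s hr hrs _ y => ?_⟩
  · exact (hfam.continuousOn_valueFun hc hsym hcont hell hgm hgc hgrowth t).mono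
      (Set.prod_mono Set.Icc_subset_Ici_self subset_rfl)
  · simp only [hpath s hs.1]
    rfl
  · simp [valueFun]
  · simp only [hpath s (hr.trans hrs)]
    exact hfam.condExp_eq_valueFun hc hsym hcont hell hgm hgc hgrowth hr hrs t y
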